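/- Let T be an ABC-tile having exactly 14 neighbors. Then for every α ∈ ℤ³ \ {0}, the 2-fold intersection T ∩ (T + α) is homeomorphic to the closed unit disk {x ∈ ℝ² : |x| ≤ 1} if α is a neighbor of T, and is empty otherwise. -/

import Mathlib

open MeasureTheory

noncomputable def Mmat (A B C : ℤ) : Matrix (Fin 3) (Fin 3) ℝ :=
  !![0, 0, -(C : ℝ); 1, 0, -(B : ℝ); 0, 1, -(A : ℝ)]

def Ddig (C : ℤ) : Set (Fin 3 → ℝ) :=
  {d | ∃ i : ℤ, 0 ≤ i ∧ i < C ∧ d = ![(i : ℝ), 0, 0]}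

def toR (α : Fin 3 → ℤ) : Fin 3 → ℝ := fun i => (α i : ℝ)

def tileTranslate (v : Fin 3 → ℝ) (T : Set (Fin 3 → ℝ)) : Set (Fin 3 → ℝ) :=
  (fun x => x + v) '' T

def IsABCTile (A B C : ℤ) (T : Set (Fin 3 → ℝ)) : Prop :=
  1 ≤ A ∧ A ≤ B ∧ B < C ∧
  T.Nonempty ∧ IsCompact T ∧ 0 < volume T ∧
  (Mmat A B C).mulVec '' T = ⋃ d ∈ Ddig C, tileTranslate d T

def Neighbors (T : Set (Fin 3 → ℝ)) : Set (Fin 3 → ℤ) :=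
  {α | α ≠ 0 ∧ (T ∩ tileTranslate (toR α) T).Nonempty}


set_option linter.all false

namespace ABCT

abbrev Pt := ℝ × ℝ

/-- orientation determinant -/
def det (u v w : Pt) : ℝ := (v.1 - u.1) * (w.2 - u.2) - (v.2 - u.2) * (w.1 - u.1)

theorem det_rot (u v w : Pt) : det v w u = det u v w := by unfold det; ring
theorem det_swap (u v w : Pt) : det v u w = - det u v w := by unfold det; ring
theorem det_swap' (u v w : Pt) : det u w v = - det u v w := by unfold det; ring
theorem det_add (u v w p : Pt) : det u v p + det v w p + det w u p = det u v w := by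
  unfold det; ring
theorem det_bary (u v w p : Pt) :
    det u v p * (w.1 - p.1) + det v w p * (u.1 - p.1) + det w u p * (v.1 - p.1) = 0 := by
  unfold det; ring

open Classical in
/-- indicator: the point `p` is above the rightward edge `u → v` -/
noncomputable def above (p u v : Pt) : ℝ :=
  if u.1 < p.1 ∧ p.1 < v.1 ∧ 0 < det u v p then 1 else 0

noncomputable def crs (p u v : Pt) : ℝ := above p u v - above p v u

theorem crs_anti (p u v : Pt) : crs p u v = - crs p v u := by unfold crs; ring

/-- genericity of `p` with respect to a triangle -/
def Gen (p u v : Pt) : Prop := p.1 ≠ u.1 ∧ p.1 ≠ v.1 ∧ det u v p ≠ 0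

def InT (p u v w : Pt) : Prop := 0 < det u v p ∧ 0 < det v w p ∧ 0 < det w u p

open Classical in
theorem tri_crs (p u v w : Pt) (h : 0 < det u v w)
    (hu : p.1 ≠ u.1) (hv : p.1 ≠ v.1) (hw : p.1 ≠ w.1)
    (h1 : det u v p ≠ 0) (h2 : det v w p ≠ 0) (h3 : det w u p ≠ 0) :
    crs p u v + crs p v w + crs p w u = if InT p u v w then 1 else 0 := by
  have e1 := det_add u v w p
  have e2 := det_bary u v w p
  have s1 := det_swap u v p
  have s2 := det_swap v w p
  have s3 := det_swap w u p
  unfold crs above InT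
  rw [s1, s2, s3]
  generalize det u v p = a at *
  generalize det v w p = b at *
  generalize det w u p = c at *
  rw [← e1] at h
  obtain ⟨x, hx⟩ : ∃ x, x = u.1 - p.1 := ⟨_, rfl⟩
  obtain ⟨y, hy⟩ : ∃ y, y = v.1 - p.1 := ⟨_, rfl⟩
  obtain ⟨z, hz⟩ : ∃ z, z = w.1 - p.1 := ⟨_, rfl⟩
  rw [← hx, ← hy, ← hz] at e2
  have i1 : (u.1 < p.1) ↔ x < 0 := by rw [hx]; constructor <;> intro h <;> linarith
  have i2 : (v.1 < p.1) ↔ y < 0 := by rw [hy]; constructor <;> intro h <;> linarith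
  have i3 : (w.1 < p.1) ↔ z < 0 := by rw [hz]; constructor <;> intro h <;> linarith
  have j1 : (p.1 < u.1) ↔ 0 < x := by rw [hx]; constructor <;> intro h <;> linarith
  have j2 : (p.1 < v.1) ↔ 0 < y := by rw [hy]; constructor <;> intro h <;> linarith
  have j3 : (p.1 < w.1) ↔ 0 < z := by rw [hz]; constructor <;> intro h <;> linarith
  simp only [i1, i2, i3, j1, j2, j3]
  have hx0 : x ≠ 0 := fun h => hu (by linarith)
  have hy0 : y ≠ 0 := fun h => hv (by linarith)
  have hz0 : z ≠ 0 := fun h => hw (by linarith)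
  clear hx hy hz i1 i2 i3 j1 j2 j3 hu hv hw e1 s1 s2 s3
  rcases lt_or_gt_of_ne hx0 with hx | hx <;> rcases lt_or_gt_of_ne hy0 with hy | hy <;>
  rcases lt_or_gt_of_ne hz0 with hz | hz <;> rcases lt_or_gt_of_ne h1 with ha | ha <;>
  rcases lt_or_gt_of_ne h2 with hb | hb <;> rcases lt_or_gt_of_ne h3 with hc | hc <;>
  first
  | (exfalso; linarith)
  | (simp only [hx, hy, hz, ha, hb, hc, not_lt_of_gt hx, not_lt_of_gt hy, not_lt_of_gt hz,
      not_lt_of_gt ha, not_lt_of_gt hb, not_lt_of_gt hc, Left.neg_pos_iff, and_true, and_false,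
      true_and, false_and, if_true, if_false]; norm_num; done)
  | (exfalso; nlinarith only [e2, h, ha, hb, hc, hx, hy, hz])


end ABCT

set_option linter.all false

namespace ABCT

/-- cyclic edge sum of a polygon, via the fan triangulation -/
def cyc {V : Type*} (s : V → V → ℝ) : List V → ℝ
  | a :: b :: c :: l => (s a b + s b c + s c a) + cyc s (a :: c :: l)
  | _ => 0
termination_by l => l.length

/-- strictly convex, counterclockwise -/
def CV (l : List Pt) : Prop := ∀ u v w, [u, v, w].Sublist l → 0 < det u v w

/-- path inequality: `P` holds for consecutive pairs, closing up to `z` -/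
def QP {V : Type*} (P : V → V → Prop) (z : V) : List V → Prop
  | [] => True
  | [a] => P a z
  | a :: b :: l => P a b ∧ QP P z (b :: l)

def QC {V : Type*} (P : V → V → Prop) : List V → Prop
  | [] => True
  | a :: l => QP P a (a :: l)

def prs {V : Type*} (z : V) : List V → List (V × V)
  | [] => []
  | [a] => [(a, z)]
  | a :: b :: l => (a, b) :: prs z (b :: l)

def cprs {V : Type*} : List V → List (V × V)
  | [] => []
  | a :: l => prs a (a :: l)

theorem QP_iff {V : Type*} (P : V → V → Prop) (z : V) : ∀ l : List V, QP P z l ↔ ∀ q ∈ prs z l, P q.1 q.2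
  | [] => by simp [QP, prs]
  | [a] => by simp [QP, prs]
  | a :: b :: l => by
    rw [QP, prs, QP_iff P z (b :: l)]; simp

theorem QC_iff {V : Type*} (P : V → V → Prop) (l : List V) : QC P l ↔ ∀ q ∈ cprs l, P q.1 q.2 := by
  cases l with
  | nil => simp [QC, cprs]
  | cons a l => exact QP_iff P a _

/-- a finite abstract oriented planar complex -/
structure Cx (V ι : Type*) where
  Fl : Finset ι
  w : ι → ℝ
  poly : ι → List V
  O : Finset (V × V)
  RV : Finset V
  hw : ∀ φ ∈ Fl, 0 < w φ
  hlen : ∀ φ ∈ Fl, 3 ≤ (poly φ).length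
  hR : ∀ φ ∈ Fl, ∀ v ∈ poly φ, v ∈ RV
  hR' : ∀ v ∈ RV, ∃ φ ∈ Fl, v ∈ poly φ
  hRO : ∀ o ∈ O, o.1 ∈ RV ∧ o.2 ∈ RV
  hcancel : ∀ s : V → V → ℝ, (∀ u v, s u v = - s v u) →
    ∑ φ ∈ Fl, w φ * cyc s (poly φ) = ∑ o ∈ O, s o.1 o.2
  grp : ι → Finset ι
  hgs : ∀ φ ∈ Fl, grp φ ⊆ Fl
  hg1 : ∀ φ ∈ Fl, ∑ ψ ∈ grp φ, w ψ = 1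
  hgc : ∀ φ ∈ Fl, ∀ ψ ∈ grp φ, ∀ s : V → V → ℝ, (∀ u v, s u v = - s v u) →
    cyc s (poly ψ) = cyc s (poly φ)
  hconn : ∀ S : V → Prop, (∃ u ∈ RV, S u) → (∃ v ∈ RV, ¬ S v) →
    ∃ φ ∈ Fl, ∃ u ∈ poly φ, ∃ v ∈ poly φ, S u ∧ ¬ S v

variable {V ι : Type*}

structure Drawn (K : Cx V ι) (pos : V → Pt) : Prop where
  hT : ∀ φ ∈ K.Fl, CV ((K.poly φ).map pos)
  hO : ∀ o ∈ K.O, ∀ v ∈ K.RV, v ≠ o.1 → v ≠ o.2 → 0 < det (pos o.1) (pos o.2) (pos v)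

theorem dense_aff (a b c : ℝ) (h : a ≠ 0 ∨ b ≠ 0) : Dense {p : Pt | a * p.1 + b * p.2 + c ≠ 0} := by
  intro p
  rw [Metric.mem_closure_iff]
  intro ε hε
  have hs : 0 < a ^ 2 + b ^ 2 := by
    rcases h with h | h
    · have := sq_nonneg b; have := pow_pos (abs_pos.2 h) 2; rw [sq_abs] at this; linarith
    · have := sq_nonneg a; have := pow_pos (abs_pos.2 h) 2; rw [sq_abs] at this; linarith
  by_cases h0 : a * p.1 + b * p.2 + c = 0
  · obtain ⟨t, ht, ht1⟩ : ∃ t : ℝ, 0 < t ∧ t * (|a| + |b|) < ε := by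
      refine ⟨ε / (|a| + |b| + 1), by positivity, ?_⟩
      rw [div_mul_eq_mul_div, div_lt_iff₀ (by positivity)]
      nlinarith [abs_nonneg a, abs_nonneg b]
    refine ⟨(p.1 + t * a, p.2 + t * b), ?_, ?_⟩
    · simp only [Set.mem_setOf_eq]
      have : a * (p.1 + t * a) + b * (p.2 + t * b) + c = t * (a ^ 2 + b ^ 2) := by linear_combination h0
      rw [this]; positivity
    · rw [Prod.dist_eq, max_lt_iff]
      simp only [Real.dist_eq]
      have e1 : |p.1 - (p.1 + t * a)| = t * |a| := by
        rw [show p.1 - (p.1 + t * a) = -(t * a) by ring, abs_neg, abs_mul, abs_of_pos ht]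
      have e2 : |p.2 - (p.2 + t * b)| = t * |b| := by
        rw [show p.2 - (p.2 + t * b) = -(t * b) by ring, abs_neg, abs_mul, abs_of_pos ht]
      rw [e1, e2]
      constructor <;> nlinarith [abs_nonneg a, abs_nonneg b]
  · exact ⟨p, h0, by simpa using hε⟩

/-- generic point with respect to a finite set of points -/
def Gn (R : Finset V) (pos : V → Pt) (p : Pt) : Prop :=
  (∀ v ∈ R, p.1 ≠ (pos v).1) ∧ ∀ u ∈ R, ∀ v ∈ R, pos u ≠ pos v → det (pos u) (pos v) p ≠ 0

theorem dense_Gn (R : Finset V) (pos : V → Pt) : Dense {p | Gn R pos p} := by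
  have h1 : Dense (⋂ v ∈ (R : Set V), {p : Pt | p.1 ≠ (pos v).1}) := by
    apply dense_biInter_of_isOpen
    · intro v _
      exact isOpen_ne_fun continuous_fst continuous_const
    · exact R.finite_toSet.countable
    · intro v _
      have := dense_aff 1 0 (-(pos v).1) (Or.inl one_ne_zero)
      convert this using 1
      ext p; simp only [Set.mem_setOf_eq]; constructor <;> intro h h' <;> apply h <;> linarith
  have o1 : IsOpen (⋂ v ∈ (R : Set V), {p : Pt | p.1 ≠ (pos v).1}) := by
    apply R.finite_toSet.isOpen_biInter
    intro v _
    exact isOpen_ne_fun continuous_fst continuous_const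
  have h2 : Dense (⋂ q ∈ ({q : V × V | q.1 ∈ R ∧ q.2 ∈ R ∧ pos q.1 ≠ pos q.2} : Set (V × V)),
      {p : Pt | det (pos q.1) (pos q.2) p ≠ 0}) := by
    apply dense_biInter_of_isOpen
    · intro v _
      apply isOpen_ne_fun _ continuous_const
      unfold det; fun_prop
    · apply Set.Finite.countable
      apply ((R ×ˢ R).finite_toSet).subset
      intro q hq; simp; exact ⟨hq.1, hq.2.1⟩
    · rintro ⟨u, v⟩ ⟨_, _, hne⟩
      simp only at hne
      have := dense_aff (-((pos v).2 - (pos u).2)) ((pos v).1 - (pos u).1)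
        (-((pos v).1 - (pos u).1) * (pos u).2 + ((pos v).2 - (pos u).2) * (pos u).1) (by
          by_contra hc
          push Not at hc
          apply hne
          ext <;> linarith [hc.1, hc.2])
      convert this using 1
      ext p; simp only [Set.mem_setOf_eq, det]; constructor <;> intro h h' <;> apply h <;> linarith
  have := h1.inter_of_isOpen_left h2 o1
  refine this.mono ?_
  rintro p ⟨ha, hb⟩
  simp only [Set.mem_iInter] at ha hb
  exact ⟨fun v hv => ha v hv, fun u hu v hv hne => hb (u, v) ⟨hu, hv, hne⟩⟩

theorem exists_Gn (R : Finset V) (pos : V → Pt) (U : Set Pt) (hU : IsOpen U) (hn : U.Nonempty) :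
    ∃ p ∈ U, Gn R pos p := by
  obtain ⟨p, hp, hp'⟩ := (dense_Gn R pos).inter_open_nonempty U hU hn
  exact ⟨p, hp, hp'⟩

theorem ne_of_det {u v w : Pt} (h : 0 < det u v w) : u ≠ v ∧ v ≠ w ∧ w ≠ u := by
  refine ⟨?_, ?_, ?_⟩ <;> rintro rfl <;> unfold det at h <;> nlinarith


theorem CV.sub {l l' : List Pt} (h : CV l) (hs : l'.Sublist l) : CV l' :=
  fun u v w h' => h u v w (h'.trans hs)

theorem fan_sub (a b c : Pt) (l : List Pt) : (a :: c :: l).Sublist (a :: b :: c :: l) :=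
  List.Sublist.cons_cons _ (List.Sublist.cons _ (List.Sublist.refl _))

theorem fan_tri (a b c : Pt) (l : List Pt) : [a, b, c].Sublist (a :: b :: c :: l) := by simp

theorem cyc_map {V W : Type*} (f : V → W) (s : W → W → ℝ) :
    ∀ l : List V, cyc s (l.map f) = cyc (fun u v => s (f u) (f v)) l
  | a :: b :: c :: l => by
    have := cyc_map f s (a :: c :: l)
    simp only [List.map_cons] at this ⊢
    rw [cyc, cyc, this]
  | [] => by simp [cyc]
  | [a] => by simp [cyc]
  | [a, b] => by simp [cyc]
termination_by l => l.length

/-- generic point for a list -/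
def GenL (p : Pt) (l : List Pt) : Prop :=
  (∀ v ∈ l, p.1 ≠ v.1) ∧ ∀ u ∈ l, ∀ v ∈ l, u ≠ v → det u v p ≠ 0

theorem GenL.sub {p : Pt} {l l' : List Pt} (h : GenL p l) (hs : l' ⊆ l) : GenL p l' :=
  ⟨fun v hv => h.1 v (hs hv), fun u hu v hv => h.2 u (hs hu) v (hs hv)⟩

open Classical in
theorem fan_crs (p a b c : Pt) (l : List Pt) (h : CV (a :: b :: c :: l)) (hg : GenL p (a :: b :: c :: l)) :
    crs p a b + crs p b c + crs p c a = if InT p a b c then 1 else 0 := by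
  have hd := h _ _ _ (fan_tri a b c l)
  obtain ⟨n1, n2, n3⟩ := ne_of_det hd
  exact tri_crs p a b c hd (hg.1 a (by simp)) (hg.1 b (by simp)) (hg.1 c (by simp))
    (hg.2 _ (by simp) _ (by simp) n1) (hg.2 _ (by simp) _ (by simp) n2) (hg.2 _ (by simp) _ (by simp) n3)

theorem cyc_nonneg (p : Pt) : ∀ l : List Pt, CV l → GenL p l → 0 ≤ cyc (crs p) l
  | a :: b :: c :: l => by
    intro h hg
    have ih := cyc_nonneg p (a :: c :: l) (h.sub (fan_sub _ _ _ _)) (hg.sub (fan_sub a b c l).subset)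
    rw [cyc, fan_crs p a b c l h hg]
    split_ifs <;> linarith
  | [] => by simp [cyc]
  | [a] => by simp [cyc]
  | [a, b] => by simp [cyc]
termination_by l => l.length

theorem in_tri_hull {p a b c : Pt} (h : 0 < det a b c) (h1 : 0 ≤ det a b p) (h2 : 0 ≤ det b c p)
    (h3 : 0 ≤ det c a p) : p ∈ convexHull ℝ ({a, b, c} : Set Pt) := by
  have e := det_add a b c p
  have : p = (det b c p / det a b c) • a + (det c a p / det a b c) • b + (det a b p / det a b c) • c := by
    have hne := h.ne'
    ext
    · simp only [Prod.fst_add, Prod.smul_fst, smul_eq_mul]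
      field_simp
      unfold det; ring
    · simp only [Prod.snd_add, Prod.smul_snd, smul_eq_mul]
      field_simp
      unfold det; ring
  rw [this]
  have hc := convex_convexHull ℝ ({a, b, c} : Set Pt)
  have ha : a ∈ convexHull ℝ ({a, b, c} : Set Pt) := subset_convexHull _ _ (by simp)
  have hb : b ∈ convexHull ℝ ({a, b, c} : Set Pt) := subset_convexHull _ _ (by simp)
  have hcc : c ∈ convexHull ℝ ({a, b, c} : Set Pt) := subset_convexHull _ _ (by simp)
  have := hc.sum_mem (t := Finset.univ) (w := ![det b c p / det a b c, det c a p / det a b c, det a b p / det a b c])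
    (z := ![a, b, c]) (by intro i _; fin_cases i <;> simp <;> positivity)
    (by rw [Fin.sum_univ_three]; simp only [Matrix.cons_val]
        rw [← add_div, ← add_div, div_eq_one_iff_eq h.ne']; linarith)
    (by intro i _; fin_cases i <;> simp [ha, hb, hcc])
  rw [Fin.sum_univ_three] at this
  exact this

theorem cyc_pos_hull (p : Pt) : ∀ l : List Pt, CV l → GenL p l → 0 < cyc (crs p) l →
    p ∈ convexHull ℝ {v | v ∈ l}
  | a :: b :: c :: l => by
    intro h hg h0
    rw [cyc, fan_crs p a b c l h hg] at h0
    split_ifs at h0 with hi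
    · refine convexHull_mono ?_ (in_tri_hull (h _ _ _ (fan_tri a b c l)) hi.1.le hi.2.1.le hi.2.2.le)
      intro v hv
      simp only [Set.mem_insert_iff, Set.mem_singleton_iff] at hv
      simp only [Set.mem_setOf_eq, List.mem_cons]; tauto
    · refine convexHull_mono ?_ (cyc_pos_hull p (a :: c :: l) (h.sub (fan_sub _ _ _ _))
        (hg.sub (fan_sub a b c l).subset) (by linarith))
      intro v hv; exact (fan_sub a b c l).subset hv
  | [] => by simp [cyc]
  | [a] => by simp [cyc]
  | [a, b] => by simp [cyc]
termination_by l => l.length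

/-- a strictly interior generic point is counted -/
theorem cyc_ge_one (p : Pt) : ∀ l : List Pt, 3 ≤ l.length → CV l → GenL p l →
    QC (fun u v => 0 < det u v p) l → 1 ≤ cyc (crs p) l
  | a :: b :: c :: l => by
    intro _ h hg hq
    have hnn := cyc_nonneg p (a :: c :: l) (h.sub (fan_sub _ _ _ _)) (hg.sub (fan_sub a b c l).subset)
    rw [cyc, fan_crs p a b c l h hg]
    have hne := (ne_of_det (h _ _ _ (fan_tri a b c l))).2.2
    have hd := hg.2 c (by simp) a (by simp) hne
    simp only [QC, QP] at hq
    obtain ⟨q1, q2, q3⟩ := hq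
    split_ifs with hi
    · linarith
    · have hca : det c a p < 0 := by
        rcases lt_or_gt_of_ne hd with h' | h'
        · exact h'
        · exact absurd ⟨q1, q2, h'⟩ hi
      rcases l with _ | ⟨d, l⟩
      · simp only [QP] at q3; linarith
      · have := cyc_ge_one p (a :: c :: d :: l) (by simp) (h.sub (fan_sub _ _ _ _))
          (hg.sub (fan_sub a b c (d :: l)).subset) (by
            simp only [QC, QP]
            simp only [QP] at q3
            refine ⟨?_, q3⟩
            rw [det_swap]; linarith)
        linarith
  | [] => by simp
  | [a] => by simp
  | [a, b] => by simp
termination_by l => l.length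

/-- height comparison of two rightward edges over `x` -/
theorem right_aux {u v u' v' : Pt} {x : ℝ} (h1 : u.1 < x) (h2 : x < v.1) (h1' : u'.1 < x) (h2' : x < v'.1)
    (a : 0 ≤ det u v u') (b : 0 ≤ det u v v') (ab : 0 < det u v u' + det u v v')
    (a' : 0 ≤ det u' v' u) (b' : 0 ≤ det u' v' v) : False := by
  have e : (det u v u' * (v'.1 - x) + det u v v' * (x - u'.1)) +
     (det u' v' u * (v.1 - x) + det u' v' v * (x - u.1)) = 0 := by
    unfold det; ring
  have p1 : 0 ≤ det u' v' u * (v.1 - x) := mul_nonneg a' (by linarith)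
  have p2 : 0 ≤ det u' v' v * (x - u.1) := mul_nonneg b' (by linarith)
  have p3 : 0 ≤ det u v u' * (v'.1 - x) := mul_nonneg a (by linarith)
  have p4 : 0 ≤ det u v v' * (x - u'.1) := mul_nonneg b (by linarith)
  have z3 : det u v u' * (v'.1 - x) = 0 := by linarith
  have z4 : det u v v' * (x - u'.1) = 0 := by linarith
  have z5 : det u v u' = 0 := by
    rcases mul_eq_zero.1 z3 with h | h
    · exact h
    · linarith
  have z6 : det u v v' = 0 := by
    rcases mul_eq_zero.1 z4 with h | h
    · exact h
    · linarith
  linarith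


end ABCT

set_option linter.all false

namespace ABCT
variable {V ι : Type*}

theorem det_lin (u v p q : Pt) (t : ℝ) : det u v (p + t • (q - p)) = (1 - t) * det u v p + t * det u v q := by
  unfold det; simp only [Prod.fst_add, Prod.snd_add, Prod.smul_fst, Prod.smul_snd, Prod.fst_sub, Prod.snd_sub,
    smul_eq_mul]; ring

theorem det_tr (u v p d : Pt) : det (u + d) (v + d) (p + d) = det u v p := by
  unfold det; simp only [Prod.fst_add, Prod.snd_add]; ring

theorem CV_QP (a : Pt) (l : List Pt) (h : CV l) (v : Pt) (hv : v ∈ l) (hd : l.head? = some a) :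
    ∀ suf pre, l = pre ++ suf → QP (fun u u' => v = u ∨ v = u' ∨ 0 < det u u' v) a suf
  | [], _ => by simp [QP]
  | [x], pre => by
    intro hl
    simp only [QP]
    by_cases h1 : v = x
    · exact Or.inl h1
    by_cases h2 : v = a
    · exact Or.inr (Or.inl h2)
    right; right
    rw [← det_rot]
    apply h
    rcases pre with _ | ⟨y, pre⟩
    · simp at hl; subst hl; simp at hv; exact absurd hv h1
    · subst hl
      simp at hd; subst hd
      simp only [List.cons_append, List.mem_cons, List.mem_append, List.mem_singleton] at hv
      simp only [List.cons_append]
      apply List.Sublist.cons_cons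
      have : v ∈ pre := by
        rcases hv with h' | h' | h'
        · exact absurd h' h2
        · exact h'
        · simp at h'; exact absurd h' h1
      exact (List.singleton_sublist.2 this).append (List.Sublist.refl [x])
  | x :: y :: t, pre => by
    intro hl
    simp only [QP]
    refine ⟨?_, CV_QP a l h v hv hd (y :: t) (pre ++ [x]) (by rw [hl]; simp)⟩
    by_cases h1 : v = x
    · exact Or.inl h1
    by_cases h2 : v = y
    · exact Or.inr (Or.inl h2)
    right; right
    rw [hl] at hv
    simp only [List.mem_append, List.mem_cons] at hv
    rcases hv with h' | h' | h' | h'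
    · rw [det_rot]
      apply h
      rw [hl]
      exact (List.singleton_sublist.2 h').append (by simp : [x, y].Sublist (x :: y :: t))
    · exact absurd h' h1
    · exact absurd h' h2
    · apply h
      rw [hl]
      refine List.Sublist.trans ?_ (List.sublist_append_right pre _)
      simpa using h'

theorem CV_QC (l : List Pt) (h : CV l) (v : Pt) (hv : v ∈ l) :
    QC (fun u u' => v = u ∨ v = u' ∨ 0 < det u u' v) l := by
  cases l with
  | nil => simp [QC]
  | cons a l => exact CV_QP a _ h v hv rfl _ [] rfl

theorem CV_QC' (l : List Pt) (h : CV l) (v : Pt) (hv : v ∈ l) :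
    QC (fun u u' => 0 ≤ det u u' v) l := by
  rw [QC_iff]
  intro q hq
  rcases (QC_iff _ _).1 (CV_QC l h v hv) q hq with h | h | h
  · rw [h]; unfold det; ring_nf; exact le_rfl
  · rw [h]; unfold det; ring_nf; exact le_rfl
  · exact h.le

theorem convex_det (u v : Pt) : Convex ℝ {p | 0 ≤ det u v p} := by
  intro x hx y hy a b ha hb hab
  simp only [Set.mem_setOf_eq] at *
  have : det u v (a • x + b • y) = a * det u v x + b * det u v y := by
    unfold det; simp only [Prod.fst_add, Prod.snd_add, Prod.smul_fst, Prod.smul_snd, smul_eq_mul]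
    linear_combination ((v.1 - u.1) * u.2 - (v.2-u.2) * u.1) * hab
  rw [this]; positivity

theorem hull_QC (l : List Pt) (h : CV l) (p : Pt) (hp : p ∈ convexHull ℝ {v | v ∈ l}) :
    QC (fun u u' => 0 ≤ det u u' p) l := by
  rw [QC_iff]
  intro q hq
  have := convexHull_min (s := {v | v ∈ l}) (t := {p | 0 ≤ det q.1 q.2 p}) (by
    intro v hv
    exact (QC_iff _ _).1 (CV_QC' l h v hv) q hq) (convex_det _ _)
  exact this hp

theorem exists_interior (l : List Pt) (h : CV l) (hl : 3 ≤ l.length) :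
    ∃ q, QC (fun u u' => 0 < det u u' q) l := by
  match l, hl with
  | a :: b :: c :: l, _ =>
    refine ⟨((a.1 + b.1 + c.1) / 3, (a.2 + b.2 + c.2) / 3), ?_⟩
    rw [QC_iff]
    intro q hq
    have ha := (QC_iff _ _).1 (CV_QC _ h a (by simp)) q hq
    have hb := (QC_iff _ _).1 (CV_QC _ h b (by simp)) q hq
    have hc := (QC_iff _ _).1 (CV_QC _ h c (by simp)) q hq
    have ha' := (QC_iff _ _).1 (CV_QC' _ h a (by simp)) q hq
    have hb' := (QC_iff _ _).1 (CV_QC' _ h b (by simp)) q hq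
    have hc' := (QC_iff _ _).1 (CV_QC' _ h c (by simp)) q hq
    have e : det q.1 q.2 ((a.1 + b.1 + c.1) / 3, (a.2 + b.2 + c.2) / 3) =
      (det q.1 q.2 a + det q.1 q.2 b + det q.1 q.2 c) / 3 := by unfold det; ring
    rw [e]
    obtain ⟨n1, n2, n3⟩ := ne_of_det (h _ _ _ (fan_tri a b c l))
    have : 0 < det q.1 q.2 a ∨ 0 < det q.1 q.2 b ∨ 0 < det q.1 q.2 c := by
      by_contra hcon
      push Not at hcon
      rcases ha with ha | ha | ha <;> rcases hb with hb | hb | hb <;> rcases hc with hc | hc | hc <;>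
        first
        | exact n1 (ha.trans hb.symm)
        | exact n2 (hb.trans hc.symm)
        | exact n3 (hc.trans ha.symm)
        | (exfalso; linarith [hcon.1, hcon.2.1, hcon.2.2])
    rcases this with h | h | h <;> linarith

theorem QC_seg (l : List Pt) (p q : Pt) (hp : QC (fun u u' => 0 ≤ det u u' p) l)
    (hq : QC (fun u u' => 0 < det u u' q) l) (t : ℝ) (ht : 0 < t) (ht1 : t ≤ 1) :
    QC (fun u u' => 0 < det u u' (p + t • (q - p))) l := by
  rw [QC_iff] at *
  intro r hr
  rw [det_lin]
  have := hp r hr; have := hq r hr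
  have := mul_pos ht this
  have : 0 ≤ (1 - t) * det r.1 r.2 p := mul_nonneg (by linarith) (by assumption)
  linarith

theorem isOpen_QC (l : List Pt) : IsOpen {p | QC (fun u u' => 0 < det u u' p) l} := by
  simp only [QC_iff]
  have : {p | ∀ q ∈ cprs l, 0 < det q.1 q.2 p} = ⋂ q ∈ {q | q ∈ cprs l}, {p | 0 < det q.1 q.2 p} := by
    ext p; simp
  rw [this]
  apply Set.Finite.isOpen_biInter
  · exact List.finite_toSet _
  · intro q _
    apply isOpen_lt continuous_const
    unfold det; fun_prop

/-- a nonstrict point can be approximated by strict ones -/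
theorem QC_closure (l : List Pt) (h : CV l) (hl : 3 ≤ l.length) (p : Pt)
    (hp : QC (fun u u' => 0 ≤ det u u' p) l) (U : Set Pt) (hU : IsOpen U) (hpU : p ∈ U) :
    ∃ q ∈ U, QC (fun u u' => 0 < det u u' q) l := by
  obtain ⟨q, hq⟩ := exists_interior l h hl
  have hc : Filter.Tendsto (fun t : ℝ => p + t • (q - p)) (nhdsWithin 0 (Set.Ioi 0)) (nhds p) := by
    have : Continuous (fun t : ℝ => p + t • (q - p)) := by fun_prop
    have := this.tendsto 0
    simp only [zero_smul, add_zero] at this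
    exact this.mono_left nhdsWithin_le_nhds
  have h1 := hc.eventually (hU.mem_nhds hpU)
  have h2 : ∀ᶠ t : ℝ in nhdsWithin 0 (Set.Ioi 0), 0 < t := self_mem_nhdsWithin
  have h3 : ∀ᶠ t : ℝ in nhdsWithin 0 (Set.Ioi 0), t < 1 :=
    nhdsWithin_le_nhds (isOpen_Iio.mem_nhds (by norm_num))
  obtain ⟨t, t1, t2, t3⟩ := (h1.and (h2.and h3)).exists
  exact ⟨_, t1, QC_seg l p q hp hq t t2 t3.le⟩

end ABCT

set_option linter.all false

namespace ABCT
variable {V ι : Type*}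

theorem det_self1 (u v : Pt) : det u v u = 0 := by unfold det; ring
theorem det_self2 (u v : Pt) : det u v v = 0 := by unfold det; ring

theorem Drawn.nonneg {K : Cx V ι} {pos : V → Pt} (h : Drawn K pos) {o : V × V} (ho : o ∈ K.O) {v : V}
    (hv : v ∈ K.RV) : 0 ≤ det (pos o.1) (pos o.2) (pos v) := by
  by_cases h1 : v = o.1
  · rw [h1, det_self1]
  by_cases h2 : v = o.2
  · rw [h2, det_self2]
  exact (h.hO o ho v hv h1 h2).le

theorem right_unique {K : Cx V ι} {pos : V → Pt} (h : Drawn K pos) {o o' : V × V} (ho : o ∈ K.O)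
    (ho' : o' ∈ K.O) {x : ℝ} (h1 : (pos o.1).1 < x) (h2 : x < (pos o.2).1)
    (h1' : (pos o'.1).1 < x) (h2' : x < (pos o'.2).1) : o = o' := by
  by_contra hne
  have r1 := K.hRO o ho
  have r2 := K.hRO o' ho'
  have n12 : o'.1 ≠ o.2 := by intro e; rw [e] at h1'; linarith
  have n21 : o'.2 ≠ o.1 := by intro e; rw [e] at h2'; linarith
  have a := h.nonneg ho r2.1
  have b := h.nonneg ho r2.2
  have a' := h.nonneg ho' r1.1
  have b' := h.nonneg ho' r1.2
  refine right_aux h1 h2 h1' h2' a b ?_ a' b'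
  by_cases e1 : o'.1 = o.1
  · have e2 : o'.2 ≠ o.2 := fun e2 => hne (Prod.ext e1.symm e2.symm)
    have := h.hO o ho _ r2.2 n21 e2
    linarith
  · have := h.hO o ho _ r2.1 e1 n12
    linarith

theorem Gn.genL {R : Finset V} {pos : V → Pt} {p : Pt} (h : Gn R pos p) (l : List V) (hl : ∀ v ∈ l, v ∈ R) :
    GenL p (l.map pos) := by
  constructor
  · intro v hv
    obtain ⟨u, hu, rfl⟩ := List.mem_map.1 hv
    exact h.1 u (hl u hu)
  · intro u hu v hv hne
    obtain ⟨u', hu', rfl⟩ := List.mem_map.1 hu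
    obtain ⟨v', hv', rfl⟩ := List.mem_map.1 hv
    exact h.2 u' (hl u' hu') v' (hl v' hv') hne

theorem sum_cross {K : Cx V ι} (pos : V → Pt) (p : Pt) :
    ∑ φ ∈ K.Fl, K.w φ * cyc (crs p) ((K.poly φ).map pos) = ∑ o ∈ K.O, crs p (pos o.1) (pos o.2) := by
  rw [← K.hcancel (fun u v => crs p (pos u) (pos v)) (fun u v => crs_anti _ _ _)]
  refine Finset.sum_congr rfl fun φ _ => ?_
  rw [cyc_map]

theorem count_le_one {K : Cx V ι} {pos : V → Pt} (h : Drawn K pos) {p : Pt} :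
    ∑ φ ∈ K.Fl, K.w φ * cyc (crs p) ((K.poly φ).map pos) ≤ 1 := by
  classical
  rw [sum_cross]
  have : ∀ o ∈ K.O, crs p (pos o.1) (pos o.2) ≤ if ((pos o.1).1 < p.1 ∧ p.1 < (pos o.2).1) then 1 else 0 := by
    intro o ho
    unfold crs above
    split_ifs <;> first | linarith | (exfalso; tauto)
  refine (Finset.sum_le_sum this).trans ?_
  rw [Finset.sum_boole]
  have : (Finset.filter (fun o : V × V => (pos o.1).1 < p.1 ∧ p.1 < (pos o.2).1) K.O).card ≤ 1 := by
    rw [Finset.card_le_one]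
    intro a ha b hb
    rw [Finset.mem_filter] at ha hb
    exact right_unique h ha.1 hb.1 ha.2.1 ha.2.2 hb.2.1 hb.2.2
  exact_mod_cast this

theorem cyc_nn {K : Cx V ι} {pos : V → Pt} (h : Drawn K pos) {p : Pt} (hp : Gn K.RV pos p) {φ : ι} (hφ : φ ∈ K.Fl) :
    0 ≤ cyc (crs p) ((K.poly φ).map pos) :=
  cyc_nonneg p _ (h.hT φ hφ) (hp.genL _ (K.hR φ hφ))

/-- group contributions -/
theorem grp_sum {K : Cx V ι} {pos : V → Pt} {p : Pt} {φ : ι} (hφ : φ ∈ K.Fl) :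
    ∑ ψ ∈ K.grp φ, K.w ψ * cyc (crs p) ((K.poly ψ).map pos) = cyc (crs p) ((K.poly φ).map pos) := by
  have : ∀ ψ ∈ K.grp φ, K.w ψ * cyc (crs p) ((K.poly ψ).map pos) = K.w ψ * cyc (crs p) ((K.poly φ).map pos) := by
    intro ψ hψ
    rw [cyc_map, cyc_map, K.hgc φ hφ ψ hψ (fun u v => crs p (pos u) (pos v)) (fun u v => crs_anti _ _ _)]
  rw [Finset.sum_congr rfl this, ← Finset.sum_mul, K.hg1 φ hφ, one_mul]

theorem interior_disjoint {K : Cx V ι} {pos : V → Pt} (h : Drawn K pos) {φ ψ : ι} (hφ : φ ∈ K.Fl)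
    (hψ : ψ ∈ K.Fl) (hd : Disjoint (K.grp φ) (K.grp ψ)) (p : Pt)
    (h1 : QC (fun u v => 0 < det u v p) ((K.poly φ).map pos))
    (h2 : QC (fun u v => 0 < det u v p) ((K.poly ψ).map pos)) : False := by
  classical
  obtain ⟨q, ⟨hq1, hq2⟩, hq⟩ := exists_Gn K.RV pos _ ((isOpen_QC _).inter (isOpen_QC _)) ⟨p, h1, h2⟩
  have a1 := cyc_ge_one q _ (by rw [List.length_map]; exact K.hlen φ hφ) (h.hT φ hφ) (hq.genL _ (K.hR φ hφ)) hq1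
  have a2 := cyc_ge_one q _ (by rw [List.length_map]; exact K.hlen ψ hψ) (h.hT ψ hψ) (hq.genL _ (K.hR ψ hψ)) hq2
  have c := count_le_one h (p := q)
  have s : ∑ ξ ∈ K.grp φ ∪ K.grp ψ, K.w ξ * cyc (crs q) ((K.poly ξ).map pos) ≤
      ∑ ξ ∈ K.Fl, K.w ξ * cyc (crs q) ((K.poly ξ).map pos) := by
    apply Finset.sum_le_sum_of_subset_of_nonneg (Finset.union_subset (K.hgs φ hφ) (K.hgs ψ hψ))
    intro ξ hξ _
    exact mul_nonneg (K.hw ξ hξ).le (cyc_nn h hq hξ)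
  rw [Finset.sum_union hd, grp_sum hφ, grp_sum hψ] at s
  linarith

theorem continuous_det' {X : Type*} [TopologicalSpace X] {f g k : X → Pt} (hf : Continuous f) (hg : Continuous g)
    (hk : Continuous k) : Continuous fun x => det (f x) (g x) (k x) := by
  unfold det; fun_prop

theorem list_eq_of_sublist_map {V W : Type*} {f : V → W} {l : List V} {u v w : W} (h : [u,v,w].Sublist (l.map f)) :
    ∃ a b c, [a,b,c].Sublist l ∧ f a = u ∧ f b = v ∧ f c = w := by
  obtain ⟨l', hl', e⟩ := List.sublist_map_iff.1 h
  match l', e with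
  | [a,b,c], e =>
    simp only [List.map_cons, List.map_nil, List.cons.injEq, and_true] at e
    exact ⟨a, b, c, hl', e.1.symm, e.2.1.symm, e.2.2.symm⟩
  | [], e => simp at e
  | [a], e => simp at e
  | [a,b], e => simp at e
  | a::b::c::d::l, e => simp at e

theorem mem3_of_sublist {V : Type*} {l : List V} {a b c : V} (h : [a,b,c].Sublist l) : a ∈ l ∧ b ∈ l ∧ c ∈ l :=
  ⟨h.subset (by simp), h.subset (by simp), h.subset (by simp)⟩

/-- being drawn is an open condition along continuous families -/
theorem Drawn.eventually {K : Cx V ι} {pos : ℝ → V → Pt} (hc : ∀ v, Continuous fun t => pos t v)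
    (h : Drawn K (pos 0)) : ∀ᶠ t in nhds 0, Drawn K (pos t) := by
  have e1 : ∀ᶠ t in nhds (0:ℝ), ∀ φ ∈ K.Fl, ∀ a ∈ K.RV, ∀ b ∈ K.RV, ∀ c ∈ K.RV, [a,b,c].Sublist (K.poly φ) →
      0 < det (pos t a) (pos t b) (pos t c) := by
    rw [Filter.eventually_all_finset]; intro φ hφ
    rw [Filter.eventually_all_finset]; intro a ha
    rw [Filter.eventually_all_finset]; intro b hb
    rw [Filter.eventually_all_finset]; intro c hc'
    by_cases hs : [a,b,c].Sublist (K.poly φ)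
    · have : 0 < det (pos 0 a) (pos 0 b) (pos 0 c) := by
        apply h.hT φ hφ
        exact hs.map (pos 0)
      have := (continuous_det' (hc a) (hc b) (hc c)).continuousAt.eventually (lt_mem_nhds this)
      filter_upwards [this] with t ht _ using ht
    · exact Filter.Eventually.of_forall fun t h => absurd h hs
  have e2 : ∀ᶠ t in nhds (0:ℝ), ∀ o ∈ K.O, ∀ v ∈ K.RV, v ≠ o.1 → v ≠ o.2 → 
      0 < det (pos t o.1) (pos t o.2) (pos t v) := by
    rw [Filter.eventually_all_finset]; intro o ho
    rw [Filter.eventually_all_finset]; intro v hv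
    by_cases h1 : v = o.1
    · exact Filter.Eventually.of_forall fun t h => absurd h1 h
    by_cases h2 : v = o.2
    · exact Filter.Eventually.of_forall fun t _ h => absurd h2 h
    have := (continuous_det' (hc o.1) (hc o.2) (hc v)).continuousAt.eventually (lt_mem_nhds (h.hO o ho v hv h1 h2))
    filter_upwards [this] with t ht _ _ using ht
  filter_upwards [e1, e2] with t h1 h2
  refine ⟨?_, h2⟩
  intro φ hφ u v w hs
  obtain ⟨a, b, c, hs', rfl, rfl, rfl⟩ := list_eq_of_sublist_map hs
  obtain ⟨ha, hb, hc⟩ := mem3_of_sublist hs'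
  exact h1 φ hφ a (K.hR φ hφ a ha) b (K.hR φ hφ b hb) c (K.hR φ hφ c hc) hs'

def hullP (K : Cx V ι) (pos : V → Pt) (φ : ι) : Set Pt := convexHull ℝ (pos '' {v | v ∈ K.poly φ})

theorem hullP_eq (K : Cx V ι) (pos : V → Pt) (φ : ι) : hullP K pos φ = convexHull ℝ {v | v ∈ (K.poly φ).map pos} := by
  unfold hullP; congr 1; ext x; simp

theorem cprs_map {V W : Type*} (f : V → W) (l : List V) : cprs (l.map f) = (cprs l).map (Prod.map f f) := by
  have : ∀ z : V, ∀ l : List V, prs (f z) (l.map f) = (prs z l).map (Prod.map f f) := by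
    intro z l
    induction l with
    | nil => rfl
    | cons a l ih =>
      cases l with
      | nil => rfl
      | cons b l => simp only [List.map_cons, prs] at ih ⊢; rw [ih]; rfl
  cases l with
  | nil => rfl
  | cons a l => exact this a (a :: l)

theorem mem_prs {V : Type*} {z : V} {l : List V} {q : V × V} (h : q ∈ prs z l) : q.1 ∈ l ∧ (q.2 ∈ l ∨ q.2 = z) := by
  induction l with
  | nil => simp [prs] at h
  | cons a l ih =>
    cases l with
    | nil => simp [prs] at h; simp [h]
    | cons b l =>
      rw [prs] at h
      rcases List.mem_cons.1 h with h | h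
      · simp [h]
      · have := ih h; simp only [List.mem_cons] at this ⊢; tauto

theorem mem_cprs {V : Type*} {l : List V} {q : V × V} (h : q ∈ cprs l) : q.1 ∈ l ∧ q.2 ∈ l := by
  cases l with
  | nil => simp [cprs] at h
  | cons a l =>
    have := mem_prs h
    refine ⟨this.1, this.2.elim id ?_⟩
    intro e; rw [e]; simp

theorem hull_disjoint {K : Cx V ι} {pos : V → Pt} (h : Drawn K pos) {φ ψ : ι} (hφ : φ ∈ K.Fl)
    (hψ : ψ ∈ K.Fl) (hd : Disjoint (K.grp φ) (K.grp ψ)) (hv : ∀ v ∈ K.poly φ, v ∉ K.poly ψ) :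
    Disjoint (hullP K pos φ) (hullP K pos ψ) := by
  classical
  rw [Set.disjoint_left]
  intro p hp1 hp2
  rw [hullP_eq] at hp1 hp2
  have q1 := hull_QC _ (h.hT φ hφ) p hp1
  have q2 := hull_QC _ (h.hT ψ hψ) p hp2
  obtain ⟨q, hq⟩ := exists_interior _ (h.hT ψ hψ) (by rw [List.length_map]; exact K.hlen ψ hψ)
  let P : ℝ → V → Pt := fun t v => if v ∈ K.poly φ then pos v + t • (q - p) else pos v
  have hP0 : P 0 = pos := by funext v; simp only [P]; split_ifs <;> simp
  have hcont : ∀ v, Continuous fun t => P t v := by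
    intro v; simp only [P]; split_ifs <;> fun_prop
  have ev := Drawn.eventually hcont (by rw [hP0]; exact h)
  have ev1 : ∀ᶠ t in nhdsWithin (0:ℝ) (Set.Ioi 0), Drawn K (P t) ∧ t ∈ Set.Ioc (0:ℝ) 1 :=
    (ev.filter_mono nhdsWithin_le_nhds).and (Ioc_mem_nhdsGT one_pos)
  obtain ⟨t, ht, ht0, ht1⟩ := ev1.exists
  have m1 : (K.poly φ).map (P t) = ((K.poly φ).map pos).map (fun x => x + t • (q - p)) := by
    rw [List.map_map]; apply List.map_congr_left
    intro v hv; simp [P, hv]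
  have m2 : (K.poly ψ).map (P t) = (K.poly ψ).map pos := by
    apply List.map_congr_left
    intro v hv'; simp only [P]; rw [if_neg]; intro h; exact hv v h hv'
  have r2 : QC (fun u v => 0 < det u v (p + t • (q - p))) ((K.poly ψ).map (P t)) := by
    rw [m2]; exact QC_seg _ p q q2 hq t ht0 ht1
  have r1 : QC (fun u v => 0 ≤ det u v (p + t • (q - p))) ((K.poly φ).map (P t)) := by
    rw [m1, QC_iff, cprs_map]
    intro r hr
    obtain ⟨r', hr', rfl⟩ := List.mem_map.1 hr
    simp only [Prod.map]
    rw [det_tr]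
    exact (QC_iff _ _).1 q1 r' hr'
  obtain ⟨x, hx, hx'⟩ := QC_closure _ (ht.hT φ hφ) (by rw [List.length_map]; exact K.hlen φ hφ) _ r1 _ (isOpen_QC _) r2
  exact interior_disjoint ht hφ hψ hd x hx' hx

def hullR (K : Cx V ι) (pos : V → Pt) : Set Pt := convexHull ℝ (pos '' {v | v ∈ K.RV})

theorem det_hullR {K : Cx V ι} {pos : V → Pt} (h : Drawn K pos) {p : Pt} (hp : p ∈ hullR K pos) {o : V × V}
    (ho : o ∈ K.O) : 0 ≤ det (pos o.1) (pos o.2) p := by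
  refine convexHull_min (t := {p | 0 ≤ det (pos o.1) (pos o.2) p}) ?_ (convex_det _ _) hp
  rintro _ ⟨v, hv, rfl⟩
  exact h.nonneg ho hv

theorem convex_fst_lt (c : ℝ) : Convex ℝ {p : Pt | p.1 < c} := by
  have := (convex_Iio c).linear_preimage (LinearMap.fst ℝ ℝ ℝ)
  exact this
theorem convex_fst_gt (c : ℝ) : Convex ℝ {p : Pt | c < p.1} := by
  have := (convex_Ioi c).linear_preimage (LinearMap.fst ℝ ℝ ℝ)
  exact this

theorem cover_gen {K : Cx V ι} {pos : V → Pt} (h : Drawn K pos) {p : Pt} (hp : p ∈ hullR K pos)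
    (hg : Gn K.RV pos p) : ∃ φ ∈ K.Fl, p ∈ hullP K pos φ := by
  classical
  have hu : ∃ u ∈ K.RV, (pos u).1 < p.1 := by
    by_contra hc
    push Not at hc
    have : p ∈ {p' : Pt | p.1 < p'.1} := by
      refine convexHull_min ?_ (convex_fst_gt _) hp
      rintro _ ⟨v, hv, rfl⟩
      exact lt_of_le_of_ne (hc v hv) (hg.1 v hv)
    exact lt_irrefl p.1 this
  have hv : ∃ u ∈ K.RV, ¬ (pos u).1 < p.1 := by
    by_contra hc
    push Not at hc
    have : p ∈ {p' : Pt | p'.1 < p.1} := by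
      refine convexHull_min ?_ (convex_fst_lt _) hp
      rintro _ ⟨v, hv, rfl⟩
      exact hc v hv
    exact lt_irrefl p.1 this
  obtain ⟨φ, hφ, u, hu, v, hv, h1, h2⟩ := K.hconn (fun v => (pos v).1 < p.1) hu hv
  have h2 : p.1 < (pos v).1 := lt_of_le_of_ne (not_lt.1 h2) (hg.1 v (K.hR φ hφ v hv))
  -- a point of the polygon over the same abscissa
  obtain ⟨r, hr, hr1⟩ : ∃ r ∈ hullP K pos φ, r.1 = p.1 := by
    have hu' : pos u ∈ hullP K pos φ := subset_convexHull _ _ ⟨u, hu, rfl⟩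
    have hv' : pos v ∈ hullP K pos φ := subset_convexHull _ _ ⟨v, hv, rfl⟩
    have hpos : 0 < (pos v).1 - (pos u).1 := by linarith
    refine ⟨(((pos v).1 - p.1) / ((pos v).1 - (pos u).1)) • pos u + ((p.1 - (pos u).1) / ((pos v).1 - (pos u).1)) • pos v,
      convex_convexHull ℝ _ hu' hv' (div_nonneg (by linarith) hpos.le) (div_nonneg (by linarith) hpos.le)
      (by field_simp; ring), ?_⟩
    simp only [Prod.fst_add, Prod.smul_fst, smul_eq_mul]
    field_simp; ring
  let U : Set Pt := ⋂ v ∈ {v | v ∈ K.RV}, {q | ((pos v).1 < p.1 → (pos v).1 < q.1) ∧ (p.1 < (pos v).1 → q.1 < (pos v).1)}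
  have hU : IsOpen U := by
    apply Set.Finite.isOpen_biInter (K.RV.finite_toSet)
    intro v hv
    by_cases h1 : (pos v).1 < p.1
    · have : ¬ p.1 < (pos v).1 := by linarith
      simp only [h1, this, true_imp_iff, false_imp_iff, and_true]
      exact isOpen_lt continuous_const continuous_fst
    · have h2 : p.1 < (pos v).1 := lt_of_le_of_ne (not_lt.1 h1) (hg.1 v hv)
      simp only [h1, h2, true_imp_iff, false_imp_iff, true_and]
      exact isOpen_lt continuous_fst continuous_const
  have hrU : r ∈ U := by
    simp only [U, Set.mem_iInter]
    intro v _
    simp only [Set.mem_setOf_eq, hr1]; exact ⟨id, id⟩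
  rw [hullP_eq] at hr
  have hlen : 3 ≤ ((K.poly φ).map pos).length := by rw [List.length_map]; exact K.hlen φ hφ
  obtain ⟨q0, hq0, hq0'⟩ := QC_closure _ (h.hT φ hφ) hlen r (hull_QC _ (h.hT φ hφ) r hr) U hU hrU
  obtain ⟨q, ⟨hqU, hq⟩, hqg⟩ := exists_Gn K.RV pos _ (hU.inter (isOpen_QC ((K.poly φ).map pos))) ⟨q0, hq0, hq0'⟩
  have a1 := cyc_ge_one q _ hlen (h.hT φ hφ) (hqg.genL _ (K.hR φ hφ)) hq
  have a2 : 0 < ∑ φ ∈ K.Fl, K.w φ * cyc (crs q) ((K.poly φ).map pos) := by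
    apply Finset.sum_pos'
    · intro ξ hξ; exact mul_nonneg (K.hw ξ hξ).le (cyc_nn h hqg hξ)
    · exact ⟨φ, hφ, mul_pos (K.hw φ hφ) (by linarith)⟩
  have a3 : 0 < ∑ φ ∈ K.Fl, K.w φ * cyc (crs p) ((K.poly φ).map pos) := by
    rw [sum_cross] at a2 ⊢
    refine a2.trans_le (Finset.sum_le_sum ?_)
    intro o ho
    have r := K.hRO o ho
    simp only [U, Set.mem_iInter] at hqU
    have b1 := hqU o.1 r.1
    have b2 := hqU o.2 r.2
    have c1 := hg.1 o.1 r.1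
    have c2 := hg.1 o.2 r.2
    have e1 : (pos o.1).1 < q.1 → (pos o.1).1 < p.1 := by
      intro h; by_contra hc
      have := b1.2 (lt_of_le_of_ne (not_lt.1 hc) c1); linarith
    have e2 : q.1 < (pos o.2).1 → p.1 < (pos o.2).1 := by
      intro h; by_contra hc
      have := b2.1 (lt_of_le_of_ne (not_lt.1 hc) c2.symm); linarith
    have d := det_hullR h hp ho
    have d' := det_swap (pos o.1) (pos o.2) p
    unfold crs above
    by_cases hne : pos o.1 = pos o.2
    · rw [hne]; simp
    have d1 := hg.2 _ r.1 _ r.2 hne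
    have d2 : 0 < det (pos o.1) (pos o.2) p := lt_of_le_of_ne d d1.symm
    rw [d']
    have : ¬ 0 < - det (pos o.1) (pos o.2) p := by linarith
    simp only [d2, this, and_true, and_false, if_false, sub_zero]
    split_ifs <;> first | linarith | (exfalso; tauto)
  obtain ⟨ψ, hψ, hψ'⟩ := Finset.exists_lt_of_sum_lt (f := fun _ => (0:ℝ)) (by simpa using a3)
  refine ⟨ψ, hψ, ?_⟩
  rw [hullP_eq]
  exact cyc_pos_hull p _ (h.hT ψ hψ) (hg.genL _ (K.hR ψ hψ)) (pos_of_mul_pos_right hψ' (K.hw ψ hψ).le)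

theorem isClosed_hullP (K : Cx V ι) (pos : V → Pt) (φ : ι) : IsCompact (hullP K pos φ) :=
  Set.Finite.isCompact_convexHull ℝ ((List.finite_toSet (K.poly φ)).image pos)

theorem hullP_interior {K : Cx V ι} {pos : V → Pt} (h : Drawn K pos) {φ : ι} (hφ : φ ∈ K.Fl) :
    (interior (hullP K pos φ)).Nonempty := by
  obtain ⟨a, b, c, l, e⟩ : ∃ a b c l, (K.poly φ).map pos = a :: b :: c :: l := by
    have := K.hlen φ hφ
    rw [← List.length_map (f := pos)] at this
    match (K.poly φ).map pos, this with
    | a :: b :: c :: l, _ => exact ⟨a, b, c, l, rfl⟩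
  have hd : CV [a,b,c] := (h.hT φ hφ).sub (by rw [e]; simp)
  have hd' := hd a b c (List.Sublist.refl _)
  obtain ⟨q, hq⟩ := exists_interior _ hd (by simp)
  refine ⟨q, mem_interior.2 ⟨_, ?_, isOpen_QC [a,b,c], hq⟩⟩
  intro x hx
  simp only [QC, QP, Set.mem_setOf_eq] at hx
  rw [hullP_eq, e]
  refine convexHull_mono ?_ (in_tri_hull hd' hx.1.le hx.2.1.le hx.2.2.le)
  intro y hy
  simp only [Set.mem_insert_iff, Set.mem_singleton_iff] at hy
  simp only [Set.mem_setOf_eq, List.mem_cons]; tauto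

theorem hullP_sub (K : Cx V ι) (pos : V → Pt) {φ : ι} (hφ : φ ∈ K.Fl) : hullP K pos φ ⊆ hullR K pos :=
  convexHull_mono (Set.image_mono fun v hv => K.hR φ hφ v hv)

theorem cover {K : Cx V ι} {pos : V → Pt} (h : Drawn K pos) {p : Pt} (hp : p ∈ hullR K pos) :
    ∃ φ ∈ K.Fl, p ∈ hullP K pos φ := by
  have hne : (interior (hullR K pos)).Nonempty := by
    have : (hullR K pos).Nonempty := ⟨p, hp⟩
    obtain ⟨_, v, hv, rfl⟩ := convexHull_nonempty_iff.1 this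
    obtain ⟨φ, hφ, _⟩ := K.hR' v hv
    exact (hullP_interior h hφ).mono (interior_mono (hullP_sub K pos hφ))
  have hcl : IsClosed (⋃ φ ∈ {φ | φ ∈ K.Fl}, hullP K pos φ) :=
    Set.Finite.isClosed_biUnion K.Fl.finite_toSet fun φ _ => (isClosed_hullP K pos φ).isClosed
  have hp' : p ∈ closure (interior (hullR K pos)) := by
    have hc : Convex ℝ (hullR K pos) := convex_convexHull ℝ _
    rw [hc.closure_interior_eq_closure_of_nonempty_interior hne]
    exact subset_closure hp
  have : p ∈ ⋃ φ ∈ {φ | φ ∈ K.Fl}, hullP K pos φ := by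
    have h1 := closure_mono ((dense_Gn K.RV pos).open_subset_closure_inter (isOpen_interior (s := hullR K pos))) hp'
    rw [closure_closure] at h1
    refine closure_minimal ?_ hcl h1
    rintro x ⟨hx1, hx2⟩
    obtain ⟨φ, hφ, hx⟩ := cover_gen h (interior_subset hx1) hx2
    simp only [Set.mem_iUnion]
    exact ⟨φ, hφ, hx⟩
  simpa using this

end ABCT

set_option linter.all false

namespace ABCT
open Filter Topology

/-- linear interpolation data -/
structure Ip (V : Type*) where
  ea : V → V
  eb : V → V
  tt : V → ℝ
  κ : ℝ
  hκ : 0 < κ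
  hκ1 : κ ≤ 1
  ht0 : ∀ v, 0 ≤ tt v
  ht1 : ∀ v, tt v ≤ 1
  hta : ∀ v, tt v ≠ 1 → κ ≤ 1 - tt v
  htb : ∀ v, tt v ≠ 0 → κ ≤ tt v

variable {V ι : Type*}

def Ip.ip (I : Ip V) (pos : V → Pt) (v : V) : Pt := (1 - I.tt v) • pos (I.ea v) + I.tt v • pos (I.eb v)

def Ip.IsEnd (I : Ip V) (v a : V) : Prop := (a = I.ea v ∧ I.tt v ≠ 1) ∨ (a = I.eb v ∧ I.tt v ≠ 0)

def Ip.Anc (I : Ip V) : ℕ → V → V → Prop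
  | 0, v, u => v = u
  | k + 1, v, u => ∃ a, I.IsEnd v a ∧ I.Anc k a u

structure Sys (V ι E : Type*) [MetricSpace E] where
  I : Ip V
  K : ℕ → Cx V ι
  X : Set E
  hX : IsCompact X
  F : ℕ → ι → Set E
  par : ℕ → ι → ι → Prop
  hgm : ∀ n, ∀ φ ∈ (K n).Fl, ∀ ψ ∈ (K n).grp φ, ∀ v, v ∈ (K n).poly ψ ↔ v ∈ (K n).poly φ
  hFc : ∀ n, ∀ φ ∈ (K n).Fl, IsClosed (F n φ)
  hFn : ∀ n, ∀ φ ∈ (K n).Fl, (F n φ).Nonempty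
  hFX : ∀ n, ∀ φ ∈ (K n).Fl, F n φ ⊆ X
  hX0 : ∀ x ∈ X, ∃ φ ∈ (K 0).Fl, x ∈ F 0 φ
  hch : ∀ n, ∀ φ ∈ (K n).Fl, ∀ x ∈ F n φ, ∃ ψ ∈ (K (n+1)).Fl, par n ψ φ ∧ x ∈ F (n+1) ψ
  D : ℕ → ℝ
  hD : Tendsto D atTop (𝓝 0)
  hdiam : ∀ n, ∀ φ ∈ (K n).Fl, ∀ x ∈ F n φ, ∀ y ∈ F n φ, dist x y ≤ D n
  hadj : ∀ n, ∀ φ ∈ (K n).Fl, ∀ ψ ∈ (K n).Fl, (F n φ ∩ F n ψ).Nonempty →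
    ∃ v, v ∈ (K n).poly φ ∧ v ∈ (K n).poly ψ
  hadj' : ∀ n, ∀ φ ∈ (K n).Fl, ∀ ψ ∈ (K n).Fl, ∀ v, v ∈ (K n).poly φ → v ∈ (K n).poly ψ →
    (F n φ ∩ F n ψ).Nonempty
  hend : ∀ n, ∀ φ ∈ (K n).Fl, ∀ ψ ∈ (K (n+1)).Fl, par n ψ φ → ∀ v ∈ (K (n+1)).poly ψ,
    I.ea v ∈ (K n).poly φ ∧ I.eb v ∈ (K n).poly φ
  hpar : ∀ n, ∀ ψ ∈ (K (n+1)).Fl, ∃ φ ∈ (K n).Fl, par n ψ φ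
  hold : ∀ n, ∀ v ∈ (K n).RV, ∃ v' ∈ (K (n+1)).RV, I.ea v' = v ∧ I.tt v' = 0
  N : ℕ
  hN : 0 < N
  hmesh : ∀ n, ∀ c : ℕ → ι, (∀ j ≤ N, c j ∈ (K (n+j)).Fl) →
    (∀ j < N, par (n+j) (c (j+1)) (c j)) → ∀ v ∈ (K (n+N)).poly (c N), ∀ w ∈ (K (n+N)).poly (c N),
    ∃ u, I.Anc N v u ∧ I.Anc N w u
  hstep : ∀ n pos, Drawn (K n) pos → ∀ ε > 0, ∃ pos', Drawn (K (n+1)) pos' ∧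
    (∀ v ∈ (K (n+1)).RV, dist (pos' v) (I.ip pos v) ≤ ε ∧ (I.tt v = 0 → pos' v = pos (I.ea v)))
  h0 : ∃ pos, Drawn (K 0) pos
  hne : (K 0).Fl.Nonempty

variable {E : Type*} [MetricSpace E]

/-- A drawing with separation radius -/
def Sys.Good (S : Sys V ι E) (n : ℕ) (pos : V → Pt) (r : ℝ) : Prop :=
  Drawn (S.K n) pos ∧ 0 < r ∧ ∀ φ ∈ (S.K n).Fl, ∀ ψ ∈ (S.K n).Fl,
    (∀ v ∈ (S.K n).poly φ, v ∉ (S.K n).poly ψ) →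
    Disjoint (Metric.cthickening r (hullP (S.K n) pos φ)) (Metric.cthickening r (hullP (S.K n) pos ψ))

theorem Sys.exists_good (S : Sys V ι E) (n : ℕ) {pos : V → Pt} (h : Drawn (S.K n) pos) {ε : ℝ} (hε : 0 < ε) :
    ∃ r ≤ ε, S.Good n pos r := by
  classical
  have : ∀ᶠ r in 𝓝[>] (0:ℝ), ∀ φ ∈ (S.K n).Fl, ∀ ψ ∈ (S.K n).Fl,
    (∀ v ∈ (S.K n).poly φ, v ∉ (S.K n).poly ψ) →
    Disjoint (Metric.cthickening r (hullP (S.K n) pos φ)) (Metric.cthickening r (hullP (S.K n) pos ψ)) := by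
    rw [Filter.eventually_all_finset]; intro φ hφ
    rw [Filter.eventually_all_finset]; intro ψ hψ
    by_cases hv : ∀ v ∈ (S.K n).poly φ, v ∉ (S.K n).poly ψ
    · have hd : Disjoint ((S.K n).grp φ) ((S.K n).grp ψ) := by
        rw [Finset.disjoint_left]
        intro ξ h1 h2
        have hl := (S.K n).hlen φ hφ
        obtain ⟨v, hv'⟩ := List.exists_mem_of_length_pos (show 0 < ((S.K n).poly φ).length by omega)
        apply hv v hv'
        rw [← S.hgm n ψ hψ ξ h2, S.hgm n φ hφ ξ h1]; exact hv'
      have := hull_disjoint h hφ hψ hd hv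
      obtain ⟨δ, hδ, hdis⟩ := this.exists_cthickenings (isClosed_hullP _ _ _) (isClosed_hullP _ _ _).isClosed
      filter_upwards [Ioc_mem_nhdsGT hδ] with r hr _
      exact hdis.mono (Metric.cthickening_mono hr.2 _) (Metric.cthickening_mono hr.2 _)
    · exact Eventually.of_forall fun _ h => absurd h hv
  obtain ⟨r, hr, hr2⟩ := (this.and (Ioc_mem_nhdsGT hε)).exists
  exact ⟨r, hr2.2, h, hr2.1, hr⟩

theorem Sys.exists_seq (S : Sys V ι E) : ∃ (pos : ℕ → V → Pt) (r : ℕ → ℝ),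
    (∀ n, S.Good n (pos n) (r n)) ∧ (∀ n, r (n+1) ≤ r n / 2) ∧
    (∀ n, ∀ v ∈ (S.K (n+1)).RV, dist (pos (n+1) v) (S.I.ip (pos n) v) ≤ r n / 2 ∧
      (S.I.tt v = 0 → pos (n+1) v = pos n (S.I.ea v))) := by
  obtain ⟨pos0, h0⟩ := S.h0
  obtain ⟨r0, _, g0⟩ := S.exists_good 0 h0 one_pos
  let T : ℕ → Type _ := fun n => {q : (V → Pt) × ℝ // S.Good n q.1 q.2}
  have nx : ∀ n (q : T n), ∃ q' : T (n+1), q'.1.2 ≤ q.1.2 / 2 ∧ ∀ v ∈ (S.K (n+1)).RV,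
      dist (q'.1.1 v) (S.I.ip q.1.1 v) ≤ q.1.2 / 2 ∧ (S.I.tt v = 0 → q'.1.1 v = q.1.1 (S.I.ea v)) := by
    intro n q
    obtain ⟨pos', h1, h2⟩ := S.hstep n q.1.1 q.2.1 (q.1.2 / 2) (half_pos q.2.2.1)
    obtain ⟨r, hr, hg⟩ := S.exists_good (n+1) h1 (half_pos q.2.2.1)
    exact ⟨⟨(pos', r), hg⟩, hr, h2⟩
  choose f hf1 hf2 using nx
  let sq : ∀ n, T n := fun n => Nat.rec (⟨(pos0, r0), g0⟩ : T 0) (fun n q => f n q) n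
  exact ⟨fun n => (sq n).1.1, fun n => (sq n).1.2, fun n => (sq n).2, fun n => hf1 n (sq n), fun n => hf2 n (sq n)⟩

/-- realised system -/
structure Rlz (S : Sys V ι E) (pos : ℕ → V → Pt) (r : ℕ → ℝ) : Prop where
  good : ∀ n, S.Good n (pos n) (r n)
  half : ∀ n, r (n+1) ≤ r n / 2
  near : ∀ n, ∀ v ∈ (S.K (n+1)).RV, dist (pos (n+1) v) (S.I.ip (pos n) v) ≤ r n / 2 ∧
      (S.I.tt v = 0 → pos (n+1) v = pos n (S.I.ea v))

variable {S : Sys V ι E} {pos : ℕ → V → Pt} {r : ℕ → ℝ}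

theorem Rlz.rpos (R : Rlz S pos r) (n : ℕ) : 0 < r n := (R.good n).2.1

theorem Rlz.rtend (R : Rlz S pos r) : Tendsto r atTop (𝓝 0) := by
  have hb : ∀ n, r n ≤ r 0 * (1/2)^n := by
    intro n
    induction n with
    | zero => simp
    | succ n ih => rw [pow_succ]; have := R.half n; linarith
  refine squeeze_zero (fun n => (R.rpos n).le) hb ?_
  have := (tendsto_pow_atTop_nhds_zero_of_lt_one (r := (1/2:ℝ)) (by norm_num) (by norm_num)).const_mul (r 0)
  simpa using this

/-- a coherent chain of cells starting at level n -/
def Chain (S : Sys V ι E) (n k : ℕ) (c : ℕ → ι) : Prop :=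
  (∀ j ≤ k, c j ∈ (S.K (n+j)).Fl) ∧ ∀ j < k, S.par (n+j) (c (j+1)) (c j)

/-- closed approximation set -/
theorem chain_near (R : Rlz S pos r) {n k : ℕ} {c : ℕ → ι} (hc : Chain S n k c) (j : ℕ) (hj : j ≤ k) {v : V}
    (hv : v ∈ (S.K (n+j)).poly (c j)) :
    ∃ z ∈ hullP (S.K n) (pos n) (c 0), dist (pos (n+j) v) z ≤ r n - r (n+j) := by
  induction j generalizing v with
  | zero => exact ⟨pos n v, subset_convexHull _ _ ⟨v, hv, rfl⟩, by simp⟩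
  | succ j ih =>
    obtain ⟨h1, h2⟩ := S.hend (n+j) _ (hc.1 j (by omega)) _ (hc.1 (j+1) (by omega)) (hc.2 j (by omega)) v hv
    obtain ⟨z1, hz1, d1⟩ := ih (by omega) h1
    obtain ⟨z2, hz2, d2⟩ := ih (by omega) h2
    have ht0 := S.I.ht0 v
    have ht1 := S.I.ht1 v
    refine ⟨(1 - S.I.tt v) • z1 + S.I.tt v • z2, convex_convexHull ℝ _ hz1 hz2 (by linarith) ht0 (by ring), ?_⟩
    have hR := (S.K (n+(j+1))).hR _ (hc.1 (j+1) (by omega)) v hv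
    have e := (R.near (n+j) v hR).1
    have hh := R.half (n+j)
    have : dist (S.I.ip (pos (n+j)) v) ((1 - S.I.tt v) • z1 + S.I.tt v • z2) ≤ r n - r (n+j) := by
      unfold Ip.ip
      refine (dist_add_add_le _ _ _ _).trans ?_
      rw [dist_smul₀, dist_smul₀, Real.norm_of_nonneg ht0, Real.norm_of_nonneg (by linarith)]
      nlinarith
    have t := dist_triangle (pos (n+(j+1)) v) (S.I.ip (pos (n+j)) v) ((1 - S.I.tt v) • z1 + S.I.tt v • z2)
    rw [show n + (j+1) = n+j+1 by ring] at *
    linarith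

theorem chain_anc (R : Rlz S pos r) {n k : ℕ} {c : ℕ → ι} (hc : Chain S n k c) (j : ℕ) (hj : j ≤ k) {v u : V}
    (hv : v ∈ (S.K (n+j)).poly (c j)) (hu : S.I.Anc j v u) :
    ∃ z ∈ hullP (S.K n) (pos n) (c 0), 
      dist (pos (n+j) v) (S.I.κ ^ j • pos n u + (1 - S.I.κ ^ j) • z) ≤ r n - r (n+j) := by
  induction j generalizing v with
  | zero =>
    have : v = u := hu
    subst this
    exact ⟨pos n v, subset_convexHull _ _ ⟨v, hv, rfl⟩, by simp⟩
  | succ j ih =>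
    obtain ⟨a, ha, hau⟩ := hu
    obtain ⟨h1, h2⟩ := S.hend (n+j) _ (hc.1 j (by omega)) _ (hc.1 (j+1) (by omega)) (hc.2 j (by omega)) v hv
    have hR := (S.K (n+(j+1))).hR _ (hc.1 (j+1) (by omega)) v hv
    have e := (R.near (n+j) v hR).1
    have hh := R.half (n+j)
    have ht0 := S.I.ht0 v
    have ht1 := S.I.ht1 v
    have k0 := S.I.hκ
    have k1 := S.I.hκ1
    have kj : S.I.κ ^ j ≤ 1 := pow_le_one₀ k0.le k1
    have kj0 : 0 < S.I.κ ^ j := pow_pos k0 j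
    -- normalise to: ip = (1-s) a + s b
    obtain ⟨s, b, hs0, hs1, hb, hip⟩ : ∃ (s : ℝ) (b : V), 0 ≤ s ∧ S.I.κ ≤ 1 - s ∧ b ∈ (S.K (n+j)).poly (c j) ∧
        S.I.ip (pos (n+j)) v = (1 - s) • pos (n+j) a + s • pos (n+j) b := by
      rcases ha with ⟨rfl, h⟩ | ⟨rfl, h⟩
      · exact ⟨S.I.tt v, S.I.eb v, ht0, S.I.hta v h, h2, rfl⟩
      · exact ⟨1 - S.I.tt v, S.I.ea v, by linarith, by have := S.I.htb v h; linarith, h1, by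
          unfold Ip.ip; rw [add_comm]; congr 2; ring⟩
    have ha' : a ∈ (S.K (n+j)).poly (c j) := by
      rcases ha with ⟨rfl, h⟩ | ⟨rfl, h⟩
      · exact h1
      · exact h2
    obtain ⟨z1, hz1, d1⟩ := ih (by omega) ha' hau
    obtain ⟨z2, hz2, d2⟩ := chain_near R hc j (by omega) hb
    -- find z
    have hu' : pos n u ∈ hullP (S.K n) (pos n) (c 0) := by
      -- u is a corner of c 0
      have : ∀ i ≤ j, ∀ a, a ∈ (S.K (n+i)).poly (c i) → S.I.Anc i a u → u ∈ (S.K n).poly (c 0) := by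
        intro i
        induction i with
        | zero => intro _ a ha h; have : a = u := h; rw [← this]; exact ha
        | succ i ih' =>
          intro hi a ha h
          obtain ⟨b, hb, hbu⟩ := h
          have hh := S.hend (n+i) _ (hc.1 i (by omega)) _ (hc.1 (i+1) (by omega)) (hc.2 i (by omega)) a ha
          refine ih' (by omega) b ?_ hbu
          rcases hb with ⟨rfl, h⟩ | ⟨rfl, h⟩
          · exact hh.1
          · exact hh.2
      exact subset_convexHull _ _ ⟨u, this j le_rfl a ha' hau, rfl⟩
    obtain ⟨z, hz, ez⟩ : ∃ z ∈ hullP (S.K n) (pos n) (c 0), (1 - s) • (S.I.κ ^ j • pos n u + (1 - S.I.κ ^ j) • z1) + s • z2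
        = S.I.κ ^ (j+1) • pos n u + (1 - S.I.κ ^ (j+1)) • z := by
      have hcv : Convex ℝ (hullP (S.K n) (pos n) (c 0)) := convex_convexHull ℝ _
      set α := (1 - s) * S.I.κ ^ j - S.I.κ ^ (j+1) with hα
      have hα0 : 0 ≤ α := by rw [hα, pow_succ]; nlinarith
      have hβ0 : 0 ≤ (1 - s) * (1 - S.I.κ ^ j) := mul_nonneg (by linarith) (by linarith)
      have hsum : α + (1 - s) * (1 - S.I.κ ^ j) + s = 1 - S.I.κ ^ (j+1) := by rw [hα]; ring
      have hk : S.I.κ ^ (j+1) ≤ 1 := pow_le_one₀ k0.le k1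
      rcases hk.lt_or_eq with hlt | heq
      · have hp : 0 < 1 - S.I.κ ^ (j+1) := by linarith
        refine ⟨(α / (1 - S.I.κ ^ (j+1))) • pos n u + ((1 - s) * (1 - S.I.κ ^ j) / (1 - S.I.κ ^ (j+1))) • z1 + (s / (1 - S.I.κ ^ (j+1))) • z2, ?_, ?_⟩
        · have := hcv.sum_mem (t := Finset.univ) (w := ![α / (1 - S.I.κ ^ (j+1)), (1 - s) * (1 - S.I.κ ^ j) / (1 - S.I.κ ^ (j+1)), s / (1 - S.I.κ ^ (j+1))])
            (z := ![pos n u, z1, z2]) (by intro i _; fin_cases i <;> simp <;> positivity)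
            (by rw [Fin.sum_univ_three]; simp only [Matrix.cons_val]
                rw [← add_div, ← add_div, div_eq_one_iff_eq hp.ne']; linarith)
            (by intro i _; fin_cases i <;> simp [hu', hz1, hz2])
          rw [Fin.sum_univ_three] at this
          exact this
        · simp only [smul_add, smul_smul, mul_div_cancel₀ _ hp.ne', hα]
          module
      · refine ⟨z1, hz1, ?_⟩
        have h3 : α = 0 := by nlinarith
        have h4 : (1 - s) * (1 - S.I.κ ^ j) = 0 := by nlinarith
        have h5 : s = 0 := by nlinarith
        rw [heq]
        subst h5
        have h6 : S.I.κ ^ j = 1 := by linarith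
        rw [h6]; module
    refine ⟨z, hz, ?_⟩
    rw [← ez]
    have : dist (S.I.ip (pos (n+j)) v) ((1 - s) • (S.I.κ ^ j • pos n u + (1 - S.I.κ ^ j) • z1) + s • z2) ≤ r n - r (n+j) := by
      rw [hip]
      refine (dist_add_add_le _ _ _ _).trans ?_
      rw [dist_smul₀, dist_smul₀, Real.norm_of_nonneg hs0, Real.norm_of_nonneg (by linarith)]
      nlinarith
    have t := dist_triangle (pos (n+(j+1)) v) (S.I.ip (pos (n+j)) v) ((1 - s) • (S.I.κ ^ j • pos n u + (1 - S.I.κ ^ j) • z1) + s • z2)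
    rw [show n + (j+1) = n+j+1 by ring] at *
    linarith

end ABCT

set_option linter.all false

namespace ABCT
open Filter Topology
variable {V ι : Type*} {E : Type*} [MetricSpace E]
variable {S : Sys V ι E} {pos : ℕ → V → Pt} {r : ℕ → ℝ}

def Dm (S : Sys V ι E) (pos : ℕ → V → Pt) (n : ℕ) (δ : ℝ) : Prop :=
  ∀ φ ∈ (S.K n).Fl, ∀ v ∈ (S.K n).poly φ, ∀ w ∈ (S.K n).poly φ, dist (pos n v) (pos n w) ≤ δ

theorem Dm.hull {n : ℕ} {δ : ℝ} (h : Dm S pos n δ) {φ : ι} (hφ : φ ∈ (S.K n).Fl) {x y : Pt}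
    (hx : x ∈ hullP (S.K n) (pos n) φ) (hy : y ∈ hullP (S.K n) (pos n) φ) : dist x y ≤ δ := by
  obtain ⟨_, ⟨v, hv, rfl⟩, _, ⟨w, hw, rfl⟩, h'⟩ := convexHull_exists_dist_ge2 hx hy
  exact h'.trans (h φ hφ v hv w hw)

theorem Dm.mono {n : ℕ} {δ δ' : ℝ} (h : Dm S pos n δ) (hd : δ ≤ δ') : Dm S pos n δ' :=
  fun φ hφ v hv w hw => (h φ hφ v hv w hw).trans hd

theorem exists_Dm (S : Sys V ι E) (pos : ℕ → V → Pt) (n : ℕ) : ∃ δ ≥ 0, Dm S pos n δ := by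
  classical
  have hb : Bornology.IsBounded (pos n '' (S.K n).RV) := ((S.K n).RV.finite_toSet.image _).isBounded
  obtain ⟨C, hC⟩ := Metric.isBounded_iff.1 hb
  refine ⟨max C 0, le_max_right _ _, ?_⟩
  intro φ hφ v hv w hw
  exact (hC ⟨v, (S.K n).hR φ hφ v hv, rfl⟩ ⟨w, (S.K n).hR φ hφ w hw, rfl⟩).trans (le_max_left _ _)

theorem exists_chain (S : Sys V ι E) (n k : ℕ) (ψ : ι) (hψ : ψ ∈ (S.K (n+k)).Fl) :
    ∃ c, Chain S n k c ∧ c k = ψ := by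
  induction k generalizing ψ with
  | zero =>
    refine ⟨fun _ => ψ, ⟨?_, ?_⟩, rfl⟩
    · intro j hj; have : j = 0 := by omega
      subst this; exact hψ
    · intro j hj; omega
  | succ k ih =>
    obtain ⟨φ, hφ, hp⟩ := S.hpar (n+k) ψ hψ
    obtain ⟨c, hc, hck⟩ := ih φ hφ
    refine ⟨fun j => if j ≤ k then c j else ψ, ⟨?_, ?_⟩, by simp⟩
    · intro j hj
      by_cases h : j ≤ k
      · simp only [h, if_true]; exact hc.1 j h
      · have : j = k + 1 := by omega
        subst this; simpa using hψ
    · intro j hj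
      by_cases h : j < k
      · simp only [show j ≤ k by omega, show j + 1 ≤ k by omega, if_true]; exact hc.2 j h
      · have : j = k := by omega
        subst this
        simp only [le_refl, if_true, show ¬ (j + 1 ≤ j) by omega, if_false, hck]; exact hp

theorem Rlz.Dm_add (R : Rlz S pos r) {n : ℕ} {δ : ℝ} (h : Dm S pos n δ) (k : ℕ) : Dm S pos (n+k) (δ + 2 * r n) := by
  intro ψ hψ v hv w hw
  obtain ⟨c, hc, rfl⟩ := exists_chain S n k ψ hψ
  obtain ⟨z1, hz1, d1⟩ := chain_near R hc k le_rfl hv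
  obtain ⟨z2, hz2, d2⟩ := chain_near R hc k le_rfl hw
  have := h.hull (hc.1 0 (by omega)) hz1 hz2
  have t1 := dist_triangle4 (pos (n+k) v) z1 z2 (pos (n+k) w)
  rw [dist_comm z2] at t1
  have := R.rpos (n+k)
  linarith

theorem Rlz.Dm_N (R : Rlz S pos r) {n : ℕ} {δ : ℝ} (h : Dm S pos n δ) :
    Dm S pos (n+S.N) ((1 - S.I.κ ^ S.N) * δ + 2 * r n) := by
  intro ψ hψ v hv w hw
  obtain ⟨c, hc, rfl⟩ := exists_chain S n S.N ψ hψ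
  obtain ⟨u, hu1, hu2⟩ := S.hmesh n c hc.1 hc.2 v hv w hw
  obtain ⟨z1, hz1, d1⟩ := chain_anc R hc _ le_rfl hv hu1
  obtain ⟨z2, hz2, d2⟩ := chain_anc R hc _ le_rfl hw hu2
  have h1 := h.hull (hc.1 0 (by omega)) hz1 hz2
  have kj : S.I.κ ^ S.N ≤ 1 := pow_le_one₀ S.I.hκ.le S.I.hκ1
  have h2 : dist (S.I.κ ^ S.N • pos n u + (1 - S.I.κ ^ S.N) • z1) (S.I.κ ^ S.N • pos n u + (1 - S.I.κ ^ S.N) • z2)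
    ≤ (1 - S.I.κ ^ S.N) * δ := by
    rw [dist_add_left, dist_smul₀, Real.norm_of_nonneg (by linarith)]
    exact mul_le_mul_of_nonneg_left h1 (by linarith)
  have t1 := dist_triangle4 (pos (n+S.N) v) (S.I.κ ^ S.N • pos n u + (1 - S.I.κ ^ S.N) • z1)
    (S.I.κ ^ S.N • pos n u + (1 - S.I.κ ^ S.N) • z2) (pos (n+S.N) w)
  rw [dist_comm (pos (n+S.N) w)] at d2
  have := R.rpos (n+S.N)
  linarith

theorem Rlz.Dm_tend (R : Rlz S pos r) {ε : ℝ} (hε : 0 < ε) : ∃ n0, ∀ n ≥ n0, Dm S pos n ε := by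
  set θ := 1 - S.I.κ ^ S.N with hθ
  have kN : 0 < S.I.κ ^ S.N := pow_pos S.I.hκ _
  have kj : S.I.κ ^ S.N ≤ 1 := pow_le_one₀ S.I.hκ.le S.I.hκ1
  have hθ0 : 0 ≤ θ := by linarith
  have hθ1 : θ < 1 := by linarith
  set η := ε * (1 - θ) / 8 with hη
  have hηp : 0 < η := by rw [hη]; have : 0 < 1 - θ := by linarith
                         positivity
  obtain ⟨n0, hn0⟩ := (eventually_atTop.1 (R.rtend.eventually (gt_mem_nhds hηp)))
  obtain ⟨δ, hδ0, hδ⟩ := exists_Dm S pos n0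
  have ind : ∀ m, Dm S pos (n0 + m * S.N) (θ ^ m * δ + ε / 4) := by
    intro m
    induction m with
    | zero => simpa using hδ.mono (by linarith)
    | succ m ih =>
      have := R.Dm_N ih
      rw [← hθ] at this
      rw [show n0 + (m+1) * S.N = n0 + m * S.N + S.N by ring]
      refine this.mono ?_
      have := hn0 (n0 + m * S.N) (by omega)
      rw [pow_succ]
      nlinarith
  obtain ⟨m, hm⟩ := (((tendsto_pow_atTop_nhds_zero_of_lt_one hθ0 hθ1).mul_const δ).eventually
    (gt_mem_nhds (show 0 * δ < ε / 4 by linarith))).exists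
  refine ⟨n0 + m * S.N, fun n hn => ?_⟩
  obtain ⟨k, rfl⟩ := Nat.exists_eq_add_of_le hn
  refine (R.Dm_add (ind m) k).mono ?_
  have := hn0 (n0 + m * S.N) (by omega)
  have : η ≤ ε / 8 := by rw [hη]; nlinarith
  linarith

/-- coherent chain through a point -/
theorem exists_pchain (S : Sys V ι E) (x : E) (hx : x ∈ S.X) : ∃ c : ℕ → ι, (∀ n, c n ∈ (S.K n).Fl) ∧
    (∀ n, S.par n (c (n+1)) (c n)) ∧ ∀ n, x ∈ S.F n (c n) := by
  obtain ⟨φ, hφ, hx0⟩ := S.hX0 x hx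
  let T : ℕ → Type _ := fun n => {φ : ι // φ ∈ (S.K n).Fl ∧ x ∈ S.F n φ}
  have nx : ∀ n (q : T n), ∃ q' : T (n+1), S.par n q'.1 q.1 := by
    intro n q
    obtain ⟨ψ, h1, h2, h3⟩ := S.hch n q.1 q.2.1 x q.2.2
    exact ⟨⟨ψ, h1, h3⟩, h2⟩
  choose f hf using nx
  let sq : ∀ n, T n := fun n => Nat.rec (⟨φ, hφ, hx0⟩ : T 0) (fun n q => f n q) n
  exact ⟨fun n => (sq n).1, fun n => (sq n).2.1, fun n => hf n (sq n), fun n => (sq n).2.2⟩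

theorem poly_ne (S : Sys V ι E) (n : ℕ) (φ : ι) (hφ : φ ∈ (S.K n).Fl) : ∃ v, v ∈ (S.K n).poly φ := by
  have hl := (S.K n).hlen φ hφ
  exact List.exists_mem_of_length_pos (by omega)

theorem exists_lim (R : Rlz S pos r) (x : E) (hx : x ∈ S.X) : ∃ k : Pt, ∃ c : ℕ → ι, (∀ n, c n ∈ (S.K n).Fl) ∧
    (∀ n, x ∈ S.F n (c n)) ∧ ∀ n, k ∈ Metric.cthickening (r n) (hullP (S.K n) (pos n) (c n)) := by
  obtain ⟨c, hc, hp, hF⟩ := exists_pchain S x hx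
  choose v hv using fun n => poly_ne S n (c n) (hc n)
  have hch : ∀ n k, Chain S n k (fun j => c (n+j)) := fun n k => ⟨fun j _ => hc _, fun j _ => hp _⟩
  have hnear : ∀ n j, ∃ z ∈ hullP (S.K n) (pos n) (c n), dist (pos (n+j) (v (n+j))) z ≤ r n := by
    intro n j
    obtain ⟨z, hz, d⟩ := chain_near R (hch n j) j le_rfl (hv (n+j))
    have := R.rpos (n+j)
    exact ⟨z, hz, by linarith⟩
  have hcau : CauchySeq (fun n => pos n (v n)) := by
    rw [Metric.cauchySeq_iff']
    intro ε hε
    obtain ⟨n0, hn0⟩ := R.Dm_tend (half_pos hε)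
    obtain ⟨n1, hn1⟩ := (eventually_atTop.1 (R.rtend.eventually (gt_mem_nhds (half_pos hε))))
    refine ⟨max n0 n1, fun n hn => ?_⟩
    obtain ⟨k, rfl⟩ := Nat.exists_eq_add_of_le hn
    obtain ⟨z, hz, d⟩ := hnear (max n0 n1) k
    have a1 := (hn0 _ (le_max_left n0 n1)).hull (hc _) hz (subset_convexHull _ _ ⟨v _, hv (max n0 n1), rfl⟩)
    have a2 := hn1 _ (le_max_right n0 n1)
    have := dist_triangle (pos (max n0 n1 + k) (v (max n0 n1 + k))) z (pos (max n0 n1) (v (max n0 n1)))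
    linarith
  obtain ⟨k, hk⟩ := cauchySeq_tendsto_of_complete hcau
  refine ⟨k, c, hc, hF, fun n => ?_⟩
  refine Metric.isClosed_cthickening.mem_of_tendsto hk ?_
  filter_upwards [eventually_ge_atTop n] with m hm
  obtain ⟨j, rfl⟩ := Nat.exists_eq_add_of_le hm
  obtain ⟨z, hz, d⟩ := hnear n j
  exact Metric.mem_cthickening_of_dist_le _ z _ _ hz d

theorem main_map (R : Rlz S pos r) : ∃ k : S.X → Pt, Continuous k ∧ Function.Injective k ∧ Convex ℝ (Set.range k) ∧
    (interior (Set.range k)).Nonempty := by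
  choose! k c hc hF hk using fun x : S.X => exists_lim R x.1 x.2
  have mem : ∀ (x : S.X) n φ, φ ∈ (S.K n).Fl → x.1 ∈ S.F n φ → ∀ δ, Dm S pos n δ → ∀ z ∈ hullP (S.K n) (pos n) φ,
      dist (k x) z ≤ 2 * δ + r n := by
    intro x n φ hφ hx δ hδ z hz
    obtain ⟨v, hv1, hv2⟩ := S.hadj n φ hφ (c x n) (hc x n) ⟨x.1, hx, hF x n⟩
    have hcp : IsCompact (hullP (S.K n) (pos n) (c x n)) := isClosed_hullP _ _ _
    have h1 := hk x n
    rw [hcp.cthickening_eq_biUnion_closedBall (R.rpos n).le] at h1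
    simp only [Set.mem_iUnion] at h1
    obtain ⟨y, hy, hy'⟩ := h1
    rw [Metric.mem_closedBall] at hy'
    have a1 := hδ.hull (hc x n) hy (subset_convexHull _ _ ⟨v, hv2, rfl⟩)
    have a2 := hδ.hull hφ (subset_convexHull _ _ ⟨v, hv1, rfl⟩) hz
    have := dist_triangle4 (k x) y (pos n v) z
    linarith
  have small : ∀ ε > 0, ∃ n0, ∀ n ≥ n0, Dm S pos n ε ∧ r n < ε := by
    intro ε hε
    obtain ⟨n0, hn0⟩ := R.Dm_tend hε
    obtain ⟨n1, hn1⟩ := (eventually_atTop.1 (R.rtend.eventually (gt_mem_nhds hε)))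
    exact ⟨max n0 n1, fun n hn => ⟨hn0 n (le_of_max_le_left hn), hn1 n (le_of_max_le_right hn)⟩⟩
  have cont : Continuous k := by
    rw [continuous_iff_continuousAt]
    intro x
    rw [ContinuousAt, Metric.tendsto_nhds]
    intro ε hε
    obtain ⟨n, hn⟩ := small (ε/8) (by linarith)
    obtain ⟨hD, hr⟩ := hn n le_rfl
    have : ∀ᶠ y : S.X in 𝓝 x, ∀ φ ∈ (S.K n).Fl, x.1 ∉ S.F n φ → y.1 ∉ S.F n φ := by
      rw [Filter.eventually_all_finset]
      intro φ hφ
      by_cases h : x.1 ∈ S.F n φ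
      · exact Eventually.of_forall fun y h' => absurd h h'
      · have ho : IsOpen ((Subtype.val : S.X → E) ⁻¹' (S.F n φ)ᶜ) := (S.hFc n φ hφ).isOpen_compl.preimage continuous_subtype_val
        filter_upwards [ho.mem_nhds h] with y hy _ using hy
    filter_upwards [this] with y hy
    have hx' : x.1 ∈ S.F n (c y n) := by
      by_contra h
      exact hy _ (hc y n) h (hF y n)
    obtain ⟨v, hv⟩ := poly_ne S n _ (hc y n)
    have a1 := mem x n _ (hc y n) hx' _ hD (pos n v) (subset_convexHull _ _ ⟨v, hv, rfl⟩)
    have a2 := mem y n _ (hc y n) (hF y n) _ hD (pos n v) (subset_convexHull _ _ ⟨v, hv, rfl⟩)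
    have := dist_triangle_right (k y) (k x) (pos n v)
    linarith
  have inj : Function.Injective k := by
    intro x y hxy
    by_contra hne
    have hd : 0 < dist x.1 y.1 := dist_pos.2 fun h => hne (Subtype.ext h)
    obtain ⟨n, hn⟩ := (S.hD.eventually (gt_mem_nhds (half_pos hd))).exists
    have hno : ∀ v ∈ (S.K n).poly (c x n), v ∉ (S.K n).poly (c y n) := by
      intro v h1 h2
      obtain ⟨z, hz1, hz2⟩ := S.hadj' n _ (hc x n) _ (hc y n) v h1 h2
      have a1 := S.hdiam n _ (hc x n) _ (hF x n) _ hz1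
      have a2 := S.hdiam n _ (hc y n) _ (hF y n) _ hz2
      have := dist_triangle_right x.1 y.1 z
      linarith
    have := (R.good n).2.2 _ (hc x n) _ (hc y n) hno
    exact Set.disjoint_left.1 this (hk x n) (hxy ▸ hk y n)
  haveI : CompactSpace S.X := isCompact_iff_compactSpace.1 S.hX
  have hclosed : IsClosed (Set.range k) := (isCompact_range cont).isClosed
  -- every point of level n hull is near the range
  have near : ∀ n δ, Dm S pos n δ → ∀ z ∈ hullR (S.K n) (pos n), ∃ y, dist (k y) z ≤ 2 * δ + r n := by
    intro n δ hδ z hz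
    obtain ⟨φ, hφ, hzφ⟩ := cover (R.good n).1 hz
    obtain ⟨s, hs⟩ := S.hFn n φ hφ
    exact ⟨⟨s, S.hFX n φ hφ hs⟩, mem ⟨s, S.hFX n φ hφ hs⟩ n φ hφ hs δ hδ z hzφ⟩
  have conv : Convex ℝ (Set.range k) := by
    rintro _ ⟨x, rfl⟩ _ ⟨y, rfl⟩ a b ha hb hab
    rw [← hclosed.closure_eq, Metric.mem_closure_iff]
    intro ε hε
    obtain ⟨n, hn⟩ := small (ε/8) (by linarith)
    obtain ⟨hD, hr⟩ := hn n le_rfl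
    obtain ⟨v, hv⟩ := poly_ne S n _ (hc x n)
    obtain ⟨w, hw⟩ := poly_ne S n _ (hc y n)
    have a1 := mem x n _ (hc x n) (hF x n) _ hD (pos n v) (subset_convexHull _ _ ⟨v, hv, rfl⟩)
    have a2 := mem y n _ (hc y n) (hF y n) _ hD (pos n w) (subset_convexHull _ _ ⟨w, hw, rfl⟩)
    have hz : a • pos n v + b • pos n w ∈ hullR (S.K n) (pos n) :=
      convex_convexHull ℝ _ (subset_convexHull ℝ _ (Set.mem_image_of_mem (pos n) ((S.K n).hR _ (hc x n) v hv)))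
        (subset_convexHull ℝ _ (Set.mem_image_of_mem (pos n) ((S.K n).hR _ (hc y n) w hw))) ha hb hab
    obtain ⟨s, hs⟩ := near n _ hD _ hz
    refine ⟨k s, ⟨s, rfl⟩, ?_⟩
    have h1 : dist (a • k x + b • k y) (a • pos n v + b • pos n w) ≤ 3 * (ε/8) := by
      refine (dist_add_add_le _ _ _ _).trans ?_
      rw [dist_smul₀, dist_smul₀, Real.norm_of_nonneg ha, Real.norm_of_nonneg hb]
      have : a = 1 - b := by linarith
      subst this
      nlinarith
    have := dist_triangle_right (a • k x + b • k y) (k s) (a • pos n v + b • pos n w)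
    linarith
  refine ⟨k, cont, inj, conv, ?_⟩
  obtain ⟨φ, hφ⟩ := S.hne
  have hv0 : ∀ v ∈ (S.K 0).RV, ∀ n, ∃ v' ∈ (S.K n).RV, pos n v' = pos 0 v := by
    intro v hv n
    induction n with
    | zero => exact ⟨v, hv, rfl⟩
    | succ n ih =>
      obtain ⟨v', hv', e⟩ := ih
      obtain ⟨v'', h1, h2, h3⟩ := S.hold n v' hv'
      exact ⟨v'', h1, by rw [(R.near n v'' h1).2 h3, h2, e]⟩
  have hv1 : ∀ v ∈ (S.K 0).RV, pos 0 v ∈ Set.range k := by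
    intro v hv
    rw [← hclosed.closure_eq, Metric.mem_closure_iff]
    intro ε hε
    obtain ⟨n, hn⟩ := small (ε/8) (by linarith)
    obtain ⟨hD, hr⟩ := hn n le_rfl
    obtain ⟨v', hv', e⟩ := hv0 v hv n
    obtain ⟨s, hs⟩ := near n _ hD (pos n v') (subset_convexHull _ _ ⟨v', hv', rfl⟩)
    refine ⟨k s, ⟨s, rfl⟩, ?_⟩
    rw [← e, dist_comm]; linarith
  refine (hullP_interior (R.good 0).1 hφ).mono (interior_mono ?_)
  refine convexHull_min ?_ conv
  rintro _ ⟨v, hv, rfl⟩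
  exact hv1 v ((S.K 0).hR φ hφ v hv)

theorem convex_disk (s : Set Pt) (hs : IsCompact s) (hc : Convex ℝ s) (hi : (interior s).Nonempty) :
    Nonempty (s ≃ₜ Metric.closedBall (0 : EuclideanSpace ℝ (Fin 2)) 1) := by
  have e : Pt ≃L[ℝ] EuclideanSpace ℝ (Fin 2) := ContinuousLinearEquiv.ofFinrankEq (by simp)
  have hs' : IsCompact (e '' s) := hs.image e.continuous
  have hc' : Convex ℝ (e '' s) := hc.linear_image e.toLinearMap
  have hi' : (interior (e '' s)).Nonempty := by
    have := e.toHomeomorph.image_interior s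
    have h2 : interior (e '' s) = e '' interior s := this.symm
    rw [h2]; exact hi.image _
  obtain ⟨h, h1, h2, h3⟩ := exists_homeomorph_image_interior_closure_frontier_eq_unitBall hc' hi' hs'.isBounded
  rw [hs'.isClosed.closure_eq] at h2
  refine ⟨(e.toHomeomorph.image s).trans ((h.image (e '' s)).trans (Homeomorph.setCongr h2))⟩

theorem Sys.disk (S : Sys V ι E) : Nonempty (S.X ≃ₜ Metric.closedBall (0 : EuclideanSpace ℝ (Fin 2)) 1) := by
  obtain ⟨pos, r, h1, h2, h3⟩ := S.exists_seq
  obtain ⟨k, kc, ki, kv, kn⟩ := main_map (S := S) (pos := pos) (r := r) ⟨h1, h2, h3⟩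
  haveI : CompactSpace S.X := isCompact_iff_compactSpace.1 S.hX
  obtain ⟨f⟩ := convex_disk _ (isCompact_range kc) kv kn
  have hemb : Topology.IsEmbedding k := (kc.isClosedEmbedding ki).isEmbedding
  exact ⟨hemb.toHomeomorph.trans f⟩

end ABCT

set_option linter.all false

namespace ABCT

abbrev L := ℤ × ℤ × ℤ
abbrev Wd := Equiv.Perm (Fin 4)

def e : Fin 4 → L := ![(-1,-1,-1), (1,0,0), (0,1,0), (0,0,1)]

theorem e_sum : e 0 + e 1 + e 2 + e 3 = 0 := by decide

theorem e_perm (σ : Wd) : e (σ 0) + e (σ 1) + e (σ 2) + e (σ 3) = 0 := by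
  have := Equiv.sum_comp σ e
  rw [Fin.sum_univ_four, Fin.sum_univ_four, e_sum] at this
  exact this

structure Prm where
  a : ℤ
  b : ℤ
  c : ℤ
  ha : 0 ≤ a
  hb : 1 ≤ b
  hc : 1 ≤ c

namespace Prm
variable (P : Prm)
def C : ℤ := 1 + P.a + P.b + P.c
def g : Fin 4 → ℤ := ![-(P.a + P.b + P.c), P.a, P.b, P.c]
def ch (X : L) (i : ℤ) : L := (-X.1 * P.a - X.2.1 * P.b - X.2.2 * (P.c + 1) + i, X.1 - X.2.2, X.2.1 - X.2.2)
def key (y : L) : ℤ := y.1 + P.a * y.2.1 + P.b * y.2.2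
def dig (y : L) : ℤ := P.key y % P.C
def dl (y : L) : L := (y.2.1 - P.key y / P.C, y.2.2 - P.key y / P.C, - (P.key y / P.C))

theorem C_pos : 0 < P.C := by have := P.ha; have := P.hb; have := P.hc; unfold C; omega

theorem g_zero : P.g 0 = 1 - P.C := by simp [g, C]; ring
theorem g_nonneg {k : Fin 4} (h : k ≠ 0) : 0 ≤ P.g k := by
  have := P.ha; have := P.hb; have := P.hc
  fin_cases k <;> simp [g] at * <;> omega
theorem g_pos {k : Fin 4} (h : k ≠ 0) (h1 : k ≠ 1) : 1 ≤ P.g k := by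
  have := P.ha; have := P.hb; have := P.hc
  fin_cases k <;> simp [g] at * <;> omega

theorem g_perm (σ : Wd) : P.g (σ 0) + P.g (σ 1) + P.g (σ 2) + P.g (σ 3) = 0 := by
  have := Equiv.sum_comp σ P.g
  rw [Fin.sum_univ_four, Fin.sum_univ_four] at this
  rw [this]; simp [g]; ring

theorem g3 {σ : Wd} (h : σ 3 = 0) : P.g (σ 0) + P.g (σ 1) + P.g (σ 2) = P.C - 1 := by
  have := P.g_perm σ
  rw [h, g_zero] at this; linarith

theorem ch_e (X : L) (i : ℤ) (k : Fin 4) : P.ch (X + e k) (i + P.g k) = P.ch X i + e (k + 1) := by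
  obtain ⟨x, y, z⟩ := X
  ext
  · fin_cases k <;> simp [ch, e, g] <;> ring
  · fin_cases k <;> simp [ch, e, g] <;> ring
  · fin_cases k <;> simp [ch, e, g] <;> ring

theorem ch_one (X : L) (i : ℤ) : P.ch X (i + 1) = P.ch X i + e 1 := by
  simp [ch, e]; ring

theorem ch_C (X : L) (i : ℤ) : P.ch X (i + P.C) = P.ch (X + e 0) i := by
  simp [ch, e, C]; ring

theorem ch_dl (y : L) : P.ch (P.dl y) (P.dig y) = y := by
  have h := Int.emod_add_mul_ediv (P.key y) P.C
  unfold ch dl dig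
  have hk : P.key y = y.1 + P.a * y.2.1 + P.b * y.2.2 := rfl
  generalize P.key y / P.C = q at *
  generalize P.key y % P.C = m at *
  ext
  · simp only; rw [hk] at h; unfold C at h; linarith
  · simp
  · simp

theorem dig_nonneg (y : L) : 0 ≤ P.dig y := Int.emod_nonneg _ P.C_pos.ne'
theorem dig_lt (y : L) : P.dig y < P.C := Int.emod_lt_of_pos _ P.C_pos

theorem key_ch (X : L) (i : ℤ) : P.key (P.ch X i) = i + P.C * (- X.2.2) := by
  simp [key, ch, C]; ring

theorem dig_ch (X : L) {i : ℤ} (h0 : 0 ≤ i) (h1 : i < P.C) : P.dig (P.ch X i) = i := by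
  unfold dig; rw [key_ch, Int.add_mul_emod_self_left, Int.emod_eq_of_lt h0 h1]

theorem dl_ch (X : L) {i : ℤ} (h0 : 0 ≤ i) (h1 : i < P.C) : P.dl (P.ch X i) = X := by
  unfold dl; rw [key_ch, Int.add_mul_ediv_left _ _ P.C_pos.ne', Int.ediv_eq_zero_of_lt h0 h1]
  simp [ch]

theorem exists_ch (y : L) : ∃ X i, 0 ≤ i ∧ i < P.C ∧ y = P.ch X i :=
  ⟨_, _, P.dig_nonneg y, P.dig_lt y, (P.ch_dl y).symm⟩

end Prm

/-! words -/
def s0 : Wd := Equiv.swap 0 1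
def s1 : Wd := Equiv.swap 1 2
def s2 : Wd := Equiv.swap 2 3
/-- rotation of positions / letters -/
def rr : Wd := finRotate 4

theorem rr_ap (i : Fin 4) : rr i = i + 1 := by revert i; decide
theorem s0_ap : s0 0 = 1 ∧ s0 1 = 0 ∧ s0 2 = 2 ∧ s0 3 = 3 := by decide
theorem s1_ap : s1 0 = 0 ∧ s1 1 = 2 ∧ s1 2 = 1 ∧ s1 3 = 3 := by decide
theorem s2_ap : s2 0 = 0 ∧ s2 1 = 1 ∧ s2 2 = 3 ∧ s2 3 = 2 := by decide
theorem rr4 : rr * rr * rr * rr = 1 := by decide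

/-- normal form of a vertex: letter 1 last -/
def vx (x : L) (σ : Wd) : L × Wd :=
  if σ 3 = 1 then (x, σ) else if σ 0 = 1 then (x + e (σ 0), σ * rr) else
  if σ 1 = 1 then (x + e (σ 0) + e (σ 1), σ * rr * rr) else
    (x + e (σ 0) + e (σ 1) + e (σ 2), σ * rr * rr * rr)

abbrev Vt := L × Wd

theorem perm_ne {σ : Wd} {i j : Fin 4} (h : i ≠ j) : σ i ≠ σ j := fun h' => h (σ.injective h')

theorem perm_one (σ : Wd) : σ 0 = 1 ∨ σ 1 = 1 ∨ σ 2 = 1 ∨ σ 3 = 1 := by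
  obtain ⟨i, hi⟩ := σ.surjective 1
  fin_cases i <;> simp at hi <;> tauto
theorem perm_zero (σ : Wd) : σ 0 = 0 ∨ σ 1 = 0 ∨ σ 2 = 0 ∨ σ 3 = 0 := by
  obtain ⟨i, hi⟩ := σ.surjective 0
  fin_cases i <;> simp at hi <;> tauto

theorem vx_of3 (x : L) {σ : Wd} (h : σ 3 = 1) : vx x σ = (x, σ) := by simp [vx, h]

theorem vx_rot (x : L) (σ : Wd) : vx (x + e (σ 0)) (σ * rr) = vx x σ := by
  have a0 : (σ * rr) 0 = σ 1 := rfl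
  have a1 : (σ * rr) 1 = σ 2 := rfl
  have a2 : (σ * rr) 2 = σ 3 := rfl
  have a3 : (σ * rr) 3 = σ 0 := rfl
  have n01 := perm_ne (σ := σ) (show (0:Fin 4) ≠ 1 by decide)
  have n02 := perm_ne (σ := σ) (show (0:Fin 4) ≠ 2 by decide)
  have n03 := perm_ne (σ := σ) (show (0:Fin 4) ≠ 3 by decide)
  have n12 := perm_ne (σ := σ) (show (1:Fin 4) ≠ 2 by decide)
  have n13 := perm_ne (σ := σ) (show (1:Fin 4) ≠ 3 by decide)
  have n23 := perm_ne (σ := σ) (show (2:Fin 4) ≠ 3 by decide)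
  have r4 : σ * rr * rr * rr * rr = σ := by
    have := rr4; simp only [mul_assoc] at this ⊢; rw [this, mul_one]
  have hs := e_perm σ
  unfold vx
  rw [a0, a1, a2, a3]
  rcases perm_one σ with h | h | h | h
  · rw [h] at n01 n02 n03
    simp [h, n01.symm, n02.symm, n03.symm]
  · rw [h] at n01 n12 n13
    simp [h, n01, n12.symm, n13.symm]
  · rw [h] at n02 n12 n23
    simp [h, n02, n12, n23.symm]
  · rw [h] at n03 n13 n23
    simp only [h, n03, n13, n23, r4, if_true, if_false]
    rw [h] at hs
    rw [add_assoc x, add_assoc x, add_assoc x, hs, add_zero]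

theorem vx_rot2 (x : L) (σ : Wd) : vx (x + e (σ 0) + e (σ 1)) (σ * rr * rr) = vx x σ := by
  rw [← vx_rot x σ, ← vx_rot (x + e (σ 0)) (σ * rr)]; rfl

theorem vx_rot3 (x : L) (σ : Wd) : vx (x + e (σ 0) + e (σ 1) + e (σ 2)) (σ * rr * rr * rr) = vx x σ := by
  rw [← vx_rot2 x σ, ← vx_rot (x + e (σ 0) + e (σ 1)) (σ * rr * rr)]; rfl

theorem vx_rotm (x : L) (σ : Wd) : vx (x - e (σ 3)) (σ * rr * rr * rr) = vx x σ := by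
  rw [← vx_rot3 x σ]; congr 1
  have := e_perm σ
  rw [sub_eq_iff_eq_add, add_assoc x, add_assoc x, add_assoc x, this, add_zero]

/-- the four tiles around a vertex -/
def Tl (v : Vt) : Set L := {x | x = v.1 ∨ x = v.1 + e (v.2 0) ∨ x = v.1 + e (v.2 0) + e (v.2 1) ∨
  x = v.1 + e (v.2 0) + e (v.2 1) + e (v.2 2)}

theorem Tl_rot (x : L) (σ : Wd) : Tl (x + e (σ 0), σ * rr) = Tl (x, σ) := by
  have a0 : (σ * rr) 0 = σ 1 := rfl
  have a1 : (σ * rr) 1 = σ 2 := rfl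
  have a2 : (σ * rr) 2 = σ 3 := rfl
  have hs := e_perm σ
  ext y
  simp only [Tl, Set.mem_setOf_eq, a0, a1, a2]
  have : x + e (σ 0) + e (σ 1) + e (σ 2) + e (σ 3) = x := by
    rw [add_assoc x, add_assoc x, add_assoc x, hs, add_zero]
  rw [this]; tauto

theorem Tl_vx (x : L) (σ : Wd) : Tl (vx x σ) = Tl (x, σ) := by
  have h1 := Tl_rot x σ
  have h2 := Tl_rot (x + e (σ 0)) (σ * rr)
  have h3 := Tl_rot (x + e (σ 0) + e (σ 1)) (σ * rr * rr)
  unfold vx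
  split_ifs
  · rfl
  · exact h1
  · exact h2.trans h1
  · exact h3.trans (h2.trans h1)

end ABCT

set_option linter.all false

namespace ABCT

/-! membership of vertices -/
theorem e_inj2 : ∀ i j : Fin 4, e i = e j → i = j := by decide
theorem e_ne0 : ∀ i : Fin 4, e i ≠ 0 := by decide
theorem e_ne2 : ∀ i j k : Fin 4, j ≠ k → e i ≠ e j + e k := by decide
theorem e_ne3 : ∀ i j k l : Fin 4, j ≠ k → j ≠ l → k ≠ l → e i ≠ e j + e k + e l := by decide
theorem e_2ne0 : ∀ i j : Fin 4, i ≠ j → e i + e j ≠ 0 := by decide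
theorem e_2ne3 : ∀ i j k l m : Fin 4, i ≠ j → k ≠ l → k ≠ m → l ≠ m → e i + e j ≠ e k + e l + e m := by decide
theorem e_22 : ∀ i j k l : Fin 4, i ≠ j → k ≠ l → e i + e j = e k + e l → (i = k ∧ j = l) ∨ (i = l ∧ j = k) := by decide

def Can (v : Vt) : Prop := v.2 3 = 1

theorem vx_can (x : L) (σ : Wd) : Can (vx x σ) := by
  have h := perm_one σ
  unfold vx Can
  split_ifs with h1 h2 h3
  · exact h1
  · exact h2
  · exact h3
  · show σ 2 = 1
    tauto

theorem vx_of_can {v : Vt} (h : Can v) : vx v.1 v.2 = v := vx_of3 v.1 h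

/-- a canonical vertex containing the tile `x` is `vx x τ`. -/
theorem exists_vx {v : Vt} (h : Can v) {x : L} (hx : x ∈ Tl v) : ∃ τ, v = vx x τ := by
  have hv := vx_of_can h
  rcases hx with hx | hx | hx | hx
  · exact ⟨v.2, by rw [hx, hv]⟩
  · exact ⟨v.2 * rr, by rw [hx, vx_rot, hv]⟩
  · exact ⟨v.2 * rr * rr, by rw [hx, vx_rot2, hv]⟩
  · exact ⟨v.2 * rr * rr * rr, by rw [hx, vx_rot3, hv]⟩

theorem mem_Tl0 (x : L) (σ : Wd) : x ∈ Tl (vx x σ) := by rw [Tl_vx]; simp [Tl]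
theorem mem_Tl1 (x : L) (σ : Wd) : x + e (σ 0) ∈ Tl (vx x σ) := by rw [Tl_vx]; simp [Tl]
theorem mem_Tl2 (x : L) (σ : Wd) : x + e (σ 0) + e (σ 1) ∈ Tl (vx x σ) := by rw [Tl_vx]; simp [Tl]
theorem mem_Tl3 (x : L) (σ : Wd) : x + e (σ 0) + e (σ 1) + e (σ 2) ∈ Tl (vx x σ) := by rw [Tl_vx]; simp [Tl]

theorem ne01 (σ : Wd) : σ 0 ≠ σ 1 := perm_ne (by decide)
theorem ne02 (σ : Wd) : σ 0 ≠ σ 2 := perm_ne (by decide)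
theorem ne03 (σ : Wd) : σ 0 ≠ σ 3 := perm_ne (by decide)
theorem ne12 (σ : Wd) : σ 1 ≠ σ 2 := perm_ne (by decide)
theorem ne13 (σ : Wd) : σ 1 ≠ σ 3 := perm_ne (by decide)
theorem ne23 (σ : Wd) : σ 2 ≠ σ 3 := perm_ne (by decide)

theorem Tl_hex {x : L} {τ : Wd} {i : Fin 4} : x + e i ∈ Tl (vx x τ) ↔ τ 0 = i := by
  rw [Tl_vx]
  constructor
  · rintro (h | h | h | h)
    · exact absurd (by simpa using h) (e_ne0 i)
    · exact (e_inj2 _ _ (by simpa using h)).symm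
    · exact absurd (by simpa [add_assoc] using h) (e_ne2 i _ _ (ne01 τ))
    · exact absurd (by simpa [add_assoc] using h) (by simpa [add_assoc] using e_ne3 i _ _ _ (ne01 τ) (ne02 τ) (ne12 τ))
  · rintro rfl; simp [Tl]

theorem Tl_sq {x : L} {τ : Wd} {i j : Fin 4} (hij : i ≠ j) :
    x + e i + e j ∈ Tl (vx x τ) ↔ (τ 0 = i ∧ τ 1 = j) ∨ (τ 0 = j ∧ τ 1 = i) := by
  rw [Tl_vx]
  constructor
  · rintro (h | h | h | h)
    · exact absurd (by simpa [add_assoc] using h) (e_2ne0 i j hij)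
    · exact absurd (by simpa [add_assoc] using h.symm) (e_ne2 _ _ _ hij)
    · have := e_22 i j _ _ hij (ne01 τ) (by simpa [add_assoc] using h)
      tauto
    · exact absurd (by simpa [add_assoc] using h) (by simpa [add_assoc] using e_2ne3 i j _ _ _ hij (ne01 τ) (ne02 τ) (ne12 τ))
  · rintro (⟨rfl, rfl⟩ | ⟨rfl, rfl⟩)
    · simp [Tl]
    · simp [Tl, add_right_comm]

abbrev Fg := Bool × L × Wd

def hexP (x : L) (σ : Wd) : List Vt := [vx x σ, vx x (σ * s2), vx x (σ * (s2 * s1)), vx x (σ * (s2 * s1 * s2)),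
  vx x (σ * (s1 * s2)), vx x (σ * s1)]
def sqP (x : L) (σ : Wd) : List Vt := [vx x σ, vx x (σ * s2), vx x (σ * (s2 * s0)), vx x (σ * s0)]

def pol : Fg → List Vt
  | (true, x, σ) => hexP x σ
  | (false, x, σ) => sqP x σ

/-- other tile of a flag -/
def oth : Fg → L
  | (true, x, σ) => x + e (σ 0)
  | (false, x, σ) => x + e (σ 0) + e (σ 1)

theorem w6 : ∀ ρ : Wd, ρ 0 = 0 → ρ = 1 ∨ ρ = s2 ∨ ρ = s2 * s1 ∨ ρ = s2 * s1 * s2 ∨ ρ = s1 * s2 ∨ ρ = s1 := by decide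
theorem w4 : ∀ ρ : Wd, (ρ 0 = 0 ∧ ρ 1 = 1) ∨ (ρ 0 = 1 ∧ ρ 1 = 0) → ρ = 1 ∨ ρ = s2 ∨ ρ = s2 * s0 ∨ ρ = s0 := by decide

theorem mem_pol (φ : Fg) (v : Vt) (hv : Can v) : v ∈ pol φ ↔ φ.2.1 ∈ Tl v ∧ oth φ ∈ Tl v := by
  obtain ⟨b, x, σ⟩ := φ
  constructor
  · intro h
    cases b
    · simp only [pol, sqP, List.mem_cons, List.not_mem_nil, or_false] at h
      simp only [oth]
      rcases h with rfl | rfl | rfl | rfl <;> refine ⟨mem_Tl0 _ _, (Tl_sq (ne01 σ)).2 ?_⟩ <;>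
        simp [s0_ap, s2_ap]
    · simp only [pol, hexP, List.mem_cons, List.not_mem_nil, or_false] at h
      simp only [oth]
      rcases h with rfl | rfl | rfl | rfl | rfl | rfl <;> refine ⟨mem_Tl0 _ _, Tl_hex.2 ?_⟩ <;>
        simp [s1_ap, s2_ap]
  · rintro ⟨h1, h2⟩
    obtain ⟨τ, rfl⟩ := exists_vx hv h1
    have hτ : τ = σ * (σ⁻¹ * τ) := by simp
    cases b
    · have := (Tl_sq (ne01 σ)).1 h2
      have := w4 (σ⁻¹ * τ) (by
        rcases this with ⟨h, h'⟩ | ⟨h, h'⟩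
        · left; simp [h, h']
        · right; simp [h, h'])
      simp only [pol, sqP, List.mem_cons, List.not_mem_nil, or_false]
      rcases this with h | h | h | h <;> rw [h] at hτ <;> rw [hτ] <;> simp
    · have := Tl_hex.1 h2
      have := w6 (σ⁻¹ * τ) (by simp [this])
      simp only [pol, hexP, List.mem_cons, List.not_mem_nil, or_false]
      rcases this with h | h | h | h | h | h <;> rw [h] at hτ <;> rw [hτ] <;> simp

theorem pol_can (φ : Fg) (v : Vt) (hv : v ∈ pol φ) : Can v := by
  obtain ⟨b, x, σ⟩ := φ
  cases b
  · simp only [pol, sqP, List.mem_cons, List.not_mem_nil, or_false] at hv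
    rcases hv with rfl | rfl | rfl | rfl <;> exact vx_can _ _
  · simp only [pol, hexP, List.mem_cons, List.not_mem_nil, or_false] at hv
    rcases hv with rfl | rfl | rfl | rfl | rfl | rfl <;> exact vx_can _ _

/-! edges -/
theorem vx_snd (x : L) (σ : Wd) : (vx x σ).2 = σ ∨ (vx x σ).2 = σ * rr ∨ (vx x σ).2 = σ * (rr * rr) ∨
    (vx x σ).2 = σ * (rr * rr * rr) := by
  unfold vx; split_ifs <;> simp [mul_assoc]

theorem Tl_fst (v : Vt) : v.1 ∈ Tl v := Or.inl rfl

theorem vx_inj {x x' : L} {σ σ' : Wd} (h : vx x σ = vx x' σ') :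
    (x' = x ∧ σ' = σ) ∨ (x' = x + e (σ 0) ∧ σ' = σ * rr) ∨ (x' = x + e (σ 0) + e (σ 1) ∧ σ' = σ * rr * rr) ∨
    (x' = x + e (σ 0) + e (σ 1) + e (σ 2) ∧ σ' = σ * rr * rr * rr) := by
  have key : ∀ τ τ', vx x' τ = vx x' τ' → τ = τ' := by
    intro τ τ' hh
    have t := Tl_vx x' τ
    have h0 : τ 0 = τ' 0 := Tl_hex.1 (hh ▸ mem_Tl1 x' τ' : x' + e (τ' 0) ∈ Tl (vx x' τ))
    have h1 := (Tl_sq (x := x') (τ := τ) (ne01 τ')).1 (hh ▸ mem_Tl2 x' τ')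
    have h3 : x' - e (τ' 3) ∈ Tl (vx x' τ) := by
      rw [hh]
      have := mem_Tl3 x' τ'
      have h4 := e_perm τ'
      rw [show x' - e (τ' 3) = x' + e (τ' 0) + e (τ' 1) + e (τ' 2) by
        rw [sub_eq_iff_eq_add, add_assoc x', add_assoc x', add_assoc x', h4, add_zero]]
      exact this
    have h01 : τ 1 = τ' 1 := by
      rcases h1 with h1 | h1
      · exact h1.2
      · exact absurd (h0.symm.trans h1.1) (ne01 τ')
    have h33 : e (τ' 3) = e (τ 3) ∨ False := by
      rw [Tl_vx] at h3
      have e1 : ∀ i j : Fin 4, - e i ≠ e j := by decide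
      have e2 : ∀ i j k : Fin 4, -e i ≠ e j + e k := by decide
      rcases h3 with h | h | h | h
      · simp only [sub_eq_self] at h; exact absurd h (e_ne0 _)
      · rw [sub_eq_add_neg, add_right_inj] at h; exact absurd h (e1 _ _)
      · rw [sub_eq_add_neg, add_assoc, add_right_inj] at h; exact absurd h (e2 _ _ _)
      · left
        have h4 := e_perm τ
        rw [sub_eq_add_neg, add_assoc x', add_assoc x', add_right_inj] at h
        have := eq_neg_of_add_eq_zero_left h4
        have h5 := h.trans this
        exact neg_injective h5
    have h33 := e_inj2 _ _ (h33.resolve_right id)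
    have h22 : τ 2 = τ' 2 := by
      have k : ∀ a b c d d' : Fin 4, a ≠ b → a ≠ c → b ≠ c → d ≠ a → d ≠ b → d ≠ c → d' ≠ a → d' ≠ b → d' ≠ c → d = d' := by decide
      apply k (τ 0) (τ 1) (τ 3) _ _ (ne01 τ) (ne03 τ) (ne13 τ) (ne02 τ).symm (ne12 τ).symm (ne23 τ)
      · rw [h0]; exact (ne02 τ').symm
      · rw [h01]; exact (ne12 τ').symm
      · rw [← h33]; exact ne23 τ'
    ext i; fin_cases i <;> simp [h0, h01, h22, h33]
  have hm : x' ∈ Tl (vx x σ) := h ▸ mem_Tl0 x' σ'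
  rw [Tl_vx] at hm
  rcases hm with hm | hm | hm | hm
  · left; refine ⟨hm, key _ _ ?_⟩; rw [← h, hm]
  · right; left; refine ⟨hm, key _ _ ?_⟩; rw [← h, hm]; exact (vx_rot x σ).symm
  · right; right; left; refine ⟨hm, key _ _ ?_⟩; rw [← h, hm]; exact (vx_rot2 x σ).symm
  · right; right; right; refine ⟨hm, key _ _ ?_⟩; rw [← h, hm]; exact (vx_rot3 x σ).symm

theorem vx_inj' {x : L} {σ σ' : Wd} (h : vx x σ = vx x σ') : σ = σ' := by
  rcases vx_inj h with h | h | h | h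
  · exact h.2.symm
  · exact absurd (by simpa using h.1) (e_ne0 (σ 0))
  · exact absurd (by simpa [add_assoc] using h.1) (e_2ne0 _ _ (ne01 σ))
  · have : ∀ i j k : Fin 4, i ≠ j → i ≠ k → j ≠ k → ¬ (e i + e j + e k = 0) := by decide
    exact absurd (by simpa [add_assoc] using h.1) (by simpa [add_assoc] using this _ _ _ (ne01 σ) (ne02 σ) (ne12 σ))

theorem edge_inj {x x' : L} {σ σ' : Wd} (h : vx x σ = vx x' σ') (h2 : vx x (σ * s2) = vx x' (σ' * s2)) :
    x = x' ∧ σ = σ' := by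
  have h2' := vx_snd x (σ * s2)
  have h3' := vx_snd x' (σ' * s2)
  rw [← h2] at h3'
  have key : ∀ ρ : Wd, (ρ = rr ∨ ρ = rr * rr ∨ ρ = rr * rr * rr) →
      ∀ i j : Fin 4, ρ * s2 * rr ^ (i : ℕ) ≠ s2 * rr ^ (j : ℕ) := by decide
  have k2 : ∀ ρ : Wd, (ρ = rr ∨ ρ = rr * rr ∨ ρ = rr * rr * rr) → σ' = σ * ρ → False := by
    intro ρ hρ hs
    subst hs
    obtain ⟨i, hi⟩ : ∃ i : Fin 4, (vx x (σ * s2)).2 = σ * (s2 * rr ^ (i:ℕ)) := by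
      rcases h2' with h | h | h | h
      · exact ⟨0, by simp [h]⟩
      · exact ⟨1, by simp [h, mul_assoc]⟩
      · exact ⟨2, by simp [h, mul_assoc, pow_two]⟩
      · exact ⟨3, by simp [h, mul_assoc, pow_succ]⟩
    obtain ⟨j, hj⟩ : ∃ i : Fin 4, (vx x (σ * s2)).2 = σ * (ρ * s2 * rr ^ (i:ℕ)) := by
      rcases h3' with h | h | h | h
      · exact ⟨0, by simp [h, mul_assoc]⟩
      · exact ⟨1, by simp [h, mul_assoc]⟩
      · exact ⟨2, by simp [h, mul_assoc, pow_two]⟩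
      · exact ⟨3, by simp [h, mul_assoc, pow_succ]⟩
    exact key ρ hρ j i (mul_left_cancel (hj.symm.trans hi))
  rcases vx_inj h with h | h | h | h
  · exact ⟨h.1.symm, h.2.symm⟩
  · exact (k2 rr (by simp) h.2).elim
  · exact (k2 (rr * rr) (by simp) (by rw [h.2, mul_assoc])).elim
  · exact (k2 (rr * rr * rr) (by simp) (by rw [h.2, mul_assoc, mul_assoc, mul_assoc])).elim

end ABCT

set_option linter.all false

namespace ABCT

def sg (σ : Wd) : ℤ := (Equiv.Perm.sign σ : ℤ)

theorem sg_mul (σ τ : Wd) : sg (σ * τ) = sg σ * sg τ := by simp [sg]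
theorem sg_s0 : sg s0 = -1 := by decide
theorem sg_s1 : sg s1 = -1 := by decide
theorem sg_s2 : sg s2 = -1 := by decide
theorem sg_rr : sg rr = -1 := by decide
theorem sg_cases (σ : Wd) : sg σ = 1 ∨ sg σ = -1 := by
  rcases Int.units_eq_one_or (Equiv.Perm.sign σ) with h | h <;> simp [sg, h]

/-- sidedness -/
structure SD where
  sd : L → ℤ
  h1 : ∀ x, sd x = -1 ∨ sd x = 0 ∨ sd x = 1
  hf : {x | sd x ≠ 0}.Finite

variable (D : SD)

namespace SD

def hexOK (z : Vt) : Prop := D.sd z.1 * sg z.2 = -1 ∧ D.sd (z.1 + e (z.2 0)) = - D.sd z.1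
def sqOK (z : Vt) : Prop := D.sd z.1 * sg z.2 = 1 ∧ D.sd (z.1 + e (z.2 0) + e (z.2 1)) = - D.sd z.1

def OK : Fg → Prop
  | (true, z) => D.hexOK z
  | (false, z) => D.sqOK z

theorem hexOK_ne {z : Vt} (h : D.hexOK z) : D.sd z.1 ≠ 0 := by
  intro h0; have := h.1; rw [h0] at this; simp at this
theorem sqOK_ne {z : Vt} (h : D.sqOK z) : D.sd z.1 ≠ 0 := by
  intro h0; have := h.1; rw [h0] at this; simp at this

theorem finZ : {z : Vt | D.sd z.1 ≠ 0}.Finite := by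
  have := D.hf.prod (Set.finite_univ : (Set.univ : Set Wd).Finite)
  refine this.subset ?_
  rintro ⟨x, σ⟩ h; exact ⟨h, trivial⟩

theorem finOK : {φ | D.OK φ}.Finite := by
  have := (Set.finite_univ : (Set.univ : Set Bool).Finite).prod D.finZ
  refine this.subset ?_
  rintro ⟨b, z⟩ h
  refine ⟨trivial, ?_⟩
  cases b
  · exact D.sqOK_ne h
  · exact D.hexOK_ne h

noncomputable def Fl : Finset Fg := D.finOK.toFinset
theorem mem_Fl {φ : Fg} : φ ∈ D.Fl ↔ D.OK φ := by simp [Fl]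

def isR (v : Vt) : Prop := Can v ∧ (∃ x ∈ Tl v, D.sd x = 1) ∧ ∃ x ∈ Tl v, D.sd x = -1

theorem finR : {v | D.isR v}.Finite := by
  have := D.finZ.image (fun z => vx z.1 z.2)
  refine this.subset ?_
  rintro v ⟨hc, ⟨x, hx, h1⟩, _⟩
  obtain ⟨τ, rfl⟩ := exists_vx hc hx
  exact ⟨(x, τ), by simp [h1], rfl⟩

noncomputable def RV : Finset Vt := D.finR.toFinset
theorem mem_RV {v : Vt} : v ∈ D.RV ↔ D.isR v := by simp [RV]

def kp (u v : ℤ) : ℤ := if u = -1 ∧ v = 1 then 1 else if u = 1 ∧ v = -1 then -1 else 0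
def kt (u v w : ℤ) : ℤ := kp u v + kp v w + kp w u

def kap (z : Vt) : ℤ := kt (D.sd z.1) (D.sd (z.1 + e (z.2 0))) (D.sd (z.1 + e (z.2 0) + e (z.2 1)))

theorem kap_s2 (x : L) (σ : Wd) : D.kap (x, σ * s2) = D.kap (x, σ) := by simp [kap, s2_ap]

theorem kt_cases {u v w : ℤ} (hu : u = -1 ∨ u = 0 ∨ u = 1) (hv : v = -1 ∨ v = 0 ∨ v = 1)
    (hw : w = -1 ∨ w = 0 ∨ w = 1) : kt u v w = -1 ∨ kt u v w = 0 ∨ kt u v w = 1 := by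
  rcases hu with rfl | rfl | rfl <;> rcases hv with rfl | rfl | rfl <;> rcases hw with rfl | rfl | rfl <;> decide

theorem kap_cases (z : Vt) : D.kap z = -1 ∨ D.kap z = 0 ∨ D.kap z = 1 := kt_cases (D.h1 _) (D.h1 _) (D.h1 _)

def isO (z : Vt) : Prop := sg z.2 * D.kap z = 1

def ed (z : Vt) : Vt × Vt := (vx z.1 z.2, vx z.1 (z.2 * s2))

theorem ed_inj : Function.Injective ed := by
  rintro ⟨x, σ⟩ ⟨x', σ'⟩ h
  have h1 := congrArg Prod.fst h
  have h2 := congrArg Prod.snd h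
  obtain ⟨rfl, rfl⟩ := edge_inj h1 h2
  rfl

/-- both signs among the three tiles -/
theorem kt_signs {u v w : ℤ} (hu : u = -1 ∨ u = 0 ∨ u = 1) (hv : v = -1 ∨ v = 0 ∨ v = 1)
    (hw : w = -1 ∨ w = 0 ∨ w = 1) (h : kt u v w ≠ 0) : (u = 1 ∨ v = 1 ∨ w = 1) ∧ (u = -1 ∨ v = -1 ∨ w = -1) := by
  rcases hu with rfl | rfl | rfl <;> rcases hv with rfl | rfl | rfl <;> rcases hw with rfl | rfl | rfl <;> revert h <;> decide

theorem isR_of {x : L} {σ : Wd}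
    (h : (D.sd x = 1 ∨ D.sd (x + e (σ 0)) = 1 ∨ D.sd (x + e (σ 0) + e (σ 1)) = 1) ∧
      (D.sd x = -1 ∨ D.sd (x + e (σ 0)) = -1 ∨ D.sd (x + e (σ 0) + e (σ 1)) = -1)) : D.isR (vx x σ) := by
  refine ⟨vx_can _ _, ?_, ?_⟩
  · rcases h.1 with h | h | h
    · exact ⟨_, mem_Tl0 _ _, h⟩
    · exact ⟨_, mem_Tl1 _ _, h⟩
    · exact ⟨_, mem_Tl2 _ _, h⟩
  · rcases h.2 with h | h | h
    · exact ⟨_, mem_Tl0 _ _, h⟩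
    · exact ⟨_, mem_Tl1 _ _, h⟩
    · exact ⟨_, mem_Tl2 _ _, h⟩

theorem isR_kap {z : Vt} (h : D.kap z ≠ 0) : D.isR (vx z.1 z.2) ∧ D.isR (vx z.1 (z.2 * s2)) := by
  have := kt_signs (D.h1 _) (D.h1 _) (D.h1 _) h
  exact ⟨D.isR_of this, D.isR_of (by simpa [s2_ap] using this)⟩

theorem isO_ne {z : Vt} (h : D.isO z) : D.kap z ≠ 0 := by
  intro h0; unfold isO at h; rw [h0] at h; simp at h

theorem finO : {z | D.isO z}.Finite := by
  refine Set.Finite.of_finite_image (f := ed) ?_ ed_inj.injOn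
  refine (D.finR.prod D.finR).subset ?_
  rintro _ ⟨z, hz, rfl⟩
  exact D.isR_kap (D.isO_ne hz)

noncomputable def Oz : Finset Vt := D.finO.toFinset
noncomputable def O : Finset (Vt × Vt) := by classical exact D.Oz.image ed

theorem mem_O {o : Vt × Vt} : o ∈ D.O ↔ ∃ z, D.isO z ∧ o = ed z := by
  classical
  simp only [O, Oz, Finset.mem_image, Set.Finite.mem_toFinset, Set.mem_setOf_eq]
  constructor
  · rintro ⟨z, h, rfl⟩; exact ⟨z, h, rfl⟩
  · rintro ⟨z, h, rfl⟩; exact ⟨z, h, rfl⟩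

/-! the equivalences -/
def eqS2 : Vt ≃ Vt where
  toFun z := (z.1, z.2 * s2)
  invFun z := (z.1, z.2 * s2)
  left_inv z := by ext1 <;> simp [mul_assoc, show s2 * s2 = 1 by decide]
  right_inv z := by ext1 <;> simp [mul_assoc, show s2 * s2 = 1 by decide]

def eq3 : Vt ≃ Vt where
  toFun z := (z.1, z.2 * (s2 * s1))
  invFun z := (z.1, z.2 * (s1 * s2))
  left_inv z := by ext1; simp; simp [mul_assoc, show s2 * (s1 * (s1 * s2)) = 1 by decide]
  right_inv z := by ext1; simp; simp [mul_assoc, show s1 * (s2 * (s2 * s1)) = 1 by decide]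

def eqG : Vt ≃ Vt where
  toFun z := (z.1 - e (z.2 2), z.2 * (s2 * rr⁻¹))
  invFun z := (z.1 + e (z.2 0), z.2 * (rr * s2))
  left_inv z := by
    ext1
    · have : (z.2 * (s2 * rr⁻¹)) 0 = z.2 2 := by
        rw [Equiv.Perm.mul_apply, show (s2 * rr⁻¹) 0 = 2 by decide]
      simp only [this]; simp
    · simp only [mul_assoc, show s2 * (rr⁻¹ * (rr * s2)) = 1 by decide, mul_one]
  right_inv z := by
    ext1
    · have : (z.2 * (rr * s2)) 2 = z.2 0 := by
        rw [Equiv.Perm.mul_apply, show (rr * s2) 2 = 0 by decide]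
      simp only [this]; simp
    · simp only [mul_assoc, show rr * (s2 * (s2 * rr⁻¹)) = 1 by decide, mul_one]

def hh (z : Vt) : Vt := (z.1 + e (z.2 0) + e (z.2 1), z.2 * (s2 * (rr * rr)))

theorem hh2 (z : Vt) : hh (hh z) = (z.1, z.2 * (s2 * s0)) := by
  unfold hh
  have a : (z.2 * (s2 * (rr * rr))) 0 = z.2 3 := by
    rw [Equiv.Perm.mul_apply, show (s2 * (rr * rr)) 0 = 3 by decide]
  have b : (z.2 * (s2 * (rr * rr))) 1 = z.2 2 := by
    rw [Equiv.Perm.mul_apply, show (s2 * (rr * rr)) 1 = 2 by decide]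
  ext1
  · simp only [a, b]
    have := e_perm z.2
    rw [add_assoc z.1, add_assoc z.1, add_assoc z.1, add_right_comm (e (z.2 0) + e (z.2 1)), this, add_zero]
  · simp only [mul_assoc, show s2 * (rr * (rr * (s2 * (rr * rr)))) = s2 * s0 by decide]

theorem hh4 (z : Vt) : hh (hh (hh (hh z))) = z := by
  rw [hh2, hh2]; ext1 <;> simp [mul_assoc, show s2 * (s0 * (s2 * s0)) = 1 by decide]

def eqH : Vt ≃ Vt where
  toFun := hh
  invFun z := hh (hh (hh z))
  left_inv := hh4
  right_inv := hh4

def Sv (s : Vt → Vt → ℝ) (z : Vt) : ℝ := s (vx z.1 z.2) (vx z.1 (z.2 * s2))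

theorem s22 : s2 * s2 = 1 := by decide

theorem Sv_s2 (s : Vt → Vt → ℝ) (hs : ∀ u v, s u v = - s v u) (z : Vt) : Sv s (eqS2 z) = - Sv s z := by
  simp only [Sv, eqS2, Equiv.coe_fn_mk, mul_assoc, s22, mul_one]
  exact hs _ _

theorem Sv_G (s : Vt → Vt → ℝ) (z : Vt) :
    Sv s (eqG z) = s (vx z.1 (z.2 * s2)) (vx z.1 (z.2 * (s2 * s1))) := by
  simp only [Sv, eqG, Equiv.coe_fn_mk]
  have h1 := vx_rotm z.1 (z.2 * s2)
  have h2 := vx_rotm z.1 (z.2 * (s2 * s1))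
  have a : (z.2 * s2) 3 = z.2 2 := by simp [s2_ap]
  have b : (z.2 * (s2 * s1)) 3 = z.2 2 := by simp [s2_ap, s1_ap]
  rw [a] at h1; rw [b] at h2
  rw [← h1, ← h2]
  congr 2
  · simp only [mul_assoc]; rw [show s2 * rr⁻¹ = s2 * (rr * (rr * rr)) by decide]
  · simp only [mul_assoc]; rw [show s2 * (rr⁻¹ * s2) = s2 * (s1 * (rr * (rr * rr))) by decide]

theorem vx_hh (z : Vt) : vx (hh z).1 (hh z).2 = vx z.1 (z.2 * s2) := by
  have h := vx_rot2 z.1 (z.2 * s2)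
  simp only [Equiv.Perm.mul_apply, s2_ap] at h
  rw [← h]; simp [hh, mul_assoc]
theorem vx_hh2 (z : Vt) : vx (hh z).1 ((hh z).2 * s2) = vx z.1 (z.2 * (s2 * s0)) := by
  have h := vx_rot2 z.1 (z.2 * (s2 * s0))
  simp only [Equiv.Perm.mul_apply, s2_ap, s0_ap] at h
  rw [← h]; simp only [hh]
  congr 1
  · rw [add_right_comm]
  · simp only [mul_assoc]; rw [show s2 * (rr * (rr * s2)) = s2 * (s0 * (rr * rr)) by decide]

theorem cyc6 (s : Vt → Vt → ℝ) (hs : ∀ u v, s u v = - s v u) (a b c d f g : Vt) :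
    cyc s [a, b, c, d, f, g] = s a b + s b c + s c d + s d f + s f g + s g a := by
  simp only [cyc]
  linarith [hs a c, hs a d, hs a f]

theorem cyc4 (s : Vt → Vt → ℝ) (hs : ∀ u v, s u v = - s v u) (a b c d : Vt) :
    cyc s [a, b, c, d] = s a b + s b c + s c d + s d a := by
  simp only [cyc]
  linarith [hs a c]


theorem cyc_hex {s : Vt → Vt → ℝ} (hs : ∀ u v, s u v = - s v u) (z : Vt) : cyc s (hexP z.1 z.2) =
    (Sv s z + Sv s (eqG z)) + (Sv s (eq3 z) + Sv s (eqG (eq3 z))) +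
      (Sv s (eq3 (eq3 z)) + Sv s (eqG (eq3 (eq3 z)))) := by
  rw [Sv_G, Sv_G, Sv_G, hexP, cyc6 s hs]
  simp only [Sv, eq3, Equiv.coe_fn_mk, mul_assoc]
  rw [show s2 * (s1 * (s2 * s1)) = s1 * s2 by decide, show s2 * (s1 * (s2 * (s1 * s2))) = s1 by decide,
    show s2 * (s1 * (s1 * s2)) = 1 by decide, mul_one]
  ring

theorem cyc_sq {s : Vt → Vt → ℝ} (hs : ∀ u v, s u v = - s v u) (z : Vt) : cyc s (sqP z.1 z.2) =
    Sv s z + Sv s (eqH z) + Sv s (eqH (eqH z)) + Sv s (eqH (eqH (eqH z))) := by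
  have h : ∀ z, Sv s (eqH z) = s (vx z.1 (z.2 * s2)) (vx z.1 (z.2 * (s2 * s0))) := by
    intro z; simp only [Sv, eqH, Equiv.coe_fn_mk, vx_hh, vx_hh2]
  rw [h (eqH (eqH z)), h z]
  have h2 : eqH (eqH z) = (z.1, z.2 * (s2 * s0)) := hh2 z
  rw [h2, sqP, cyc4 s hs]
  simp only [Sv, mul_assoc]
  rw [show s2 * (s0 * s2) = s0 by decide, show s2 * (s0 * (s2 * s0)) = 1 by decide, mul_one]

open Classical in
noncomputable def ind (p : Prop) : ℝ := if p then 1 else 0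

theorem hexOK_3 (z : Vt) : D.hexOK (eq3 z) ↔ D.hexOK z := by
  simp only [hexOK, eq3, Equiv.coe_fn_mk, sg_mul, sg_s1, sg_s2, Equiv.Perm.mul_apply, s1_ap, s2_ap]
  norm_num

theorem sqOK_hh (z : Vt) : D.sqOK z → D.sqOK (hh z) := by
  rintro ⟨h1, h2⟩
  have a : (z.2 * (s2 * (rr * rr))) 0 = z.2 3 := by
    rw [Equiv.Perm.mul_apply, show (s2 * (rr * rr)) 0 = 3 by decide]
  have b : (z.2 * (s2 * (rr * rr))) 1 = z.2 2 := by
    rw [Equiv.Perm.mul_apply, show (s2 * (rr * rr)) 1 = 2 by decide]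
  have := e_perm z.2
  have hx : z.1 + e (z.2 0) + e (z.2 1) + e (z.2 3) + e (z.2 2) = z.1 := by
    rw [add_assoc z.1, add_assoc z.1, add_assoc z.1, add_right_comm (e (z.2 0) + e (z.2 1)), this, add_zero]
  constructor
  · simp only [hh, sg_mul, sg_s2, sg_rr, h2]; linarith
  · simp only [hh, a, b, hx, h2]; simp

theorem sqOK_H (z : Vt) : D.sqOK (eqH z) ↔ D.sqOK z := by
  constructor
  · intro h
    have := D.sqOK_hh _ (D.sqOK_hh _ (D.sqOK_hh _ h))
    rwa [show hh (hh (hh (eqH z))) = z from hh4 z] at this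
  · exact D.sqOK_hh z

noncomputable def cc (z : Vt) : ℝ := ind (D.hexOK z) + ind (D.hexOK (eqG.symm z)) + ind (D.sqOK z)

theorem cc_aux (u v w ε : ℤ) (hu : u = -1 ∨ u = 0 ∨ u = 1) (hv : v = -1 ∨ v = 0 ∨ v = 1)
    (hw : w = -1 ∨ w = 0 ∨ w = 1) (hε : ε = 1 ∨ ε = -1) :
    (ind (u * ε = -1 ∧ v = -u) + ind (v * ε = -1 ∧ w = -v) + ind (u * ε = 1 ∧ w = -u))
    - (ind (u * (-ε) = -1 ∧ v = -u) + ind (v * (-ε) = -1 ∧ w = -v) + ind (u * (-ε) = 1 ∧ w = -u))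
    = ind (ε * kt u v w = 1) - ind ((-ε) * kt u v w = 1) := by
  rcases hu with rfl | rfl | rfl <;> rcases hv with rfl | rfl | rfl <;> rcases hw with rfl | rfl | rfl <;>
   rcases hε with rfl | rfl <;> simp [ind, kt, kp]

theorem cc_s2 (z : Vt) : D.cc z - D.cc (eqS2 z) = ind (D.isO z) - ind (D.isO (eqS2 z)) := by
  have h := cc_aux _ _ _ _ (D.h1 z.1) (D.h1 (z.1 + e (z.2 0))) (D.h1 (z.1 + e (z.2 0) + e (z.2 1))) (sg_cases z.2)
  have a : ∀ z : Vt, D.hexOK (eqG.symm z) ↔ (D.sd (z.1 + e (z.2 0)) * sg z.2 = -1 ∧ D.sd (z.1 + e (z.2 0) + e (z.2 1)) = - D.sd (z.1 + e (z.2 0))) := by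
    intro z
    simp only [hexOK, eqG, Equiv.coe_fn_symm_mk, sg_mul, sg_rr, sg_s2]
    rw [show (z.2 * (rr * s2)) 0 = z.2 1 from rfl]; norm_num
  have b : sg (z.2 * s2) = - sg z.2 := by rw [sg_mul, sg_s2]; ring
  simp only [cc, a]
  simp only [hexOK, sqOK, isO, eqS2, Equiv.coe_fn_mk, kap_s2, b, Equiv.Perm.mul_apply, s2_ap]
  exact h

noncomputable def Hz : Finset Vt := (D.finZ.subset (fun z h => D.hexOK_ne h) : {z | D.hexOK z}.Finite).toFinset
noncomputable def Qz : Finset Vt := (D.finZ.subset (fun z h => D.sqOK_ne h) : {z | D.sqOK z}.Finite).toFinset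
theorem mem_Hz {z} : z ∈ D.Hz ↔ D.hexOK z := by simp [Hz]
theorem mem_Qz {z} : z ∈ D.Qz ↔ D.sqOK z := by simp [Qz]

theorem eqS2_2 (z : Vt) : eqS2 (eqS2 z) = z := by
  simp only [eqS2, Equiv.coe_fn_mk, mul_assoc, s22, mul_one]

theorem sum_ind (Z : Finset Vt) (p : Vt → Prop) (A : Finset Vt) (hA : ∀ z, z ∈ A ↔ p z) (hZ : A ⊆ Z) (f : Vt → ℝ) :
    ∑ z ∈ A, f z = ∑ z ∈ Z, ind (p z) * f z := by
  classical
  rw [← Finset.sum_subset hZ]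
  · apply Finset.sum_congr rfl
    intro z hz; simp [ind, (hA z).1 hz]
  · intro z _ hz; rw [hA] at hz; simp [ind, hz]

theorem main_sum {s : Vt → Vt → ℝ} (hs : ∀ u v, s u v = - s v u) : ∑ z ∈ D.Hz, (Sv s z + Sv s (eqG z)) + ∑ z ∈ D.Qz, Sv s z = ∑ z ∈ D.Oz, Sv s z := by
  classical
  have mO : ∀ z, z ∈ D.Oz ↔ D.isO z := by intro z; simp [Oz]
  set Z0 : Finset Vt := D.Hz ∪ D.Hz.map eqG.toEmbedding ∪ D.Qz ∪ D.Oz with hZ0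
  set Z : Finset Vt := Z0 ∪ Z0.map eqS2.toEmbedding with hZ
  have hZs : ∀ z, z ∈ Z ↔ eqS2 z ∈ Z := by
    intro z
    have k : ∀ z, z ∈ Z → eqS2 z ∈ Z := by
      intro z h
      rw [hZ, Finset.mem_union, Finset.mem_map] at h ⊢
      rcases h with h | ⟨y, hy, rfl⟩
      · right; exact ⟨z, h, rfl⟩
      · left; simp only [Equiv.coe_toEmbedding, eqS2_2]; exact hy
    refine ⟨k z, fun h => ?_⟩
    have := k _ h; rwa [eqS2_2] at this
  have sub0 : Z0 ⊆ Z := Finset.subset_union_left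
  have e1 := sum_ind Z D.hexOK D.Hz (fun z => D.mem_Hz) (by
    refine Finset.Subset.trans ?_ sub0; intro z hz; simp [hZ0, hz]) (Sv s)
  have e2 := sum_ind Z (fun z => D.hexOK (eqG.symm z)) (D.Hz.map eqG.toEmbedding) (fun z => by
      rw [Finset.mem_map_equiv, mem_Hz]) (by
    refine Finset.Subset.trans ?_ sub0; intro z hz; rw [hZ0]; simp only [Finset.mem_union]; tauto) (Sv s)
  have e3 := sum_ind Z D.sqOK D.Qz (fun z => D.mem_Qz) (by
    refine Finset.Subset.trans ?_ sub0; intro z hz; simp [hZ0, hz]) (Sv s)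
  have e4 := sum_ind Z D.isO D.Oz mO (by
    refine Finset.Subset.trans ?_ sub0; intro z hz; simp [hZ0, hz]) (Sv s)
  rw [Finset.sum_add_distrib]
  have e2' : ∑ z ∈ D.Hz, Sv s (eqG z) = ∑ z ∈ D.Hz.map eqG.toEmbedding, Sv s z := by
    rw [Finset.sum_map]; rfl
  rw [e2', e1, e2, e3, e4]
  have r : ∀ f : Vt → ℝ, ∑ z ∈ Z, f z * Sv s z = - ∑ z ∈ Z, f (eqS2 z) * Sv s z := by
    intro f
    rw [← Finset.sum_neg_distrib]
    refine Finset.sum_equiv eqS2 hZs ?_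
    intro z _
    rw [eqS2_2, Sv_s2 s hs]; ring
  have r1 := r D.cc
  have r2 := r (fun z => ind (D.isO z))
  have r3 : ∑ z ∈ Z, D.cc z * Sv s z - ∑ z ∈ Z, D.cc (eqS2 z) * Sv s z =
      ∑ z ∈ Z, ind (D.isO z) * Sv s z - ∑ z ∈ Z, ind (D.isO (eqS2 z)) * Sv s z := by
    rw [← Finset.sum_sub_distrib, ← Finset.sum_sub_distrib]
    apply Finset.sum_congr rfl; intro z _
    rw [← sub_mul, ← sub_mul, D.cc_s2]
  have r4 : ∑ z ∈ Z, D.cc z * Sv s z = ∑ z ∈ Z, ind (D.hexOK z) * Sv s z + ∑ z ∈ Z, ind (D.hexOK (eqG.symm z)) * Sv s z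
      + ∑ z ∈ Z, ind (D.sqOK z) * Sv s z := by
    rw [← Finset.sum_add_distrib, ← Finset.sum_add_distrib]
    apply Finset.sum_congr rfl; intro z _
    unfold cc; ring
  linarith

noncomputable def wt (φ : Fg) : ℝ := if φ.1 = true then 1/3 else 1/4

theorem cancel {s : Vt → Vt → ℝ} (hs : ∀ u v, s u v = - s v u) : ∑ φ ∈ D.Fl, wt φ * cyc s (pol φ) = ∑ o ∈ D.O, s o.1 o.2 := by
  classical
  have hFl : D.Fl = (D.Hz.image (fun z => ((true, z) : Fg))) ∪
      (D.Qz.image (fun z => ((false, z) : Fg))) := by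
    ext ⟨b, z⟩
    rw [mem_Fl]
    simp only [Finset.mem_union, Finset.mem_image, Prod.mk.injEq, mem_Hz, mem_Qz]
    constructor
    · intro h
      cases b
      · right; exact ⟨z, h, rfl, rfl⟩
      · left; exact ⟨z, h, rfl, rfl⟩
    · rintro (⟨z', h, rfl, rfl⟩ | ⟨z', h, rfl, rfl⟩) <;> exact h
  have hO : ∑ o ∈ D.O, s o.1 o.2 = ∑ z ∈ D.Oz, Sv s z := by
    unfold O; rw [Finset.sum_image (fun a _ b _ h => ed_inj h)]; rfl
  rw [hO, ← D.main_sum hs, hFl, Finset.sum_union, Finset.sum_image (fun a _ b _ h => (Prod.mk.inj h).2), Finset.sum_image (fun a _ b _ h => (Prod.mk.inj h).2)]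
  · congr 1
    · have k3 : ∀ f : Vt → ℝ, ∑ z ∈ D.Hz, f (eq3 z) = ∑ z ∈ D.Hz, f z := by
        intro f
        refine Finset.sum_equiv eq3 ?_ (fun _ _ => rfl)
        intro z; rw [mem_Hz, mem_Hz, hexOK_3]
      have k1 := k3 (fun z => Sv s z + Sv s (eqG z))
      have k2 := k3 (fun z => Sv s (eq3 z) + Sv s (eqG (eq3 z)))
      have : ∀ z ∈ D.Hz, wt (true, z) * cyc s (pol (true, z)) = 1/3 * ((Sv s z + Sv s (eqG z)) + (Sv s (eq3 z) + Sv s (eqG (eq3 z))) +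
      (Sv s (eq3 (eq3 z)) + Sv s (eqG (eq3 (eq3 z))))) := by
        intro z _
        rw [← cyc_hex hs]; simp [wt, pol]
      rw [Finset.sum_congr rfl this, ← Finset.mul_sum, Finset.sum_add_distrib, Finset.sum_add_distrib, k2, k1]
      ring
    · have k3 : ∀ f : Vt → ℝ, ∑ z ∈ D.Qz, f (eqH z) = ∑ z ∈ D.Qz, f z := by
        intro f
        refine Finset.sum_equiv eqH ?_ (fun _ _ => rfl)
        intro z; rw [mem_Qz, mem_Qz, sqOK_H]
      have k1 := k3 (fun z => Sv s z)
      have k2 := k3 (fun z => Sv s (eqH z))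
      have k4 := k3 (fun z => Sv s (eqH (eqH z)))
      have : ∀ z ∈ D.Qz, wt (false, z) * cyc s (pol (false, z)) = 1/4 * (
         Sv s z + Sv s (eqH z) + Sv s (eqH (eqH z)) + Sv s (eqH (eqH (eqH z)))) := by
        intro z _
        rw [← cyc_sq hs]; simp [wt, pol]
      rw [Finset.sum_congr rfl this, ← Finset.mul_sum, Finset.sum_add_distrib, Finset.sum_add_distrib, Finset.sum_add_distrib, k4, k2, k1]
      ring
  · rw [Finset.disjoint_left]; rintro ⟨b, z⟩ h1 h2
    simp only [Finset.mem_image, Prod.mk.injEq] at h1 h2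
    obtain ⟨_, _, h1, _⟩ := h1
    obtain ⟨_, _, h2, _⟩ := h2
    rw [← h1] at h2; simp at h2

end SD
end ABCT

set_option linter.all false

namespace ABCT
namespace SD
variable (D : SD)

theorem sd_ne {φ : Fg} (h : D.OK φ) : D.sd φ.2.1 ≠ 0 := by
  obtain ⟨b, z⟩ := φ
  cases b
  · exact D.sqOK_ne h
  · exact D.hexOK_ne h

theorem OK_oth {φ : Fg} (h : D.OK φ) : D.sd (oth φ) = - D.sd φ.2.1 := by
  obtain ⟨b, z⟩ := φ
  cases b
  · exact h.2
  · exact h.2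

/-- the two tiles as an unordered pair of (negative, positive) -/
theorem OK_tiles {φ : Fg} (h : D.OK φ) : ∃ x y, D.sd x = -1 ∧ D.sd y = 1 ∧
    ((φ.2.1 = x ∧ oth φ = y) ∨ (φ.2.1 = y ∧ oth φ = x)) := by
  have h1 := D.h1 φ.2.1
  have h2 := D.sd_ne h
  have h3 := D.OK_oth h
  rcases h1 with h1 | h1 | h1
  · exact ⟨_, _, h1, by rw [h3, h1]; rfl, Or.inl ⟨rfl, rfl⟩⟩
  · exact absurd h1 h2
  · exact ⟨_, _, by rw [h3, h1], h1, Or.inr ⟨rfl, rfl⟩⟩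

theorem OK_isR {φ : Fg} (h : D.OK φ) {v : Vt} (hv : v ∈ pol φ) : D.isR v := by
  have hc := pol_can φ v hv
  rw [mem_pol φ v hc] at hv
  obtain ⟨x, y, hx, hy, ⟨rfl, rfl⟩ | ⟨rfl, rfl⟩⟩ := D.OK_tiles h
  · exact ⟨hc, ⟨_, hv.2, hy⟩, ⟨_, hv.1, hx⟩⟩
  · exact ⟨hc, ⟨_, hv.1, hy⟩, ⟨_, hv.2, hx⟩⟩

/-- FLAG lemma: if `v` contains `x`, `y` with opposite signs there is an OK flag through `v` with tiles `x`, `y` -/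
theorem flag_aux {v : Vt} (hc : Can v) {x y : L} (hx : x ∈ Tl v) (hy : y ∈ Tl v) (h0 : D.sd x ≠ 0) (h : D.sd y = - D.sd x) :
    ∃ φ, D.OK φ ∧ ((φ.2.1 = x ∧ oth φ = y) ∨ (φ.2.1 = y ∧ oth φ = x)) := by
  obtain ⟨τ, rfl⟩ := exists_vx hc hx
  rw [Tl_vx] at hy
  have hτ : ∀ x', D.sd x' ≠ 0 → ∀ τ : Wd, ∀ k : ℤ, k = 1 ∨ k = -1 → D.sd x' * sg τ = k ∨ D.sd x' * sg (τ * s2) = k := by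
    intro x' h0 τ k hk
    rw [sg_mul, sg_s2]
    have h1 := D.h1 x'
    rcases h1 with h1 | h1 | h1
    · rcases sg_cases τ with h2 | h2 <;> rcases hk with rfl | rfl <;> simp [h1, h2]
    · exact absurd h1 h0
    · rcases sg_cases τ with h2 | h2 <;> rcases hk with rfl | rfl <;> simp [h1, h2]
  rcases hy with hy | hy | hy | hy
  · simp only at hy; subst hy
    exfalso; apply h0; omega
  · simp only at hy; subst hy
    rcases hτ x h0 τ (-1) (by simp) with h2 | h2
    · exact ⟨(true, x, τ), ⟨h2, h⟩, Or.inl ⟨rfl, rfl⟩⟩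
    · exact ⟨(true, x, τ * s2), ⟨h2, by simpa [s2_ap] using h⟩, Or.inl ⟨rfl, by simp [oth, s2_ap]⟩⟩
  · simp only at hy; subst hy
    rcases hτ x h0 τ (1) (by simp) with h2 | h2
    · exact ⟨(false, x, τ), ⟨h2, h⟩, Or.inl ⟨rfl, rfl⟩⟩
    · exact ⟨(false, x, τ * s2), ⟨h2, by simpa [s2_ap] using h⟩, Or.inl ⟨rfl, by simp [oth, s2_ap]⟩⟩
  · simp only at hy
    have hxy : x = y + e (τ 3) := by
      have := e_perm τ
      rw [hy, add_assoc x, add_assoc x, add_assoc x, this, add_zero]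
    have h0' : D.sd y ≠ 0 := by omega
    have ap : (τ * (rr * rr * rr)) 0 = τ 3 := rfl
    rcases hτ y h0' (τ * (rr * rr * rr)) (-1) (by simp) with h2 | h2
    · refine ⟨(true, y, τ * (rr * rr * rr)), ⟨h2, ?_⟩, Or.inr ⟨rfl, ?_⟩⟩
      · rw [ap]; rw [← hxy]; show D.sd x = - D.sd y; omega
      · simp only [oth]; rw [ap, ← hxy]
    · have ap2 : (τ * (rr * rr * rr) * s2) 0 = τ 3 := rfl
      refine ⟨(true, y, τ * (rr * rr * rr) * s2), ⟨h2, ?_⟩, Or.inr ⟨rfl, ?_⟩⟩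
      · rw [ap2, ← hxy]; show D.sd x = - D.sd y; omega
      · simp only [oth]; rw [ap2, ← hxy]

theorem flag {v : Vt} (hc : Can v) {x y : L} (hx : x ∈ Tl v) (hy : y ∈ Tl v) (h0 : D.sd x ≠ 0) (h : D.sd y = - D.sd x) :
    ∃ φ, D.OK φ ∧ v ∈ pol φ ∧ ((φ.2.1 = x ∧ oth φ = y) ∨ (φ.2.1 = y ∧ oth φ = x)) := by
  obtain ⟨φ, h1, h2⟩ := D.flag_aux hc hx hy h0 h
  refine ⟨φ, h1, ?_, h2⟩
  rw [mem_pol φ v hc]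
  rcases h2 with ⟨rfl, rfl⟩ | ⟨rfl, rfl⟩ <;> exact ⟨by assumption, by assumption⟩

theorem isR_flag {v : Vt} (h : D.isR v) : ∃ φ, D.OK φ ∧ v ∈ pol φ := by
  obtain ⟨hc, ⟨x, hx, h1⟩, ⟨y, hy, h2⟩⟩ := h
  obtain ⟨φ, h3, h4, _⟩ := D.flag hc hx hy (by omega) (by omega)
  exact ⟨φ, h3, h4⟩

def gp : Fg → Finset Fg
  | (true, z) => {(true, z), (true, eq3 z), (true, eq3 (eq3 z))}
  | (false, z) => {(false, z), (false, eqH z), (false, eqH (eqH z)), (false, eqH (eqH (eqH z)))}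

theorem eq3_3 (z : Vt) : eq3 (eq3 (eq3 z)) = z := by
  ext1
  · rfl
  · simp only [eq3, Equiv.coe_fn_mk, mul_assoc]
    rw [show s2 * (s1 * (s2 * (s1 * (s2 * s1)))) = 1 by decide, mul_one]

theorem gp_OK {φ ψ : Fg} (h : D.OK φ) (hψ : ψ ∈ gp φ) : D.OK ψ := by
  obtain ⟨b, z⟩ := φ
  cases b
  · simp only [gp, Finset.mem_insert, Finset.mem_singleton] at hψ
    have h' : D.sqOK z := h
    rcases hψ with rfl | rfl | rfl | rfl
    · exact h
    · exact (D.sqOK_H _).2 h'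
    · exact (D.sqOK_H _).2 ((D.sqOK_H _).2 h')
    · exact (D.sqOK_H _).2 ((D.sqOK_H _).2 ((D.sqOK_H _).2 h'))
  · simp only [gp, Finset.mem_insert, Finset.mem_singleton] at hψ
    have h' : D.hexOK z := h
    rcases hψ with rfl | rfl | rfl
    · exact h
    · exact (D.hexOK_3 _).2 h'
    · exact (D.hexOK_3 _).2 ((D.hexOK_3 _).2 h')

theorem ne_word {σ τ τ' : Wd} (h : τ ≠ τ') : σ * τ ≠ σ * τ' := fun h' => h (mul_left_cancel h')

theorem gp_sum (φ : Fg) : ∑ ψ ∈ gp φ, wt ψ = 1 := by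
  obtain ⟨b, x, σ⟩ := φ
  cases b
  · have h2 : eqH (eqH (x, σ)) = (x, σ * (s2 * s0)) := hh2 (x, σ)
    have n1 : ∀ z : Vt, eqH z ≠ z := by
      intro z h
      have := congrArg Prod.fst h
      simp only [eqH, hh, Equiv.coe_fn_mk] at this
      exact e_2ne0 _ _ (ne01 z.2) (by simpa [add_assoc] using this)
    have n2 : ∀ z : Vt, eqH (eqH z) ≠ z := by
      intro z h
      have h2 : eqH (eqH z) = (z.1, z.2 * (s2 * s0)) := hh2 z
      rw [h2] at h
      have := congrArg Prod.snd h
      simp only at this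
      exact absurd (mul_eq_left.1 this) (by decide)
    have n3 : ∀ z : Vt, eqH (eqH (eqH z)) ≠ z := by
      intro z h
      have := hh4 z
      change eqH (eqH (eqH (eqH z))) = z at this
      rw [h] at this; exact n1 z this
    have inj : ∀ z z' : Vt, eqH z = eqH z' → z = z' := fun _ _ h => eqH.injective h
    simp only [gp]
    rw [Finset.sum_insert, Finset.sum_insert, Finset.sum_insert, Finset.sum_singleton]
    · simp [wt]; norm_num
    · simp only [Finset.mem_singleton, Prod.mk.injEq, true_and]
      exact (n1 _).symm
    · simp only [Finset.mem_insert, Finset.mem_singleton, Prod.mk.injEq, true_and, not_or]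
      exact ⟨(n1 _).symm, (n2 _).symm⟩
    · simp only [Finset.mem_insert, Finset.mem_singleton, Prod.mk.injEq, true_and, not_or]
      exact ⟨(n1 _).symm, (n2 _).symm, (n3 _).symm⟩
  · have n1 : ∀ z : Vt, eq3 z ≠ z := by
      intro z h
      have := congrArg Prod.snd h
      simp only [eq3, Equiv.coe_fn_mk] at this
      exact absurd (mul_eq_left.1 this) (by decide)
    have n2 : ∀ z : Vt, eq3 (eq3 z) ≠ z := by
      intro z h
      have := eq3_3 z
      rw [h] at this; exact n1 z this
    simp only [gp]
    rw [Finset.sum_insert, Finset.sum_insert, Finset.sum_singleton]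
    · simp [wt]; norm_num
    · simp only [Finset.mem_singleton, Prod.mk.injEq, true_and]
      exact (n1 _).symm
    · simp only [Finset.mem_insert, Finset.mem_singleton, Prod.mk.injEq, true_and, not_or]
      exact ⟨(n1 _).symm, (n2 _).symm⟩

theorem gp_cyc {φ ψ : Fg} (hψ : ψ ∈ gp φ) {s : Vt → Vt → ℝ} (hs : ∀ u v, s u v = - s v u) :
    cyc s (pol ψ) = cyc s (pol φ) := by
  obtain ⟨b, z⟩ := φ
  cases b
  · simp only [gp, Finset.mem_insert, Finset.mem_singleton] at hψ
    have hp : ∀ z : Vt, cyc s (pol (false, z)) = cyc s (sqP z.1 z.2) := fun z => rfl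
    have h4 : eqH (eqH (eqH (eqH z))) = z := hh4 z
    have k : ∀ z, cyc s (pol (false, eqH z)) = cyc s (pol (false, z)) := by
      intro z
      have h4 : eqH (eqH (eqH (eqH z))) = z := hh4 z
      rw [hp, hp, cyc_sq hs, cyc_sq hs, h4]; ring
    rcases hψ with rfl | rfl | rfl | rfl
    · rfl
    · rw [k]
    · rw [k, k]
    · rw [k, k, k]
  · simp only [gp, Finset.mem_insert, Finset.mem_singleton] at hψ
    have hp : ∀ z : Vt, cyc s (pol (true, z)) = cyc s (hexP z.1 z.2) := fun z => rfl
    have k : ∀ z, cyc s (pol (true, eq3 z)) = cyc s (pol (true, z)) := by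
      intro z
      rw [hp, hp, cyc_hex hs, cyc_hex hs, eq3_3]; ring
    rcases hψ with rfl | rfl | rfl
    · rfl
    · rw [k]
    · rw [k, k]

theorem gp_mem {φ ψ : Fg} (hψ : ψ ∈ gp φ) (v : Vt) : v ∈ pol ψ ↔ v ∈ pol φ := by
  by_cases hc : Can v
  swap
  · exact ⟨fun h => absurd (pol_can _ _ h) hc, fun h => absurd (pol_can _ _ h) hc⟩
  obtain ⟨b, z⟩ := φ
  cases b
  · simp only [gp, Finset.mem_insert, Finset.mem_singleton] at hψ
    have k : ∀ z : Vt, v ∈ pol (false, eqH z) ↔ v ∈ pol (false, z) := by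
      intro z
      rw [mem_pol _ _ hc, mem_pol _ _ hc]
      have h2 := congrArg Prod.fst (hh2 z)
      have e1 : (eqH z).1 = oth (false, z) := rfl
      have e2 : oth (false, eqH z) = z.1 := h2
      simp only at e1 ⊢
      rw [e1, e2]; tauto
    rcases hψ with rfl | rfl | rfl | rfl
    · rfl
    · rw [k]
    · rw [k, k]
    · rw [k, k, k]
  · simp only [gp, Finset.mem_insert, Finset.mem_singleton] at hψ
    have k : ∀ z : Vt, v ∈ pol (true, eq3 z) ↔ v ∈ pol (true, z) := by
      intro z
      rw [mem_pol _ _ hc, mem_pol _ _ hc]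
      have e2 : oth (true, eq3 z) = oth (true, z) := by
        simp [oth, eq3, s1_ap, s2_ap]
      rw [e2]; rfl
    rcases hψ with rfl | rfl | rfl
    · rfl
    · rw [k]
    · rw [k, k]

def Conn : Prop := ∀ S : Vt → Prop, (∃ u, D.isR u ∧ S u) → (∃ v, D.isR v ∧ ¬ S v) →
    ∃ φ, D.OK φ ∧ ∃ u ∈ pol φ, ∃ v ∈ pol φ, S u ∧ ¬ S v

noncomputable def cx (hc : D.Conn) : Cx Vt Fg where
  Fl := D.Fl
  w := wt
  poly := pol
  O := D.O
  RV := D.RV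
  hw φ _ := by unfold wt; split_ifs <;> norm_num
  hlen φ _ := by obtain ⟨b, x, σ⟩ := φ; cases b <;> simp [pol, hexP, sqP]
  hR φ h v hv := D.mem_RV.2 (D.OK_isR (D.mem_Fl.1 h) hv)
  hR' v hv := by
    obtain ⟨φ, h1, h2⟩ := D.isR_flag (D.mem_RV.1 hv)
    exact ⟨φ, D.mem_Fl.2 h1, h2⟩
  hRO o ho := by
    obtain ⟨z, hz, rfl⟩ := D.mem_O.1 ho
    have := D.isR_kap (D.isO_ne hz)
    exact ⟨D.mem_RV.2 this.1, D.mem_RV.2 this.2⟩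
  hcancel s hs := D.cancel hs
  grp := gp
  hgs φ h ψ hψ := D.mem_Fl.2 (D.gp_OK (D.mem_Fl.1 h) hψ)
  hg1 φ _ := gp_sum φ
  hgc φ _ ψ hψ s hs := gp_cyc hψ hs
  hconn S h1 h2 := by
    obtain ⟨u, hu, hu'⟩ := h1
    obtain ⟨v, hv, hv'⟩ := h2
    obtain ⟨φ, h, r⟩ := hc S ⟨u, D.mem_RV.1 hu, hu'⟩ ⟨v, D.mem_RV.1 hv, hv'⟩
    exact ⟨φ, D.mem_Fl.2 h, r⟩

end SD
end ABCT

set_option linter.all false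

namespace ABCT
namespace Prm
variable (P : Prm)

def tk : ℕ → Wd := fun k => if k = 0 then 1 else if k = 1 then s2 else s2 * s1

/-- subdivision path -/
def tv (X : L) (σ : Wd) (m : ℕ) : Vt := vx (P.ch X ((m / 3 : ℕ) : ℤ)) (rr * σ * tk (m % 3))

theorem tv0 (X : L) (σ : Wd) (i : ℕ) : P.tv X σ (3 * i) = vx (P.ch X i) (rr * σ) := by
  simp [tv, tk]
theorem tv1 (X : L) (σ : Wd) (i : ℕ) : P.tv X σ (3 * i + 1) = vx (P.ch X i) (rr * σ * s2) := by
  unfold tv; rw [show (3 * i + 1) / 3 = i by omega, show (3 * i + 1) % 3 = 1 by omega]; simp [tk]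
theorem tv2 (X : L) (σ : Wd) (i : ℕ) : P.tv X σ (3 * i + 2) = vx (P.ch X i) (rr * σ * (s2 * s1)) := by
  unfold tv; rw [show (3 * i + 2) / 3 = i by omega, show (3 * i + 2) % 3 = 2 by omega]; simp [tk]

theorem mod3 (m : ℕ) : ∃ i, m = 3 * i ∨ m = 3 * i + 1 ∨ m = 3 * i + 2 := ⟨m / 3, by omega⟩

def gn (k : Fin 4) : ℕ := (P.g k).toNat
theorem gn_cast {k : Fin 4} (h : k ≠ 0) : (P.gn k : ℤ) = P.g k := Int.toNat_of_nonneg (P.g_nonneg h)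

/-- number of pieces of the edge -/
def nE (σ : Wd) : ℕ := 3 * P.gn (σ 2) + 1

theorem nE_pos (σ : Wd) : 0 < P.nE σ := by unfold nE; omega

/-- cyclic shift of the first three letters : (a b c d) ↦ (c a b d) -/
def qq : Wd := s2 * (rr * (rr * rr))
theorem qq_ap : qq 0 = 2 ∧ qq 1 = 0 ∧ qq 2 = 1 ∧ qq 3 = 3 := by decide
theorem sg_qq : sg qq = 1 := by decide

theorem ne0 {σ : Wd} (h : σ 3 = 0) : σ 0 ≠ 0 ∧ σ 1 ≠ 0 ∧ σ 2 ≠ 0 := by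
  exact ⟨fun h' => ne03 σ (h'.trans h.symm), fun h' => ne13 σ (h'.trans h.symm), fun h' => ne23 σ (h'.trans h.symm)⟩

theorem gsum {σ : Wd} (h : σ 3 = 0) : (P.gn (σ 0) + P.gn (σ 1) + P.gn (σ 2) : ℤ) = P.C - 1 := by
  obtain ⟨h0, h1, h2⟩ := ne0 h
  rw [P.gn_cast h0, P.gn_cast h1, P.gn_cast h2, P.g3 h]

theorem rr_ap' (σ : Wd) (i : Fin 4) : (rr * σ) i = σ i + 1 := by
  rw [Equiv.Perm.mul_apply, rr_ap]

theorem ch_sub {k : Fin 4} (hk : k ≠ 0) (X : L) (i : ℤ) : P.ch (X - e k) i = P.ch X (i + P.gn k) - e (k + 1) := by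
  have := P.ch_e (X - e k) i k
  rw [sub_add_cancel] at this
  rw [P.gn_cast hk, this]; simp

theorem ch_add {k : Fin 4} (hk : k ≠ 0) (X : L) (i : ℤ) : P.ch X i + e (k + 1) = P.ch (X + e k) (i + P.gn k) := by
  rw [P.gn_cast hk, P.ch_e]

theorem vx_eqm {x x' : L} {σ τ : Wd} {k : Fin 4} (hk : σ 3 = k) (hx : x' = x - e k) (hσ : τ = σ * (rr * (rr * rr))) :
    vx x σ = vx x' τ := by
  rw [← vx_rotm, hk, hx, hσ]; simp only [mul_assoc]

theorem tv_R (X : L) {σ : Wd} (h : σ 3 = 0) (m : ℕ) :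
    P.tv X σ (m + P.nE σ) = P.tv (X - e (σ 2)) (σ * qq) m := by
  obtain ⟨h0, h1, h2⟩ := ne0 h
  obtain ⟨i, rfl | rfl | rfl⟩ := mod3 m
  · rw [show 3 * i + P.nE σ = 3 * (i + P.gn (σ 2)) + 1 by unfold nE; ring, tv1, tv0, P.ch_sub h2, Nat.cast_add]
    refine vx_eqm (k := σ 2 + 1) (rr_ap' σ 2) rfl ?_
    simp only [mul_assoc]; rw [show s2 * (rr * (rr * rr)) = qq from rfl]
  · rw [show 3 * i + 1 + P.nE σ = 3 * (i + P.gn (σ 2)) + 2 by unfold nE; ring, tv2, tv1, P.ch_sub h2, Nat.cast_add]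
    refine vx_eqm (k := σ 2 + 1) (rr_ap' σ 2) rfl ?_
    simp only [mul_assoc]; rw [show s2 * (s1 * (rr * (rr * rr))) = qq * s2 by decide]
  · rw [show 3 * i + 2 + P.nE σ = 3 * (i + P.gn (σ 2) + 1) by unfold nE; ring, tv0, tv2, P.ch_sub h2, Nat.cast_add,
      Nat.cast_add, Nat.cast_one, P.ch_one]
    refine (vx_eqm (k := 1) (τ := rr * σ * (rr * (rr * rr))) ((rr_ap' σ 3).trans (by rw [h]; rfl)) rfl rfl).trans ?_
    refine vx_eqm (k := σ 2 + 1) (rr_ap' σ 2) (by rw [add_sub_cancel_right]) ?_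
    simp only [mul_assoc]
    rw [show rr * (rr * (rr * (rr * (rr * rr)))) = qq * (s2 * s1) by decide]

theorem tv_n (X : L) {σ : Wd} (h : σ 3 = 0) : P.tv X σ (P.nE σ) = P.tv (X - e (σ 2)) (σ * qq) 0 := by
  have := P.tv_R X h 0
  rwa [zero_add] at this

theorem qq3 {σ : Wd} (h : σ 3 = 0) : (σ * qq) 3 = 0 := by rw [Equiv.Perm.mul_apply, qq_ap.2.2.2, h]

/-- every canonical vertex lies on a subdivided edge -/
theorem exists_tv {v : Vt} (hv : Can v) : ∃ X σ m, σ 3 = 0 ∧ m < P.nE σ ∧ v = P.tv X σ m := by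
  obtain ⟨X, i, h0, h1, hx⟩ := P.exists_ch v.1
  lift i to ℕ using h0
  set σ : Wd := rr⁻¹ * v.2 with hσ
  have hs : rr * σ = v.2 := by simp [hσ]
  have h3 : σ 3 = 0 := by
    have : (rr * σ) 3 = 1 := by rw [hs]; exact hv
    rw [rr_ap'] at this
    revert this; generalize σ 3 = k; revert k; decide
  have hv' : v = P.tv X σ (3 * i) := by
    rw [tv0, hs, ← hx]; exact (vx_of_can hv).symm
  have hsum := P.gsum h3
  by_cases c1 : 3 * i < P.nE σ
  · exact ⟨X, σ, 3 * i, h3, c1, hv'⟩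
  · have e1 : P.tv X σ (3 * i) = P.tv (X - e (σ 2)) (σ * qq) (3 * i - P.nE σ) := by
      rw [← P.tv_R X h3]; congr 1; omega
    by_cases c2 : 3 * i - P.nE σ < P.nE (σ * qq)
    · exact ⟨_, _, _, qq3 h3, c2, hv'.trans e1⟩
    · have e2 : P.tv (X - e (σ 2)) (σ * qq) (3 * i - P.nE σ) =
          P.tv (X - e (σ 2) - e ((σ * qq) 2)) (σ * qq * qq) (3 * i - P.nE σ - P.nE (σ * qq)) := by
        rw [← P.tv_R _ (qq3 h3)]; congr 1; omega
      refine ⟨_, _, _, qq3 (qq3 h3), ?_, hv'.trans (e1.trans e2)⟩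
      have a1 : (σ * qq) 2 = σ 1 := by rw [Equiv.Perm.mul_apply, qq_ap.2.2.1]
      have a2 : (σ * qq * qq) 2 = σ 0 := by rw [Equiv.Perm.mul_apply, qq_ap.2.2.1, Equiv.Perm.mul_apply, qq_ap.2.1]
      unfold nE at *
      rw [a1] at *; rw [a2]
      omega

def loc (v : Vt) : Vt × ℕ :=
  let X := P.dl v.1
  let i := (P.dig v.1).toNat
  let σ := rr⁻¹ * v.2
  if i ≤ P.gn (σ 2) then ((X, σ), 3 * i) else
  if i ≤ P.gn (σ 2) + P.gn (σ 1) then ((X - e (σ 2), σ * qq), 3 * (i - P.gn (σ 2)) - 1) else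
  ((X - e (σ 2) - e (σ 1), σ * qq * qq), 3 * (i - P.gn (σ 2) - P.gn (σ 1)) - 2)

theorem tv_can (X : L) (σ : Wd) (m : ℕ) : Can (P.tv X σ m) := vx_can _ _

theorem i_le {σ : Wd} {i k : ℕ} (hm : 3 * i + k < P.nE σ) : i ≤ P.gn (σ 2) := by unfold nE at hm; omega

/-- explicit canonical forms -/
theorem tv1' (X : L) {σ : Wd} (h : σ 3 = 0) (i : ℕ) : P.tv X σ (3 * i + 1) =
    (P.ch (X + e (σ 0) + e (σ 1)) ((i + 1 + P.gn (σ 0) + P.gn (σ 1) : ℕ)), rr * (σ * qq)) := by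
  obtain ⟨h0, h1, h2⟩ := ne0 h
  have a0 : (rr * σ * s2) 0 = σ 0 + 1 := rr_ap' σ 0
  have a1 : (rr * σ * s2) 1 = σ 1 + 1 := rr_ap' σ 1
  have a2 : (rr * σ * s2) 2 = 1 := (rr_ap' σ 3).trans (by rw [h]; rfl)
  rw [tv1, ← vx_rot3, vx_of3 _ (show (rr * σ * s2 * rr * rr * rr) 3 = 1 from a2), a0, a1, a2]
  have : ((i + 1 + P.gn (σ 0) + P.gn (σ 1) : ℕ) : ℤ) = (i + P.gn (σ 0) + P.gn (σ 1)) + 1 := by push_cast; ring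
  rw [this, ch_one, ← P.ch_add h1, ← P.ch_add h0]
  simp only [mul_assoc]; rw [show s2 * (rr * (rr * rr)) = qq from rfl]

theorem tv2' (X : L) {σ : Wd} (h : σ 3 = 0) (i : ℕ) : P.tv X σ (3 * i + 2) =
    (P.ch (X + e (σ 0)) ((i + 1 + P.gn (σ 0) : ℕ)), rr * (σ * (qq * qq))) := by
  obtain ⟨h0, h1, h2⟩ := ne0 h
  have a0 : (rr * σ * (s2 * s1)) 0 = σ 0 + 1 := rr_ap' σ 0
  have a1 : (rr * σ * (s2 * s1)) 1 = 1 := (rr_ap' σ 3).trans (by rw [h]; rfl)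
  rw [tv2, ← vx_rot2, vx_of3 _ (show (rr * σ * (s2 * s1) * rr * rr) 3 = 1 from a1), a0, a1]
  have : ((i + 1 + P.gn (σ 0) : ℕ) : ℤ) = (i + P.gn (σ 0)) + 1 := by push_cast; ring
  rw [this, ch_one, ← P.ch_add h0]
  simp only [mul_assoc]; rw [show s2 * (s1 * (rr * rr)) = qq * qq by decide]

theorem tv0' (X : L) {σ : Wd} (h : σ 3 = 0) (i : ℕ) : P.tv X σ (3 * i) = (P.ch X i, rr * σ) := by
  rw [tv0, vx_of3]; rw [rr_ap', h]; rfl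

theorem loc_tv (X : L) {σ : Wd} (h : σ 3 = 0) {m : ℕ} (hm : m < P.nE σ) : P.loc (P.tv X σ m) = ((X, σ), m) := by
  have hsum := P.gsum h
  obtain ⟨i, rfl | rfl | rfl⟩ := mod3 m
  · have hi : i ≤ P.gn (σ 2) := by unfold nE at hm; omega
    rw [P.tv0' X h]
    unfold loc
    simp only [P.dl_ch X (i := (i:ℤ)) (by omega) (by omega), P.dig_ch X (i := (i:ℤ)) (by omega) (by omega),
      Int.toNat_natCast, inv_mul_cancel_left]
    rw [if_pos hi]
  · have hi : i + 1 ≤ P.gn (σ 2) := by unfold nE at hm; omega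
    rw [P.tv1' X h]
    have q1 : (σ * qq) 1 = σ 0 := by rw [Equiv.Perm.mul_apply, qq_ap.2.1]
    have q2 : (σ * qq) 2 = σ 1 := by rw [Equiv.Perm.mul_apply, qq_ap.2.2.1]
    unfold loc
    simp only
    rw [P.dl_ch _ (by omega) (by push_cast; omega), P.dig_ch _ (by omega) (by push_cast; omega),
      Int.toNat_natCast, inv_mul_cancel_left, q1, q2, if_neg (by omega), if_neg (by omega)]
    refine Prod.ext (Prod.ext ?_ ?_) ?_
    · simp
    · simp only [mul_assoc]; rw [show qq * (qq * qq) = 1 by decide, mul_one]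
    · simp only; omega
  · have hi : i + 1 ≤ P.gn (σ 2) := by unfold nE at hm; omega
    rw [P.tv2' X h]
    have q1 : (σ * (qq * qq)) 1 = σ 2 := by rw [Equiv.Perm.mul_apply, show (qq * qq) 1 = 2 by decide]
    have q2 : (σ * (qq * qq)) 2 = σ 0 := by rw [Equiv.Perm.mul_apply, show (qq * qq) 2 = 0 by decide]
    unfold loc
    simp only
    rw [P.dl_ch _ (by omega) (by push_cast; omega), P.dig_ch _ (by omega) (by push_cast; omega),
      Int.toNat_natCast, inv_mul_cancel_left, q1, q2, if_neg (by omega), if_pos (by omega)]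
    refine Prod.ext (Prod.ext ?_ ?_) ?_
    · simp
    · simp only [mul_assoc]; rw [show qq * (qq * qq) = 1 by decide, mul_one]
    · simp only; omega

end Prm
end ABCT

set_option linter.all false

namespace ABCT

theorem mem_Tl_iff (x : L) (σ : Wd) (y : L) : y ∈ Tl (vx x σ) ↔ y = x ∨ y = x + e (σ 0) ∨ y = x + e (σ 0) + e (σ 1) ∨
  y = x + e (σ 0) + e (σ 1) + e (σ 2) := by rw [Tl_vx]; rfl

namespace Prm
variable (P : Prm)

theorem vx_qq (X : L) (σ : Wd) : vx (X - e (σ 2)) (σ * qq) = vx X (σ * s2) := by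
  refine (vx_eqm (k := σ 2) rfl rfl ?_).symm
  simp only [mul_assoc]; rw [show s2 * (rr * (rr * rr)) = qq from rfl]


/-- tiles around tv, as children -/
theorem Tl_tv0 (X : L) {σ : Wd} (h : σ 3 = 0) (i : ℕ) (y : L) : y ∈ Tl (P.tv X σ (3 * i)) ↔
    y = P.ch X i ∨ y = P.ch (X + e (σ 0)) (i + P.gn (σ 0)) ∨
    y = P.ch (X + e (σ 0) + e (σ 1)) (i + P.gn (σ 0) + P.gn (σ 1)) ∨
    y = P.ch (X + e (σ 0) + e (σ 1) + e (σ 2)) (i + P.gn (σ 0) + P.gn (σ 1) + P.gn (σ 2)) := by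
  obtain ⟨h0, h1, h2⟩ := ne0 h
  rw [tv0, mem_Tl_iff, rr_ap', rr_ap', rr_ap', P.ch_add h0, P.ch_add h1, P.ch_add h2]

theorem Tl_tv1 (X : L) {σ : Wd} (h : σ 3 = 0) (i : ℕ) (y : L) : y ∈ Tl (P.tv X σ (3 * i + 1)) ↔
    y = P.ch X i ∨ y = P.ch (X + e (σ 0)) (i + P.gn (σ 0)) ∨
    y = P.ch (X + e (σ 0) + e (σ 1)) (i + P.gn (σ 0) + P.gn (σ 1)) ∨
    y = P.ch (X + e (σ 0) + e (σ 1)) (i + P.gn (σ 0) + P.gn (σ 1) + 1) := by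
  obtain ⟨h0, h1, h2⟩ := ne0 h
  have a0 : (rr * σ * s2) 0 = σ 0 + 1 := rr_ap' σ 0
  have a1 : (rr * σ * s2) 1 = σ 1 + 1 := rr_ap' σ 1
  have a2 : (rr * σ * s2) 2 = 1 := (rr_ap' σ 3).trans (by rw [h]; rfl)
  rw [tv1, mem_Tl_iff, a0, a1, a2, P.ch_add h0, P.ch_add h1, P.ch_one]

theorem Tl_tv2 (X : L) {σ : Wd} (h : σ 3 = 0) (i : ℕ) (y : L) : y ∈ Tl (P.tv X σ (3 * i + 2)) ↔
    y = P.ch X i ∨ y = P.ch (X + e (σ 0)) (i + P.gn (σ 0)) ∨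
    y = P.ch (X + e (σ 0)) (i + P.gn (σ 0) + 1) ∨
    y = P.ch (X + e (σ 0) + e (σ 1)) (i + P.gn (σ 0) + 1 + P.gn (σ 1)) := by
  obtain ⟨h0, h1, h2⟩ := ne0 h
  have a0 : (rr * σ * (s2 * s1)) 0 = σ 0 + 1 := rr_ap' σ 0
  have a1 : (rr * σ * (s2 * s1)) 1 = 1 := (rr_ap' σ 3).trans (by rw [h]; rfl)
  have a2 : (rr * σ * (s2 * s1)) 2 = σ 1 + 1 := rr_ap' σ 1
  rw [tv2, mem_Tl_iff, a0, a1, a2, P.ch_add h0, ← P.ch_one, P.ch_add h1]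

theorem dl_tv0 (X : L) {σ : Wd} (h : σ 3 = 0) : P.dl '' Tl (P.tv X σ 0) = Tl (vx X σ) := by
  have hs := P.gsum h
  have key := P.Tl_tv0 X h 0
  simp only [Nat.cast_zero, zero_add, mul_zero] at key
  have d0 := P.dl_ch X (i := 0) le_rfl P.C_pos
  have d1 := P.dl_ch (X + e (σ 0)) (i := P.gn (σ 0)) (by omega) (by omega)
  have d2 := P.dl_ch (X + e (σ 0) + e (σ 1)) (i := P.gn (σ 0) + P.gn (σ 1)) (by omega) (by omega)
  have d3 := P.dl_ch (X + e (σ 0) + e (σ 1) + e (σ 2)) (i := P.gn (σ 0) + P.gn (σ 1) + P.gn (σ 2)) (by omega) (by omega)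
  ext Y
  rw [mem_Tl_iff, Set.mem_image]
  constructor
  · rintro ⟨y, hy, rfl⟩
    rcases (key y).1 hy with rfl | rfl | rfl | rfl
    · left; exact d0
    · right; left; exact d1
    · right; right; left; exact d2
    · right; right; right; exact d3
  · rintro (rfl | rfl | rfl | rfl)
    · exact ⟨_, (key _).2 (Or.inl rfl), d0⟩
    · exact ⟨_, (key _).2 (Or.inr (Or.inl rfl)), d1⟩
    · exact ⟨_, (key _).2 (Or.inr (Or.inr (Or.inl rfl))), d2⟩
    · exact ⟨_, (key _).2 (Or.inr (Or.inr (Or.inr rfl))), d3⟩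

theorem dl_tv (X : L) {σ : Wd} (h : σ 3 = 0) {m : ℕ} (h0 : 0 < m) (hm : m < P.nE σ) :
    P.dl '' Tl (P.tv X σ m) = {X, X + e (σ 0), X + e (σ 0) + e (σ 1)} := by
  have hs := P.gsum h
  unfold nE at hm
  ext Y
  rw [Set.mem_image]
  simp only [Set.mem_insert_iff, Set.mem_singleton_iff]
  obtain ⟨i, rfl | rfl | rfl⟩ := mod3 m
  · have key := P.Tl_tv0 X h i
    have d0 := P.dl_ch X (i := i) (by omega) (by omega)
    have d1 := P.dl_ch (X + e (σ 0)) (i := i + P.gn (σ 0)) (by omega) (by omega)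
    have d2 := P.dl_ch (X + e (σ 0) + e (σ 1)) (i := i + P.gn (σ 0) + P.gn (σ 1)) (by omega) (by omega)
    have d3 : P.dl (P.ch (X + e (σ 0) + e (σ 1) + e (σ 2)) (i + P.gn (σ 0) + P.gn (σ 1) + P.gn (σ 2))) = X := by
      rw [show (i + P.gn (σ 0) + P.gn (σ 1) + P.gn (σ 2) : ℤ) = (i - 1) + P.C by omega, P.ch_C]
      have hz : X + e (σ 0) + e (σ 1) + e (σ 2) + e 0 = X := by
        have := e_perm σ; rw [h] at this
        rw [add_assoc X, add_assoc X, add_assoc X, this, add_zero]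
      rw [hz]; exact P.dl_ch X (by omega) (by omega)
    constructor
    · rintro ⟨y, hy, rfl⟩
      rcases (key y).1 hy with rfl | rfl | rfl | rfl
      · left; exact d0
      · right; left; exact d1
      · right; right; exact d2
      · left; exact d3
    · rintro (rfl | rfl | rfl)
      · exact ⟨_, (key _).2 (Or.inl rfl), d0⟩
      · exact ⟨_, (key _).2 (Or.inr (Or.inl rfl)), d1⟩
      · exact ⟨_, (key _).2 (Or.inr (Or.inr (Or.inl rfl))), d2⟩
  · have key := P.Tl_tv1 X h i
    have d0 := P.dl_ch X (i := i) (by omega) (by omega)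
    have d1 := P.dl_ch (X + e (σ 0)) (i := i + P.gn (σ 0)) (by omega) (by omega)
    have d2 := P.dl_ch (X + e (σ 0) + e (σ 1)) (i := i + P.gn (σ 0) + P.gn (σ 1)) (by omega) (by omega)
    have d3 := P.dl_ch (X + e (σ 0) + e (σ 1)) (i := i + P.gn (σ 0) + P.gn (σ 1) + 1) (by omega) (by omega)
    constructor
    · rintro ⟨y, hy, rfl⟩
      rcases (key y).1 hy with rfl | rfl | rfl | rfl
      · left; exact d0
      · right; left; exact d1
      · right; right; exact d2
      · right; right; exact d3
    · rintro (rfl | rfl | rfl)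
      · exact ⟨_, (key _).2 (Or.inl rfl), d0⟩
      · exact ⟨_, (key _).2 (Or.inr (Or.inl rfl)), d1⟩
      · exact ⟨_, (key _).2 (Or.inr (Or.inr (Or.inl rfl))), d2⟩
  · have key := P.Tl_tv2 X h i
    have d0 := P.dl_ch X (i := i) (by omega) (by omega)
    have d1 := P.dl_ch (X + e (σ 0)) (i := i + P.gn (σ 0)) (by omega) (by omega)
    have d2 := P.dl_ch (X + e (σ 0)) (i := i + P.gn (σ 0) + 1) (by omega) (by omega)
    have d3 := P.dl_ch (X + e (σ 0) + e (σ 1)) (i := i + P.gn (σ 0) + 1 + P.gn (σ 1)) (by omega) (by omega)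
    constructor
    · rintro ⟨y, hy, rfl⟩
      rcases (key y).1 hy with rfl | rfl | rfl | rfl
      · left; exact d0
      · right; left; exact d1
      · right; left; exact d2
      · right; right; exact d3
    · rintro (rfl | rfl | rfl)
      · exact ⟨_, (key _).2 (Or.inl rfl), d0⟩
      · exact ⟨_, (key _).2 (Or.inr (Or.inl rfl)), d1⟩
      · exact ⟨_, (key _).2 (Or.inr (Or.inr (Or.inr rfl))), d3⟩

/-! interpolation -/
def eaf (v : Vt) : Vt := vx (P.loc v).1.1 (P.loc v).1.2
def ebf (v : Vt) : Vt := if (P.loc v).2 = 0 then P.eaf v else vx (P.loc v).1.1 ((P.loc v).1.2 * s2)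
open Classical in
noncomputable def ttf (v : Vt) : ℝ := if Can v then ((P.loc v).2 : ℝ) / P.nE (P.loc v).1.2 else 0

theorem ea_tv (X : L) {σ : Wd} (h : σ 3 = 0) {m : ℕ} (hm : m < P.nE σ) : P.eaf (P.tv X σ m) = vx X σ := by
  unfold eaf; rw [P.loc_tv X h hm]
theorem eb_tv (X : L) {σ : Wd} (h : σ 3 = 0) {m : ℕ} (h0 : 0 < m) (hm : m < P.nE σ) :
    P.ebf (P.tv X σ m) = vx X (σ * s2) := by
  unfold ebf; rw [P.loc_tv X h hm, if_neg (by simp; omega)]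
theorem eb_tv0 (X : L) {σ : Wd} (h : σ 3 = 0) : P.ebf (P.tv X σ 0) = vx X σ := by
  unfold ebf; rw [P.ea_tv X h (P.nE_pos _), P.loc_tv X h (P.nE_pos _)]; simp
theorem tt_tv (X : L) {σ : Wd} (h : σ 3 = 0) {m : ℕ} (hm : m < P.nE σ) :
    P.ttf (P.tv X σ m) = (m : ℝ) / P.nE σ := by
  unfold ttf; rw [if_pos (P.tv_can _ _ _), P.loc_tv X h hm]

theorem nE_le {σ : Wd} (h : σ 3 = 0) : (P.nE σ : ℝ) ≤ 3 * P.C := by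
  have hs := P.gsum h
  have : (P.nE σ : ℤ) ≤ 3 * P.C := by unfold nE; push_cast; omega
  exact_mod_cast this

theorem tt_cases (v : Vt) : P.ttf v = 0 ∨ ∃ m n : ℕ, 0 < m ∧ m < n ∧ (n : ℝ) ≤ 3 * P.C ∧ P.ttf v = (m : ℝ) / n := by
  by_cases hv : Can v
  · obtain ⟨X, σ, m, h, hm, rfl⟩ := P.exists_tv hv
    rcases Nat.eq_zero_or_pos m with rfl | h0
    · left; rw [P.tt_tv X h hm]; simp
    · right; exact ⟨m, _, h0, hm, P.nE_le h, P.tt_tv X h hm⟩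
  · left; unfold ttf; rw [if_neg hv]

theorem C_posR : (1:ℝ) ≤ P.C := by have := P.C_pos; exact_mod_cast this

noncomputable def I : Ip Vt where
  ea := P.eaf
  eb := P.ebf
  tt := P.ttf
  κ := 1 / (3 * P.C)
  hκ := by have := P.C_posR; positivity
  hκ1 := by have := P.C_posR; rw [div_le_one (by linarith)]; linarith
  ht0 v := by
    rcases P.tt_cases v with h | ⟨m, n, h0, h1, h2, h⟩ <;> rw [h]; positivity
  ht1 v := by
    rcases P.tt_cases v with h | ⟨m, n, h0, h1, h2, h⟩ <;> rw [h]
    · exact zero_le_one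
    · apply div_le_one_of_le₀ (by exact_mod_cast h1.le) (by positivity)
  hta v _ := by
    have hC := P.C_posR
    rcases P.tt_cases v with h | ⟨m, n, h0, h1, h2, h⟩ <;> rw [h]
    · rw [sub_zero, div_le_one (by linarith)]; linarith
    · have hn : (0:ℝ) < n := by exact_mod_cast (lt_trans h0 h1)
      have : (m:ℝ) + 1 ≤ n := by exact_mod_cast h1
      calc 1 / (3 * (P.C:ℝ)) ≤ 1 / n := one_div_le_one_div_of_le hn h2
        _ ≤ _ := by rw [one_sub_div hn.ne']; gcongr; linarith
  htb v hv := by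
    have hC := P.C_posR
    rcases P.tt_cases v with h | ⟨m, n, h0, h1, h2, h⟩
    · exact absurd h hv
    · rw [h]
      have hn : (0:ℝ) < n := by exact_mod_cast (lt_trans h0 h1)
      have : (1:ℝ) ≤ m := by exact_mod_cast h0
      calc 1 / (3 * (P.C:ℝ)) ≤ 1 / n := one_div_le_one_div_of_le hn h2
        _ ≤ _ := by gcongr

theorem ip_tv (pos : Vt → Pt) (X : L) {σ : Wd} (h : σ 3 = 0) {m : ℕ} (hm : m ≤ P.nE σ) :
    P.I.ip pos (P.tv X σ m) = (1 - (m:ℝ) / P.nE σ) • pos (vx X σ) + ((m:ℝ) / P.nE σ) • pos (vx X (σ * s2)) := by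
  have hn : (P.nE σ : ℝ) ≠ 0 := by have := P.nE_pos σ; positivity
  unfold Ip.ip
  show (1 - P.ttf _) • pos (P.eaf _) + P.ttf _ • pos (P.ebf _) = _
  rcases hm.lt_or_eq with hm | rfl
  · rw [P.tt_tv X h hm, P.ea_tv X h hm]
    rcases Nat.eq_zero_or_pos m with rfl | h0
    · simp
    · rw [P.eb_tv X h h0 hm]
  · rw [P.tv_n X h, P.tt_tv _ (qq3 h) (P.nE_pos _), P.ea_tv _ (qq3 h) (P.nE_pos _), vx_qq, div_self hn]
    simp

/-- tiles of ancestor vertices -/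
theorem dl_ea {v : Vt} (hv : Can v) {x : L} (hx : x ∈ Tl v) : P.dl x ∈ Tl (P.eaf v) ∧ P.dl x ∈ Tl (P.ebf v) := by
  obtain ⟨X, σ, m, h, hm, rfl⟩ := P.exists_tv hv
  have hx' : P.dl x ∈ P.dl '' Tl (P.tv X σ m) := ⟨x, hx, rfl⟩
  rw [P.ea_tv X h hm]
  rcases Nat.eq_zero_or_pos m with rfl | h0
  · rw [P.dl_tv0 X h] at hx'
    rw [P.eb_tv0 X h]; exact ⟨hx', hx'⟩
  · rw [P.dl_tv X h h0 hm] at hx'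
    rw [P.eb_tv X h h0 hm, mem_Tl_iff, mem_Tl_iff]
    have b0 : (σ * s2) 0 = σ 0 := rfl
    have b1 : (σ * s2) 1 = σ 1 := rfl
    rw [b0, b1]
    simp only [Set.mem_insert_iff, Set.mem_singleton_iff] at hx'
    tauto

theorem ea_can (v : Vt) : Can (P.eaf v) := vx_can _ _
theorem eb_can (v : Vt) : Can (P.ebf v) := by
  unfold ebf; split_ifs
  · exact vx_can _ _
  · exact vx_can _ _

def par (ψ φ : Fg) : Prop := (P.dl ψ.2.1 = φ.2.1 ∧ P.dl (oth ψ) = oth φ) ∨ (P.dl ψ.2.1 = oth φ ∧ P.dl (oth ψ) = φ.2.1)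

theorem par_end {ψ φ : Fg} (h : P.par ψ φ) {v : Vt} (hv : v ∈ pol ψ) : P.eaf v ∈ pol φ ∧ P.ebf v ∈ pol φ := by
  have hc := pol_can _ _ hv
  rw [mem_pol _ _ hc] at hv
  rw [mem_pol _ _ (P.ea_can v), mem_pol _ _ (P.eb_can v)]
  have h1 := P.dl_ea hc hv.1
  have h2 := P.dl_ea hc hv.2
  rcases h with ⟨a, b⟩ | ⟨a, b⟩ <;> rw [a] at h1 <;> rw [b] at h2 <;> tauto

end Prm

namespace SD
variable (P : Prm) (D : SD)

def nx : SD where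
  sd x := - D.sd (P.dl x)
  h1 x := by have := D.h1 (P.dl x); omega
  hf := by
    have h1 : ((fun z : L × ℤ => P.ch z.1 z.2) '' ({x | D.sd x ≠ 0} ×ˢ Set.Ico 0 P.C)).Finite :=
      (D.hf.prod (Set.finite_Ico _ _)).image _
    refine h1.subset ?_
    intro x hx
    exact ⟨(P.dl x, P.dig x), ⟨by simpa using hx, P.dig_nonneg x, P.dig_lt x⟩, P.ch_dl x⟩

theorem nx_sd (x : L) : (D.nx P).sd x = - D.sd (P.dl x) := rfl

theorem nx_hpar {ψ : Fg} (h : (D.nx P).OK ψ) : ∃ φ, D.OK φ ∧ P.par ψ φ := by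
  have hne := (D.nx P).sd_ne h
  have ho := (D.nx P).OK_oth h
  rw [nx_sd] at hne ho
  rw [nx_sd] at ho
  obtain ⟨v, hv⟩ : ∃ v, v ∈ pol ψ := by
    obtain ⟨b, x, σ⟩ := ψ
    cases b
    · exact ⟨vx x σ, by simp [pol, sqP]⟩
    · exact ⟨vx x σ, by simp [pol, hexP]⟩
  have hc := pol_can _ _ hv
  rw [mem_pol _ _ hc] at hv
  obtain ⟨φ, h1, h2, h3⟩ := D.flag (P.ea_can v) (P.dl_ea hc hv.1).1 (P.dl_ea hc hv.2).1 (by omega) (by omega)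
  refine ⟨φ, h1, ?_⟩
  unfold Prm.par
  rcases h3 with ⟨a, b⟩ | ⟨a, b⟩ <;> rw [a, b] <;> simp

theorem nx_R {v : Vt} (h : (D.nx P).isR v) : D.isR (P.eaf v) ∧ D.isR (P.ebf v) := by
  obtain ⟨hc, ⟨x, hx, h1⟩, ⟨y, hy, h2⟩⟩ := h
  rw [nx_sd] at h1 h2
  exact ⟨⟨P.ea_can v, ⟨_, (P.dl_ea hc hy).1, by omega⟩, ⟨_, (P.dl_ea hc hx).1, by omega⟩⟩,
    ⟨P.eb_can v, ⟨_, (P.dl_ea hc hy).2, by omega⟩, ⟨_, (P.dl_ea hc hx).2, by omega⟩⟩⟩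

/-- every canonical vertex is vx X σ with last letter 0 -/
theorem can_zero {v : Vt} (hv : Can v) : ∃ X σ, σ 3 = 0 ∧ v = vx X σ := by
  have hv' := vx_of_can hv
  rcases perm_zero v.2 with h | h | h | h
  · exact ⟨_, _, h, by rw [vx_rot, hv']⟩
  · exact ⟨_, _, h, by rw [vx_rot2, hv']⟩
  · exact ⟨_, _, h, by rw [vx_rot3, hv']⟩
  · exact ⟨_, _, h, hv'.symm⟩

theorem nx_old {v : Vt} (h : D.isR v) : ∃ v', (D.nx P).isR v' ∧ P.eaf v' = v ∧ P.ttf v' = 0 ∧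
    ∃ X σ, σ 3 = 0 ∧ v = vx X σ ∧ v' = P.tv X σ 0 := by
  obtain ⟨X, σ, h3, rfl⟩ := can_zero h.1
  refine ⟨P.tv X σ 0, ?_, P.ea_tv X h3 (P.nE_pos _), by rw [P.tt_tv X h3 (P.nE_pos _)]; simp, X, σ, h3, rfl, rfl⟩
  obtain ⟨hc, ⟨x, hx, h1⟩, ⟨y, hy, h2⟩⟩ := h
  rw [← P.dl_tv0 X h3] at hx hy
  obtain ⟨x', hx', rfl⟩ := hx
  obtain ⟨y', hy', rfl⟩ := hy
  exact ⟨P.tv_can _ _ _, ⟨y', hy', by rw [nx_sd]; omega⟩, ⟨x', hx', by rw [nx_sd]; omega⟩⟩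

end SD
end ABCT

set_option linter.all false

namespace ABCT
open Filter Topology

/-! bending profile -/
def D2 (s : ℕ → ℝ) (j : ℕ) : ℝ := ∑ i ∈ Finset.range j, ∑ k ∈ Finset.range (i + 1), s k
noncomputable def dlt (s : ℕ → ℝ) (n j : ℕ) : ℝ := ((j : ℝ) / n) * D2 s n - D2 s j

theorem dlt_zero (s : ℕ → ℝ) (n : ℕ) : dlt s n 0 = 0 := by simp [dlt, D2]
theorem dlt_n (s : ℕ → ℝ) {n : ℕ} (h : 0 < n) : dlt s n n = 0 := by
  have : (n:ℝ) ≠ 0 := by positivity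
  simp [dlt, this]

theorem D2_snd (s : ℕ → ℝ) (j : ℕ) : D2 s (j + 2) - 2 * D2 s (j + 1) + D2 s j = s (j + 1) := by
  unfold D2
  rw [Finset.sum_range_succ _ (j + 1), Finset.sum_range_succ _ j, Finset.sum_range_succ _ (j + 1)]
  ring

theorem D2_const (s : ℕ → ℝ) (c : ℝ) (h : ∀ j, s j = c) (j : ℕ) : D2 s j = c * (j * (j + 1) / 2) := by
  induction j with
  | zero => simp [D2]
  | succ j ih =>
    have : D2 s (j + 1) = D2 s j + c * (j + 1) := by
      unfold D2; rw [Finset.sum_range_succ]; congr 1; simp [h]; ring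
    rw [this, ih]; push_cast; ring

/-- points on a bent edge -/
theorem det_bent (V W : Pt) (x y z η a b c : ℝ) :
    det ((1 - x) • V + x • W + (η * a) • (((W - V).2, -(W - V).1) : Pt))
      ((1 - y) • V + y • W + (η * b) • (((W - V).2, -(W - V).1) : Pt))
      ((1 - z) • V + z • W + (η * c) • (((W - V).2, -(W - V).1) : Pt)) =
    η * ((W - V).1 ^ 2 + (W - V).2 ^ 2) * ((z - x) * (b - a) - (y - x) * (c - a)) := by
  unfold det
  simp only [Prod.fst_add, Prod.snd_add, Prod.smul_fst, Prod.smul_snd, Prod.fst_sub, Prod.snd_sub, smul_eq_mul]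
  ring

theorem bent_mid (s : ℕ → ℝ) {n j : ℕ} (hn : 0 < n) :
    ((((j + 2 : ℕ) : ℝ) / n - (j:ℝ) / n) * (dlt s n (j + 1) - dlt s n j) -
      (((j + 1 : ℕ) : ℝ) / n - (j:ℝ) / n) * (dlt s n (j + 2) - dlt s n j)) = s (j + 1) / n := by
  have : (n:ℝ) ≠ 0 := by positivity
  rw [← D2_snd s j]
  unfold dlt
  push_cast
  field_simp
  ring

theorem bent_const (s : ℕ → ℝ) (ε : ℝ) (h : ∀ j, s j = ε) {n j k : ℕ} (hn : 0 < n) :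
    (((k : ℝ) / n - (j:ℝ) / n) * (dlt s n (j + 1) - dlt s n j) -
      (((j + 1 : ℕ) : ℝ) / n - (j:ℝ) / n) * (dlt s n k - dlt s n j)) = ε * (((k:ℝ) - j) * (k - j - 1) / (2 * n)) := by
  have : (n:ℝ) ≠ 0 := by positivity
  unfold dlt
  rw [D2_const s ε h, D2_const s ε h, D2_const s ε h, D2_const s ε h]
  push_cast
  field_simp
  ring

theorem kk_pos {j k : ℕ} (h1 : k ≠ j) (h2 : k ≠ j + 1) : (0:ℝ) < ((k:ℝ) - j) * (k - j - 1) := by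
  rcases lt_or_gt_of_ne h1 with h | h
  · have : (k:ℝ) + 1 ≤ j := by exact_mod_cast h
    nlinarith
  · have : j + 2 ≤ k := by omega
    have : (j:ℝ) + 2 ≤ k := by exact_mod_cast this
    nlinarith

variable (P : Prm) (D : SD) (pos : Vt → Pt)

namespace SD

def sj (z : Vt) (j : ℕ) : ℤ := sg z.2 *
  (if D.kap z ≠ 0 then D.kap z else
   if j % 3 = 1 then kp (D.sd z.1) (D.sd (z.1 + e (z.2 0))) else
   if j % 3 = 0 then kp (D.sd (z.1 + e (z.2 0))) (D.sd (z.1 + e (z.2 0) + e (z.2 1))) else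
   kp (D.sd (z.1 + e (z.2 0) + e (z.2 1))) (D.sd z.1))

def sjr (z : Vt) (j : ℕ) : ℝ := D.sj z j

def nrm (z : Vt) : Pt := ((pos (vx z.1 (z.2 * s2)) - pos (vx z.1 z.2)).2, -(pos (vx z.1 (z.2 * s2)) - pos (vx z.1 z.2)).1)

noncomputable def ps (η : ℝ) (v : Vt) : Pt := P.I.ip pos v + (η * dlt (D.sjr (P.loc v).1) (P.nE (P.loc v).1.2) (P.loc v).2) • nrm pos (P.loc v).1

theorem ps_zero (v : Vt) : D.ps P pos 0 v = P.I.ip pos v := by simp [ps]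

theorem ps_tv (η : ℝ) (X : L) {σ : Wd} (h : σ 3 = 0) {m : ℕ} (hm : m ≤ P.nE σ) : D.ps P pos η (P.tv X σ m) =
    (1 - (m:ℝ) / P.nE σ) • pos (vx X σ) + ((m:ℝ) / P.nE σ) • pos (vx X (σ * s2)) +
      (η * dlt (D.sjr (X, σ)) (P.nE σ) m) • nrm pos (X, σ) := by
  unfold ps
  rw [P.ip_tv pos X h hm]
  congr 1
  rcases hm.lt_or_eq with hm | rfl
  · rw [P.loc_tv X h hm]
  · rw [P.tv_n X h, P.loc_tv _ (Prm.qq3 h) (P.nE_pos _), dlt_n _ (P.nE_pos _)]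
    simp [dlt_zero]

theorem ps_old (η : ℝ) {v : Vt} (hv : Can v) (h0 : P.ttf v = 0) : D.ps P pos η v = pos (P.eaf v) := by
  obtain ⟨X, σ, m, h, hm, rfl⟩ := P.exists_tv hv
  have : m = 0 := by
    rw [P.tt_tv X h hm] at h0
    have hn : (P.nE σ : ℝ) ≠ 0 := by have := P.nE_pos σ; positivity
    field_simp at h0; exact_mod_cast h0
  subst this
  rw [D.ps_tv P pos η X h hm.le, P.ea_tv X h hm, dlt_zero]; simp

theorem ps_cont (v : Vt) : Continuous fun η => D.ps P pos η v := by unfold ps; fun_prop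

/-- eventually positive -/
def Ev (a b c : Vt) : Prop := ∀ᶠ η in 𝓝[>] (0:ℝ), 0 < det (D.ps P pos η a) (D.ps P pos η b) (D.ps P pos η c)

variable {P D pos}

theorem Ev.rot {a b c : Vt} (h : D.Ev P pos a b c) : D.Ev P pos b c a := by
  unfold Ev at *
  filter_upwards [h] with η hη
  rwa [det_rot]

theorem Ev.of_zero {a b c : Vt} (h : 0 < det (P.I.ip pos a) (P.I.ip pos b) (P.I.ip pos c)) : D.Ev P pos a b c := by
  unfold Ev
  have := (continuous_det' (D.ps_cont P pos a) (D.ps_cont P pos b) (D.ps_cont P pos c)).continuousAt (x := 0)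
  rw [ContinuousAt] at this
  simp only [ps_zero] at this
  exact (this.eventually (lt_mem_nhds h)).filter_mono nhdsWithin_le_nhds

def EvCV (P : Prm) (D : SD) (pos : Vt → Pt) (l : List Vt) : Prop := ∀ a b c, [a,b,c].Sublist l → D.Ev P pos a b c

theorem EvCV.ev {l : List Vt} (h : EvCV P D pos l) : ∀ᶠ η in 𝓝[>] (0:ℝ), CV (l.map (D.ps P pos η)) := by
  classical
  have : ∀ᶠ η in 𝓝[>] (0:ℝ), ∀ a ∈ l.toFinset, ∀ b ∈ l.toFinset, ∀ c ∈ l.toFinset, [a,b,c].Sublist l →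
      0 < det (D.ps P pos η a) (D.ps P pos η b) (D.ps P pos η c) := by
    rw [Filter.eventually_all_finset]; intro a ha
    rw [Filter.eventually_all_finset]; intro b hb
    rw [Filter.eventually_all_finset]; intro c hc
    by_cases hs : [a,b,c].Sublist l
    · filter_upwards [h a b c hs] with η hη _ using hη
    · exact Filter.Eventually.of_forall fun t h => absurd h hs
  filter_upwards [this] with η hη
  intro u v w hs
  rw [List.sublist_map_iff] at hs
  obtain ⟨l', hl', he⟩ := hs
  match l', hl', he with
  | [a,b,c], hl', he =>
    simp only [List.map_cons, List.map_nil, List.cons.injEq, and_true] at he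
    obtain ⟨rfl, rfl, rfl⟩ := he
    obtain ⟨ha, hb, hc⟩ := mem3_of_sublist hl'
    exact hη a (by simpa using ha) b (by simpa using hb) c (by simpa using hc) hl'

theorem EvCV.rot {a : Vt} {l : List Vt} (h : EvCV P D pos (a :: l)) : EvCV P D pos (l ++ [a]) := by
  intro u v w hs
  rw [List.sublist_append_iff] at hs
  obtain ⟨l1, l2, he, h1, h2⟩ := hs
  have h2' : l2 = [] ∨ l2 = [a] := by
    cases h2 with
    | cons _ h => left; exact List.eq_nil_of_sublist_nil h
    | cons_cons _ h => right; rw [List.eq_nil_of_sublist_nil h]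
  rcases h2' with rfl | rfl
  · rw [List.append_nil] at he
    subst he
    exact h u v w (h1.trans (List.sublist_cons_self _ _))
  · match l1, h1, he with
    | [x, y], h1, he =>
      simp only [List.cons_append, List.nil_append, List.cons.injEq, and_true] at he
      obtain ⟨rfl, rfl, rfl⟩ := he
      exact (h w u v (h1.cons_cons w)).rot
    | [], h1, he => simp at he
    | [x], h1, he => simp at he
    | x :: y :: z :: r, h1, he => simp at he

theorem sub1 {l : List Vt} {u : Vt} (h : [u].Sublist l) : u ∈ l := List.singleton_sublist.1 h

theorem EvCV.append {l1 l2 : List Vt} (h1 : EvCV P D pos l1) (h2 : EvCV P D pos l2)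
    (h12 : ∀ u v, [u,v].Sublist l1 → ∀ w ∈ l2, D.Ev P pos u v w)
    (h21 : ∀ u v, [u,v].Sublist l2 → ∀ w ∈ l1, D.Ev P pos u v w) : EvCV P D pos (l1 ++ l2) := by
  intro u v w hs
  rw [List.sublist_append_iff] at hs
  obtain ⟨m1, m2, he, hm1, hm2⟩ := hs
  match m1, hm1, he with
  | [], hm1, he =>
    rw [List.nil_append] at he; subst he; exact h2 u v w hm2
  | [x], hm1, he =>
    simp only [List.cons_append, List.nil_append, List.cons.injEq] at he
    obtain ⟨rfl, rfl⟩ := he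
    exact (h21 _ _ hm2 _ (sub1 hm1)).rot.rot
  | [x, y], hm1, he =>
    simp only [List.cons_append, List.nil_append, List.cons.injEq] at he
    obtain ⟨rfl, rfl, rfl⟩ := he
    exact (h12 _ _ hm1 _ (sub1 hm2))
  | [x, y, z], hm1, he =>
    simp only [List.cons_append, List.nil_append, List.cons.injEq] at he
    obtain ⟨rfl, rfl, rfl, _⟩ := he
    exact h1 _ _ _ hm1
  | x :: y :: z :: t :: r, hm1, he =>
    simp at he

theorem sub22 {a b u v : Vt} (h : [u,v].Sublist [a,b]) : u = a ∧ v = b := by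
  have := h.eq_of_length (by simp)
  simpa using this
theorem sub23 {a b c u v : Vt} (h : [u,v].Sublist [a,b,c]) : (u = a ∧ v = b) ∨ (u = a ∧ v = c) ∨ (u = b ∧ v = c) := by
  cases h with
  | cons _ h => right; right; exact sub22 h
  | cons_cons _ h =>
    have := sub1 h
    simp at this; tauto
theorem sub33 {a b c u v w : Vt} (h : [u,v,w].Sublist [a,b,c]) : u = a ∧ v = b ∧ w = c := by
  have := h.eq_of_length (by simp)
  simpa using this

/-- ladders -/
theorem lad2 (T B : ℕ → Vt) (m : ℕ) {N : ℕ} (hm : m + 1 ≤ N)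
    (hT : ∀ i j k, i < j → j ≤ N → k ≤ N → D.Ev P pos (T i) (T j) (B k))
    (hB : ∀ i j k, i < j → j ≤ N → k ≤ N → D.Ev P pos (B j) (B i) (T k)) :
    EvCV P D pos [T m, T (m+1), B (m+1), B m] := by
  refine EvCV.append (l1 := [T m, T (m+1)]) (l2 := [B (m+1), B m]) ?_ ?_ ?_ ?_
  · intro a b c h; have := h.length_le; simp at this
  · intro a b c h; have := h.length_le; simp at this
  · intro u v h w hw
    obtain ⟨rfl, rfl⟩ := sub22 h
    simp only [List.mem_cons, List.not_mem_nil, or_false] at hw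
    rcases hw with rfl | rfl <;> exact hT _ _ _ (by omega) (by omega) (by omega)
  · intro u v h w hw
    obtain ⟨rfl, rfl⟩ := sub22 h
    simp only [List.mem_cons, List.not_mem_nil, or_false] at hw
    rcases hw with rfl | rfl <;> exact hB _ _ _ (by omega) (by omega) (by omega)

theorem lad3 (T B : ℕ → Vt) (m : ℕ) {N : ℕ} (hm : m + 2 ≤ N)
    (hT : ∀ i j k, i < j → j ≤ N → k ≤ N → D.Ev P pos (T i) (T j) (B k))
    (hB : ∀ i j k, i < j → j ≤ N → k ≤ N → D.Ev P pos (B j) (B i) (T k))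
    (hTT : D.Ev P pos (T m) (T (m+1)) (T (m+2))) (hBB : D.Ev P pos (B (m+2)) (B (m+1)) (B m)) :
    EvCV P D pos [T m, T (m+1), T (m+2), B (m+2), B (m+1), B m] := by
  refine EvCV.append (l1 := [T m, T (m+1), T (m+2)]) (l2 := [B (m+2), B (m+1), B m]) ?_ ?_ ?_ ?_
  · intro a b c h; obtain ⟨rfl, rfl, rfl⟩ := sub33 h; exact hTT
  · intro a b c h; obtain ⟨rfl, rfl, rfl⟩ := sub33 h; exact hBB
  · intro u v h w hw
    simp only [List.mem_cons, List.not_mem_nil, or_false] at hw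
    rcases sub23 h with ⟨rfl, rfl⟩ | ⟨rfl, rfl⟩ | ⟨rfl, rfl⟩ <;> rcases hw with rfl | rfl | rfl <;>
      exact hT _ _ _ (by omega) (by omega) (by omega)
  · intro u v h w hw
    simp only [List.mem_cons, List.not_mem_nil, or_false] at hw
    rcases sub23 h with ⟨rfl, rfl⟩ | ⟨rfl, rfl⟩ | ⟨rfl, rfl⟩ <;> rcases hw with rfl | rfl | rfl <;>
      exact hB _ _ _ (by omega) (by omega) (by omega)

/-- exact formulas on an edge -/
theorem sq_pos_of_det {V W Q : Pt} (h : det V W Q ≠ 0) : 0 < (W - V).1 ^ 2 + (W - V).2 ^ 2 := by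
  by_contra hc
  have h1 : (W - V).1 = 0 := by nlinarith [sq_nonneg (W - V).1, sq_nonneg (W - V).2]
  have h2 : (W - V).2 = 0 := by nlinarith [sq_nonneg (W - V).1, sq_nonneg (W - V).2]
  apply h
  simp only [Prod.fst_sub, Prod.snd_sub] at h1 h2
  unfold det; rw [h1, h2]; ring

theorem Ev_edge (X : L) {σ : Wd} (h : σ 3 = 0) {Q : Pt} (hd : det (pos (vx X σ)) (pos (vx X (σ * s2))) Q ≠ 0)
    {i j k : ℕ} (hi : i ≤ P.nE σ) (hj : j ≤ P.nE σ) (hk : k ≤ P.nE σ)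
    (hpos : 0 < (((k : ℝ) / P.nE σ - (i:ℝ) / P.nE σ) * (dlt (D.sjr (X, σ)) (P.nE σ) j - dlt (D.sjr (X, σ)) (P.nE σ) i) -
      ((j : ℝ) / P.nE σ - (i:ℝ) / P.nE σ) * (dlt (D.sjr (X, σ)) (P.nE σ) k - dlt (D.sjr (X, σ)) (P.nE σ) i))) :
    D.Ev P pos (P.tv X σ i) (P.tv X σ j) (P.tv X σ k) := by
  unfold Ev
  have := sq_pos_of_det hd
  filter_upwards [self_mem_nhdsWithin] with η hη
  rw [D.ps_tv P pos η X h hi, D.ps_tv P pos η X h hj, D.ps_tv P pos η X h hk]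
  unfold nrm
  rw [det_bent]
  exact mul_pos (mul_pos hη this) hpos

theorem Ev_mid (X : L) {σ : Wd} (h : σ 3 = 0) {Q : Pt} (hd : det (pos (vx X σ)) (pos (vx X (σ * s2))) Q ≠ 0)
    {j : ℕ} (hj : j + 2 ≤ P.nE σ) (hs : D.sj (X, σ) (j + 1) = 1) :
    D.Ev P pos (P.tv X σ j) (P.tv X σ (j + 1)) (P.tv X σ (j + 2)) := by
  refine Ev_edge X h hd (by omega) (by omega) hj ?_
  rw [bent_mid _ (P.nE_pos _)]
  have : (0:ℝ) < P.nE σ := by have := P.nE_pos σ; positivity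
  simp only [sjr, hs]; simpa using this

theorem Ev_mid' (X : L) {σ : Wd} (h : σ 3 = 0) {Q : Pt} (hd : det (pos (vx X σ)) (pos (vx X (σ * s2))) Q ≠ 0)
    {j : ℕ} (hj : j + 2 ≤ P.nE σ) (hs : D.sj (X, σ) (j + 1) = -1) :
    D.Ev P pos (P.tv X σ (j + 2)) (P.tv X σ (j + 1)) (P.tv X σ j) := by
  have := P.nE_pos σ
  refine Ev_edge X h hd hj (by omega) (by omega) ?_
  have h1 := bent_mid (D.sjr (X, σ)) (j := j) (P.nE_pos σ)
  have h2 : D.sjr (X, σ) (j + 1) = -1 := by simp [sjr, hs]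
  rw [h2] at h1
  have h3 : (0:ℝ) < 1 / P.nE σ := by positivity
  have h4 : (-1:ℝ) / P.nE σ = - (1 / P.nE σ) := by ring
  rw [h4] at h1
  push_cast at h1 ⊢
  linarith

theorem Ev_out (X : L) {σ : Wd} (h : σ 3 = 0) {Q : Pt} (hd : det (pos (vx X σ)) (pos (vx X (σ * s2))) Q ≠ 0)
    {j k : ℕ} (hj : j + 1 ≤ P.nE σ) (hk : k ≤ P.nE σ) (h1 : k ≠ j) (h2 : k ≠ j + 1) (hs : ∀ j, D.sj (X, σ) j = 1) :
    D.Ev P pos (P.tv X σ j) (P.tv X σ (j + 1)) (P.tv X σ k) := by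
  have := P.nE_pos σ
  refine Ev_edge X h hd (by omega) hj hk ?_
  rw [bent_const _ 1 (fun j => by simp [sjr, hs]) (P.nE_pos _)]
  have := kk_pos h1 h2
  positivity

theorem Ev_out' (X : L) {σ : Wd} (h : σ 3 = 0) {Q : Pt} (hd : det (pos (vx X σ)) (pos (vx X (σ * s2))) Q ≠ 0)
    {j k : ℕ} (hj : j + 1 ≤ P.nE σ) (hk : k ≤ P.nE σ) (h1 : k ≠ j) (h2 : k ≠ j + 1) (hs : ∀ j, D.sj (X, σ) j = -1) :
    D.Ev P pos (P.tv X σ (j + 1)) (P.tv X σ j) (P.tv X σ k) := by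
  have := P.nE_pos σ
  refine Ev_edge X h hd hj (by omega) hk ?_
  have h3 := bent_const (D.sjr (X, σ)) (-1) (fun j => by simp [sjr, hs]) (j := j) (k := k) (P.nE_pos σ)
  have h4 := kk_pos h1 h2
  have h5 : (0:ℝ) < ((k:ℝ) - j) * (k - j - 1) / (2 * P.nE σ) := by positivity
  push_cast at h3 ⊢
  linarith

end SD
end ABCT

set_option linter.all false

namespace ABCT
open Filter Topology

def lr (V W : Pt) (t : ℝ) : Pt := (1 - t) • V + t • W

theorem det_lr3 (p q V W : Pt) (t : ℝ) : det p q (lr V W t) = (1 - t) * det p q V + t * det p q W := by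
  unfold det lr; simp only [Prod.fst_add, Prod.snd_add, Prod.smul_fst, Prod.smul_snd, smul_eq_mul]; ring
theorem det_lr_same (b V W : Pt) (s t : ℝ) : det (lr V W s) (lr V W t) b = (t - s) * det V W b := by
  unfold det lr; simp only [Prod.fst_add, Prod.snd_add, Prod.smul_fst, Prod.smul_snd, smul_eq_mul]; ring
theorem det_lr_mix (b U V W : Pt) (s t : ℝ) : det (lr U V s) (lr V W t) b =
    (1 - s) * (1 - t) * det U V b + (1 - s) * t * det U W b + s * t * det V W b := by
  unfold det lr; simp only [Prod.fst_add, Prod.snd_add, Prod.smul_fst, Prod.smul_snd, smul_eq_mul]; ring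

theorem cvx_pos {x y t : ℝ} (hx : 0 < x) (hy : 0 < y) (h0 : 0 ≤ t) (h1 : t ≤ 1) : 0 < (1 - t) * x + t * y := by
  rcases h0.eq_or_lt with rfl | h
  · simpa using hx
  · have := mul_pos h hy; have := mul_nonneg (sub_nonneg.2 h1) hx.le; linarith

noncomputable def pth (n n' : ℕ) (U V W : Pt) (m : ℕ) : Pt :=
  if m ≤ n then lr U V ((m:ℝ) / n) else lr V W (((m - n : ℕ):ℝ) / n')

theorem frac_mem {m n : ℕ} (h : m ≤ n) : 0 ≤ (m:ℝ) / n ∧ (m:ℝ) / n ≤ 1 :=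
  ⟨by positivity, div_le_one_of_le₀ (by exact_mod_cast h) (by positivity)⟩

theorem frac_lt {m k n : ℕ} (h : m < k) (hk : k ≤ n) : (m:ℝ) / n < (k:ℝ) / n := by
  have : (0:ℝ) < n := by have : 0 < n := by omega
                         positivity
  gcongr

theorem pth_cvx {n n' : ℕ} {p q U V W : Pt} (hU : 0 < det p q U) (hV : 0 < det p q V) (hW : 0 < det p q W) {m : ℕ}
    (hm : m ≤ n + n') : 0 < det p q (pth n n' U V W m) := by
  unfold pth
  split_ifs with h
  · rw [det_lr3]; exact cvx_pos hU hV (frac_mem h).1 (frac_mem h).2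
  · have := frac_mem (m := m - n) (n := n') (by omega)
    rw [det_lr3]; exact cvx_pos hV hW this.1 this.2

theorem pth_det {n n' : ℕ} {b U V W : Pt} (ε : ℝ) (h1 : 0 < ε * det U V b) (h2 : 0 < ε * det V W b) (h3 : 0 < ε * det U W b) {m k : ℕ}
    (hm : m < k) (hk : k ≤ n + n') : 0 < ε * det (pth n n' U V W m) (pth n n' U V W k) b := by
  unfold pth
  by_cases hk' : k ≤ n
  · rw [if_pos hk', if_pos (by omega), det_lr_same]
    have := mul_pos (sub_pos.2 (frac_lt hm hk')) h1
    linarith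
  · rw [if_neg hk']
    have hk2 : k - n ≤ n' := by omega
    by_cases hm' : m ≤ n
    · rw [if_pos hm', det_lr_mix]
      have hs := frac_mem hm'
      have ht := frac_mem hk2
      have ht0 : 0 < ((k - n : ℕ):ℝ) / n' := by
        have : (0:ℝ) < ((k - n : ℕ):ℝ) := by have : 0 < k - n := by omega
                                             positivity
        have : (0:ℝ) < n' := by have : 0 < n' := by omega
                                positivity
        positivity
      set s := (m:ℝ) / n
      set t := ((k - n : ℕ):ℝ) / n'
      have a1 : 0 ≤ (1 - s) * (1 - t) * (ε * det U V b) := mul_nonneg (mul_nonneg (by linarith) (by linarith)) h1.le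
      have a2 := mul_pos ht0 (cvx_pos h3 h2 hs.1 hs.2)
      nlinarith
    · rw [if_neg hm', det_lr_same]
      have := mul_pos (sub_pos.2 (frac_lt (n := n') (show m - n < k - n by omega) hk2)) h2
      linarith

variable {P : Prm} {D : SD} {pos : Vt → Pt}

namespace SD
open Prm

theorem vx_qq2 (X : L) (σ : Wd) : vx (X - e (σ 2)) (σ * qq * s2) = vx X (σ * (s2 * s1)) := by
  refine (vx_eqm (k := σ 2) rfl rfl ?_).symm
  simp only [mul_assoc]; rw [show s2 * (s1 * (rr * (rr * rr))) = qq * s2 by decide]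

theorem ip_path (pos : Vt → Pt) (X : L) {σ : Wd} (h : σ 3 = 0) {m : ℕ} (hm : m ≤ P.nE σ + P.nE (σ * qq)) :
    P.I.ip pos (P.tv X σ m) = pth (P.nE σ) (P.nE (σ * qq)) (pos (vx X σ)) (pos (vx X (σ * s2))) (pos (vx X (σ * (s2 * s1)))) m := by
  unfold pth
  split_ifs with h1
  · exact P.ip_tv pos X h h1
  · have : P.tv X σ m = P.tv (X - e (σ 2)) (σ * qq) (m - P.nE σ) := by
      rw [← P.tv_R X h]; congr 1; omega
    rw [this, P.ip_tv pos _ (qq3 h) (by omega), vx_qq, vx_qq2]; rfl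

theorem s1s1 (σ : Wd) : σ * s1 * s1 = σ := by rw [mul_assoc, show s1 * s1 = 1 by decide, mul_one]
theorem qq_2 (σ : Wd) : (σ * qq) 2 = σ 1 := rfl
theorem s1_2 (σ : Wd) : (σ * s1) 2 = σ 1 := rfl
theorem s1_1 (σ : Wd) : (σ * s1) 1 = σ 2 := rfl
theorem s1_3 {σ : Wd} (h : σ 3 = 0) : (σ * s1) 3 = 0 := h
theorem s0_3 {σ : Wd} (h : σ 3 = 0) : (σ * s0) 3 = 0 := h

theorem nE_qq (σ : Wd) : P.nE (σ * qq) = 3 * P.gn (σ 1) + 1 := rfl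
theorem nE_s1 (σ : Wd) : P.nE (σ * s1) = 3 * P.gn (σ 1) + 1 := rfl
theorem nE_s0 (σ : Wd) : P.nE (σ * s0) = 3 * P.gn (σ 2) + 1 := rfl
theorem nE_s1q (σ : Wd) : P.nE (σ * s1 * qq) = 3 * P.gn (σ 2) + 1 := rfl

theorem CV6 {a b c d f g : Pt} (h : CV [a,b,c,d,f,g]) : (0 < det a b c ∧ 0 < det d f g) ∧
    (∀ w, w = d ∨ w = f ∨ w = g → 0 < det a b w ∧ 0 < det a c w ∧ 0 < det b c w) ∧
    (∀ w, w = a ∨ w = b ∨ w = c → 0 < det d f w ∧ 0 < det d g w ∧ 0 < det f g w) := by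
  refine ⟨⟨h _ _ _ (by simp), h _ _ _ ?_⟩, ?_, ?_⟩
  · exact List.Sublist.cons _ (List.Sublist.cons _ (List.Sublist.cons _ (List.Sublist.refl _)))
  · have hb : [b, c, d, f, g].Sublist [a,b,c,d,f,g] := by simp
    have hc : [c, d, f, g].Sublist [b,c,d,f,g] := by simp
    rintro w hw
    have hw2 : [w].Sublist [d,f,g] := by rw [List.singleton_sublist]; simpa using hw
    refine ⟨h _ _ _ ?_, h _ _ _ ?_, h _ _ _ ?_⟩
    · exact (hw2.cons c).cons_cons b |>.cons_cons a
    · exact (hw2.cons_cons c).cons b |>.cons_cons a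
    · exact (hw2.cons_cons c).cons_cons b |>.cons a
  · rintro w hw
    have hw2 : [w].Sublist [a,b,c] := by rw [List.singleton_sublist]; simpa using hw
    have key : ∀ u v, [u,v].Sublist [d,f,g] → 0 < det u v w := by
      intro u v huv
      rw [det_rot]
      exact h w u v (hw2.append huv)
    exact ⟨key _ _ (by simp), key _ _ (by simp), key _ _ (by simp)⟩

theorem det_ne_of_pos {V W Q : Pt} (h : 0 < det V W Q) : det V W Q ≠ 0 := ne_of_gt h

/-- hexagon parents -/
theorem hex_lad (X : L) {σ : Wd} (h : σ 3 = 0) (hcv : CV ((hexP X σ).map pos)) :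
    (∀ i j k, i < j → j ≤ P.nE σ + P.nE (σ * qq) → k ≤ P.nE σ + P.nE (σ * qq) →
      D.Ev P pos (P.tv X σ i) (P.tv X σ j) (P.tv X (σ * s1) k)) ∧
    (∀ i j k, i < j → j ≤ P.nE σ + P.nE (σ * qq) → k ≤ P.nE σ + P.nE (σ * qq) →
      D.Ev P pos (P.tv X (σ * s1) j) (P.tv X (σ * s1) i) (P.tv X σ k)) := by
  obtain ⟨_, h1, h2⟩ := CV6 hcv
  have e1 : σ * s1 * (s2 * s1) = σ * (s2 * s1 * s2) := by
    simp only [mul_assoc]; rw [show s1 * (s2 * s1) = s2 * (s1 * s2) by decide]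
  have e2 : σ * s1 * s2 = σ * (s1 * s2) := by rw [mul_assoc]
  have hn : P.nE σ + P.nE (σ * qq) = P.nE (σ * s1) + P.nE (σ * s1 * qq) := by
    rw [nE_qq, nE_s1, nE_s1q]; unfold nE; ring
  constructor
  · intro i j k hij hj hk
    apply Ev.of_zero
    rw [ip_path pos X h (by omega), ip_path pos X h hj]
    rw [ip_path pos X (s1_3 h) (by omega), e1, e2]
    have key : ∀ w, w = pos (vx X (σ * (s2 * s1 * s2))) ∨ w = pos (vx X (σ * (s1 * s2))) ∨ w = pos (vx X (σ * s1)) →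
        0 < det (pth (P.nE σ) (P.nE (σ * qq)) (pos (vx X σ)) (pos (vx X (σ * s2))) (pos (vx X (σ * (s2 * s1)))) i)
          (pth (P.nE σ) (P.nE (σ * qq)) (pos (vx X σ)) (pos (vx X (σ * s2))) (pos (vx X (σ * (s2 * s1)))) j) w := by
      intro w hw
      have := h1 w hw
      have := pth_det (n := P.nE σ) (n' := P.nE (σ * qq)) 1
        (U := pos (vx X σ)) (V := pos (vx X (σ * s2))) (W := pos (vx X (σ * (s2 * s1)))) (b := w) (by linarith) (by linarith [this.2.2]) (by linarith [this.2.1]) hij hj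
      linarith
    exact pth_cvx (key _ (by tauto)) (key _ (by tauto)) (key _ (by tauto)) (by omega)
  · intro i j k hij hj hk
    apply Ev.of_zero
    rw [ip_path pos X h hk]
    rw [ip_path pos X (s1_3 h) (by omega), ip_path pos X (s1_3 h) (by omega), e1, e2]
    have key : ∀ w, w = pos (vx X σ) ∨ w = pos (vx X (σ * s2)) ∨ w = pos (vx X (σ * (s2 * s1))) →
        0 < det (pth (P.nE (σ * s1)) (P.nE (σ * s1 * qq)) (pos (vx X (σ * s1))) (pos (vx X (σ * (s1 * s2)))) (pos (vx X (σ * (s2 * s1 * s2)))) j)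
          (pth (P.nE (σ * s1)) (P.nE (σ * s1 * qq)) (pos (vx X (σ * s1))) (pos (vx X (σ * (s1 * s2)))) (pos (vx X (σ * (s2 * s1 * s2)))) i) w := by
      intro w hw
      have := h2 w hw
      have := pth_det (n := P.nE (σ * s1)) (n' := P.nE (σ * s1 * qq)) (-1)
        (U := pos (vx X (σ * s1))) (V := pos (vx X (σ * (s1 * s2)))) (W := pos (vx X (σ * (s2 * s1 * s2)))) (b := w)
        (by rw [det_swap]; linarith [this.2.2]) (by rw [det_swap]; linarith) (by rw [det_swap]; linarith [this.2.1]) hij (by omega)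
      rw [det_swap]; linarith
    exact pth_cvx (key _ (by tauto)) (key _ (by tauto)) (key _ (by tauto)) hk

theorem CV4 {a b c d : Pt} (h : CV [a,b,c,d]) : 
    (∀ w, w = c ∨ w = d → 0 < det a b w) ∧ (∀ w, w = a ∨ w = b → 0 < det c d w) := by
  refine ⟨?_, ?_⟩
  · rintro w hw
    have hw2 : [w].Sublist [c,d] := by rw [List.singleton_sublist]; simpa using hw
    exact h _ _ _ ((hw2.cons_cons b).cons_cons a)
  · rintro w hw
    have hw2 : [w].Sublist [a,b] := by rw [List.singleton_sublist]; simpa using hw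
    rw [det_rot]
    exact h _ _ _ (hw2.append (List.Sublist.refl [c,d]))

theorem sq_lad (X : L) {σ : Wd} (h : σ 3 = 0) (hcv : CV ((sqP X σ).map pos)) :
    (∀ i j k, i < j → j ≤ P.nE σ → k ≤ P.nE σ →
      D.Ev P pos (P.tv X σ i) (P.tv X σ j) (P.tv X (σ * s0) k)) ∧
    (∀ i j k, i < j → j ≤ P.nE σ → k ≤ P.nE σ →
      D.Ev P pos (P.tv X (σ * s0) j) (P.tv X (σ * s0) i) (P.tv X σ k)) := by
  obtain ⟨h1, h2⟩ := CV4 hcv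
  have e2 : σ * s0 * s2 = σ * (s2 * s0) := by rw [mul_assoc, show s0 * s2 = s2 * s0 by decide]
  have hn : P.nE (σ * s0) = P.nE σ := rfl
  constructor
  · intro i j k hij hj hk
    apply Ev.of_zero
    rw [P.ip_tv pos X h (by omega), P.ip_tv pos X h hj, P.ip_tv pos X (s0_3 h) (by omega), e2, hn]
    show 0 < det (lr _ _ _) (lr _ _ _) (lr _ _ _)
    rw [det_lr_same, det_lr3]
    exact mul_pos (sub_pos.2 (frac_lt hij hj)) (cvx_pos (h1 _ (Or.inr rfl)) (h1 _ (Or.inl rfl)) (frac_mem hk).1 (frac_mem hk).2)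
  · intro i j k hij hj hk
    apply Ev.of_zero
    rw [P.ip_tv pos X h hk, P.ip_tv pos X (s0_3 h) (by omega), P.ip_tv pos X (s0_3 h) (by omega), e2, hn]
    show 0 < det (lr _ _ _) (lr _ _ _) (lr _ _ _)
    rw [det_lr_same, det_lr3, det_swap (pos (vx X (σ * (s2 * s0)))), det_swap (pos (vx X (σ * (s2 * s0))))]
    have := mul_pos (sub_pos.2 (frac_lt hij hj)) (cvx_pos (h2 _ (Or.inl rfl)) (h2 _ (Or.inr rfl)) (frac_mem hk).1 (frac_mem hk).2)
    linarith

/-- bending directions -/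
theorem sj_01 {X : L} {σ : Wd} (hε : D.sd X ≠ 0) (hv : D.sd (X + e (σ 0)) = - D.sd X) {j : ℕ} (hj : j % 3 = 1) :
    D.sj (X, σ) j = - (D.sd X * sg σ) := by
  unfold sj kap kt
  simp only [hj, hv]
  rcases D.h1 X with h | h | h
  · rw [h]; rcases D.h1 (X + e (σ 0) + e (σ 1)) with h' | h' | h' <;> rw [h'] <;> simp [kp]
  · exact absurd h hε
  · rw [h]; rcases D.h1 (X + e (σ 0) + e (σ 1)) with h' | h' | h' <;> rw [h'] <;> simp [kp]

theorem sj_12 {X : L} {σ : Wd} (hε : D.sd (X + e (σ 0)) ≠ 0) (hv : D.sd (X + e (σ 0) + e (σ 1)) = - D.sd (X + e (σ 0)))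
    {j : ℕ} (hj : j % 3 = 0) : D.sj (X, σ) j = - (D.sd (X + e (σ 0)) * sg σ) := by
  unfold sj kap kt
  simp only [hj, hv]
  rcases D.h1 (X + e (σ 0)) with h | h | h
  · rw [h]; rcases D.h1 X with h' | h' | h' <;> rw [h'] <;> simp [kp]
  · exact absurd h hε
  · rw [h]; rcases D.h1 X with h' | h' | h' <;> rw [h'] <;> simp [kp]

theorem sj_20 {X : L} {σ : Wd} (hε : D.sd X ≠ 0) (hv : D.sd (X + e (σ 0) + e (σ 1)) = - D.sd X)
    {j : ℕ} (hj : j % 3 = 2) : D.sj (X, σ) j = D.sd X * sg σ := by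
  unfold sj kap kt
  simp only [hj, hv]
  rcases D.h1 X with h | h | h
  · rw [h]; rcases D.h1 (X + e (σ 0)) with h' | h' | h' <;> rw [h'] <;> simp [kp]
  · exact absurd h hε
  · rw [h]; rcases D.h1 (X + e (σ 0)) with h' | h' | h' <;> rw [h'] <;> simp [kp]

theorem pth_break {n n' : ℕ} (hn : 0 < n) (hn' : 0 < n') {U V W : Pt} : det (pth n n' U V W (n - 1)) (pth n n' U V W n) (pth n n' U V W (n + 1)) =
    1 / n * (1 / n') * det U V W := by
  unfold pth
  have h1 : (n:ℝ) ≠ 0 := by positivity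
  have h2 : (n':ℝ) ≠ 0 := by positivity
  rw [if_pos (by omega), if_pos le_rfl, if_neg (by omega), show n + 1 - n = 1 by omega, Nat.cast_pred hn, div_self h1]
  unfold det lr; simp only [Prod.fst_add, Prod.snd_add, Prod.smul_fst, Prod.smul_snd, smul_eq_mul]
  push_cast
  field_simp
  ring

theorem hex_TTT (X : L) {σ : Wd} (h : σ 3 = 0) (hε : D.sd X * sg σ = -1) (hv : D.sd (X + e (σ 0)) = - D.sd X)
    (hdet : 0 < det (pos (vx X σ)) (pos (vx X (σ * s2))) (pos (vx X (σ * (s2 * s1))))) {i : ℕ}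
    (hm : 3 * i + 2 ≤ P.nE σ + P.nE (σ * qq)) :
    D.Ev P pos (P.tv X σ (3 * i)) (P.tv X σ (3 * i + 1)) (P.tv X σ (3 * i + 2)) := by
  have hX0 : D.sd X ≠ 0 := by intro h0; rw [h0] at hε; simp at hε
  rcases lt_trichotomy (3 * i + 1) (P.nE σ) with hlt | heq | hgt
  · refine Ev_mid X h hdet.ne' (by omega) ?_
    rw [sj_01 hX0 hv (by omega), hε]; rfl
  · apply Ev.of_zero
    rw [ip_path pos X h (by omega), ip_path pos X h (by omega), ip_path pos X h (by omega)]
    have := pth_break (P.nE_pos σ) (P.nE_pos (σ * qq)) (U := pos (vx X σ)) (V := pos (vx X (σ * s2))) (W := pos (vx X (σ * (s2 * s1))))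
    rw [show 3 * i = P.nE σ - 1 by omega, show P.nE σ - 1 + 1 = P.nE σ by omega, show P.nE σ - 1 + 2 = P.nE σ + 1 by omega, this]
    have := P.nE_pos σ
    have := P.nE_pos (σ * qq)
    positivity
  · have hr : ∀ k, P.nE σ ≤ k → P.tv X σ k = P.tv (X - e (σ 2)) (σ * qq) (k - P.nE σ) := by
      intro k hk
      rw [← P.tv_R X h]; congr 1; omega
    have hg : P.nE σ = 3 * P.gn (σ 2) + 1 := rfl
    rw [hr _ (by omega), hr _ (by omega), hr _ (by omega)]
    rw [show 3 * i + 1 - P.nE σ = 3 * i - P.nE σ + 1 by omega, show 3 * i + 2 - P.nE σ = 3 * i - P.nE σ + 2 by omega]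
    have q0 : (σ * qq) 0 = σ 2 := rfl
    have q1 : (σ * qq) 1 = σ 0 := rfl
    refine Ev_mid (Q := pos (vx X σ)) _ (qq3 h) ?_ (by omega) ?_
    · rw [vx_qq, vx_qq2, det_rot]; exact hdet.ne'
    · have hs : sg (σ * qq) = sg σ := by rw [sg_mul, sg_qq, mul_one]
      rw [sj_12 (by rw [q0, sub_add_cancel]; exact hX0) (by rw [q0, q1, sub_add_cancel]; exact hv) (by omega), q0,
        sub_add_cancel, hs, hε]; rfl

theorem hex_BBB (X : L) {σ : Wd} (h : σ 3 = 0) (hε : D.sd X * sg σ = 1) (hv : D.sd (X + e (σ 0)) = - D.sd X)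
    (hdet : 0 < det (pos (vx X (σ * (s2 * s1)))) (pos (vx X (σ * s2))) (pos (vx X σ))) {i : ℕ}
    (hm : 3 * i + 2 ≤ P.nE σ + P.nE (σ * qq)) :
    D.Ev P pos (P.tv X σ (3 * i + 2)) (P.tv X σ (3 * i + 1)) (P.tv X σ (3 * i)) := by
  have hX0 : D.sd X ≠ 0 := by intro h0; rw [h0] at hε; simp at hε
  have hdet' : det (pos (vx X σ)) (pos (vx X (σ * s2))) (pos (vx X (σ * (s2 * s1)))) < 0 := by
    rw [← det_rot, det_swap] at hdet; linarith
  rcases lt_trichotomy (3 * i + 1) (P.nE σ) with hlt | heq | hgt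
  · refine Ev_mid' X h hdet'.ne (by omega) ?_
    rw [sj_01 hX0 hv (by omega), hε]
  · apply Ev.of_zero
    rw [ip_path pos X h (by omega), ip_path pos X h (by omega), ip_path pos X h (by omega)]
    have := pth_break (P.nE_pos σ) (P.nE_pos (σ * qq)) (U := pos (vx X σ)) (V := pos (vx X (σ * s2))) (W := pos (vx X (σ * (s2 * s1))))
    rw [show 3 * i = P.nE σ - 1 by omega, show P.nE σ - 1 + 1 = P.nE σ by omega, show P.nE σ - 1 + 2 = P.nE σ + 1 by omega]
    rw [← det_rot, det_swap, this]
    have := P.nE_pos σ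
    have := P.nE_pos (σ * qq)
    have : 0 < 1 / (P.nE σ : ℝ) * (1 / (P.nE (σ * qq) : ℝ)) := by positivity
    nlinarith
  · have hr : ∀ k, P.nE σ ≤ k → P.tv X σ k = P.tv (X - e (σ 2)) (σ * qq) (k - P.nE σ) := by
      intro k hk
      rw [← P.tv_R X h]; congr 1; omega
    have hg : P.nE σ = 3 * P.gn (σ 2) + 1 := rfl
    rw [hr _ (by omega), hr _ (by omega), hr _ (by omega)]
    rw [show 3 * i + 1 - P.nE σ = 3 * i - P.nE σ + 1 by omega, show 3 * i + 2 - P.nE σ = 3 * i - P.nE σ + 2 by omega]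
    have q0 : (σ * qq) 0 = σ 2 := rfl
    have q1 : (σ * qq) 1 = σ 0 := rfl
    refine Ev_mid' (Q := pos (vx X σ)) _ (qq3 h) ?_ (by omega) ?_
    · rw [vx_qq, vx_qq2, det_rot]; exact hdet'.ne
    · have hs : sg (σ * qq) = sg σ := by rw [sg_mul, sg_qq, mul_one]
      rw [sj_12 (by rw [q0, sub_add_cancel]; exact hX0) (by rw [q0, q1, sub_add_cancel]; exact hv) (by omega), q0,
        sub_add_cancel, hs, hε]

end SD
end ABCT

set_option linter.all false

namespace ABCT
namespace SD
open Prm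
variable {P : Prm} {D : SD} {pos : Vt → Pt}

theorem nx_ch (X : L) {i : ℕ} (hi : (i:ℤ) < P.C) : (D.nx P).sd (P.ch X i) = - D.sd X := by
  rw [nx_sd, P.dl_ch X (by positivity) hi]

theorem nx_ch' {X : L} {y : L} {i : ℕ} (hi : (i:ℤ) < P.C) (h : y = P.ch X i) : (D.nx P).sd y = - D.sd X := by
  rw [h, nx_ch X hi]

theorem ch_wrap (X : L) (i : ℕ) {j : ℕ} (h : (j : ℤ) = i + P.C) : P.ch X j = P.ch (X + e 0) i := by
  rw [h, P.ch_C]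

theorem sg_rrm (σ : Wd) : sg (rr * σ) = - sg σ := by rw [sg_mul, sg_rr]; ring

theorem x0 (X : L) {σ : Wd} (h : σ 3 = 0) : X + e (σ 0) + e 0 = X - e (σ 2) - e (σ 1) := by
  have := e_perm σ
  rw [h] at this
  have h2 : e (σ 0) + e 0 = - e (σ 2) - e (σ 1) := by
    rw [← sub_eq_zero, ← this]; abel
  rw [add_assoc, h2]; abel
theorem x01 (X : L) {σ : Wd} (h : σ 3 = 0) : X + e (σ 0) + e (σ 1) + e 0 = X - e (σ 2) := by
  have := x0 X h
  rw [add_right_comm, this]; abel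

theorem hexA (X : L) {σ : Wd} (h : σ 3 = 0) {i : ℕ} (hi : (i + P.gn (σ 0) : ℤ) < P.C) :
    (D.nx P).hexOK (P.ch X i, rr * σ) ↔ D.hexOK (X, σ) := by
  obtain ⟨h0, h1, h2⟩ := ne0 h
  unfold hexOK
  simp only
  rw [rr_ap', P.ch_add h0, ← Nat.cast_add, nx_ch (X + e (σ 0)) (by push_cast; exact hi), nx_ch X (by linarith [Int.natCast_nonneg (P.gn (σ 0))]), sg_rrm]
  constructor
  · rintro ⟨a, b⟩; exact ⟨by linarith, by linarith⟩
  · rintro ⟨a, b⟩; exact ⟨by linarith, by linarith⟩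

theorem hexB (X : L) {σ : Wd} (h : σ 3 = 0) {i j : ℕ} (hi : (i:ℤ) < P.C) (hj : (i + P.gn (σ 0) : ℤ) = j + P.C) :
    (D.nx P).hexOK (P.ch X i, rr * σ) ↔ D.sqOK (X - e (σ 2) - e (σ 1), σ * qq * qq) := by
  obtain ⟨h0, h1, h2⟩ := ne0 h
  have hs := P.gsum h
  have hjC : (j:ℤ) < P.C := by omega
  have q0 : (σ * qq * qq) 0 = σ 1 := rfl
  have q1 : (σ * qq * qq) 1 = σ 2 := rfl
  unfold hexOK sqOK
  simp only
  rw [rr_ap', P.ch_add h0, ← Nat.cast_add, ch_wrap (X + e (σ 0)) j (by push_cast; exact hj), x0 X h, nx_ch _ hjC, nx_ch X hi, sg_rrm, q0, q1,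
    sub_add_cancel, sub_add_cancel, sg_mul, sg_mul, sg_qq]
  constructor
  · rintro ⟨a, b⟩
    have b' : D.sd X = - D.sd (X - e (σ 2) - e (σ 1)) := by linarith
    rw [b'] at a
    exact ⟨by linarith, by linarith⟩
  · rintro ⟨a, b⟩; rw [b]; exact ⟨by linarith, by linarith⟩

theorem sqA (X : L) {σ : Wd} (h : σ 3 = 0) {i : ℕ} (hi : i ≤ P.gn (σ 2)) :
    (D.nx P).sqOK (P.ch X i, rr * σ) ↔ D.sqOK (X, σ) := by
  obtain ⟨h0, h1, h2⟩ := ne0 h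
  have hs := P.gsum h
  unfold sqOK
  simp only
  rw [rr_ap', rr_ap', P.ch_add h0, P.ch_add h1, ← Nat.cast_add, ← Nat.cast_add, nx_ch (X + e (σ 0) + e (σ 1)) (by push_cast; omega), nx_ch X (by omega), sg_rrm]
  constructor
  · rintro ⟨a, b⟩; exact ⟨by linarith, by linarith⟩
  · rintro ⟨a, b⟩; exact ⟨by linarith, by linarith⟩

theorem sqB (X : L) {σ : Wd} (h : σ 3 = 0) {i j : ℕ} (hi : (i:ℤ) < P.C) (hj : i = P.gn (σ 2) + 1 + j) :
    (D.nx P).sqOK (P.ch X i, rr * σ) ↔ D.hexOK (X - e (σ 2), σ * qq) := by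
  obtain ⟨h0, h1, h2⟩ := ne0 h
  have hs := P.gsum h
  have hjC : (j:ℤ) < P.C := by omega
  have q0 : (σ * qq) 0 = σ 2 := rfl
  unfold hexOK sqOK
  simp only
  rw [rr_ap', rr_ap', P.ch_add h0, P.ch_add h1, ← Nat.cast_add, ← Nat.cast_add,
    ch_wrap (X + e (σ 0) + e (σ 1)) j (by push_cast; omega), x01 X h, nx_ch _ hjC, nx_ch X hi, sg_rrm, q0,
    sub_add_cancel, sg_mul, sg_qq]
  constructor
  · rintro ⟨a, b⟩
    have b' : D.sd X = - D.sd (X - e (σ 2)) := by linarith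
    rw [b'] at a
    exact ⟨by linarith, by linarith⟩
  · rintro ⟨a, b⟩; rw [b]; exact ⟨by linarith, by linarith⟩

theorem hexP_tv (X : L) (σ : Wd) (i : ℕ) : hexP (P.ch X i) (rr * σ) =
    [P.tv X σ (3*i), P.tv X σ (3*i+1), P.tv X σ (3*i+2), P.tv X (σ * s1) (3*i+2), P.tv X (σ * s1) (3*i+1), P.tv X (σ * s1) (3*i)] := by
  simp only [tv0, tv1, tv2, hexP, mul_assoc, show s1 * (s2 * s1) = s2 * (s1 * s2) by decide]

theorem sqP_tv (X : L) (σ : Wd) (i : ℕ) : sqP (P.ch X i) (rr * σ) =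
    [P.tv X σ (3*i), P.tv X σ (3*i+1), P.tv X (σ * s0) (3*i+1), P.tv X (σ * s0) (3*i)] := by
  simp only [tv0, tv1, tv2, sqP, mul_assoc, show s0 * s2 = s2 * s0 by decide]

theorem tv_RR (X : L) {σ : Wd} (h : σ 3 = 0) (m : ℕ) :
    P.tv X σ (m + P.nE (σ * qq) + P.nE σ) = P.tv (X - e (σ 2) - e (σ 1)) (σ * qq * qq) m := by
  rw [P.tv_R X h, P.tv_R _ (qq3 h)]; rfl

theorem hexP_tvB (X : L) {σ : Wd} (h : σ 3 = 0) {i j : ℕ} (hj : (i + P.gn (σ 0) : ℤ) = j + P.C) : hexP (P.ch X i) (rr * σ) =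
    let X' := X - e (σ 2) - e (σ 1)
    let σ' := σ * qq * qq
    [P.tv X' σ' (3*j+1), P.tv X' σ' (3*j+1+1), P.tv X' σ' (3*j+1+2), P.tv X' (σ' * s0) (3*j+1+2), P.tv X' (σ' * s0) (3*j+1+1), P.tv X' (σ' * s0) (3*j+1)] := by
  have hs := P.gsum h
  have e1 : 3 * i = 3 * j + 1 + P.nE (σ * qq) + P.nE σ := by
    have : (σ * qq) 2 = σ 1 := rfl
    unfold nE; rw [this]; omega
  have h' : (σ * s1) 3 = 0 := h
  have e2 : P.nE (σ * s1) = P.nE (σ * qq) := rfl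
  have e3 : P.nE (σ * s1 * qq) = P.nE σ := rfl
  have a : ∀ k, P.tv X σ (3 * i + k) = P.tv (X - e (σ 2) - e (σ 1)) (σ * qq * qq) (3*j+1+k) := by
    intro k
    rw [← tv_RR X h]; congr 1; omega
  have b : ∀ k, P.tv X (σ * s1) (3 * i + k) = P.tv (X - e (σ 2) - e (σ 1)) (σ * qq * qq * s0) (3*j+1+k) := by
    intro k
    have := tv_RR (P := P) X h' (3 * j + 1 + k)
    rw [show (σ * s1) 2 = σ 1 from rfl, show (σ * s1) 1 = σ 2 from rfl, sub_right_comm,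
      show σ * s1 * qq * qq = σ * qq * qq * s0 by simp only [mul_assoc]; rw [show s1 * (qq * qq) = qq * (qq * s0) by decide]] at this
    rw [← this]; congr 1; omega
  have a0 := a 0; have b0 := b 0; simp only [add_zero] at a0 b0
  rw [hexP_tv, a0, b0, a, a, b, b]

theorem sqP_tvB (X : L) {σ : Wd} (h : σ 3 = 0) {i j : ℕ} (hj : i = P.gn (σ 2) + 1 + j) : sqP (P.ch X i) (rr * σ) =
    let X' := X - e (σ 2)
    let σ' := σ * qq
    [P.tv X' σ' (3*j+2), P.tv X' σ' (3*j+2+1), P.tv X' (σ' * s1) (3*j+2+1), P.tv X' (σ' * s1) (3*j+2)] := by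
  have e1 : 3 * i = 3 * j + 2 + P.nE σ := by
    unfold nE; omega
  have h' : (σ * s0) 3 = 0 := h
  have e2 : P.nE (σ * s0) = P.nE σ := rfl
  have a : ∀ k, P.tv X σ (3 * i + k) = P.tv (X - e (σ 2)) (σ * qq) (3*j+2+k) := by
    intro k
    rw [← tv_R P X h]; congr 1; omega
  have b : ∀ k, P.tv X (σ * s0) (3 * i + k) = P.tv (X - e (σ 2)) (σ * qq * s1) (3*j+2+k) := by
    intro k
    have := P.tv_R X h' (3 * j + 2 + k)
    rw [show (σ * s0) 2 = σ 2 from rfl,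
      show σ * s0 * qq = σ * qq * s1 by simp only [mul_assoc]; rw [show s0 * qq = qq * s1 by decide]] at this
    rw [← this]; congr 1; omega
  have a0 := a 0; have b0 := b 0; simp only [add_zero] at a0 b0
  rw [sqP_tv, a0, b0, a, b]

/-- drawing hypotheses: parent polygons convex -/
def PCV (D : SD) (pos : Vt → Pt) : Prop := (∀ z, D.hexOK z → CV ((hexP z.1 z.2).map pos)) ∧ ∀ z, D.sqOK z → CV ((sqP z.1 z.2).map pos)

theorem ev_hexA (hP : D.PCV pos) (X : L) {σ : Wd} (h : σ 3 = 0) (hok : D.hexOK (X, σ)) {i : ℕ}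
    (hm : 3 * i + 2 ≤ P.nE σ + P.nE (σ * qq)) :
    EvCV P D pos [P.tv X σ (3*i), P.tv X σ (3*i+1), P.tv X σ (3*i+2), P.tv X (σ * s1) (3*i+2), P.tv X (σ * s1) (3*i+1), P.tv X (σ * s1) (3*i)] := by
  have hcv := hP.1 _ hok
  obtain ⟨hT, hB⟩ := hex_lad (P := P) (D := D) X h hcv
  obtain ⟨o1, o2⟩ := hok
  simp only at o1 o2
  have e1 : σ * s1 * (s2 * s1) = σ * (s2 * s1 * s2) := by
    simp only [mul_assoc]; rw [show s1 * (s2 * s1) = s2 * (s1 * s2) by decide]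
  have e2 : σ * s1 * s2 = σ * (s1 * s2) := by rw [mul_assoc]
  refine lad3 _ _ _ hm hT hB (hex_TTT X h o1 o2 ?_ hm) (hex_BBB X (s1_3 h) ?_ o2 ?_ ?_)
  · exact hcv _ _ _ (by simp [hexP])
  · rw [sg_mul, sg_s1]; linarith
  · rw [e1, e2]
    exact hcv _ _ _ (by simp only [hexP, List.map]; exact ((List.Sublist.refl _).cons _).cons _ |>.cons _)
  · show _ ≤ P.nE (σ * qq) + P.nE σ
    omega

theorem ev_hexAs (hP : D.PCV pos) (X : L) {σ : Wd} (h : σ 3 = 0) (hok : D.hexOK (X, σ)) {m : ℕ}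
    (hm : m + 1 ≤ P.nE σ + P.nE (σ * qq)) :
    EvCV P D pos [P.tv X σ m, P.tv X σ (m+1), P.tv X (σ * s1) (m+1), P.tv X (σ * s1) m] := by
  have hcv := hP.1 _ hok
  obtain ⟨hT, hB⟩ := hex_lad (P := P) (D := D) X h hcv
  exact lad2 _ _ _ hm hT hB

theorem ev_sqA (hP : D.PCV pos) (X : L) {σ : Wd} (h : σ 3 = 0) (hok : D.sqOK (X, σ)) {m : ℕ}
    (hm : m + 1 ≤ P.nE σ) :
    EvCV P D pos [P.tv X σ m, P.tv X σ (m+1), P.tv X (σ * s0) (m+1), P.tv X (σ * s0) m] := by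
  have hcv := hP.2 _ hok
  obtain ⟨hT, hB⟩ := sq_lad (P := P) (D := D) X h hcv
  exact lad2 _ _ _ hm hT hB

theorem ev_sqAh (hP : D.PCV pos) (X : L) {σ : Wd} (h : σ 3 = 0) (hok : D.sqOK (X, σ)) {j : ℕ}
    (hm : 3 * j + 1 + 2 ≤ P.nE σ) :
    EvCV P D pos [P.tv X σ (3*j+1), P.tv X σ (3*j+1+1), P.tv X σ (3*j+1+2), P.tv X (σ * s0) (3*j+1+2), P.tv X (σ * s0) (3*j+1+1), P.tv X (σ * s0) (3*j+1)] := by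
  have hcv := hP.2 _ hok
  obtain ⟨hT, hB⟩ := sq_lad (P := P) (D := D) X h hcv
  have hX0 := D.sqOK_ne hok
  obtain ⟨o1, o2⟩ := hok
  simp only at o1 o2 hX0
  have e2 : σ * s0 * s2 = σ * (s2 * s0) := by rw [mul_assoc, show s0 * s2 = s2 * s0 by decide]
  refine lad3 _ _ _ hm hT hB ?_ ?_
  · refine Ev_mid (Q := pos (vx X (σ * (s2 * s0)))) X h (ne_of_gt ?_) hm ?_
    · exact hcv _ _ _ (by simp [sqP])
    · rw [sj_20 hX0 o2 (by omega), o1]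
  · refine Ev_mid' (Q := pos (vx X σ)) X (s0_3 h) (ne_of_lt ?_) hm ?_
    · have := hcv (pos (vx X σ)) (pos (vx X (σ * (s2 * s0)))) (pos (vx X (σ * s0))) (by simp only [sqP, List.map]; exact ((List.Sublist.refl _).cons _).cons_cons _)
      rw [e2, ← det_rot, ← det_rot, ← det_rot, det_swap, ← det_rot, ← det_rot]
      first | linarith | (rw [det_rot]; linarith) | (rw [det_rot, det_rot]; linarith)
    · have o2' : D.sd (X + e ((σ * s0) 0) + e ((σ * s0) 1)) = - D.sd X := by
        rw [show (σ * s0) 0 = σ 1 from rfl, show (σ * s0) 1 = σ 0 from rfl, add_right_comm, o2]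
      rw [sj_20 hX0 o2' (by omega), sg_mul, sg_s0]
      linarith

theorem EvCV.rotn {l : List Vt} (h : EvCV P D pos l) (n : ℕ) : EvCV P D pos (l.rotate n) := by
  induction n with
  | zero => simpa using h
  | succ n ih =>
    rw [← List.rotate_rotate]
    cases hl : l.rotate n with
    | nil => rw [hl] at ih; simpa using ih
    | cons a r => rw [hl] at ih; simpa using ih.rot

theorem rot_eq3 (z : Vt) : hexP (eq3 z).1 (eq3 z).2 = (hexP z.1 z.2).rotate 2 := by
  show hexP z.1 (z.2 * (s2 * s1)) = _
  simp only [hexP, List.rotate_cons_succ, List.rotate_zero, List.cons_append, List.nil_append, mul_assoc]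
  rw [show s2 * (s1 * (s2 * s1)) = s1 * s2 by decide, show s2 * (s1 * (s2 * (s1 * s2))) = s1 by decide,
    show s2 * (s1 * (s1 * s2)) = 1 by decide, show s1 * s1 = 1 by decide]
  simp

theorem rot_hh (z : Vt) : sqP (hh z).1 (hh z).2 = (sqP z.1 z.2).rotate 1 := by
  have h2 := hh2 z
  have h3 : ∀ w : Vt, hh (w.1, w.2 * (s2 * s0)) = ((hh w).1, (hh w).2 * (s2 * s0)) := by
    intro w
    rw [← hh2, ← hh2]
  have a1 := vx_hh (hh (hh z))
  have a2 := vx_hh2 (hh (hh z))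
  have a3 : vx (hh z).1 ((hh z).2 * (s2 * s0)) = vx z.1 (z.2 * s0) := by
    rw [h2] at a1 a2
    rw [h3] at a1 
    simp only at a1
    rw [a1]; simp only [mul_assoc]; rw [show s2 * (s0 * s2) = s0 by decide]
  have a4 : vx (hh z).1 ((hh z).2 * s0) = vx z.1 z.2 := by
    rw [h2] at a2
    rw [h3] at a2
    simp only [mul_assoc] at a2
    rw [show s2 * (s0 * s2) = s0 by decide, show s2 * (s0 * (s2 * s0)) = 1 by decide, mul_one] at a2
    exact a2
  simp only [sqP, List.rotate_cons_succ, List.rotate_zero, List.cons_append, List.nil_append]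
  rw [vx_hh, vx_hh2, a3, a4]

theorem rrinv (τ : Wd) : ∃ σ : Wd, τ = rr * σ := ⟨rr⁻¹ * τ, by simp⟩

theorem rr3 {σ : Wd} {k : Fin 4} (h : (rr * σ) k = 1) : σ k = 0 := by
  rw [rr_ap'] at h
  have : ∀ x : Fin 4, x + 1 = 1 → x = 0 := by decide
  exact this _ h

theorem ev_hex3 (hP : D.PCV pos) {z : Vt} (h : (D.nx P).hexOK z) (h3 : z.2 3 = 1) : EvCV P D pos (hexP z.1 z.2) := by
  obtain ⟨x, τ⟩ := z
  obtain ⟨X, i, hi0, hi, rfl⟩ := P.exists_ch x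
  obtain ⟨σ, rfl⟩ := rrinv τ
  have hσ := rr3 h3
  lift i to ℕ using hi0
  have hs := P.gsum hσ
  rcases lt_or_ge (i + P.gn (σ 0) : ℤ) P.C with hl | hl
  · rw [hexA X hσ hl] at h
    simp only [hexP_tv]
    refine ev_hexA hP X hσ h ?_
    have : (σ * qq) 2 = σ 1 := rfl
    unfold nE; rw [this]; omega
  · obtain ⟨j, hj⟩ := Int.le.dest hl
    have hj' : (i + P.gn (σ 0) : ℤ) = j + P.C := by omega
    rw [hexB X hσ hi hj'] at h
    simp only [hexP_tvB X hσ hj']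
    refine ev_sqAh hP _ (qq3 (qq3 hσ)) h ?_
    have : (σ * qq * qq) 2 = σ 0 := rfl
    unfold nE; rw [this]; omega

theorem ev_sq3 (hP : D.PCV pos) {z : Vt} (h : (D.nx P).sqOK z) (h3 : z.2 3 = 1) : EvCV P D pos (sqP z.1 z.2) := by
  obtain ⟨x, τ⟩ := z
  obtain ⟨X, i, hi0, hi, rfl⟩ := P.exists_ch x
  obtain ⟨σ, rfl⟩ := rrinv τ
  have hσ := rr3 h3
  lift i to ℕ using hi0
  have hs := P.gsum hσ
  rcases le_or_gt i (P.gn (σ 2)) with hl | hl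
  · rw [sqA X hσ hl] at h
    simp only [sqP_tv]
    refine ev_sqA hP X hσ h ?_
    unfold nE; omega
  · obtain ⟨j, hj⟩ := Nat.exists_eq_add_of_le hl
    have hj' : i = P.gn (σ 2) + 1 + j := by omega
    rw [sqB X hσ hi hj'] at h
    simp only [sqP_tvB X hσ hj']
    refine ev_hexAs hP _ (qq3 hσ) h ?_
    have : (σ * qq) 2 = σ 1 := rfl
    have : (σ * qq * qq) 2 = σ 0 := rfl
    unfold nE; simp only [*]; omega

/-- the last subtile corner is an old vertex -/
theorem tv_last (X : L) {σ : Wd} (h : σ 0 = 0) : vx (P.ch X (P.C - 1)) (rr * σ) = P.tv (X + e 0) (σ * rr) 0 := by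
  have a : (rr * σ) 0 = 1 := by rw [rr_ap', h]; rfl
  rw [← vx_rot, a, ← P.ch_one, sub_add_cancel]
  have := P.ch_C X 0
  rw [zero_add] at this
  rw [this, mul_assoc]
  have := P.tv0 (X + e 0) (σ * rr) 0
  simpa using this.symm

theorem ps_last (η : ℝ) (X : L) {σ : Wd} (h : σ 0 = 0) : D.ps P pos η (vx (P.ch X (P.C - 1)) (rr * σ)) = pos (vx X σ) := by
  have h' : (σ * rr) 3 = 0 := h
  rw [tv_last X h, ps_tv P D pos η _ h' (Nat.zero_le _), dlt_zero, ← vx_rot X σ, h]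
  simp

theorem hex0_par {X : L} {σ : Wd} {i : ℤ} (hi0 : 0 ≤ i) (hi : i < P.C) (h : (D.nx P).hexOK (P.ch X i, rr * σ)) (h0 : σ 0 = 0) :
    i = P.C - 1 ∧ D.hexOK (X, σ) := by
  have hne := (D.nx P).hexOK_ne h
  obtain ⟨a, b⟩ := h
  simp only at a b hne
  rw [rr_ap', h0, show (0:Fin 4) + 1 = 1 from rfl, ← P.ch_one] at b
  rw [nx_sd, P.dl_ch X hi0 hi] at a hne
  rw [nx_sd, nx_sd, P.dl_ch X hi0 hi] at b
  rcases lt_or_ge (i + 1) P.C with hl | hl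
  · rw [P.dl_ch X (by omega) hl] at b; omega
  · have hi' : i = P.C - 1 := by omega
    refine ⟨hi', ?_⟩
    have := P.ch_C X 0
    rw [zero_add] at this
    rw [hi', sub_add_cancel, this, P.dl_ch _ le_rfl P.C_pos] at b
    rw [sg_rrm] at a
    exact ⟨by simp only; linarith, by simp only [h0]; linarith⟩

theorem EvCV.of_CV {l : List Vt} (f : Vt → Pt) (hf : ∀ η, ∀ v ∈ l, D.ps P pos η v = f v) (h : CV (l.map f)) : EvCV P D pos l := by
  intro a b c hs
  have hm := hs.subset
  simp only [List.cons_subset] at hm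
  unfold Ev
  refine Filter.Eventually.of_forall fun η => ?_
  rw [hf η a hm.1, hf η b hm.2.1, hf η c hm.2.2.1]
  exact h _ _ _ (by simpa using hs.map f)

theorem ev_hex (hP : D.PCV pos) {z : Vt} (h : (D.nx P).hexOK z) : EvCV P D pos (hexP z.1 z.2) := by
  have h1 := ((D.nx P).hexOK_3 z).2 h
  have h2 := ((D.nx P).hexOK_3 _).2 h1
  rcases perm_one z.2 with h0 | h0 | h0 | h0
  · obtain ⟨x, τ⟩ := z
    obtain ⟨X, i, hi0, hi, rfl⟩ := P.exists_ch x
    obtain ⟨σ, rfl⟩ := rrinv τ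
    have hσ := rr3 h0
    obtain ⟨rfl, hok⟩ := hex0_par hi0 hi h hσ
    have hcv := hP.1 _ hok
    have key : ∀ η, (hexP (P.ch X (P.C - 1)) (rr * σ)).map (D.ps P pos η) = (hexP X σ).map pos := by
      intro η
      simp only [hexP, List.map, mul_assoc]
      have hh : ∀ ρ : Wd, ρ 0 = 0 → D.ps P pos η (vx (P.ch X (P.C - 1)) (rr * (σ * ρ))) = pos (vx X (σ * ρ)) := by
        intro ρ hρ
        exact ps_last η X (by rw [Equiv.Perm.mul_apply, hρ, hσ])
      rw [ps_last η X hσ, hh _ (by decide), hh _ (by decide), hh _ (by decide), hh _ (by decide), hh _ (by decide)]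
    intro a b c hs
    unfold Ev
    refine Filter.Eventually.of_forall fun η => ?_
    simp only at hs hcv
    rw [← key η] at hcv
    exact hcv _ _ _ (by simpa using hs.map (D.ps P pos η))
  · have := ev_hex3 hP h2 h0
    have := this.rotn 2
    rw [rot_eq3, rot_eq3, List.rotate_rotate, List.rotate_rotate] at this
    simpa [hexP] using this
  · have := ev_hex3 hP h1 h0
    have := this.rotn 4
    rw [rot_eq3, List.rotate_rotate] at this
    simpa [hexP] using this
  · exact ev_hex3 hP h h0

theorem ev_sq (hP : D.PCV pos) {z : Vt} (h : (D.nx P).sqOK z) : EvCV P D pos (sqP z.1 z.2) := by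
  have h1 := (D.nx P).sqOK_hh z h
  have h2 := (D.nx P).sqOK_hh _ h1
  have h3 := (D.nx P).sqOK_hh _ h2
  rcases perm_one z.2 with h0 | h0 | h0 | h0
  · have := ev_sq3 hP h3 h0
    have := this.rotn 1
    rw [← rot_hh, hh4] at this
    exact this
  · have := ev_sq3 hP h1 h0
    have := this.rotn 3
    rw [rot_hh, List.rotate_rotate] at this
    simpa [sqP] using this
  · have := ev_sq3 hP h2 h0
    have := this.rotn 2
    rw [rot_hh, rot_hh, List.rotate_rotate, List.rotate_rotate] at this
    simpa [sqP] using this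
  · exact ev_sq3 hP h h0

end SD
end ABCT

set_option linter.all false

namespace ABCT
namespace SD
open Prm
variable {P : Prm} {D : SD} {pos : Vt → Pt}

theorem kt_cyc (u v w : ℤ) : kt u v w = kt w u v := by unfold kt; ring
theorem kp_neg (u v : ℤ) : kp (-u) (-v) = - kp u v := by
  unfold kp; split_ifs <;> omega
theorem kt_neg (u v w : ℤ) : kt (-u) (-v) (-w) = - kt u v w := by
  unfold kt; rw [kp_neg, kp_neg, kp_neg]; ring
theorem kp_self (u : ℤ) : kp u u = 0 := by unfold kp; split_ifs <;> omega
theorem kp_anti (u v : ℤ) : kp u v = - kp v u := by unfold kp; split_ifs <;> omega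
theorem kt_12 (u w : ℤ) : kt u u w = 0 := by unfold kt; rw [kp_self, kp_anti u w]; ring
theorem kt_23 (u w : ℤ) : kt u w w = 0 := by unfold kt; rw [kp_self, kp_anti u w]; ring

theorem vx_inj0 {x x' : L} {σ σ' : Wd} (h : σ 3 = 0) (h' : σ' 3 = 0) (hv : vx x σ = vx x' σ') : x' = x ∧ σ' = σ := by
  rcases vx_inj hv with ⟨a, b⟩ | ⟨a, b⟩ | ⟨a, b⟩ | ⟨a, b⟩
  · exact ⟨a, b⟩
  · rw [b] at h'; exact absurd (h'.trans h.symm) (ne03 σ)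
  · rw [b] at h'; exact absurd (h'.trans h.symm) (ne13 σ)
  · rw [b] at h'; exact absurd (h'.trans h.symm) (ne23 σ)

/-- child edges with last letter 1 are pieces of parent edges -/
theorem O_split {z : Vt} (h3 : z.2 3 = 1) : ∃ X σ j, σ 3 = 0 ∧ j + 1 ≤ P.nE σ ∧ ed z = (P.tv X σ j, P.tv X σ (j + 1)) ∧
    sg z.2 * (D.nx P).kap z = sg σ * D.kap (X, σ) := by
  obtain ⟨x, τ⟩ := z
  obtain ⟨X, i, hi0, hi, rfl⟩ := P.exists_ch x
  obtain ⟨σ, rfl⟩ := rrinv τ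
  have h := rr3 h3
  lift i to ℕ using hi0
  have hs := P.gsum h
  obtain ⟨h0, h1, h2⟩ := ne0 h
  have hed : ed (P.ch X i, rr * σ) = (P.tv X σ (3 * i), P.tv X σ (3 * i + 1)) := by
    rw [tv0, tv1]; rfl
  have hk : (D.nx P).kap (P.ch X i, rr * σ) = kt ((D.nx P).sd (P.ch X i)) ((D.nx P).sd (P.ch (X + e (σ 0)) (i + P.gn (σ 0) : ℕ)))
      ((D.nx P).sd (P.ch (X + e (σ 0) + e (σ 1)) (i + P.gn (σ 0) + P.gn (σ 1) : ℕ))) := by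
    unfold kap
    simp only
    rw [rr_ap', rr_ap', P.ch_add h0, P.ch_add h1, ← Nat.cast_add, ← Nat.cast_add]
  rw [hed, hk, nx_ch X hi]
  simp only
  rw [sg_rrm]
  rcases lt_or_ge (i + P.gn (σ 0) + P.gn (σ 1) : ℤ) P.C with hl | hl
  · refine ⟨X, σ, 3 * i, h, by unfold nE; omega, rfl, ?_⟩
    rw [nx_ch (X + e (σ 0)) (by push_cast; omega), nx_ch (X + e (σ 0) + e (σ 1)) (by push_cast; omega), kt_neg]
    unfold kap; ring
  · obtain ⟨j, hj⟩ := Int.le.dest hl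
    rw [ch_wrap (X + e (σ 0) + e (σ 1)) j (by push_cast; omega), x01 X h, nx_ch (X - e (σ 2)) (by omega)]
    rcases lt_or_ge (i + P.gn (σ 0) : ℤ) P.C with hl2 | hl2
    · refine ⟨X - e (σ 2), σ * qq, 3 * j + 2, qq3 h, ?_, ?_, ?_⟩
      · unfold nE; rw [qq_2]; omega
      · rw [← P.tv_R X h, ← P.tv_R X h]; congr 2 <;> unfold nE <;> omega
      · rw [nx_ch (X + e (σ 0)) (by push_cast; omega), kt_neg, kt_cyc, sg_mul, sg_qq]
        unfold kap
        simp only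
        rw [show (σ * qq) 0 = σ 2 from rfl, show (σ * qq) 1 = σ 0 from rfl, sub_add_cancel]; ring
    · obtain ⟨j2, hj2⟩ := Int.le.dest hl2
      rw [ch_wrap (X + e (σ 0)) j2 (by push_cast; omega), x0 X h, nx_ch (X - e (σ 2) - e (σ 1)) (by omega)]
      refine ⟨X - e (σ 2) - e (σ 1), σ * qq * qq, 3 * j2 + 1, qq3 (qq3 h), ?_, ?_, ?_⟩
      · unfold nE; rw [qq_2, show (σ * qq) 1 = σ 0 from rfl]; omega
      · rw [← tv_RR X h, ← tv_RR X h]; congr 2 <;> unfold nE <;> rw [qq_2] <;> omega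
      · rw [kt_neg, kt_cyc, kt_cyc, sg_mul, sg_mul, sg_qq]
        unfold kap
        simp only
        rw [show (σ * qq * qq) 0 = σ 1 from rfl, show (σ * qq * qq) 1 = σ 2 from rfl, sub_add_cancel, sub_add_cancel]; ring

/-- unsplit edges -/
theorem O_one {z : Vt} (h1 : z.2 1 = 1 ∨ z.2 0 = 1) (hz : (D.nx P).isO z) : ∃ Y ρ, D.isO (Y, ρ) ∧ ρ 3 ≠ 0 ∧ ρ 2 ≠ 0 ∧
    ∃ Y1 ρ1 Y2 ρ2, ρ1 3 = 0 ∧ ρ2 3 = 0 ∧ ed z = (P.tv Y1 ρ1 0, P.tv Y2 ρ2 0) ∧ vx Y1 ρ1 = vx Y ρ ∧ vx Y2 ρ2 = vx Y (ρ * s2) := by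
  have hk0 := (D.nx P).isO_ne hz
  obtain ⟨x, τ⟩ := z
  obtain ⟨X, i, hi0, hi, rfl⟩ := P.exists_ch x
  obtain ⟨σ, rfl⟩ := rrinv τ
  lift i to ℕ using hi0
  rcases h1 with h1 | h1
  · have h := rr3 h1
    have h0 : σ 0 ≠ 0 := fun h' => ne01 σ (h'.trans h.symm)
    have h2 : σ 2 ≠ 0 := fun h' => ne12 σ (h.trans h'.symm)
    have h3 : σ 3 ≠ 0 := fun h' => ne13 σ (h.trans h'.symm)
    have gC : (P.gn (σ 0) : ℤ) < P.C := by
      have := P.g_perm σ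
      rw [h, g_zero] at this
      rw [P.gn_cast h0]
      have := P.g_nonneg h2
      have := P.g_nonneg h3
      omega
    have hk : (D.nx P).kap (P.ch X i, rr * σ) = kt ((D.nx P).sd (P.ch X i)) ((D.nx P).sd (P.ch (X + e (σ 0)) (i + P.gn (σ 0) : ℕ)))
      ((D.nx P).sd (P.ch (X + e (σ 0)) (i + P.gn (σ 0) + 1 : ℕ))) := by
      unfold kap
      simp only
      rw [rr_ap', rr_ap', P.ch_add h0, h, show (0:Fin 4) + 1 = 1 from rfl, ← P.ch_one, ← Nat.cast_add, ← Nat.cast_succ]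
    rw [hk, nx_ch X hi] at hk0
    have hC : (i + P.gn (σ 0) + 1 : ℤ) = P.C := by
      rcases lt_trichotomy (i + P.gn (σ 0) + 1 : ℤ) P.C with hl | hl | hl
      · rw [nx_ch (X + e (σ 0)) (i := i + P.gn (σ 0)) (by push_cast; omega), nx_ch (X + e (σ 0)) (i := i + P.gn (σ 0) + 1) (by push_cast; omega), kt_23] at hk0
        exact absurd rfl hk0
      · exact hl
      · obtain ⟨j, hj⟩ := Int.le.dest (show P.C ≤ i + P.gn (σ 0) by omega)
        rw [ch_wrap (X + e (σ 0)) (j := i + P.gn (σ 0)) j (by push_cast; omega), ch_wrap (X + e (σ 0)) (j := i + P.gn (σ 0) + 1) (j + 1) (by push_cast; omega),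
          nx_ch (X + e (σ 0) + e 0) (i := j) (by omega),  nx_ch (X + e (σ 0) + e 0) (i := j + 1) (by push_cast; omega), kt_23] at hk0
        exact absurd rfl hk0
    have hpt : P.ch X i + e ((rr * σ) 0) + e ((rr * σ) 1) = P.ch (X + e (σ 0) + e 0) ((0:ℕ):ℤ) := by
      rw [rr_ap', rr_ap', P.ch_add h0, h, show (0:Fin 4) + 1 = 1 from rfl, ← P.ch_one, hC]
      have := P.ch_C (X + e (σ 0)) 0
      rw [zero_add] at this
      exact this
    refine ⟨X, σ, ?_, h3, h2, X + e (σ 0) + e 0, σ * rr * rr, X + e (σ 0) + e 0, σ * s2 * rr * rr, h, h, ?_, ?_, ?_⟩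
    · unfold isO at hz ⊢
      rw [hk, nx_ch X hi, nx_ch (X + e (σ 0)) (i := i + P.gn (σ 0)) (by push_cast; omega), ch_wrap (X + e (σ 0)) (j := i + P.gn (σ 0) + 1) 0 (by push_cast; omega),
        nx_ch (X + e (σ 0) + e 0) (by simpa using P.C_pos), kt_neg] at hz
      simp only at hz ⊢
      rw [sg_rrm] at hz
      unfold kap
      simp only
      rw [h]; linarith
    · unfold ed
      simp only
      have e1 := vx_rot2 (P.ch X i) (rr * σ)
      have e2 := vx_rot2 (P.ch X i) (rr * σ * s2)
      rw [show (rr * σ * s2) 0 = (rr * σ) 0 from rfl, show (rr * σ * s2) 1 = (rr * σ) 1 from rfl] at e2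
      rw [← e1, ← e2, hpt]
      have t1 := P.tv0 (X + e (σ 0) + e 0) (σ * rr * rr) 0
      have t2 := P.tv0 (X + e (σ 0) + e 0) (σ * s2 * rr * rr) 0
      rw [mul_zero] at t1 t2
      rw [t1, t2]; simp only [mul_assoc]
    · have := vx_rot2 X σ; rw [h] at this; exact this
    · have := vx_rot2 X (σ * s2)
      rw [show (σ * s2) 0 = σ 0 from rfl, show (σ * s2) 1 = σ 1 from rfl, h] at this; exact this
  · have h := rr3 h1
    have h0 : σ 1 ≠ 0 := fun h' => ne01 σ (h.trans h'.symm)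
    have h2 : σ 2 ≠ 0 := fun h' => ne02 σ (h.trans h'.symm)
    have h3 : σ 3 ≠ 0 := fun h' => ne03 σ (h.trans h'.symm)
    have gC : (P.gn (σ 1) : ℤ) < P.C := by
      have := P.g_perm σ
      rw [h, g_zero] at this
      rw [P.gn_cast h0]
      have := P.g_nonneg h2
      have := P.g_nonneg h3
      omega
    have hk : (D.nx P).kap (P.ch X i, rr * σ) = kt ((D.nx P).sd (P.ch X i)) ((D.nx P).sd (P.ch X (i + 1 : ℕ)))
      ((D.nx P).sd (P.ch (X + e (σ 1)) (i + 1 + P.gn (σ 1) : ℕ))) := by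
      unfold kap
      simp only
      rw [rr_ap', rr_ap', h, show (0:Fin 4) + 1 = 1 from rfl, ← P.ch_one, P.ch_add h0, ← Nat.cast_succ, ← Nat.cast_add]
    rw [hk, nx_ch X hi] at hk0
    have hC : (i + 1 : ℤ) = P.C := by
      rcases lt_or_ge (i + 1 : ℤ) P.C with hl | hl
      · rw [nx_ch X (i := i + 1) (by push_cast; omega), kt_12] at hk0
        exact absurd rfl hk0
      · omega
    have hiC : (i:ℤ) = P.C - 1 := by omega
    refine ⟨X, σ, ?_, h3, h2, X + e 0, σ * rr, X + e 0, σ * s2 * rr, h, h, ?_, ?_, ?_⟩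
    · unfold isO at hz ⊢
      rw [hk, nx_ch X hi, ch_wrap X (j := i + 1) 0 (by push_cast; omega), nx_ch (X + e 0) (by simpa using P.C_pos),
        ch_wrap (X + e (σ 1)) (j := i + 1 + P.gn (σ 1)) (P.gn (σ 1)) (by push_cast; omega), nx_ch (X + e (σ 1) + e 0) gC, kt_neg] at hz
      simp only at hz ⊢
      rw [sg_rrm] at hz
      unfold kap
      simp only
      rw [h, add_right_comm]; linarith
    · unfold ed
      simp only
      rw [hiC, tv_last X h, mul_assoc, tv_last X (σ := σ * s2) h]
    · have := vx_rot X σ; rw [h] at this; exact this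
    · have := vx_rot X (σ * s2)
      rw [show (σ * s2) 0 = σ 0 from rfl, h] at this; exact this

/-- hypotheses on the outer boundary -/
def PO (D : SD) (pos : Vt → Pt) : Prop := ∀ z, D.isO z → ∀ v, D.isR v → v ≠ (ed z).1 → v ≠ (ed z).2 → 0 < det (pos (ed z).1) (pos (ed z).2) (pos v)

theorem PO.nonneg (h : D.PO pos) {z : Vt} (hz : D.isO z) {v : Vt} (hv : D.isR v) : 0 ≤ det (pos (ed z).1) (pos (ed z).2) (pos v) := by
  by_cases h1 : v = (ed z).1
  · rw [h1, det_self1]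
  by_cases h2 : v = (ed z).2
  · rw [h2, det_self2]
  · exact (h z hz v hv h1 h2).le

theorem far (h : D.PO pos) {z : Vt} (hz : D.isO z) {Z : L} {ρ : Wd} {k : ℕ} (hρ : ρ 3 = 0) (hk : k < P.nE ρ)
    (hv : (D.nx P).isR (P.tv Z ρ k)) 
    (hn : ¬ ((vx Z ρ = (ed z).1 ∨ vx Z ρ = (ed z).2) ∧ (k = 0 ∨ vx Z (ρ * s2) = (ed z).1 ∨ vx Z (ρ * s2) = (ed z).2))) :
    0 < det (pos (ed z).1) (pos (ed z).2) (P.I.ip pos (P.tv Z ρ k)) := by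
  obtain ⟨r1, r2⟩ := nx_R P D hv
  rw [P.ea_tv Z hρ hk] at r1
  rw [P.ip_tv pos Z hρ hk.le]
  show 0 < det _ _ (lr _ _ _)
  rw [det_lr3]
  have n1 := h.nonneg hz r1
  have hkn : (k:ℝ) / P.nE ρ < 1 := by
    have : (k:ℝ) < P.nE ρ := by exact_mod_cast hk
    have h0 : (0:ℝ) < P.nE ρ := by have := P.nE_pos ρ; positivity
    rw [div_lt_one h0]; exact this
  rcases Nat.eq_zero_or_pos k with rfl | h0
  · simp only [Nat.cast_zero, zero_div, sub_zero, one_mul, zero_mul, add_zero]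
    simp only [true_or, and_true, not_or] at hn
    exact h z hz _ r1 hn.1 hn.2
  · rw [P.eb_tv Z hρ h0 hk] at r2
    have n2 := h.nonneg hz r2
    have hk0 : 0 < (k:ℝ) / P.nE ρ := by have := P.nE_pos ρ; positivity
    by_cases hA : vx Z ρ = (ed z).1 ∨ vx Z ρ = (ed z).2
    · have hB : ¬ (vx Z (ρ * s2) = (ed z).1 ∨ vx Z (ρ * s2) = (ed z).2) := fun hB => hn ⟨hA, Or.inr hB⟩
      simp only [not_or] at hB
      have := mul_pos hk0 (h z hz _ r2 hB.1 hB.2)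
      have := mul_nonneg (sub_nonneg.2 hkn.le) n1
      linarith
    · simp only [not_or] at hA
      have := mul_pos (sub_pos.2 hkn) (h z hz _ r1 hA.1 hA.2)
      have := mul_nonneg hk0.le n2
      linarith

theorem near_S {X : L} {σ : Wd} (h : σ 3 = 0) {Z : L} {ρ : Wd} {k : ℕ} (hρ : ρ 3 = 0) (hk : k < P.nE ρ)
    (hn : ((vx Z ρ = vx X σ ∨ vx Z ρ = vx X (σ * s2)) ∧ (k = 0 ∨ vx Z (ρ * s2) = vx X σ ∨ vx Z (ρ * s2) = vx X (σ * s2)))) :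
    ∃ k', k' ≤ P.nE σ ∧ P.tv Z ρ k = P.tv X σ k' := by
  have hne : s2 ≠ 1 := by decide
  obtain ⟨h1 | h1, h2⟩ := hn
  · obtain ⟨rfl, rfl⟩ := vx_inj0 hρ h h1
    exact ⟨k, hk.le, rfl⟩
  · rcases h2 with rfl | h2 | h2
    · rw [← vx_qq] at h1
      obtain ⟨a, b⟩ := vx_inj0 hρ (qq3 h) h1
      refine ⟨P.nE σ, le_rfl, ?_⟩
      rw [P.tv_n X h, a, b]
    · have h2' : vx Z (ρ * s2) = vx X (σ * s2 * s2) := by rw [h2, mul_assoc, s22, mul_one]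
      obtain ⟨a, b⟩ := edge_inj h1 h2'
      rw [b] at hρ
      have : σ 2 = 0 := hρ
      exact absurd (this.trans h.symm) (ne23 σ)
    · rw [← h1] at h2
      have := vx_inj' h2
      exact absurd (by simpa using this) hne

set_option maxHeartbeats 1000000 in
theorem ev_O (h : D.PO pos) (hQ : ∀ z, D.isO z → ∃ Q, det (pos (ed z).1) (pos (ed z).2) Q ≠ 0) {z : Vt} (hz : (D.nx P).isO z) {v : Vt} (hv : (D.nx P).isR v)
    (h1 : v ≠ (ed z).1) (h2 : v ≠ (ed z).2) : D.Ev P pos (ed z).1 (ed z).2 v := by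
  obtain ⟨Z, ρ, k, hρ, hk, rfl⟩ := P.exists_tv hv.1
  have hU : z.2 1 = 1 ∨ z.2 0 = 1 → D.Ev P pos (ed z).1 (ed z).2 (P.tv Z ρ k) := by
    intro hu
    obtain ⟨Y, τ, ho, t3, t2, Y1, ρ1, Y2, ρ2, hρ1, hρ2, he, e1, e2⟩ := O_one hu hz
    rw [he] at h1 h2 ⊢
    simp only at h1 h2 ⊢
    apply Ev.of_zero
    rw [P.ip_tv pos Y1 hρ1 (Nat.zero_le _), P.ip_tv pos Y2 hρ2 (Nat.zero_le _)]
    simp only [Nat.cast_zero, zero_div, sub_zero, one_smul, zero_smul, add_zero, e1, e2]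
    refine far h ho hρ hk hv ?_
    have he' : ed (Y, τ) = (vx Y τ, vx Y (τ * s2)) := rfl
    rw [he']
    rintro ⟨a, b⟩
    simp only at a b
    have hne : s2 ≠ 1 := by decide
    rcases Nat.eq_zero_or_pos k with rfl | h0
    · rcases a with a | a
      · rw [← e1] at a
        obtain ⟨a, b⟩ := vx_inj0 hρ1 hρ a.symm
        rw [a, b] at h1; exact h1 rfl
      · rw [← e2] at a
        obtain ⟨a, b⟩ := vx_inj0 hρ2 hρ a.symm
        rw [a, b] at h2; exact h2 rfl
    · have b' := b.resolve_left (by omega)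
      rcases a with a | a <;> rcases b' with b' | b'
      · rw [← a] at b'; exact hne (by simpa using vx_inj' b')
      · obtain ⟨x, y⟩ := edge_inj a b'
        rw [y] at hρ; exact t3 hρ
      · have h2' : vx Z (ρ * s2) = vx Y (τ * s2 * s2) := by rw [b', mul_assoc, s22, mul_one]
        obtain ⟨x, y⟩ := edge_inj a h2'
        rw [y] at hρ; exact t2 hρ
      · rw [← a] at b'; exact hne (by simpa using vx_inj' b')
  have hsj : ∀ (X : L) (σ : Wd), D.kap (X, σ) ≠ 0 → ∀ j, D.sj (X, σ) j = sg σ * D.kap (X, σ) := by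
    intro X σ hk0 j
    unfold sj; rw [if_pos hk0]
  rcases perm_one z.2 with h0 | h0 | h0 | h0
  · exact hU (Or.inr h0)
  · exact hU (Or.inl h0)
  · obtain ⟨X, σ, j, hσ, hj, he, hsg⟩ := O_split (P := P) (D := D) (z := (z.1, z.2 * s2)) h0
    simp only at hsg
    have hk2 : (D.nx P).kap (z.1, z.2 * s2) = (D.nx P).kap z := (D.nx P).kap_s2 _ _
    rw [hk2, sg_mul, sg_s2] at hsg
    have hz' : sg z.2 * (D.nx P).kap z = 1 := hz
    have hkk : sg σ * D.kap (X, σ) = -1 := by linarith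
    have ho : D.isO (X, σ * s2) := by unfold isO; simp only; rw [D.kap_s2, sg_mul, sg_s2]; linarith
    have he2 : ed z = (P.tv X σ (j + 1), P.tv X σ j) := by
      have a := congrArg Prod.fst he
      have b := congrArg Prod.snd he
      unfold ed at a b ⊢
      simp only [mul_assoc, s22, mul_one] at a b ⊢
      rw [a, b]
    have heo : ed (X, σ * s2) = (vx X (σ * s2), vx X σ) := by unfold ed; simp only [mul_assoc, s22, mul_one]
    rw [he2] at h1 h2 ⊢
    simp only at h1 h2 ⊢
    by_cases hn : ((vx Z ρ = vx X σ ∨ vx Z ρ = vx X (σ * s2)) ∧ (k = 0 ∨ vx Z (ρ * s2) = vx X σ ∨ vx Z (ρ * s2) = vx X (σ * s2)))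
    · obtain ⟨k', hk', hke⟩ := near_S hσ hρ hk hn
      rw [hke] at h1 h2 ⊢
      obtain ⟨Q, hQ'⟩ := hQ _ ho
      rw [heo] at hQ'
      simp only at hQ'
      refine Ev_out' (Q := Q) X hσ ?_ hj hk' (fun hh => h2 (by rw [hh])) (fun hh => h1 (by rw [hh])) ?_
      · rw [det_swap]; simpa using hQ'
      · intro j; rw [hsj, hkk]; intro h0; rw [h0] at hkk; simp at hkk
    · have := far h ho hρ hk hv (by rw [heo]; exact fun hh => hn ⟨hh.1.symm, hh.2.imp id Or.symm⟩)
      rw [heo] at this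
      simp only at this
      apply Ev.of_zero
      rw [P.ip_tv pos X hσ hj, P.ip_tv pos X hσ (m := j) (by omega)]
      show 0 < det (lr _ _ _) (lr _ _ _) _
      rw [det_lr_same, det_swap]
      have := mul_pos (sub_pos.2 (frac_lt (Nat.lt_succ_self j) hj)) this
      linarith
  · obtain ⟨X, σ, j, hσ, hj, he, hsg⟩ := O_split (P := P) (D := D) (z := z) h0
    have hz' : sg z.2 * (D.nx P).kap z = 1 := hz
    have hkk : sg σ * D.kap (X, σ) = 1 := by linarith
    have ho : D.isO (X, σ) := hkk
    have heo : ed (X, σ) = (vx X σ, vx X (σ * s2)) := rfl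
    rw [he] at h1 h2 ⊢
    simp only at h1 h2 ⊢
    by_cases hn : ((vx Z ρ = vx X σ ∨ vx Z ρ = vx X (σ * s2)) ∧ (k = 0 ∨ vx Z (ρ * s2) = vx X σ ∨ vx Z (ρ * s2) = vx X (σ * s2)))
    · obtain ⟨k', hk', hke⟩ := near_S hσ hρ hk hn
      rw [hke] at h1 h2 ⊢
      obtain ⟨Q, hQ'⟩ := hQ _ ho
      refine Ev_out (Q := Q) X hσ hQ' hj hk' (fun hh => h1 (by rw [hh])) (fun hh => h2 (by rw [hh])) ?_
      intro j; rw [hsj, hkk]; intro h0; rw [h0] at hkk; simp at hkk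
    · have := far h ho hρ hk hv (by rw [heo]; exact hn)
      rw [heo] at this
      simp only at this
      apply Ev.of_zero
      rw [P.ip_tv pos X hσ hj, P.ip_tv pos X hσ (m := j) (by omega)]
      show 0 < det (lr _ _ _) (lr _ _ _) _
      rw [det_lr_same]
      exact mul_pos (sub_pos.2 (frac_lt (Nat.lt_succ_self j) hj)) this

end SD
end ABCT

set_option linter.all false

namespace ABCT
namespace SD
open Prm Filter Topology
variable {P : Prm} {D : SD} {pos : Vt → Pt}

theorem Drawn_PCV {hc : D.Conn} (h : Drawn (D.cx hc) pos) : D.PCV pos :=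
  ⟨fun z hz => h.hT (true, z) (D.mem_Fl.2 hz), fun z hz => h.hT (false, z) (D.mem_Fl.2 hz)⟩

theorem Drawn_PO {hc : D.Conn} (h : Drawn (D.cx hc) pos) : D.PO pos :=
  fun z hz v hv h1 h2 => h.hO (ed z) (D.mem_O.2 ⟨z, hz, rfl⟩) v (D.mem_RV.2 hv) h1 h2

theorem pol_three (φ : Fg) : ∃ a b c, [a, b, c].Sublist (pol φ) := by
  obtain ⟨b, x, σ⟩ := φ
  cases b
  · exact ⟨_, _, _, List.Sublist.cons_cons _ (List.Sublist.cons_cons _ (List.Sublist.cons_cons _ (List.nil_sublist _)))⟩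
  · exact ⟨_, _, _, List.Sublist.cons_cons _ (List.Sublist.cons_cons _ (List.Sublist.cons_cons _ (List.nil_sublist _)))⟩

theorem Drawn_Q {hc : D.Conn} (h : Drawn (D.cx hc) pos) : ∀ z, D.isO z → ∃ Q, det (pos (ed z).1) (pos (ed z).2) Q ≠ 0 := by
  intro z hz
  obtain ⟨hR, _⟩ := D.isR_kap (D.isO_ne hz)
  obtain ⟨φ, hφ, hv⟩ := D.isR_flag hR
  obtain ⟨a, b, c, hs⟩ := pol_three φ
  have hCV := h.hT φ (D.mem_Fl.2 hφ)
  have hd := hCV (pos a) (pos b) (pos c) (hs.map pos)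
  have hm := hs.subset
  have ma := D.OK_isR hφ (hm (show a ∈ [a,b,c] by simp))
  have mb := D.OK_isR hφ (hm (show b ∈ [a,b,c] by simp))
  have mc := D.OK_isR hφ (hm (show c ∈ [a,b,c] by simp))
  have hab : a ≠ b := by rintro rfl; simp [det] at hd
  have hac : a ≠ c := by rintro rfl; simp [det] at hd
  have hbc : b ≠ c := by rintro rfl; rw [show det (pos a) (pos b) (pos b) = 0 by unfold det; ring] at hd; exact lt_irrefl _ hd
  have hPO := Drawn_PO h z hz
  by_contra hcon
  push Not at hcon
  have key : ∀ v, D.isR v → v = (ed z).1 ∨ v = (ed z).2 := by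
    intro v hv
    by_contra hh
    push Not at hh
    exact (hPO v hv hh.1 hh.2).ne' (hcon _)
  rcases key a ma with h1 | h1 <;> rcases key b mb with h2 | h2 <;> rcases key c mc with h3 | h3 <;>
    first
    | exact hab (h1.trans h2.symm)
    | exact hac (h1.trans h3.symm)
    | exact hbc (h2.trans h3.symm)

theorem hstep (hc : D.Conn) (hc' : (D.nx P).Conn) (pos : Vt → Pt) (h : Drawn (D.cx hc) pos) (ε : ℝ) (hε : 0 < ε) :
    ∃ pos', Drawn ((D.nx P).cx hc') pos' ∧ (∀ v ∈ ((D.nx P).cx hc').RV, dist (pos' v) (P.I.ip pos v) ≤ ε ∧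
      (P.I.tt v = 0 → pos' v = pos (P.I.ea v))) := by
  have hP := Drawn_PCV h
  have hO := Drawn_PO h
  have hQ := Drawn_Q h
  have e1 : ∀ᶠ η in 𝓝[>] (0:ℝ), ∀ φ ∈ (D.nx P).Fl, CV ((pol φ).map (D.ps P pos η)) := by
    rw [Filter.eventually_all_finset]
    rintro ⟨b, z⟩ hφ
    rw [mem_Fl] at hφ
    cases b
    · exact (ev_sq hP (z := z) hφ).ev
    · exact (ev_hex hP (z := z) hφ).ev
  have e2 : ∀ᶠ η in 𝓝[>] (0:ℝ), ∀ o ∈ (D.nx P).O, ∀ v ∈ (D.nx P).RV, v ≠ o.1 → v ≠ o.2 →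
      0 < det (D.ps P pos η o.1) (D.ps P pos η o.2) (D.ps P pos η v) := by
    rw [Filter.eventually_all_finset]
    intro o ho
    rw [Filter.eventually_all_finset]
    intro v hv
    rw [mem_RV] at hv
    obtain ⟨z, hz, rfl⟩ := (D.nx P).mem_O.1 ho
    by_cases h1 : v = (ed z).1
    · exact Filter.Eventually.of_forall fun η h' => absurd h1 h'
    by_cases h2 : v = (ed z).2
    · exact Filter.Eventually.of_forall fun η _ h' => absurd h2 h'
    have := ev_O hO hQ hz hv h1 h2
    filter_upwards [this] with η hη _ _
    exact hη
  have e3 : ∀ᶠ η in 𝓝[>] (0:ℝ), ∀ v ∈ (D.nx P).RV, dist (D.ps P pos η v) (P.I.ip pos v) ≤ ε := by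
    rw [Filter.eventually_all_finset]
    intro v hv
    have := (D.ps_cont P pos v).continuousAt (x := 0)
    have h2 := Metric.continuousAt_iff'.1 this ε hε
    rw [ps_zero] at h2
    filter_upwards [nhdsWithin_le_nhds h2] with η hη
    exact hη.le
  obtain ⟨η, h1, h2, h3⟩ := (e1.and (e2.and e3)).exists
  refine ⟨D.ps P pos η, ⟨h1, h2⟩, fun v hv => ⟨h3 v hv, fun h0 => ?_⟩⟩
  exact D.ps_old P pos η ((D.nx P).mem_RV.1 hv).1 h0

end SD
end ABCT

set_option linter.all false

namespace ABCT
namespace SD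
open Prm
variable {P : Prm} {D : SD} {S : Vt → Prop}

/-- S is constant on the polygons -/
def KS (D : SD) (S : Vt → Prop) : Prop := ∀ ψ, D.OK ψ → ∀ u ∈ pol ψ, ∀ v ∈ pol ψ, S u → S v

theorem KS.h {D : SD} (h : KS D S) {z : Vt} (hz : D.hexOK z) {u v : Vt} (hu : u ∈ hexP z.1 z.2) (hv : v ∈ hexP z.1 z.2) : S u ↔ S v :=
  ⟨h (true, z) hz u hu v hv, h (true, z) hz v hv u hu⟩
theorem KS.s {D : SD} (h : KS D S) {z : Vt} (hz : D.sqOK z) {u v : Vt} (hu : u ∈ sqP z.1 z.2) (hv : v ∈ sqP z.1 z.2) : S u ↔ S v :=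
  ⟨h (false, z) hz u hu v hv, h (false, z) hz v hv u hu⟩

theorem qqq (σ : Wd) : σ * qq * qq * qq = σ := by
  simp only [mul_assoc]; rw [show qq * (qq * qq) = 1 by decide, mul_one]

theorem hexLad (hS : KS (D.nx P) S) (X : L) {σ : Wd} (h : σ 3 = 0) (hok : D.hexOK (X, σ)) (m : ℕ)
    (hm : m ≤ P.nE σ + P.nE (σ * qq)) :
    (S (P.tv X σ m) ↔ S (P.tv X σ 0)) ∧ (S (P.tv X (σ * s1) m) ↔ S (P.tv X σ 0)) := by
  have hs := P.gsum h
  have e1 : P.nE σ + P.nE (σ * qq) = 3 * (P.gn (σ 2) + P.gn (σ 1)) + 2 := by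
    unfold nE; rw [show (σ * qq) 2 = σ 1 from rfl]; ring
  rw [e1] at hm
  have fA : ∀ i, i ≤ P.gn (σ 2) + P.gn (σ 1) → ∀ u v, u ∈ hexP (P.ch X i) (rr * σ) → v ∈ hexP (P.ch X i) (rr * σ) → (S u ↔ S v) := by
    intro i hi u v hu hv
    have := (hexA (P := P) (D := D) X h (i := i) (by omega)).2 hok
    exact hS.h this hu hv
  have fB : ∀ j, j + 1 ≤ P.gn (σ 2) + P.gn (σ 1) → ∀ u v, 
      u ∈ [P.tv X σ (3*j+2), P.tv X σ (3*j+2+1), P.tv X (σ * s1) (3*j+2+1), P.tv X (σ * s1) (3*j+2)] → 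
      v ∈ [P.tv X σ (3*j+2), P.tv X σ (3*j+2+1), P.tv X (σ * s1) (3*j+2+1), P.tv X (σ * s1) (3*j+2)] → (S u ↔ S v) := by
    intro j hj u v hu hv
    have h' : (σ * qq * qq) 3 = 0 := qq3 (qq3 h)
    have a2 : (σ * qq * qq) 2 = σ 0 := rfl
    have hx : X + e (σ 0) - e ((σ * qq * qq) 2) = X := by rw [a2, add_sub_cancel_right]
    have b := sqB (P := P) (D := D) (X + e (σ 0)) h' (i := P.gn (σ 0) + 1 + j) (j := j) (by push_cast; omega) (by rw [a2])
    have p := sqP_tvB (P := P) (X + e (σ 0)) h' (i := P.gn (σ 0) + 1 + j) (j := j) (by rw [a2])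
    rw [hx, qqq] at b p
    refine hS.s (b.2 hok) ?_ ?_
    · simp only [p]; exact hu
    · simp only [p]; exact hv
  induction m with
  | zero =>
    refine ⟨Iff.rfl, fA 0 (by omega) _ _ ?_ ?_⟩ <;> rw [hexP_tv] <;> simp
  | succ m ih =>
    obtain ⟨i1, i2⟩ := ih (by omega)
    obtain ⟨i, rfl | rfl | rfl⟩ := mod3 m
    · have f := fA i (by omega)
      rw [hexP_tv] at f
      exact ⟨(f _ _ (by simp) (by simp)).trans i1, (f _ _ (by simp) (by simp)).trans i1⟩
    · have f := fA i (by omega)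
      rw [hexP_tv] at f
      exact ⟨(f _ _ (by simp) (by simp)).trans i1, (f _ _ (by simp) (by simp)).trans i1⟩
    · have f := fB i (by omega)
      exact ⟨(f _ _ (by simp) (by simp)).trans i1, (f _ _ (by simp) (by simp)).trans i1⟩

theorem sqLad (hS : KS (D.nx P) S) (X : L) {σ : Wd} (h : σ 3 = 0) (hok : D.sqOK (X, σ)) (m : ℕ)
    (hm : m ≤ P.nE σ) :
    (S (P.tv X σ m) ↔ S (P.tv X σ 0)) ∧ (S (P.tv X (σ * s0) m) ↔ S (P.tv X σ 0)) := by
  have hs := P.gsum h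
  have e1 : P.nE σ = 3 * P.gn (σ 2) + 1 := rfl
  rw [e1] at hm
  have fA : ∀ i, i ≤ P.gn (σ 2) → ∀ u v, u ∈ sqP (P.ch X i) (rr * σ) → v ∈ sqP (P.ch X i) (rr * σ) → (S u ↔ S v) := by
    intro i hi u v hu hv
    have := (sqA (P := P) (D := D) X h (i := i) (by omega)).2 hok
    exact hS.s this hu hv
  have fB : ∀ j, j + 1 ≤ P.gn (σ 2) → ∀ u v, 
      u ∈ [P.tv X σ (3*j+1), P.tv X σ (3*j+1+1), P.tv X σ (3*j+1+2), P.tv X (σ * s0) (3*j+1+2), P.tv X (σ * s0) (3*j+1+1), P.tv X (σ * s0) (3*j+1)] → 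
      v ∈ [P.tv X σ (3*j+1), P.tv X σ (3*j+1+1), P.tv X σ (3*j+1+2), P.tv X (σ * s0) (3*j+1+2), P.tv X (σ * s0) (3*j+1+1), P.tv X (σ * s0) (3*j+1)] → (S u ↔ S v) := by
    intro j hj u v hu hv
    have h' : (σ * qq) 3 = 0 := qq3 h
    have a2 : (σ * qq) 2 = σ 1 := rfl
    have a1 : (σ * qq) 1 = σ 0 := rfl
    have a0 : (σ * qq) 0 = σ 2 := rfl
    have hx : X + e (σ 0) + e (σ 1) - e ((σ * qq) 2) - e ((σ * qq) 1) = X := by rw [a2, a1]; abel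
    have b := hexB (P := P) (D := D) (X + e (σ 0) + e (σ 1)) h' (i := P.gn (σ 0) + P.gn (σ 1) + 1 + j) (j := j) (by push_cast; omega)
      (by rw [a0]; push_cast; omega)
    have p := hexP_tvB (P := P) (X + e (σ 0) + e (σ 1)) h' (i := P.gn (σ 0) + P.gn (σ 1) + 1 + j) (j := j)
      (by rw [a0]; push_cast; omega)
    rw [hx, qqq] at b p
    refine hS.h (b.2 hok) ?_ ?_
    · simp only [p]; exact hu
    · simp only [p]; exact hv
  induction m with
  | zero =>
    refine ⟨Iff.rfl, fA 0 (by omega) _ _ ?_ ?_⟩ <;> rw [sqP_tv] <;> simp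
  | succ m ih =>
    obtain ⟨i1, i2⟩ := ih (by omega)
    obtain ⟨i, rfl | rfl | rfl⟩ := mod3 m
    · have f := fA i (by omega)
      rw [sqP_tv] at f
      exact ⟨(f _ _ (by simp) (by simp)).trans i1, (f _ _ (by simp) (by simp)).trans i1⟩
    · have f := fB i (by omega)
      exact ⟨(f _ _ (by simp) (by simp)).trans i1, (f _ _ (by simp) (by simp)).trans i1⟩
    · have f := fB i (by omega)
      exact ⟨(f (P.tv X σ (3*i+1+2)) (P.tv X σ (3*i+1+1)) (by simp) (by simp)).trans i1, (f (P.tv X (σ * s0) (3*i+1+2)) (P.tv X σ (3*i+1+1)) (by simp) (by simp)).trans i1⟩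

/-- transfer to the parents -/
def Sp (P : Prm) (S : Vt → Prop) (w : Vt) : Prop := ∀ X σ, σ 3 = 0 → w = vx X σ → S (P.tv X σ 0)

theorem Sp_vx (X : L) {σ : Wd} (h : σ 3 = 0) : Sp P S (vx X σ) ↔ S (P.tv X σ 0) := by
  constructor
  · intro hS; exact hS X σ h rfl
  · intro hS Y τ hτ he
    obtain ⟨rfl, rfl⟩ := vx_inj0 h hτ he
    exact hS

theorem s1_nE (σ : Wd) : P.nE (σ * s1) + P.nE (σ * s1 * qq) = P.nE σ + P.nE (σ * qq) := by
  unfold nE; rw [show (σ * s1 * qq) 2 = σ 2 from rfl, show (σ * s1) 2 = σ 1 from rfl, show (σ * qq) 2 = σ 1 from rfl]; ring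

theorem Sp_hex3 (hS : KS (D.nx P) S) {X : L} {σ : Wd} (h : σ 3 = 0) (hok : D.hexOK (X, σ)) {w : Vt} (hw : w ∈ hexP X σ) :
    Sp P S w ↔ S (P.tv X σ 0) := by
  have lad := hexLad hS X h hok
  have key : ∀ τ : Wd, τ 3 = 0 → (∀ m ≤ P.nE τ + P.nE (τ * qq), S (P.tv X τ m) ↔ S (P.tv X σ 0)) → 
      (Sp P S (vx X τ) ↔ S (P.tv X σ 0)) ∧ (Sp P S (vx X (τ * s2)) ↔ S (P.tv X σ 0)) ∧ (Sp P S (vx X (τ * (s2 * s1))) ↔ S (P.tv X σ 0)) := by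
    intro τ hτ f
    refine ⟨?_, ?_, ?_⟩
    · rw [Sp_vx X hτ]; exact f 0 (by omega)
    · rw [← vx_qq, Sp_vx _ (qq3 hτ), ← P.tv_n X hτ]; exact f _ (by omega)
    · have := f (0 + P.nE (τ * qq) + P.nE τ) (by omega)
      rw [tv_RR X hτ] at this
      rw [← vx_qq2, show σ = σ from rfl, ← vx_qq, Sp_vx _ (qq3 (qq3 hτ))]
      exact this
  have k1 := key σ h (fun m hm => (lad m hm).1)
  have k2 := key (σ * s1) h (fun m hm => (lad m (by rw [s1_nE] at hm; exact hm)).2)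
  simp only [mul_assoc] at k2
  simp only [hexP, List.mem_cons, List.not_mem_nil, or_false] at hw
  rcases hw with rfl | rfl | rfl | rfl | rfl | rfl
  · exact k1.1
  · exact k1.2.1
  · exact k1.2.2
  · rw [mul_assoc s2, show s2 * (s1 * s2) = s1 * (s2 * s1) by decide]; exact k2.2.2
  · exact k2.2.1
  · exact k2.1

theorem Sp_sq3 (hS : KS (D.nx P) S) {X : L} {σ : Wd} (h : σ 3 = 0) (hok : D.sqOK (X, σ)) {w : Vt} (hw : w ∈ sqP X σ) :
    Sp P S w ↔ S (P.tv X σ 0) := by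
  have lad := sqLad hS X h hok
  have key : ∀ τ : Wd, τ 3 = 0 → (∀ m ≤ P.nE τ, S (P.tv X τ m) ↔ S (P.tv X σ 0)) → 
      (Sp P S (vx X τ) ↔ S (P.tv X σ 0)) ∧ (Sp P S (vx X (τ * s2)) ↔ S (P.tv X σ 0)) := by
    intro τ hτ f
    refine ⟨?_, ?_⟩
    · rw [Sp_vx X hτ]; exact f 0 (by omega)
    · rw [← vx_qq, Sp_vx _ (qq3 hτ), ← P.tv_n X hτ]; exact f _ (by omega)
  have k1 := key σ h (fun m hm => (lad m hm).1)
  have k2 := key (σ * s0) h (fun m hm => (lad m hm).2)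
  simp only [sqP, List.mem_cons, List.not_mem_nil, or_false] at hw
  rcases hw with rfl | rfl | rfl | rfl
  · exact k1.1
  · exact k1.2
  · rw [show s2 * s0 = s0 * s2 by decide, ← mul_assoc]; exact k2.2
  · exact k2.1

theorem Sp_hex (hS : KS (D.nx P) S) {z : Vt} (h : D.hexOK z) : ∃ b : Prop, ∀ w ∈ hexP z.1 z.2, (Sp P S w ↔ b) := by
  have h1 := (D.hexOK_3 z).2 h
  have h2 := (D.hexOK_3 _).2 h1
  rcases perm_zero z.2 with h0 | h0 | h0 | h0
  · obtain ⟨X, σ⟩ := z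
    have hok : (D.nx P).hexOK (P.ch X (P.C - 1), rr * σ) := by
      have hp := P.C_pos
      have a : (rr * σ) 0 = 1 := by rw [rr_ap', h0]; rfl
      refine ⟨?_, ?_⟩
      · show (D.nx P).sd (P.ch X (P.C - 1)) * sg (rr * σ) = -1
        rw [nx_sd, P.dl_ch X (by omega) (by omega), sg_rrm]
        have := h.1; simp only at this; linarith
      · show (D.nx P).sd (P.ch X (P.C - 1) + e ((rr * σ) 0)) = - (D.nx P).sd (P.ch X (P.C - 1))
        rw [a, ← P.ch_one, sub_add_cancel]
        have := P.ch_C X 0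
        rw [zero_add] at this
        rw [this, nx_sd, nx_sd, P.dl_ch X (by omega) (by omega), P.dl_ch _ (by omega) (by omega)]
        have := h.2
        simp only [show σ 0 = 0 from h0] at this
        rw [this]
    have conv : ∀ ρ : Wd, ρ 0 = 0 → (Sp P S (vx X (σ * ρ)) ↔ S (vx (P.ch X (P.C - 1)) (rr * σ * ρ))) := by
      intro ρ hρ
      have h00 : (σ * ρ) 0 = 0 := by rw [Equiv.Perm.mul_apply, hρ]; exact h0
      rw [mul_assoc, tv_last X h00, ← vx_rot, h00, Sp_vx]
      exact h00
    have c1 := conv 1 rfl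
    rw [mul_one, mul_one] at c1
    refine ⟨S (vx (P.ch X (P.C - 1)) (rr * σ)), fun w hw => ?_⟩
    have fin : ∀ w', w' ∈ hexP (P.ch X (P.C - 1)) (rr * σ) → (S w' ↔ S (vx (P.ch X (P.C - 1)) (rr * σ))) :=
      fun w' hw' => hS.h hok hw' (by simp [hexP])
    simp only [hexP, List.mem_cons, List.not_mem_nil, or_false] at hw fin
    rcases hw with rfl | rfl | rfl | rfl | rfl | rfl
    · exact c1
    · rw [conv _ (by decide)]; exact fin _ (by simp)
    · rw [conv _ (by decide)]; exact fin _ (by simp)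
    · rw [conv _ (by decide)]; exact fin _ (by simp)
    · rw [conv _ (by decide)]; exact fin _ (by simp)
    · rw [conv _ (by decide)]; exact fin _ (by simp)
  · refine ⟨_, fun w hw => Sp_hex3 hS (X := (eq3 (eq3 z)).1) (σ := (eq3 (eq3 z)).2) h0 h2 ?_⟩
    rw [rot_eq3, rot_eq3, List.mem_rotate, List.mem_rotate]; exact hw
  · refine ⟨_, fun w hw => Sp_hex3 hS (X := (eq3 z).1) (σ := (eq3 z).2) h0 h1 ?_⟩
    rw [rot_eq3, List.mem_rotate]; exact hw
  · exact ⟨_, fun w hw => Sp_hex3 hS h0 h hw⟩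

theorem Sp_sq (hS : KS (D.nx P) S) {z : Vt} (h : D.sqOK z) : ∃ b : Prop, ∀ w ∈ sqP z.1 z.2, (Sp P S w ↔ b) := by
  have h1 := D.sqOK_hh z h
  have h2 := D.sqOK_hh _ h1
  have h3 := D.sqOK_hh _ h2
  rcases perm_zero z.2 with h0 | h0 | h0 | h0
  · refine ⟨_, fun w hw => Sp_sq3 hS (X := (hh (hh (hh z))).1) (σ := (hh (hh (hh z))).2) ?_ h3 ?_⟩
    · rw [hh2]; exact h0
    · rw [rot_hh, rot_hh, rot_hh, List.mem_rotate, List.mem_rotate, List.mem_rotate]; exact hw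
  · refine ⟨_, fun w hw => Sp_sq3 hS (X := (hh z).1) (σ := (hh z).2) h0 h1 ?_⟩
    rw [rot_hh, List.mem_rotate]; exact hw
  · refine ⟨_, fun w hw => Sp_sq3 hS (X := (hh (hh z)).1) (σ := (hh (hh z)).2) ?_ h2 ?_⟩
    · rw [hh2]; exact h0
    · rw [rot_hh, rot_hh, List.mem_rotate, List.mem_rotate]; exact hw
  · exact ⟨_, fun w hw => Sp_sq3 hS h0 h hw⟩

theorem s0s0 (σ : Wd) : σ * s0 * s0 = σ := by rw [mul_assoc, show s0 * s0 = 1 by decide, mul_one]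

theorem hexOK_or {X : L} {σ : Wd} (h0 : D.sd X ≠ 0) (h : D.sd (X + e (σ 0)) = - D.sd X) : D.hexOK (X, σ) ∨ D.hexOK (X, σ * s1) := by
  unfold hexOK
  simp only [sg_mul, sg_s1]
  rw [show (σ * s1) 0 = σ 0 from rfl]
  rcases D.h1 X with h' | h' | h' <;> rcases sg_cases σ with hs | hs <;> simp_all
theorem sqOK_or {X : L} {σ : Wd} (h0 : D.sd X ≠ 0) (h : D.sd (X + e (σ 0) + e (σ 1)) = - D.sd X) : D.sqOK (X, σ) ∨ D.sqOK (X, σ * s0) := by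
  unfold sqOK
  simp only [sg_mul, sg_s0]
  rw [show (σ * s0) 0 = σ 1 from rfl, show (σ * s0) 1 = σ 0 from rfl, add_right_comm X (e (σ 1)) (e (σ 0))]
  rcases D.h1 X with h' | h' | h' <;> rcases sg_cases σ with hs | hs <;> simp_all

theorem lad_hex' (hS : KS (D.nx P) S) (X : L) {σ : Wd} (h : σ 3 = 0) (h0 : D.sd X ≠ 0) (he : D.sd (X + e (σ 0)) = - D.sd X) {m m' : ℕ}
    (hm : m ≤ P.nE σ + P.nE (σ * qq)) (hm' : m' ≤ P.nE σ + P.nE (σ * qq)) : S (P.tv X σ m) ↔ S (P.tv X σ m') := by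
  rcases hexOK_or h0 he with hk | hk
  · have := hexLad hS X h hk
    exact (this m hm).1.trans (this m' hm').1.symm
  · have := hexLad hS X (σ := σ * s1) h hk
    rw [s1_nE, s1s1] at this
    exact (this m hm).2.trans (this m' hm').2.symm

theorem lad_sq' (hS : KS (D.nx P) S) (X : L) {σ : Wd} (h : σ 3 = 0) (h0 : D.sd X ≠ 0) (he : D.sd (X + e (σ 0) + e (σ 1)) = - D.sd X) {m m' : ℕ}
    (hm : m ≤ P.nE σ) (hm' : m' ≤ P.nE σ) : S (P.tv X σ m) ↔ S (P.tv X σ m') := by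
  rcases sqOK_or h0 he with hk | hk
  · have := sqLad hS X h hk
    exact (this m hm).1.trans (this m' hm').1.symm
  · have := sqLad hS X (σ := σ * s0) h hk
    rw [s0s0, show P.nE (σ * s0) = P.nE σ from rfl] at this
    exact (this m hm).2.trans (this m' hm').2.symm

theorem Sp_R (hS : KS (D.nx P) S) {v : Vt} (hv : (D.nx P).isR v) : S v ↔ Sp P S (P.eaf v) := by
  obtain ⟨X, σ, m, h, hm, rfl⟩ := P.exists_tv hv.1
  rw [P.ea_tv X h hm, Sp_vx X h]
  rcases Nat.eq_zero_or_pos m with rfl | hm0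
  · rfl
  obtain ⟨-, ⟨x, hx, h1⟩, ⟨y, hy, h2⟩⟩ := hv
  have hx' : P.dl x ∈ P.dl '' Tl (P.tv X σ m) := ⟨x, hx, rfl⟩
  have hy' : P.dl y ∈ P.dl '' Tl (P.tv X σ m) := ⟨y, hy, rfl⟩
  rw [P.dl_tv X h hm0 hm] at hx' hy'
  rw [nx_sd] at h1 h2
  have hY : D.sd (X + e (σ 0)) ≠ 0 → D.sd (X + e (σ 0) + e (σ 1)) = - D.sd (X + e (σ 0)) → (S (P.tv X σ m) ↔ S (P.tv X σ 0)) := by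
    intro h0 he
    have h' : (σ * qq * qq) 3 = 0 := qq3 (qq3 h)
    have := lad_hex' hS (X + e (σ 0)) (σ := σ * qq * qq) h' h0 he (m := m + P.nE (σ * qq * qq)) (m' := 0 + P.nE (σ * qq * qq))
      (by rw [qqq]; omega) (by omega)
    rw [P.tv_R _ h', P.tv_R _ h', qqq, show (σ * qq * qq) 2 = σ 0 from rfl, add_sub_cancel_right] at this
    exact this
  have hA : D.sd X ≠ 0 → D.sd (X + e (σ 0)) = - D.sd X → (S (P.tv X σ m) ↔ S (P.tv X σ 0)) :=
    fun h0 he => lad_hex' hS X h h0 he (by omega) (by omega)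
  have hB : D.sd X ≠ 0 → D.sd (X + e (σ 0) + e (σ 1)) = - D.sd X → (S (P.tv X σ m) ↔ S (P.tv X σ 0)) :=
    fun h0 he => lad_sq' hS X h h0 he (by omega) (by omega)
  rcases hx' with hx' | hx' | hx' <;> rcases hy' with hy' | hy' | hy' <;> rw [hx'] at h1 <;> rw [hy'] at h2 <;>
    first
    | omega
    | exact hA (by omega) (by omega)
    | exact hB (by omega) (by omega)
    | exact hY (by omega) (by omega)

theorem Conn_nx (hc : D.Conn) : (D.nx P).Conn := by
  rintro S ⟨u, hu, hSu⟩ ⟨v, hv, hSv⟩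
  by_contra hcon
  have hS : KS (D.nx P) S := by
    intro ψ hψ a ha b hb hSa
    by_contra hSb
    exact hcon ⟨ψ, hψ, a, ha, b, hb, hSa, hSb⟩
  rw [Sp_R hS hu] at hSu
  rw [Sp_R hS hv] at hSv
  obtain ⟨⟨b, z⟩, hφ, a, ha, c, hcm, h1, h2⟩ := hc (Sp P S) ⟨_, (D.nx_R P hu).1, hSu⟩ ⟨_, (D.nx_R P hv).1, hSv⟩
  cases b
  · obtain ⟨q, hq⟩ := Sp_sq hS (z := z) hφ
    exact h2 ((hq c hcm).2 ((hq a ha).1 h1))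
  · obtain ⟨q, hq⟩ := Sp_hex hS (z := z) hφ
    exact h2 ((hq c hcm).2 ((hq a ha).1 h1))

end SD
end ABCT

set_option linter.all false

namespace ABCT

theorem CV.rot {a : Pt} {l : List Pt} (h : CV (a :: l)) : CV (l ++ [a]) := by
  intro u v w hs
  rw [List.sublist_append_iff] at hs
  obtain ⟨l1, l2, he, h1, h2⟩ := hs
  have h2' : l2 = [] ∨ l2 = [a] := by
    cases h2 with
    | cons _ h => left; exact List.eq_nil_of_sublist_nil h
    | cons_cons _ h => right; rw [List.eq_nil_of_sublist_nil h]
  rcases h2' with rfl | rfl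
  · rw [List.append_nil] at he
    subst he
    exact h u v w (h1.trans (List.sublist_cons_self _ _))
  · match l1, h1, he with
    | [x, y], h1, he =>
      simp only [List.cons_append, List.nil_append, List.cons.injEq, and_true] at he
      obtain ⟨rfl, rfl, rfl⟩ := he
      have := h w u v (h1.cons_cons w)
      rwa [← det_rot] at this
    | [], h1, he => simp at he
    | [x], h1, he => simp at he
    | x :: y :: z :: r, h1, he => simp at he

theorem CV.rotn {l : List Pt} (h : CV l) (n : ℕ) : CV (l.rotate n) := by
  induction n generalizing l with
  | zero => simpa using h
  | succ n ih =>
    cases l with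
    | nil => simpa using h
    | cons a l => rw [List.rotate_cons_succ]; exact ih h.rot

theorem exists_pos {l : List Vt} (hl : l.Nodup) (p : List Pt) (hp : p.length = l.length) : ∃ pos : Vt → Pt, l.map pos = p := by
  classical
  refine ⟨fun v => p.getD (l.idxOf v) 0, ?_⟩
  apply List.ext_getElem
  · simp [hp]
  · intro i h1 h2
    simp only [List.length_map] at h1
    simp [hl.idxOf_getElem, List.getElem?_eq_getElem h2]

def hex0 : List Pt := [(2,0),(1,2),(-1,2),(-2,0),(-1,-2),(1,-2)]
def sq0 : List Pt := [(1,0),(0,1),(-1,0),(0,-1)]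


theorem CV_cons {a : Pt} {l : List Pt} (h1 : l.Pairwise (fun v w => 0 < det a v w)) (h2 : CV l) : CV (a :: l) := by
  intro u v w h
  cases h with
  | cons _ h => exact h2 u v w h
  | cons_cons _ h =>
    have := h1.sublist h
    simp at this
    exact this

theorem CV_nil : CV [] := by intro u v w h; simp at h

theorem CV_hex0 : CV hex0 := by
  unfold hex0
  repeat' apply CV_cons
  · norm_num [det]
  · norm_num [det]
  · norm_num [det]
  · norm_num [det]
  · norm_num [det]
  · norm_num [det]
  · exact CV_nil

theorem CV_sq0 : CV sq0 := by
  unfold sq0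
  repeat' apply CV_cons
  · norm_num [det]
  · norm_num [det]
  · norm_num [det]
  · norm_num [det]
  · exact CV_nil

theorem pol_nodup (φ : Fg) : (pol φ).Nodup := by
  obtain ⟨b, x, σ⟩ := φ
  have k : ∀ l : List Wd, l.Nodup → (l.map (fun ρ => vx x (σ * ρ))).Nodup := by
    intro l hl
    apply hl.map
    intro a b h
    exact mul_left_cancel (vx_inj' h)
  cases b
  · have := k [1, s2, s2 * s0, s0] (by decide)
    simpa only [pol, sqP, List.map, mul_one] using this
  · have := k [1, s2, s2 * s1, s2 * s1 * s2, s1 * s2, s1] (by decide)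
    simpa only [pol, hexP, List.map, mul_one] using this

namespace SD
variable {D : SD}

/-- only two marked tiles -/
def Two (D : SD) : Prop := ∃ x0 y0, D.sd x0 = -1 ∧ D.sd y0 = 1 ∧ ∀ x, D.sd x ≠ 0 → x = x0 ∨ x = y0

theorem Two.tiles (hD : D.Two) {φ ψ : Fg} (h : D.OK φ) (h' : D.OK ψ) :
    (ψ.2.1 = φ.2.1 ∧ oth ψ = oth φ) ∨ (ψ.2.1 = oth φ ∧ oth ψ = φ.2.1) := by
  obtain ⟨x0, y0, hx, hy, hxy⟩ := hD
  have key : ∀ x, D.sd x = -1 → x = x0 := by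
    intro x h
    rcases hxy x (by omega) with h1 | h1
    · exact h1
    · rw [h1] at h; omega
  have key' : ∀ x, D.sd x = 1 → x = y0 := by
    intro x h
    rcases hxy x (by omega) with h1 | h1
    · rw [h1] at h; omega
    · exact h1
  obtain ⟨a, b, ha, hb, h1⟩ := D.OK_tiles h
  obtain ⟨a', b', ha', hb', h2⟩ := D.OK_tiles h'
  rw [key a ha, key' b hb] at h1
  rw [key a' ha', key' b' hb'] at h2
  rcases h1 with ⟨h1, h3⟩ | ⟨h1, h3⟩ <;> rcases h2 with ⟨h2, h4⟩ | ⟨h2, h4⟩ <;> rw [h1, h2, h3, h4] <;> simp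

theorem w6e : ∀ ρ : Wd, ρ 0 = 0 → sg ρ = 1 → ρ = 1 ∨ ρ = s2 * s1 ∨ ρ = s2 * s1 * (s2 * s1) := by decide
theorem w4e : ∀ ρ : Wd, (ρ 0 = 0 ∧ ρ 1 = 1) ∨ (ρ 0 = 1 ∧ ρ 1 = 0) → sg ρ = 1 → ρ = 1 ∨ ρ = s2 * s0 := by decide

theorem sg_rel {x : L} {σ σ' : Wd} {k : ℤ} (hk : k = 1 ∨ k = -1) (h : D.sd x * sg σ = k) (h' : D.sd x * sg σ' = k) : sg (σ⁻¹ * σ') = 1 := by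
  have h1 : sg σ⁻¹ = sg σ := by simp [sg]
  rw [sg_mul, h1]
  rcases D.h1 x with h0 | h0 | h0 <;> rw [h0] at h h' <;> rcases sg_cases σ with h2 | h2 <;> rcases sg_cases σ' with h3 | h3 <;>
    rw [h2] at h <;> rw [h3] at h' <;> rw [h2, h3] <;> omega

theorem Two.gp_sq {z z' : Vt} (h : D.sqOK z) (h' : D.sqOK z') (e1 : z'.1 = z.1) (e2 : oth (false, z') = oth (false, z)) :
    z' = z ∨ z' = eqH (eqH z) := by
  obtain ⟨x, σ⟩ := z
  obtain ⟨x', σ'⟩ := z'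
  simp only at e1
  subst e1
  simp only [oth, add_assoc, add_right_inj] at e2
  have h3 := e_22 _ _ _ _ (ne01 σ') (ne01 σ) e2
  have h4 := w4e (σ⁻¹ * σ') (by
    rcases h3 with ⟨h, h'⟩ | ⟨h, h'⟩
    · left; simp [h, h']
    · right; simp [h, h']) (sg_rel (by simp) h.1 h'.1)
  have hσ : σ' = σ * (σ⁻¹ * σ') := by simp
  rcases h4 with h4 | h4
  · left; rw [h4, mul_one] at hσ; rw [hσ]
  · right; rw [h4] at hσ; rw [hσ]; exact (hh2 (x', σ)).symm

theorem Two.gp (hD : D.Two) {φ ψ : Fg} (h : D.OK φ) (h' : D.OK ψ) : ψ ∈ SD.gp φ := by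
  have ht := hD.tiles h h'
  obtain ⟨b, x, σ⟩ := φ
  obtain ⟨b', x', σ'⟩ := ψ
  have k1 : ∀ i j k : Fin 4, j ≠ k → e i + (e j + e k) ≠ 0 := by decide
  have k2 : ∀ i j : Fin 4, e i + e j ≠ 0 := by decide
  cases b <;> cases b'
  · rcases ht with ht | ht
    · rcases Two.gp_sq h h' ht.1 ht.2 with h3 | h3
      · rw [h3]; simp [SD.gp]
      · rw [h3]; simp [SD.gp]
    · have h2 := (D.sqOK_H _).2 h
      have e2 : oth (false, eqH (x, σ)) = x := congrArg Prod.fst (hh2 (x, σ))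
      rcases Two.gp_sq h2 h' ht.1 (ht.2.trans e2.symm) with h3 | h3
      · rw [h3]; simp [SD.gp]
      · rw [h3]; simp [SD.gp]
  · exfalso
    simp only [oth] at ht
    rcases ht with ⟨rfl, ht⟩ | ⟨rfl, ht⟩
    · rw [add_assoc, add_right_inj] at ht
      exact e_ne2 _ _ _ (ne01 σ) ht
    · rw [add_assoc, add_assoc, add_eq_left] at ht
      refine k1 (σ' 0) (σ 0) (σ 1) (ne01 _) ?_
      rw [← ht]; abel
  · exfalso
    simp only [oth] at ht
    rcases ht with ⟨rfl, ht⟩ | ⟨rfl, ht⟩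
    · rw [add_assoc, add_right_inj] at ht
      exact e_ne2 _ _ _ (ne01 σ') ht.symm
    · rw [add_assoc, add_assoc, add_eq_left] at ht
      exact k1 (σ 0) (σ' 0) (σ' 1) (ne01 _) ht
  · simp only [oth] at ht
    rcases ht with ⟨rfl, ht⟩ | ⟨rfl, ht⟩
    · rw [add_right_inj] at ht
      have h4 := w6e (σ⁻¹ * σ') (by simp [e_inj2 _ _ ht]) (sg_rel (by simp) h.1 h'.1)
      have hσ : σ' = σ * (σ⁻¹ * σ') := by simp
      rcases h4 with h4 | h4 | h4 <;> rw [h4] at hσ <;> rw [hσ]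
      · simp [SD.gp]
      · simp [SD.gp, eq3]
      · simp [SD.gp, eq3, mul_assoc]
    · rw [add_assoc, add_eq_left] at ht
      exact absurd ht (k2 _ _)

theorem gp_rot {φ ψ : Fg} (h : ψ ∈ SD.gp φ) : ∃ n, pol ψ = (pol φ).rotate n := by
  obtain ⟨b, z⟩ := φ
  cases b
  · simp only [SD.gp, Finset.mem_insert, Finset.mem_singleton] at h
    have k : ∀ z : Vt, pol (false, eqH z) = (pol (false, z)).rotate 1 := rot_hh
    rcases h with rfl | rfl | rfl | rfl
    · exact ⟨0, by simp⟩
    · exact ⟨1, k _⟩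
    · exact ⟨2, by rw [k, k, List.rotate_rotate]⟩
    · exact ⟨3, by rw [k, k, k, List.rotate_rotate, List.rotate_rotate]⟩
  · simp only [SD.gp, Finset.mem_insert, Finset.mem_singleton] at h
    have k : ∀ z : Vt, pol (true, eq3 z) = (pol (true, z)).rotate 2 := rot_eq3
    rcases h with rfl | rfl | rfl
    · exact ⟨0, by simp⟩
    · exact ⟨2, k _⟩
    · exact ⟨4, by rw [k, k, List.rotate_rotate]⟩

theorem kt_some {u v w ε : ℤ} (hu : u = -1 ∨ u = 0 ∨ u = 1) (hv : v = -1 ∨ v = 0 ∨ v = 1)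
    (hw : w = -1 ∨ w = 0 ∨ w = 1) (hε : ε = 1 ∨ ε = -1) (h : ε * kt u v w = 1) :
    (u * ε = -1 ∧ v = -u) ∨ (v * ε = -1 ∧ w = -v) ∨ (u * ε = 1 ∧ w = -u) := by
  rcases hu with rfl | rfl | rfl <;> rcases hv with rfl | rfl | rfl <;> rcases hw with rfl | rfl | rfl <;>
   rcases hε with rfl | rfl <;> revert h <;> decide

theorem ed_G (z : Vt) : ed (eqG z) = (vx z.1 (z.2 * s2), vx z.1 (z.2 * (s2 * s1))) := by
  simp only [ed, eqG, Equiv.coe_fn_mk]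
  have h1 := vx_rotm z.1 (z.2 * s2)
  have h2 := vx_rotm z.1 (z.2 * (s2 * s1))
  have a : (z.2 * s2) 3 = z.2 2 := by simp [s2_ap]
  have b : (z.2 * (s2 * s1)) 3 = z.2 2 := by simp [s2_ap, s1_ap]
  rw [a] at h1; rw [b] at h2
  rw [← h1, ← h2]
  congr 2
  · simp only [mul_assoc]; rw [show s2 * rr⁻¹ = s2 * (rr * (rr * rr)) by decide]
  · simp only [mul_assoc]; rw [show s2 * (rr⁻¹ * s2) = s2 * (s1 * (rr * (rr * rr))) by decide]

/-- an outer edge is on an OK polygon -/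
theorem isO_pol {z : Vt} (hz : D.isO z) : ∃ φ, D.OK φ ∧ ((∃ l, pol φ = (ed z).1 :: (ed z).2 :: l) ∨
    ∃ p l, pol φ = p :: (ed z).1 :: (ed z).2 :: l) := by
  rcases kt_some (D.h1 z.1) (D.h1 (z.1 + e (z.2 0))) (D.h1 (z.1 + e (z.2 0) + e (z.2 1))) (sg_cases z.2) hz with h | h | h
  · exact ⟨(true, z), h, Or.inl ⟨_, rfl⟩⟩
  · have a : D.hexOK (eqG.symm z) := by
      simp only [hexOK, eqG, Equiv.coe_fn_symm_mk, sg_mul, sg_rr, sg_s2]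
      rw [show (z.2 * (rr * s2)) 0 = z.2 1 from rfl]; simpa using h
    refine ⟨(true, eqG.symm z), a, Or.inr ?_⟩
    have := ed_G (eqG.symm z)
    rw [Equiv.apply_symm_apply] at this
    rw [this]
    exact ⟨_, _, rfl⟩
  · exact ⟨(false, z), h, Or.inl ⟨_, rfl⟩⟩

theorem Two.mem (hD : D.Two) {φ : Fg} (h : D.OK φ) {v : Vt} (hv : D.isR v) : v ∈ pol φ := by
  obtain ⟨ψ, h1, h2⟩ := D.isR_flag hv
  exact (gp_mem (hD.gp h h1) v).1 h2

theorem Two.conn (hD : D.Two) {φ : Fg} (h : D.OK φ) : D.Conn := by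
  rintro S ⟨u, hu, hu'⟩ ⟨v, hv, hv'⟩
  exact ⟨φ, h, u, hD.mem h hu, v, hD.mem h hv, hu', hv'⟩

theorem CV_mem {a b v : Pt} {l : List Pt} (h : CV (a :: b :: l)) (hv : v ∈ l) : 0 < det a b v :=
  h a b v (((List.singleton_sublist.2 hv).cons_cons b).cons_cons a)

theorem Two.drawn (hD : D.Two) {φ : Fg} (h : D.OK φ) (hc : D.Conn) : ∃ pos, Drawn (D.cx hc) pos := by
  obtain ⟨pos, hpos⟩ : ∃ pos, CV ((pol φ).map pos) := by
    obtain ⟨b, z⟩ := φ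
    cases b
    · obtain ⟨pos, hp⟩ := exists_pos (pol_nodup (false, z)) sq0 rfl
      exact ⟨pos, by rw [hp]; exact CV_sq0⟩
    · obtain ⟨pos, hp⟩ := exists_pos (pol_nodup (true, z)) hex0 rfl
      exact ⟨pos, by rw [hp]; exact CV_hex0⟩
  have hT : ∀ ψ, D.OK ψ → CV ((pol ψ).map pos) := by
    intro ψ hψ
    obtain ⟨n, hn⟩ := gp_rot (hD.gp h hψ)
    rw [hn, List.map_rotate]
    exact hpos.rotn n
  refine ⟨pos, fun ψ hψ => hT ψ (D.mem_Fl.1 hψ), ?_⟩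
  intro o ho v hv h1 h2
  obtain ⟨z, hz, rfl⟩ := D.mem_O.1 ho
  obtain ⟨ψ, hψ, hl⟩ := isO_pol hz
  have hm := hD.mem hψ (D.mem_RV.1 hv)
  have hCV := hT ψ hψ
  rcases hl with ⟨l, hl⟩ | ⟨p, l, hl⟩
  · rw [hl] at hm hCV
    simp only [List.mem_cons] at hm
    have hm := (hm.resolve_left h1).resolve_left h2
    exact CV_mem hCV (List.mem_map_of_mem hm)
  · rw [hl] at hm hCV
    simp only [List.mem_cons] at hm
    rcases hm with rfl | hm
    · rw [det_rot]
      exact CV_mem (l := _ :: l.map pos) hCV (by simp)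
    · have hm := (hm.resolve_left h1).resolve_left h2
      refine CV_mem (l := l.map pos) ?_ (List.mem_map_of_mem hm)
      intro u v w hs
      exact hCV u v w (hs.trans (List.sublist_cons_self _ _))

/-- level-0 sides -/
def D0 (α : L) : SD where
  sd x := if x = 0 then -1 else if x = α then 1 else 0
  h1 x := by split_ifs <;> simp
  hf := by
    refine (Set.toFinite {0, α}).subset ?_
    intro x hx
    by_contra hh
    simp only [Set.mem_insert_iff, Set.mem_singleton_iff, not_or] at hh
    apply hx; simp [hh.1, hh.2]

theorem D0_two {α : L} (h : α ≠ 0) : (D0 α).Two := by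
  refine ⟨0, α, by simp [D0], by simp [D0, h], ?_⟩
  intro x hx
  by_contra hh
  simp only [not_or] at hh
  apply hx; simp [D0, hh.1, hh.2]

theorem D0_OK {α : L} (h : α ≠ 0) {v : Vt} (hc : Can v) (h1 : 0 ∈ Tl v) (h2 : α ∈ Tl v) : ∃ φ, (D0 α).OK φ := by
  obtain ⟨φ, h3, _⟩ := (D0 α).flag hc h1 h2 (by simp [D0]) (by simp [D0, h])
  exact ⟨φ, h3⟩

end SD
end ABCT

set_option linter.all false

namespace ABCT

/-- adjacency of tiles -/
def adj (x y : L) : Prop := ∃ v, Can v ∧ x ∈ Tl v ∧ y ∈ Tl v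

theorem adj.symm {x y : L} (h : adj x y) : adj y x := by
  obtain ⟨v, h1, h2, h3⟩ := h; exact ⟨v, h1, h3, h2⟩

noncomputable def es (I : Finset (Fin 4)) : L := ∑ i, if i ∈ I then e i else 0

theorem es_four (I : Finset (Fin 4)) (σ : Wd) : es I = (if σ 0 ∈ I then e (σ 0) else 0) + (if σ 1 ∈ I then e (σ 1) else 0) +
    (if σ 2 ∈ I then e (σ 2) else 0) + (if σ 3 ∈ I then e (σ 3) else 0) := by
  unfold es
  rw [← Equiv.sum_comp σ, Fin.sum_univ_four]

def bb (I : Finset (Fin 4)) (i : Fin 4) : ℤ := if i ∈ I then 1 else 0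

theorem es_coord (I : Finset (Fin 4)) : es I = (bb I 1 - bb I 0, bb I 2 - bb I 0, bb I 3 - bb I 0) := by
  unfold es bb e
  rw [Fin.sum_univ_four]
  by_cases h0 : (0:Fin 4) ∈ I <;> by_cases h1 : (1:Fin 4) ∈ I <;> by_cases h2 : (2:Fin 4) ∈ I <;> by_cases h3 : (3:Fin 4) ∈ I <;>
    simp [h0, h1, h2, h3] <;> rfl

theorem bb01 (I : Finset (Fin 4)) (i : Fin 4) : bb I i = 0 ∨ bb I i = 1 := by unfold bb; split_ifs <;> simp

theorem es_chain {I J K : Finset (Fin 4)} (h : es J = es I + es K) : I ⊆ J ∨ J ⊆ I := by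
  by_contra hh
  simp only [not_or, Finset.subset_iff, not_forall] at hh
  obtain ⟨⟨i, hi, hi'⟩, ⟨j, hj, hj'⟩⟩ := hh
  rw [es_coord, es_coord, es_coord] at h
  simp only [Prod.mk_add_mk, Prod.mk.injEq] at h
  have key : ∀ i, bb J i - bb I i - bb K i = bb J 0 - bb I 0 - bb K 0 := by
    intro i; fin_cases i <;> simp <;> omega
  have h1 := key i
  have h2 := key j
  have a1 : bb I i = 1 := by simp [bb, hi]
  have a2 : bb J i = 0 := by simp [bb, hi']
  have a3 : bb J j = 1 := by simp [bb, hj]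
  have a4 : bb I j = 0 := by simp [bb, hj']
  have := bb01 K i
  have := bb01 K j
  omega

theorem adj_es {x y : L} (h : adj x y) : ∃ I, (∃ i, i ∉ I) ∧ y = x + es I := by
  obtain ⟨v, hv, hx, hy⟩ := h
  obtain ⟨τ, rfl⟩ := exists_vx hv hx
  rw [mem_Tl_iff] at hy
  have n01 := ne01 τ
  have n02 := ne02 τ
  have n03 := ne03 τ
  have n12 := ne12 τ
  have n13 := ne13 τ
  have n23 := ne23 τ
  rcases hy with rfl | rfl | rfl | rfl
  · exact ⟨∅, ⟨0, by simp⟩, by simp [es]⟩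
  · refine ⟨{τ 0}, ⟨τ 1, by simp⟩, ?_⟩
    rw [es_four _ τ]; simp
  · refine ⟨{τ 0, τ 1}, ⟨τ 2, by simp⟩, ?_⟩
    rw [es_four _ τ]; simp [add_assoc]
  · refine ⟨{τ 0, τ 1, τ 2}, ⟨τ 3, by simp⟩, ?_⟩
    rw [es_four _ τ]; simp [add_assoc]

theorem clique {S : Set L} {x0 : L} (h0 : x0 ∈ S) (h : ∀ x ∈ S, ∀ y ∈ S, adj x y) : ∃ u, Can u ∧ S ⊆ Tl u := by
  classical
  set F : Finset (Finset (Fin 4)) := Finset.univ.filter (fun I => (∃ i, i ∉ I) ∧ x0 + es I ∈ S) with hF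
  have mF : ∀ I, I ∈ F ↔ (∃ i, i ∉ I) ∧ x0 + es I ∈ S := by intro I; simp [hF]
  have hch : ∀ I ∈ F, ∀ J ∈ F, I ⊆ J ∨ J ⊆ I := by
    intro I hI J hJ
    obtain ⟨K, _, hK⟩ := adj_es (h _ ((mF I).1 hI).2 _ ((mF J).1 hJ).2)
    rw [add_assoc, add_right_inj] at hK
    exact es_chain hK
  set f : Fin 4 → ℤ := fun i => - ((F.filter (fun I => i ∈ I)).card : ℤ) with hf
  set σ : Wd := Tuple.sort f with hσ
  have hm : Monotone (f ∘ σ) := Tuple.monotone_sort f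
  have key : ∀ I ∈ F, ∀ i j, i ∈ I → j ∉ I → f i < f j := by
    intro I hI i j hi hj
    simp only [hf, neg_lt_neg_iff, Nat.cast_lt]
    apply Finset.card_lt_card
    rw [Finset.ssubset_iff_of_subset]
    · exact ⟨I, by simp [hI, hi], by simp [hj]⟩
    · intro J hJ
      simp only [Finset.mem_filter] at hJ ⊢
      refine ⟨hJ.1, ?_⟩
      rcases hch I hI J hJ.1 with h | h
      · exact h hi
      · exact absurd (h hJ.2) hj
  have key2 : ∀ I ∈ F, ∀ k l : Fin 4, k ≤ l → σ l ∈ I → σ k ∈ I := by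
    intro I hI k l hkl hl
    by_contra hk
    have h1 := key I hI _ _ hl hk
    have h2 := hm hkl
    simp only [Function.comp] at h2
    omega
  refine ⟨vx x0 σ, vx_can _ _, ?_⟩
  intro x hx
  obtain ⟨I, hI, rfl⟩ := adj_es (h x0 h0 x hx)
  have hIF : I ∈ F := (mF I).2 ⟨hI, hx⟩
  have k01 := key2 I hIF 0 1 (by decide)
  have k12 := key2 I hIF 1 2 (by decide)
  have k23 := key2 I hIF 2 3 (by decide)
  rw [mem_Tl_iff, es_four I σ]
  by_cases h0 : σ 0 ∈ I <;> by_cases h1 : σ 1 ∈ I <;> by_cases h2 : σ 2 ∈ I <;> by_cases h3 : σ 3 ∈ I <;>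
    simp only [h0, h1, h2, h3, if_true, if_false, forall_true_left, imp_false, not_true_eq_false] at k01 k12 k23 ⊢ <;>
    simp [add_assoc]
  right; right; right
  exfalso
  obtain ⟨i, hi⟩ := hI
  obtain ⟨k, rfl⟩ := σ.surjective i
  fin_cases k <;> simp_all

theorem adj_refl (x : L) : adj x x := ⟨vx x 1, vx_can _ _, mem_Tl0 _ _, mem_Tl0 _ _⟩

end ABCT

set_option linter.all false

namespace ABCT
namespace Prm
open SD
variable (P : Prm)

theorem end_a (X : L) {σ : Wd} (h : σ 3 = 0) {m : ℕ} (hm : m < P.nE σ) : P.I.IsEnd (P.tv X σ m) (vx X σ) := by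
  left
  refine ⟨(P.ea_tv X h hm).symm, ?_⟩
  show P.ttf _ ≠ 1
  rw [P.tt_tv X h hm]
  have h1 : (m:ℝ) < P.nE σ := by exact_mod_cast hm
  have h2 : (0:ℝ) < P.nE σ := by exact_mod_cast P.nE_pos σ
  exact ((div_lt_one h2).2 h1).ne

theorem end_b (X : L) {σ : Wd} (h : σ 3 = 0) {m : ℕ} (h0 : 0 < m) (hm : m < P.nE σ) :
    P.I.IsEnd (P.tv X σ m) (vx X (σ * s2)) := by
  right
  refine ⟨(P.eb_tv X h h0 hm).symm, ?_⟩
  show P.ttf _ ≠ 0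
  rw [P.tt_tv X h hm]
  have h1 : (0:ℝ) < m := by exact_mod_cast h0
  have h2 : (0:ℝ) < P.nE σ := by exact_mod_cast P.nE_pos σ
  positivity

theorem end_c (X : L) {σ : Wd} (h : σ 3 = 0) {m : ℕ} (h0 : 0 < m) (hm : m ≤ P.nE σ) :
    P.I.IsEnd (P.tv X σ m) (vx X (σ * s2)) := by
  rcases Nat.lt_or_eq_of_le hm with h1 | rfl
  · exact P.end_b X h h0 h1
  · rw [P.tv_n X h, ← vx_qq]
    exact P.end_a _ (qq3 h) (P.nE_pos _)

theorem end_ex {v : Vt} (hv : Can v) : ∃ u, Can u ∧ P.I.IsEnd v u := by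
  obtain ⟨X, σ, m, h, hm, rfl⟩ := P.exists_tv hv
  exact ⟨_, vx_can _ _, P.end_a X h hm⟩

theorem edgeP (x : L) {τ : Wd} (h : τ 3 = 1) : ∃ X σ p, σ 3 = 0 ∧ p < P.nE σ ∧ vx x τ = P.tv X σ p ∧
    vx x (τ * s2) = P.tv X σ (p + 1) ∧ (p = 0 → σ 2 + 1 = τ 2) ∧
    ∀ Y, (Y = X ∨ Y = X + e (σ 0) ∨ Y = X + e (σ 0) + e (σ 1)) →
      Y ∈ P.dl '' {y | y = x ∨ y = x + e (τ 0) ∨ y = x + e (τ 0) + e (τ 1)} := by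
  obtain ⟨σ, rfl⟩ := rrinv τ
  have h3 := rr3 h
  obtain ⟨n0, n1, n2⟩ := ne0 h3
  obtain ⟨X, i', hi0, hi1, rfl⟩ := P.exists_ch x
  obtain ⟨i, rfl⟩ := Int.eq_ofNat_of_zero_le hi0
  have hs := P.gsum h3
  have t0 : P.tv X σ (3 * i) = vx (P.ch X i) (rr * σ) := P.tv0 X σ i
  have t1 : P.tv X σ (3 * i + 1) = vx (P.ch X i) (rr * σ * s2) := P.tv1 X σ i
  have y1 : P.ch X i + e ((rr * σ) 0) = P.ch (X + e (σ 0)) (i + P.gn (σ 0)) := by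
    rw [rr_ap', P.ch_add n0]
  have y2 : P.ch X i + e ((rr * σ) 0) + e ((rr * σ) 1) = P.ch (X + e (σ 0) + e (σ 1)) (i + P.gn (σ 0) + P.gn (σ 1)) := by
    rw [y1, rr_ap', P.ch_add n1]
  have m0 : P.ch X i ∈ {y | y = P.ch X i ∨ y = P.ch X i + e ((rr * σ) 0) ∨ y = P.ch X i + e ((rr * σ) 0) + e ((rr * σ) 1)} := Or.inl rfl
  have m1 : P.ch (X + e (σ 0)) (i + P.gn (σ 0)) ∈ {y | y = P.ch X i ∨ y = P.ch X i + e ((rr * σ) 0) ∨ y = P.ch X i + e ((rr * σ) 0) + e ((rr * σ) 1)} := Or.inr (Or.inl y1.symm)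
  have m2 : P.ch (X + e (σ 0) + e (σ 1)) (i + P.gn (σ 0) + P.gn (σ 1)) ∈ {y | y = P.ch X i ∨ y = P.ch X i + e ((rr * σ) 0) ∨ y = P.ch X i + e ((rr * σ) 0) + e ((rr * σ) 1)} := Or.inr (Or.inr y2.symm)
  generalize {y | y = P.ch X i ∨ y = P.ch X i + e ((rr * σ) 0) ∨ y = P.ch X i + e ((rr * σ) 0) + e ((rr * σ) 1)} = S at m0 m1 m2
  have d0 : P.dl (P.ch X i) = X := P.dl_ch X (by omega) hi1
  have ax1 := x01 X h3
  have ax0 := x0 X h3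
  have wrap1 : ∀ Z (j k : ℤ), k = j + P.C → 0 ≤ j → j < P.C → P.dl (P.ch Z k) = Z + e 0 := by
    intro Z j k hk h0 h1
    rw [hk, P.ch_C, P.dl_ch _ h0 h1]
  by_cases c1 : i ≤ P.gn (σ 2)
  · refine ⟨X, σ, 3 * i, h3, by unfold nE; omega, t0.symm, t1.symm, fun _ => (rr_ap' σ 2).symm, ?_⟩
    rintro Y (rfl | rfl | rfl)
    · exact ⟨_, m0, d0⟩
    · exact ⟨_, m1, P.dl_ch _ (by omega) (by omega)⟩
    · exact ⟨_, m2, P.dl_ch _ (by omega) (by omega)⟩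
  by_cases c2 : i ≤ P.gn (σ 2) + P.gn (σ 1)
  · obtain ⟨j, hj⟩ : ∃ j, i = P.gn (σ 2) + 1 + j := ⟨i - P.gn (σ 2) - 1, by omega⟩
    have q0 : (σ * qq) 0 = σ 2 := rfl
    have q1 : (σ * qq) 1 = σ 0 := rfl
    refine ⟨X - e (σ 2), σ * qq, 3 * j + 2, qq3 h3, by rw [nE_qq]; omega, ?_, ?_, by omega, ?_⟩
    · rw [← P.tv_R X h3, ← t0]; congr 1; unfold nE; omega
    · rw [← P.tv_R X h3, ← t1]; congr 1; unfold nE; omega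
    · rw [q0, q1]
      rintro Y (rfl | rfl | rfl)
      · refine ⟨_, m2, ?_⟩
        rw [wrap1 _ j _ (by omega) (by omega) (by omega), ax1]
      · rw [sub_add_cancel]; exact ⟨_, m0, d0⟩
      · rw [sub_add_cancel]; exact ⟨_, m1, P.dl_ch _ (by omega) (by omega)⟩
  · obtain ⟨j, hj⟩ : ∃ j, i = P.gn (σ 2) + P.gn (σ 1) + 1 + j := ⟨i - P.gn (σ 2) - P.gn (σ 1) - 1, by omega⟩
    have q0 : (σ * qq * qq) 0 = σ 1 := rfl
    have q1 : (σ * qq * qq) 1 = σ 2 := rfl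
    have q2 : (σ * qq * qq) 2 = σ 0 := rfl
    refine ⟨X - e (σ 2) - e (σ 1), σ * qq * qq, 3 * j + 1, qq3 (qq3 h3), by unfold nE; rw [q2]; omega, ?_, ?_, by omega, ?_⟩
    · rw [← tv_RR X h3, ← t0]; congr 1; rw [nE_qq]; unfold nE; omega
    · rw [← tv_RR X h3, ← t1]; congr 1; rw [nE_qq]; unfold nE; omega
    · rw [q0, q1]
      rintro Y (rfl | rfl | rfl)
      · refine ⟨_, m1, ?_⟩
        rw [wrap1 _ j _ (by omega) (by omega) (by omega), ax0]
      · rw [sub_add_cancel]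
        refine ⟨_, m2, ?_⟩
        rw [wrap1 _ (j + P.gn (σ 1)) _ (by omega) (by omega) (by omega), ax1]
      · rw [sub_add_cancel, sub_add_cancel]; exact ⟨_, m0, d0⟩

theorem gn_zero {k : Fin 4} (h : k ≠ 0) (h1 : P.gn k = 0) : k = 1 := by
  by_contra h2
  have := P.g_pos h h2
  have := P.gn_cast h
  omega

theorem high (X : L) {σ : Wd} (h : σ 3 = 0) (h2 : P.gn (σ 2) = 0) : ∃ y, P.I.IsEnd (vx X σ) y ∧ P.I.IsEnd (vx X (σ * s2)) y := by
  have h21 := P.gn_zero (ne0 h).2.2 h2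
  have e3 : (σ * s2) 3 = 1 := h21
  have e2 : (σ * s2) 2 = 0 := h
  obtain ⟨Y, ρ, p, r3, hp, t0, t1, r2, -⟩ := P.edgeP X e3
  rw [mul_assoc, s22, mul_one] at t1
  rw [t0, t1]
  rcases Nat.eq_zero_or_pos p with rfl | h0
  · have r2 := r2 rfl
    rw [e2] at r2
    have : ρ 2 = 3 := by revert r2; generalize ρ 2 = k; revert k; decide
    have g3 : 1 ≤ P.g 3 := P.g_pos (by decide) (by decide)
    have g3' := P.gn_cast (k := 3) (by decide)
    refine ⟨vx Y ρ, P.end_a _ r3 ?_, P.end_a _ r3 hp⟩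
    unfold nE; rw [this]; omega
  · exact ⟨_, P.end_c _ r3 (by omega) (by omega), P.end_c _ r3 h0 (by omega)⟩

def Near (v w : Vt) : Prop := ∃ y, P.I.Anc 2 v y ∧ P.I.Anc 2 w y

variable {P}
theorem Near.symm {v w : Vt} (h : P.Near v w) : P.Near w v := by
  obtain ⟨y, h1, h2⟩ := h; exact ⟨y, h2, h1⟩
variable (P)

theorem near_of {v w u : Vt} (hu : Can u) (h1 : P.I.IsEnd v u) (h2 : P.I.IsEnd w u) : P.Near v w := by
  obtain ⟨y, -, hy⟩ := P.end_ex hu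
  exact ⟨y, ⟨u, h1, y, hy, rfl⟩, ⟨u, h2, y, hy, rfl⟩⟩

theorem near_of2 {v w u u' : Vt} (h1 : P.I.IsEnd v u) (h2 : P.I.IsEnd w u') (h : ∃ y, P.I.IsEnd u y ∧ P.I.IsEnd u' y) : P.Near v w := by
  obtain ⟨y, hy, hy'⟩ := h
  exact ⟨y, ⟨u, h1, y, hy, rfl⟩, ⟨u', h2, y, hy', rfl⟩⟩

theorem near_tv (m m' : ℕ) (h1 : m ≤ m') (h2 : m' ≤ m + 2) (X : L) {σ : Wd} (h : σ 3 = 0) : P.Near (P.tv X σ m) (P.tv X σ m') := by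
  induction m using Nat.strong_induction_on generalizing m' X σ with
  | _ m ih =>
    by_cases hm : m < P.nE σ
    · by_cases hm' : m' < P.nE σ
      · exact P.near_of (vx_can _ _) (P.end_a X h hm) (P.end_a X h hm')
      have hE : P.nE σ = 3 * P.gn (σ 2) + 1 := rfl
      have hE' : P.nE (σ * qq) = 3 * P.gn (σ 1) + 1 := rfl
      obtain ⟨k, rfl⟩ : ∃ k, m' = k + P.nE σ := ⟨m' - P.nE σ, by omega⟩
      rw [P.tv_R X h k]
      have hV := vx_qq X σ
      rcases Nat.eq_zero_or_pos m with rfl | h0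
      · have g0 : P.gn (σ 2) = 0 := by omega
        have g1 : P.gn (σ 1) ≠ 0 := by
          intro g1
          have a1 := P.gn_zero (ne0 h).2.2 g0
          have a2 := P.gn_zero (ne0 h).2.1 g1
          exact ne12 σ (by rw [a1, a2])
        have e2 := P.end_a (X - e (σ 2)) (qq3 h) (m := k) (by omega)
        rw [hV] at e2
        exact P.near_of2 (P.end_a X h hm) e2 (P.high X h g0)
      · have e1 := P.end_b X h h0 hm
        by_cases hk : k < P.nE (σ * qq)
        · have e2 := P.end_a (X - e (σ 2)) (qq3 h) hk
          rw [hV] at e2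
          exact P.near_of (vx_can _ _) e1 e2
        · have e2 := P.end_c (X - e (σ 2)) (qq3 h) (m := k) (by omega) (by omega)
          rw [← hV] at e1
          exact P.near_of2 e1 e2 (P.high _ (qq3 h) (by rw [qq_2]; omega))
    · have hp := P.nE_pos σ
      obtain ⟨k, rfl⟩ : ∃ k, m = k + P.nE σ := ⟨m - P.nE σ, by omega⟩
      obtain ⟨k', rfl⟩ : ∃ k, m' = k + P.nE σ := ⟨m' - P.nE σ, by omega⟩
      rw [P.tv_R X h, P.tv_R X h]
      exact ih k (by omega) k' (by omega) (by omega) _ (qq3 h)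

theorem near_tv' (m m' : ℕ) (h1 : m ≤ m' + 2) (h2 : m' ≤ m + 2) (X : L) {σ : Wd} (h : σ 3 = 0) : P.Near (P.tv X σ m) (P.tv X σ m') := by
  rcases le_total m m' with h' | h'
  · exact P.near_tv m m' h' h2 X h
  · exact (P.near_tv m' m h' h1 X h).symm

end Prm
end ABCT

set_option linter.all false

namespace ABCT
namespace Prm
open SD
variable (P : Prm)

def Feat (S : Set L) (A : Vt → Prop) : Prop := (∃ a, Can a ∧ A a ∧ Tl a ⊆ S) ∨
  ∃ X σ, A (vx X σ) ∧ A (vx X (σ * s2)) ∧ ∀ Y, (Y = X ∨ Y = X + e (σ 0) ∨ Y = X + e (σ 0) + e (σ 1)) → Y ∈ S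

theorem edge_tiles {x y : L} {τ : Wd} (h1 : y ∈ Tl (vx x τ)) (h2 : y ∈ Tl (vx x (τ * s2))) :
    y = x ∨ y = x + e (τ 0) ∨ y = x + e (τ 0) + e (τ 1) := by
  rw [mem_Tl_iff] at h1 h2
  have q0 : (τ * s2) 0 = τ 0 := rfl
  have q1 : (τ * s2) 1 = τ 1 := rfl
  have q2 : (τ * s2) 2 = τ 3 := rfl
  rw [q0, q1, q2] at h2
  rcases h1 with h | h | h | h
  · exact Or.inl h
  · exact Or.inr (Or.inl h)
  · exact Or.inr (Or.inr h)
  · rcases h2 with h' | h' | h' | h'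
    · exact Or.inl h'
    · exact Or.inr (Or.inl h')
    · exact Or.inr (Or.inr h')
    · rw [h, add_right_inj] at h'
      exact absurd (e_inj2 _ _ h') (ne23 τ)

theorem rung0 {x X : L} {i : ℕ} (hx : x = P.ch X i) {τ : Wd} (h : τ 0 = 1) {w : Vt} (hw : Can w)
    (h1 : x + e (τ 0) + e (τ 1) ∈ Tl w) (h2 : x ∈ Tl w ∨ x + e (τ 0) ∈ Tl w) :
    P.Near (vx x τ) w ∨ P.Near (vx x (τ * s2)) w := by
  obtain ⟨σ, hσ⟩ := rrinv (τ * rr)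
  have s3 : σ 3 = 0 := rr3 (by rw [← hσ]; exact h)
  have hz : x + e (τ 0) = P.ch X ((i + 1 : ℕ) : ℤ) := by rw [h, hx, ← P.ch_one]; push_cast; rfl
  have ta : vx x τ = P.tv X σ (3 * (i + 1)) := by rw [P.tv0, ← hz, ← hσ, vx_rot]
  have tb : vx x (τ * s2) = P.tv X (σ * s1) (3 * (i + 1)) := by
    rw [P.tv0, ← hz, ← mul_assoc rr σ, ← hσ, ← vx_rot x (τ * s2)]
    rw [show (τ * s2) 0 = τ 0 from rfl, mul_assoc, mul_assoc, show s2 * rr = rr * s1 by decide]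
  rcases h2 with h2 | h2
  · have hm : w ∈ pol (false, x, τ) := (mem_pol _ _ hw).2 ⟨h2, h1⟩
    have t1 : vx x (τ * s0) = P.tv X σ (3 * i + 2) := by
      rw [P.tv2, ← hx, ← hσ, mul_assoc, show rr * (s2 * s1) = s0 by decide]
    have t2 : vx x (τ * (s2 * s0)) = P.tv X (σ * s1) (3 * i + 2) := by
      rw [P.tv2, ← hx, ← mul_assoc rr σ, ← hσ, mul_assoc, mul_assoc, show rr * (s1 * (s2 * s1)) = s2 * s0 by decide]
    simp only [pol, sqP, List.mem_cons, List.not_mem_nil, or_false] at hm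
    rw [ta, tb, t1, t2] at hm
    rw [ta, tb]
    rcases hm with rfl | rfl | rfl | rfl
    · left; exact P.near_tv' _ _ (by omega) (by omega) _ s3
    · right; exact P.near_tv' _ _ (by omega) (by omega) _ (s1_3 s3)
    · right; exact P.near_tv' _ _ (by omega) (by omega) _ (s1_3 s3)
    · left; exact P.near_tv' _ _ (by omega) (by omega) _ s3
  · have hm : w ∈ pol (true, x + e (τ 0), τ * rr) := (mem_pol _ _ hw).2 ⟨h2, h1⟩
    simp only [pol] at hm
    rw [hz, hσ, hexP_tv] at hm
    simp only [List.mem_cons, List.not_mem_nil, or_false] at hm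
    rw [ta, tb]
    rcases hm with rfl | rfl | rfl | rfl | rfl | rfl
    · left; exact P.near_tv' _ _ (by omega) (by omega) _ s3
    · left; exact P.near_tv' _ _ (by omega) (by omega) _ s3
    · left; exact P.near_tv' _ _ (by omega) (by omega) _ s3
    · right; exact P.near_tv' _ _ (by omega) (by omega) _ (s1_3 s3)
    · right; exact P.near_tv' _ _ (by omega) (by omega) _ (s1_3 s3)
    · right; exact P.near_tv' _ _ (by omega) (by omega) _ (s1_3 s3)

theorem rung1 {x X : L} {τ : Wd} {i : ℕ} (hx : x + e (τ 0) = P.ch X i) (h : τ 1 = 1) {w : Vt} (hw : Can w)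
    (h1 : x ∈ Tl w) (h2 : x + e (τ 0) ∈ Tl w ∨ x + e (τ 0) + e (τ 1) ∈ Tl w) :
    P.Near (vx x τ) w ∨ P.Near (vx x (τ * s2)) w := by
  obtain ⟨σ, hσ⟩ := rrinv (τ * rr * rr)
  have s3 : σ 3 = 0 := rr3 (by rw [← hσ]; exact h)
  have hz : x + e (τ 0) + e (τ 1) = P.ch X ((i + 1 : ℕ) : ℤ) := by rw [h, hx, ← P.ch_one]; push_cast; rfl
  have key : ∀ κ κ' : Wd, κ' = κ * (rr * rr) → (τ * κ) 0 = τ 0 ∧ (τ * κ) 1 = τ 1 ∨ (τ * κ) 0 = τ 1 ∧ (τ * κ) 1 = τ 0 →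
      vx x (τ * κ) = vx (P.ch X ((i + 1 : ℕ) : ℤ)) (τ * κ') := by
    intro κ κ' hκ hh
    rw [hκ, ← vx_rot2 x (τ * κ), ← hz]; simp only [mul_assoc]
    congr 1
    rcases hh with ⟨a, b⟩ | ⟨a, b⟩ <;> rw [a, b]
    abel
  have ta : vx x τ = P.tv X σ (3 * (i + 1)) := by
    rw [P.tv0, ← hσ, mul_assoc, ← key 1 _ (by rw [one_mul]) (by simp), mul_one]
  have tb : vx x (τ * s2) = P.tv X (σ * s0) (3 * (i + 1)) := by
    rw [P.tv0, ← mul_assoc rr σ, ← hσ]; simp only [mul_assoc]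
    exact key _ _ (by decide) (Or.inl ⟨rfl, rfl⟩)
  rcases h2 with h2 | h2
  · have hm : w ∈ pol (true, x, τ) := (mem_pol _ _ hw).2 ⟨h1, h2⟩
    have key2 : ∀ κ κ' : Wd, κ' = κ * rr → (τ * κ) 0 = τ 0 → vx x (τ * κ) = vx (P.ch X i) (τ * κ') := by
      intro κ κ' hκ hh
      rw [hκ, ← vx_rot x (τ * κ), hh, hx, mul_assoc]
    have t3 : vx x (τ * (s2 * s1)) = P.tv X (σ * s0) (3 * i + 2) := by
      rw [P.tv2, ← mul_assoc rr σ, ← hσ]; simp only [mul_assoc]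
      exact key2 _ _ (by decide) rfl
    have t4 : vx x (τ * (s2 * s1 * s2)) = P.tv X (σ * s0) (3 * i + 1) := by
      rw [P.tv1, ← mul_assoc rr σ, ← hσ]; simp only [mul_assoc]
      exact key2 _ _ (by decide) rfl
    have t5 : vx x (τ * (s1 * s2)) = P.tv X σ (3 * i + 1) := by
      rw [P.tv1, ← hσ]; simp only [mul_assoc]
      exact key2 _ _ (by decide) rfl
    have t6 : vx x (τ * s1) = P.tv X σ (3 * i + 2) := by
      rw [P.tv2, ← hσ]; simp only [mul_assoc]
      exact key2 _ _ (by decide) rfl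
    simp only [pol, hexP, List.mem_cons, List.not_mem_nil, or_false] at hm
    rw [ta, tb, t3, t4, t5, t6] at hm
    rw [ta, tb]
    rcases hm with rfl | rfl | rfl | rfl | rfl | rfl
    · left; exact P.near_tv' _ _ (by omega) (by omega) _ s3
    · right; exact P.near_tv' _ _ (by omega) (by omega) _ (s0_3 s3)
    · right; exact P.near_tv' _ _ (by omega) (by omega) _ (s0_3 s3)
    · right; exact P.near_tv' _ _ (by omega) (by omega) _ (s0_3 s3)
    · left; exact P.near_tv' _ _ (by omega) (by omega) _ s3
    · left; exact P.near_tv' _ _ (by omega) (by omega) _ s3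
  · have hm : w ∈ pol (false, x, τ) := (mem_pol _ _ hw).2 ⟨h1, h2⟩
    have t3 : vx x (τ * (s2 * s0)) = P.tv X (σ * s0) (3 * (i + 1) + 1) := by
      rw [P.tv1, ← mul_assoc rr σ, ← hσ]; simp only [mul_assoc]
      exact key _ _ (by decide) (Or.inr ⟨rfl, rfl⟩)
    have t4 : vx x (τ * s0) = P.tv X σ (3 * (i + 1) + 1) := by
      rw [P.tv1, ← hσ]; simp only [mul_assoc]
      exact key _ _ (by decide) (Or.inr ⟨rfl, rfl⟩)
    simp only [pol, sqP, List.mem_cons, List.not_mem_nil, or_false] at hm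
    rw [ta, tb, t3, t4] at hm
    rw [ta, tb]
    rcases hm with rfl | rfl | rfl | rfl
    · left; exact P.near_tv' _ _ (by omega) (by omega) _ s3
    · right; exact P.near_tv' _ _ (by omega) (by omega) _ (s0_3 s3)
    · right; exact P.near_tv' _ _ (by omega) (by omega) _ (s0_3 s3)
    · left; exact P.near_tv' _ _ (by omega) (by omega) _ s3

end Prm
end ABCT

set_option linter.all false

namespace ABCT
namespace Prm
open SD
variable (P : Prm)

theorem step {S : Set L} {A : Vt → Prop} (hF : Feat S A) {c : Fg} (hA : ∀ a, A a → a ∈ pol c)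
    (hc : P.dl c.2.1 ≠ P.dl (oth c)) :
    Feat (P.dl '' S) (fun u => ∃ a, A a ∧ P.I.IsEnd a u) ∨ ∀ w ∈ pol c, ∃ a, A a ∧ P.Near a w := by
  rcases hF with ⟨a, ca, ha, hS⟩ | ⟨x, τ, a1, a2, hS⟩
  · left
    obtain ⟨X, σ, m, h, hm, rfl⟩ := P.exists_tv ca
    rcases Nat.eq_zero_or_pos m with rfl | h0
    · left
      refine ⟨_, vx_can _ _, ⟨_, ha, P.end_a X h hm⟩, ?_⟩
      rw [← P.dl_tv0 X h]; exact Set.image_mono hS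
    · right
      refine ⟨X, σ, ⟨_, ha, P.end_a X h hm⟩, ⟨_, ha, P.end_b X h h0 hm⟩, ?_⟩
      intro Y hY
      have : Y ∈ P.dl '' Tl (P.tv X σ m) := by rw [P.dl_tv X h h0 hm]; exact hY
      exact Set.image_mono hS this
  have sub : P.dl '' {y | y = x ∨ y = x + e (τ 0) ∨ y = x + e (τ 0) + e (τ 1)} ⊆ P.dl '' S := Set.image_mono hS
  have ct : ∀ t, (∀ v ∈ pol c, t ∈ Tl v) → t = x ∨ t = x + e (τ 0) ∨ t = x + e (τ 0) + e (τ 1) :=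
    fun t ht => edge_tiles (ht _ (hA _ a1)) (ht _ (hA _ a2))
  have c1 := ct c.2.1 (fun v hv => ((mem_pol c v (pol_can _ _ hv)).1 hv).1)
  have c2 := ct (oth c) (fun v hv => ((mem_pol c v (pol_can _ _ hv)).1 hv).2)
  have fin : ∀ w, P.Near (vx x τ) w ∨ P.Near (vx x (τ * s2)) w → ∃ a, A a ∧ P.Near a w := by
    rintro w (h | h)
    · exact ⟨_, a1, h⟩
    · exact ⟨_, a2, h⟩
  rcases perm_one τ with h | h | h | h
  · -- letter one in place 0
    obtain ⟨X, i', hi0, hi1, hx⟩ := P.exists_ch x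
    obtain ⟨i, rfl⟩ := Int.eq_ofNat_of_zero_le hi0
    have hz : x + e (τ 0) = P.ch X ((i:ℤ) + 1) := by rw [h, hx, ← P.ch_one]
    have dx : P.dl x = X := by rw [hx]; exact P.dl_ch X (by omega) hi1
    by_cases hi : (i:ℤ) + 1 < P.C
    · right
      have dz : P.dl (x + e (τ 0)) = X := by rw [hz]; exact P.dl_ch X (by omega) hi
      intro w hw
      have cw := pol_can _ _ hw
      obtain ⟨w1, w2⟩ := (mem_pol c w cw).1 hw
      apply fin
      apply P.rung0 hx h cw
      · rcases c1 with r | r | r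
        · rcases c2 with r' | r' | r'
          · rw [r, r'] at hc; exact absurd rfl hc
          · rw [r, r', dx, dz] at hc; exact absurd rfl hc
          · rw [← r']; exact w2
        · rcases c2 with r' | r' | r'
          · rw [r, r', dx, dz] at hc; exact absurd rfl hc
          · rw [r, r'] at hc; exact absurd rfl hc
          · rw [← r']; exact w2
        · rw [← r]; exact w1
      · rcases c1 with r | r | r
        · rw [← r]; exact Or.inl w1
        · rw [← r]; exact Or.inr w1
        · rcases c2 with r' | r' | r'
          · rw [← r']; exact Or.inl w2
          · rw [← r']; exact Or.inr w2
          · rw [r, r'] at hc; exact absurd rfl hc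
    · left; right
      have hi' : (i:ℤ) + 1 = 0 + P.C := by omega
      rw [hi', P.ch_C] at hz
      obtain ⟨σ, hσ⟩ := rrinv (τ * rr)
      have s3 : σ 3 = 0 := rr3 (by rw [← hσ]; exact h)
      have t1 : τ 1 = σ 0 + 1 := by rw [← rr_ap', ← hσ]; rfl
      have ta : vx x τ = P.tv (X + e 0) σ 0 := by
        have := P.tv0 (X + e 0) σ 0
        rw [mul_zero] at this
        rw [this, Nat.cast_zero, ← hz, ← hσ, vx_rot]
      have tb : vx x (τ * s2) = P.tv (X + e 0) (σ * s1) 0 := by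
        have := P.tv0 (X + e 0) (σ * s1) 0
        rw [mul_zero] at this
        rw [this, Nat.cast_zero, ← hz, ← mul_assoc rr σ, ← hσ, ← vx_rot x (τ * s2)]
        rw [show (τ * s2) 0 = τ 0 from rfl, mul_assoc, mul_assoc, show s2 * rr = rr * s1 by decide]
      obtain ⟨κ, hκ⟩ : ∃ κ : Wd, κ * rr = σ := ⟨σ * rr⁻¹, by simp⟩
      have k0 : κ 0 = 0 := by
        have : σ 3 = κ 0 := by rw [← hκ]; rfl
        rw [← this]; exact s3
      have k1 : κ 1 = σ 0 := by rw [← hκ]; rfl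
      refine ⟨X, κ, ?_, ?_, ?_⟩
      · refine ⟨_, a1, ?_⟩
        rw [ta, ← vx_rot X κ, k0, hκ]
        exact P.end_a _ s3 (P.nE_pos _)
      · refine ⟨_, a2, ?_⟩
        rw [tb, ← vx_rot X (κ * s2), show (κ * s2) 0 = κ 0 from rfl, k0, mul_assoc, show s2 * rr = rr * s1 by decide, ← mul_assoc, hκ]
        exact P.end_a _ (s1_3 s3) (P.nE_pos _)
      · intro Y hY
        apply sub
        rw [k0, k1] at hY
        rcases hY with rfl | rfl | rfl
        · exact ⟨x, Or.inl rfl, dx⟩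
        · refine ⟨_, Or.inr (Or.inl rfl), ?_⟩
          rw [hz, P.dl_ch _ le_rfl P.C_pos]
        · refine ⟨_, Or.inr (Or.inr rfl), ?_⟩
          have := P.gsum s3
          rw [hz, t1, P.ch_add (ne0 s3).1, P.dl_ch _ (by omega) (by omega)]
  · obtain ⟨X, i', hi0, hi1, hu⟩ := P.exists_ch (x + e (τ 0))
    obtain ⟨i, rfl⟩ := Int.eq_ofNat_of_zero_le hi0
    have hz : x + e (τ 0) + e (τ 1) = P.ch X ((i:ℤ) + 1) := by rw [h, hu, ← P.ch_one]
    have du : P.dl (x + e (τ 0)) = X := by rw [hu]; exact P.dl_ch X (by omega) hi1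
    by_cases hi : (i:ℤ) + 1 < P.C
    · right
      have dz : P.dl (x + e (τ 0) + e (τ 1)) = X := by rw [hz]; exact P.dl_ch X (by omega) hi
      intro w hw
      have cw := pol_can _ _ hw
      obtain ⟨w1, w2⟩ := (mem_pol c w cw).1 hw
      apply fin
      apply P.rung1 hu h cw
      · rcases c1 with r | r | r
        · rw [← r]; exact w1
        · rcases c2 with r' | r' | r'
          · rw [← r']; exact w2
          · rw [r, r'] at hc; exact absurd rfl hc
          · rw [r, r', du, dz] at hc; exact absurd rfl hc
        · rcases c2 with r' | r' | r'
          · rw [← r']; exact w2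
          · rw [r, r', du, dz] at hc; exact absurd rfl hc
          · rw [r, r'] at hc; exact absurd rfl hc
      · rcases c1 with r | r | r
        · rcases c2 with r' | r' | r'
          · rw [r, r'] at hc; exact absurd rfl hc
          · rw [← r']; exact Or.inl w2
          · rw [← r']; exact Or.inr w2
        · rw [← r]; exact Or.inl w1
        · rw [← r]; exact Or.inr w1
    · left; right
      have hi' : (i:ℤ) + 1 = 0 + P.C := by omega
      rw [hi', P.ch_C] at hz
      obtain ⟨σ, hσ⟩ := rrinv (τ * rr * rr)
      have s3 : σ 3 = 0 := rr3 (by rw [← hσ]; exact h)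
      have t0 : τ 0 = σ 2 + 1 := by rw [← rr_ap', ← hσ]; rfl
      have ta : vx x τ = P.tv (X + e 0) σ 0 := by
        have := P.tv0 (X + e 0) σ 0
        rw [mul_zero] at this
        rw [this, Nat.cast_zero, ← hz, ← hσ, vx_rot2]
      have tb : vx x (τ * s2) = P.tv (X + e 0) (σ * s0) 0 := by
        have := P.tv0 (X + e 0) (σ * s0) 0
        rw [mul_zero] at this
        rw [this, Nat.cast_zero, ← hz, ← mul_assoc rr σ, ← hσ, ← vx_rot2 x (τ * s2)]
        rw [show (τ * s2) 0 = τ 0 from rfl, show (τ * s2) 1 = τ 1 from rfl]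
        simp only [mul_assoc]
        rw [show s2 * (rr * rr) = rr * (rr * s0) by decide]
      obtain ⟨κ, hκ⟩ : ∃ κ : Wd, κ * rr * rr = σ := ⟨σ * rr⁻¹ * rr⁻¹, by simp⟩
      have k0 : κ 0 = σ 2 := by rw [← hκ]; rfl
      have k1 : κ 1 = 0 := by rw [← s3, ← hκ]; rfl
      refine ⟨X - e (σ 2), κ, ?_, ?_, ?_⟩
      · refine ⟨_, a1, ?_⟩
        rw [ta, ← vx_rot2 (X - e (σ 2)) κ, k0, k1, hκ, sub_add_cancel]
        exact P.end_a _ s3 (P.nE_pos _)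
      · refine ⟨_, a2, ?_⟩
        rw [tb, ← vx_rot2 (X - e (σ 2)) (κ * s2), show (κ * s2) 0 = κ 0 from rfl, show (κ * s2) 1 = κ 1 from rfl, k0, k1, sub_add_cancel,
          show κ * s2 * rr * rr = κ * rr * rr * s0 by simp only [mul_assoc]; rw [show s2 * (rr * rr) = rr * (rr * s0) by decide], hκ]
        exact P.end_a _ (s0_3 s3) (P.nE_pos _)
      · intro Y hY
        apply sub
        rw [k0, k1, sub_add_cancel] at hY
        rcases hY with rfl | rfl | rfl
        · refine ⟨x, Or.inl rfl, ?_⟩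
          have := P.gsum s3
          have hx : x = P.ch (X - e (σ 2)) ((i:ℤ) - P.gn (σ 2)) := by
            rw [P.ch_sub (ne0 s3).2.2, sub_add_cancel, ← t0, ← hu, add_sub_cancel_right]
          rw [hx]
          exact P.dl_ch _ (by omega) (by omega)
        · exact ⟨_, Or.inr (Or.inl rfl), du⟩
        · refine ⟨_, Or.inr (Or.inr rfl), ?_⟩
          rw [hz, P.dl_ch _ le_rfl P.C_pos]
  · left; right
    have e3 : (τ * s2) 3 = 1 := h
    obtain ⟨X, σ, p, s3, hp, t0, t1, -, hY⟩ := P.edgeP x e3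
    rw [mul_assoc, s22, mul_one] at t1
    rw [t0] at a2
    rw [t1] at a1
    exact ⟨X, σ, ⟨_, a2, P.end_a X s3 hp⟩, ⟨_, a1, P.end_c X s3 (by omega) (by omega)⟩, fun Y h => sub (hY Y h)⟩
  · left; right
    obtain ⟨X, σ, p, s3, hp, t0, t1, -, hY⟩ := P.edgeP x h
    rw [t0] at a1
    rw [t1] at a2
    exact ⟨X, σ, ⟨_, a1, P.end_a X s3 hp⟩, ⟨_, a2, P.end_c X s3 (by omega) (by omega)⟩, fun Y h => sub (hY Y h)⟩

/-- composition of ancestors -/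
theorem anc_trans {I : Ip Vt} {k l : ℕ} {v a u : Vt} (h : I.Anc k v a) (h' : I.Anc l a u) : I.Anc (k + l) v u := by
  induction k generalizing v with
  | zero => rw [Nat.zero_add]; have : v = a := h; rw [this]; exact h'
  | succ k ih =>
    obtain ⟨b, hb, hb'⟩ := h
    rw [show k + 1 + l = (k + l) + 1 by omega]
    exact ⟨b, hb, ih hb'⟩

theorem anc_snoc {I : Ip Vt} {k : ℕ} {v u : Vt} : I.Anc (k + 1) v u ↔ ∃ a, I.Anc k v a ∧ I.IsEnd a u := by
  induction k generalizing v with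
  | zero =>
    constructor
    · rintro ⟨a, ha, rfl⟩; exact ⟨v, rfl, ha⟩
    · rintro ⟨a, rfl, ha⟩; exact ⟨u, ha, rfl⟩
  | succ k ih =>
    constructor
    · rintro ⟨a, ha, h⟩
      obtain ⟨b, hb, hb'⟩ := ih.1 h
      exact ⟨b, ⟨a, ha, hb⟩, hb'⟩
    · rintro ⟨b, ⟨a, ha, hb⟩, hb'⟩
      exact ⟨a, ha, ih.2 ⟨b, hb, hb'⟩⟩

theorem anc_ex {v : Vt} (hv : Can v) (k : ℕ) : ∃ u, Can u ∧ P.I.Anc k v u := by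
  induction k with
  | zero => exact ⟨v, hv, rfl⟩
  | succ k ih =>
    obtain ⟨u, hu, h⟩ := ih
    obtain ⟨w, hw, h'⟩ := P.end_ex hu
    exact ⟨w, hw, anc_snoc.2 ⟨u, h, h'⟩⟩

theorem Tl_edge {u : Vt} (hu : Can u) {X : L} {σ : Wd} (h0 : X ∈ Tl u) (h1 : X + e (σ 0) ∈ Tl u)
    (h2 : X + e (σ 0) + e (σ 1) ∈ Tl u) : u = vx X σ ∨ u = vx X (σ * s2) := by
  obtain ⟨ρ, hρ⟩ := exists_vx hu h0
  rw [hρ] at h1 h2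
  have r0 := Tl_hex.1 h1
  have r1 := (Tl_sq (ne01 σ)).1 h2
  have r1' : ρ 1 = σ 1 := by
    rcases r1 with r | r
    · exact r.2
    · rw [r.1] at r0; exact absurd r0.symm (ne01 σ)
  have hw : ∀ κ : Wd, κ 0 = 0 → κ 1 = 1 → κ = 1 ∨ κ = s2 := by decide
  have := hw (σ⁻¹ * ρ) (by rw [Equiv.Perm.mul_apply, r0]; simp) (by rw [Equiv.Perm.mul_apply, r1']; simp)
  rcases this with h | h
  · left; rw [hρ, ← inv_mul_eq_one.1 h]
  · right; rw [hρ, ← h, mul_inv_cancel_left]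

theorem Tl_sub {u a : Vt} (hu : Can u) (ha : Can a) (h : Tl a ⊆ Tl u) : u = a := by
  obtain ⟨τ, hτ⟩ := exists_vx ha (Tl_fst a)
  generalize a.1 = x at hτ
  subst hτ
  rcases Tl_edge hu (h (mem_Tl0 x τ)) (h (mem_Tl1 x τ)) (h (mem_Tl2 x τ)) with rfl | rfl
  · rfl
  · rcases edge_tiles (mem_Tl3 x τ) (h (mem_Tl3 x τ)) with r | r | r
    · have := r.trans (add_zero x).symm
      simp only [add_assoc] at this
      rw [add_right_inj, ← add_assoc] at this
      have h4 := e_perm τ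
      rw [this, zero_add] at h4
      exact absurd h4 (e_ne0 _)
    · simp only [add_assoc] at r
      rw [add_right_inj, add_eq_left] at r
      exact absurd r (e_2ne0 _ _ (ne12 τ))
    · rw [add_eq_left] at r
      exact absurd r (e_ne0 _)

end Prm
end ABCT

set_option linter.all false

namespace ABCT
namespace Prm
open SD
variable (P : Prm)

theorem feat_mem {S : Set L} {A : Vt → Prop} (h : Feat S A) {u : Vt} (hu : Can u) (hS : S ⊆ Tl u) : A u := by
  rcases h with ⟨a, ca, ha, h⟩ | ⟨X, σ, h1, h2, h⟩
  · rw [Tl_sub hu ca (h.trans hS)]; exact ha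
  · rcases Tl_edge hu (hS (h _ (Or.inl rfl))) (hS (h _ (Or.inr (Or.inl rfl)))) (hS (h _ (Or.inr (Or.inr rfl)))) with r | r
    · rw [r]; exact h1
    · rw [r]; exact h2

theorem anc_pol {b : ℕ → Fg} {N : ℕ} (hp : ∀ k < N, P.par (b k) (b (k+1))) {v : Vt} (hv : v ∈ pol (b 0)) :
    ∀ k ≤ N, ∀ u, P.I.Anc k v u → u ∈ pol (b k) := by
  intro k
  induction k with
  | zero => intro _ u h; have : v = u := h; rw [← this]; exact hv
  | succ k ih =>
    intro hk u h
    obtain ⟨a, ha, h'⟩ := anc_snoc.1 h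
    have := P.par_end (hp k (by omega)) (ih (by omega) a ha)
    rcases h' with ⟨r, -⟩ | ⟨r, -⟩
    · rw [r]; exact this.1
    · rw [r]; exact this.2

theorem mesh_feat {N0 : ℕ} {b : ℕ → Fg} (hp : ∀ k < N0 + 2, P.par (b k) (b (k+1)))
    (hne : ∀ k < N0 + 2, P.dl (b k).2.1 ≠ P.dl (oth (b k))) {v w : Vt} (hv : v ∈ pol (b 0)) (hw : w ∈ pol (b 0)) :
    ∀ k ≤ N0, (∃ u, P.I.Anc (N0 + 2) v u ∧ P.I.Anc (N0 + 2) w u) ∨ Feat (P.dl^[k] '' Tl v) (P.I.Anc k v) := by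
  intro k
  induction k with
  | zero =>
    intro _; right; left
    exact ⟨v, pol_can _ _ hv, rfl, by simp⟩
  | succ k ih =>
    intro hk
    rcases ih (by omega) with h | h
    · exact Or.inl h
    rcases P.step h (P.anc_pol hp hv k (by omega)) (hne k (by omega)) with h | h
    · right
      rw [Function.iterate_succ', Set.image_comp]
      have : P.I.Anc (k+1) v = (fun u => ∃ a, P.I.Anc k v a ∧ P.I.IsEnd a u) := by
        funext u; exact propext anc_snoc
      rw [this]; exact h
    · left
      obtain ⟨w', -, hw'⟩ := P.anc_ex (pol_can _ _ hw) k
      obtain ⟨a, ha, y, h1, h2⟩ := h w' (P.anc_pol hp hw k (by omega) _ hw')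
      have k1 := anc_trans ha h1
      have k2 := anc_trans hw' h2
      have cy := pol_can _ _ (P.anc_pol hp hv (k + 2) (by omega) _ k1)
      obtain ⟨u, -, hu⟩ := P.anc_ex cy (N0 - k)
      refine ⟨u, ?_, ?_⟩
      · have := anc_trans k1 hu
        rwa [show k + 2 + (N0 - k) = N0 + 2 by omega] at this
      · have := anc_trans k2 hu
        rwa [show k + 2 + (N0 - k) = N0 + 2 by omega] at this

theorem mesh {N0 : ℕ} (hcon : ∀ t x t', adj t x → adj x t' → adj (P.dl^[N0] t) (P.dl^[N0] t'))
    {b : ℕ → Fg} (hp : ∀ k < N0 + 2, P.par (b k) (b (k+1)))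
    (hne : ∀ k < N0 + 2, P.dl (b k).2.1 ≠ P.dl (oth (b k))) {v w : Vt} (hv : v ∈ pol (b 0)) (hw : w ∈ pol (b 0)) :
    ∃ u, P.I.Anc (N0 + 2) v u ∧ P.I.Anc (N0 + 2) w u := by
  rcases P.mesh_feat hp hne hv hw N0 le_rfl with h | h
  · exact h
  rcases P.mesh_feat hp hne hw hv N0 le_rfl with h' | h'
  · obtain ⟨u, h1, h2⟩ := h'; exact ⟨u, h2, h1⟩
  have cv := pol_can _ _ hv
  have cw := pol_can _ _ hw
  have xv := ((mem_pol _ _ cv).1 hv).1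
  have xw := ((mem_pol _ _ cw).1 hw).1
  have key : ∀ t, t ∈ Tl v ∨ t ∈ Tl w → adj t (b 0).2.1 := by
    rintro t (ht | ht)
    · exact ⟨v, cv, ht, xv⟩
    · exact ⟨w, cw, ht, xw⟩
  obtain ⟨u, cu, hu⟩ := clique (S := P.dl^[N0] '' (Tl v ∪ Tl w)) (x0 := P.dl^[N0] (b 0).2.1) ⟨_, Or.inl xv, rfl⟩ (by
    rintro _ ⟨t, ht, rfl⟩ _ ⟨t', ht', rfl⟩
    exact hcon t _ t' (key t ht) (key t' ht').symm)
  have k1 := feat_mem h cu ((Set.image_mono Set.subset_union_left).trans hu)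
  have k2 := feat_mem h' cu ((Set.image_mono Set.subset_union_right).trans hu)
  obtain ⟨y, -, hy⟩ := P.anc_ex cu 2
  exact ⟨y, anc_trans k1 hy, anc_trans k2 hy⟩

end Prm
end ABCT

set_option linter.all false

namespace ABCT
open Filter Topology

abbrev V3 := Fin 3 → ℝ

/-- convex recursions contract -/
theorem rec_step {a b c : ℝ} (ha : 0 ≤ a) (hb : 0 ≤ b) (hc : 1 ≤ c) {u : ℕ → ℝ}
    (h : ∀ n, (1+a+b+c) * u (n+4) = c * u (n+3) + b * u (n+2) + a * u (n+1) + u n) {n : ℕ} {m M δ : ℝ} (hδ : δ * (1+a+b+c) = 1)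
    (hm : ∀ j < 4, m ≤ u (n+j)) (hM : ∀ j < 4, u (n+j) ≤ M) :
    ∃ m' M', (∀ j < 4, m' ≤ u (n+4+j)) ∧ (∀ j < 4, u (n+4+j) ≤ M') ∧ M' - m' = (1 - δ^4) * (M - m) := by
  have hC : 0 < 1+a+b+c := by linarith
  have hδ0 : 0 < δ := by
    by_contra h'
    nlinarith
  have hδ1 : δ ≤ 1 := by nlinarith
  -- one step
  have up : ∀ (k : ℕ) (s : ℝ), 0 ≤ s → (∀ j < 4, u (k+j) ≤ M) → u (k+3) ≤ M - s → u (k+4) ≤ M - δ * s := by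
    intro k s hs hj h3
    have h0 := hj 0 (by norm_num); have h1 := hj 1 (by norm_num); have h2 := hj 2 (by norm_num)
    have hk := h k
    have : (1+a+b+c) * u (k+4) ≤ (1+a+b+c) * (M - δ * s) := by
      have e1 : (1+a+b+c) * (M - δ * s) = (1+a+b+c) * M - s := by linear_combination (-s) * hδ
      rw [e1, hk]
      have := mul_le_mul_of_nonneg_left h1 ha
      have := mul_le_mul_of_nonneg_left h2 hb
      have := mul_le_mul_of_nonneg_left h3 (by linarith : (0:ℝ) ≤ c)
      have : s ≤ c * s := by nlinarith
      rw [add_zero] at h0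
      nlinarith
    exact le_of_mul_le_mul_left this hC
  have dn : ∀ (k : ℕ) (s : ℝ), 0 ≤ s → (∀ j < 4, m ≤ u (k+j)) → m + s ≤ u (k+3) → m + δ * s ≤ u (k+4) := by
    intro k s hs hj h3
    have h0 := hj 0 (by norm_num); have h1 := hj 1 (by norm_num); have h2 := hj 2 (by norm_num)
    have hk := h k
    have : (1+a+b+c) * (m + δ * s) ≤ (1+a+b+c) * u (k+4) := by
      have e1 : (1+a+b+c) * (m + δ * s) = (1+a+b+c) * m + s := by linear_combination s * hδ
      rw [e1, hk]
      have := mul_le_mul_of_nonneg_left h1 ha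
      have := mul_le_mul_of_nonneg_left h2 hb
      have := mul_le_mul_of_nonneg_left h3 (by linarith : (0:ℝ) ≤ c)
      have : s ≤ c * s := by nlinarith
      rw [add_zero] at h0
      nlinarith
    exact le_of_mul_le_mul_left this hC
  have hall : ∀ k, ∀ j < 4, u (n+k+j) ≤ M ∧ m ≤ u (n+k+j) := by
    intro k
    induction k with
    | zero => intro j hj; exact ⟨hM j hj, hm j hj⟩
    | succ k ih =>
      intro j hj
      rcases Nat.lt_or_ge j 3 with h' | h'
      · have := ih (j+1) (by omega)
        rwa [show n+k+(j+1) = n+(k+1)+j by ring] at this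
      · obtain rfl : j = 3 := by omega
        have k1 := up (n+k) 0 le_rfl (fun j hj => (ih j hj).1) (by simpa using (ih 3 (by norm_num)).1)
        have k2 := dn (n+k) 0 le_rfl (fun j hj => (ih j hj).2) (by simpa using (ih 3 (by norm_num)).2)
        rw [show n+k+4 = n+(k+1)+3 by ring] at k1 k2
        rw [mul_zero, sub_zero] at k1
        rw [mul_zero, add_zero] at k2
        exact ⟨k1, k2⟩
  set t := u (n+3)
  have ht1 : 0 ≤ M - t := by have := hM 3 (by norm_num); linarith
  have ht2 : 0 ≤ t - m := by have := hm 3 (by norm_num); linarith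
  have hpow : ∀ k, u (n+k+3) ≤ M - δ^k * (M - t) ∧ m + δ^k * (t - m) ≤ u (n+k+3) := by
    intro k
    induction k with
    | zero => simp [t]
    | succ k ih =>
      have k1 := up (n+k) _ (mul_nonneg (pow_nonneg hδ0.le k) ht1) (fun j hj => (hall k j hj).1) ih.1
      have k2 := dn (n+k) _ (mul_nonneg (pow_nonneg hδ0.le k) ht2) (fun j hj => (hall k j hj).2) ih.2
      rw [show n+k+4 = n+(k+1)+3 by ring] at k1 k2
      rw [pow_succ']
      exact ⟨by linarith, by linarith⟩
  refine ⟨m + δ^4 * (t - m), M - δ^4 * (M - t), ?_, ?_, by ring⟩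
  · intro j hj
    have := (hpow (j+1)).2
    rw [show n+(j+1)+3 = n+4+j by ring] at this
    have hp : δ^4 ≤ δ^(j+1) := pow_le_pow_of_le_one hδ0.le hδ1 (by omega)
    have := mul_le_mul_of_nonneg_right hp ht2
    linarith
  · intro j hj
    have := (hpow (j+1)).1
    rw [show n+(j+1)+3 = n+4+j by ring] at this
    have hp : δ^4 ≤ δ^(j+1) := pow_le_pow_of_le_one hδ0.le hδ1 (by omega)
    have := mul_le_mul_of_nonneg_right hp ht1
    linarith

theorem rec_tendsto {a b c : ℝ} (ha : 0 ≤ a) (hb : 0 ≤ b) (hc : 1 ≤ c) {u : ℕ → ℝ}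
    (h : ∀ n, u n + (a+1) * u (n+1) + (a+b+1) * u (n+2) + (1+a+b+c) * u (n+3) = 0) : Tendsto u atTop (𝓝 0) := by
  have hC : 0 < 1+a+b+c := by linarith
  have h4 : ∀ n, (1+a+b+c) * u (n+4) = c * u (n+3) + b * u (n+2) + a * u (n+1) + u n := by
    intro n
    have k1 := h n
    have k2 := h (n+1)
    rw [show n+1+1 = n+2 by ring, show n+1+2 = n+3 by ring, show n+1+3 = n+4 by ring] at k2
    linear_combination k2 - k1
  set δ := (1+a+b+c)⁻¹
  have hδ : δ * (1+a+b+c) = 1 := inv_mul_cancel₀ hC.ne'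
  have hδ0 : 0 < δ := inv_pos.2 hC
  have hδ1 : δ ≤ 1 := inv_le_one_of_one_le₀ (by linarith)
  set q := 1 - δ^4
  have hq0 : 0 ≤ q := by have := pow_le_one₀ (n := 4) hδ0.le hδ1; simp only [q]; linarith
  have hq1 : q < 1 := by have := pow_pos hδ0 4; simp only [q]; linarith
  obtain ⟨m, M, hm, hM⟩ : ∃ m M, (∀ j < 4, m ≤ u (0+j)) ∧ (∀ j < 4, u (0+j) ≤ M) := by
    refine ⟨-(|u 0| + |u 1| + |u 2| + |u 3|), |u 0| + |u 1| + |u 2| + |u 3|, ?_, ?_⟩ <;>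
    · intro j hj
      have := abs_le.1 (le_refl |u 0|); have := abs_le.1 (le_refl |u 1|); have := abs_le.1 (le_refl |u 2|); have := abs_le.1 (le_refl |u 3|)
      have := abs_nonneg (u 0); have := abs_nonneg (u 1); have := abs_nonneg (u 2); have := abs_nonneg (u 3)
      interval_cases j <;> simp only [zero_add] <;> linarith
  have key : ∀ k, ∃ m' M', (∀ j < 4, m' ≤ u (4*k+j)) ∧ (∀ j < 4, u (4*k+j) ≤ M') ∧ M' - m' = q^k * (M - m) := by
    intro k
    induction k with
    | zero => exact ⟨m, M, by simpa using hm, by simpa using hM, by simp⟩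
    | succ k ih =>
      obtain ⟨m', M', h1, h2, h3⟩ := ih
      obtain ⟨m2, M2, r1, r2, r3⟩ := rec_step ha hb hc h4 hδ h1 h2
      refine ⟨m2, M2, by simpa [mul_add] using r1, by simpa [mul_add] using r2, ?_⟩
      rw [r3, h3, pow_succ]; ring
  have bd : ∀ n, |u n| ≤ q^(n/4) * (M - m) := by
    intro n
    obtain ⟨m', M', h1, h2, h3⟩ := key (n/4)
    have z := h (4*(n/4))
    have m0 := h1 0 (by norm_num); have m1 := h1 1 (by norm_num); have m2 := h1 2 (by norm_num); have m3 := h1 3 (by norm_num)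
    have M0 := h2 0 (by norm_num); have M1 := h2 1 (by norm_num); have M2 := h2 2 (by norm_num); have M3 := h2 3 (by norm_num)
    rw [add_zero] at m0 M0
    have hm0 : m' ≤ 0 := by
      by_contra h'
      push Not at h'
      have := mul_pos hC (lt_of_lt_of_le h' m3)
      have := mul_nonneg (by linarith : (0:ℝ) ≤ a+1) (h'.le.trans m1)
      have := mul_nonneg (by linarith : (0:ℝ) ≤ a+b+1) (h'.le.trans m2)
      linarith
    have hM0 : 0 ≤ M' := by
      by_contra h'
      push Not at h'
      have := mul_neg_of_pos_of_neg hC (lt_of_le_of_lt M3 h')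
      have := mul_nonpos_of_nonneg_of_nonpos (by linarith : (0:ℝ) ≤ a+1) (M1.trans h'.le)
      have := mul_nonpos_of_nonneg_of_nonpos (by linarith : (0:ℝ) ≤ a+b+1) (M2.trans h'.le)
      linarith
    have l := h1 (n%4) (Nat.mod_lt _ (by norm_num))
    have r := h2 (n%4) (Nat.mod_lt _ (by norm_num))
    rw [Nat.div_add_mod] at l r
    rw [abs_le]; constructor <;> linarith
  have ht : Tendsto (fun n : ℕ => q^(n/4) * (M - m)) atTop (𝓝 0) := by
    have := ((tendsto_pow_atTop_nhds_zero_of_lt_one hq0 hq1).comp (Nat.tendsto_div_const_atTop (n := 4) (by norm_num))).mul_const (M - m)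
    simpa using this
  exact squeeze_zero_norm bd ht

end ABCT

set_option linter.all false

namespace ABCT
open Filter Topology

def dg (i : ℤ) : V3 := ![(i:ℝ), 0, 0]

structure Ti where
  a : ℤ
  b : ℤ
  c : ℤ
  ha : 0 ≤ a
  hb : 0 ≤ b
  hc : 1 ≤ c
  T : Set V3
  hTc : IsCompact T
  hTn : T.Nonempty
  hT : ∀ x : V3, x ∈ T ↔ ∃ i : ℤ, 0 ≤ i ∧ i < 1 + a + b + c ∧
    ![-(1+a+b+c) * x 2, x 0 - (a+b+1) * x 2, x 1 - (a+1) * x 2] - dg i ∈ T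

namespace Ti
variable (Q : Ti)

def C : ℤ := 1 + Q.a + Q.b + Q.c
def mv (x : V3) : V3 := ![-(1+Q.a+Q.b+Q.c) * x 2, x 0 - (Q.a+Q.b+1) * x 2, x 1 - (Q.a+1) * x 2]

theorem Cp : (0:ℝ) < 1 + Q.a + Q.b + Q.c := by
  have h1 : (0:ℝ) ≤ Q.a := by exact_mod_cast Q.ha
  have h2 : (0:ℝ) ≤ Q.b := by exact_mod_cast Q.hb
  have h3 : (1:ℝ) ≤ Q.c := by exact_mod_cast Q.hc
  linarith

noncomputable def mi : V3 →ₗ[ℝ] V3 where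
  toFun x := ![x 1 - (Q.a+Q.b+1) * (x 0 * (1+Q.a+Q.b+Q.c : ℝ)⁻¹), x 2 - (Q.a+1) * (x 0 * (1+Q.a+Q.b+Q.c : ℝ)⁻¹), - (x 0 * (1+Q.a+Q.b+Q.c : ℝ)⁻¹)]
  map_add' x y := by ext i; fin_cases i <;> simp <;> ring
  map_smul' r x := by ext i; fin_cases i <;> simp <;> ring

theorem mi_ap (x : V3) : Q.mi x = ![x 1 - (Q.a+Q.b+1) * (x 0 * (1+Q.a+Q.b+Q.c : ℝ)⁻¹), x 2 - (Q.a+1) * (x 0 * (1+Q.a+Q.b+Q.c : ℝ)⁻¹), - (x 0 * (1+Q.a+Q.b+Q.c : ℝ)⁻¹)] := rfl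

theorem mi_mv (x : V3) : Q.mi (Q.mv x) = x := by
  have h := Q.Cp.ne'
  rw [mi_ap]
  ext i; fin_cases i <;> simp [mv] <;> field_simp <;> ring

theorem mv_mi (x : V3) : Q.mv (Q.mi x) = x := by
  have h := Q.Cp.ne'
  rw [mi_ap]
  ext i; fin_cases i <;> simp [mv] <;> field_simp <;> ring

theorem mi_inj : Function.Injective Q.mi := Function.LeftInverse.injective Q.mv_mi

noncomputable def mp (n : ℕ) : V3 →ₗ[ℝ] V3 := Q.mi ^ n
theorem mp_zero (x : V3) : Q.mp 0 x = x := rfl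
theorem mp_succ (n : ℕ) (x : V3) : Q.mp (n+1) x = Q.mp n (Q.mi x) := by
  unfold mp; rw [pow_succ]; rfl
theorem mp_succ' (n : ℕ) (x : V3) : Q.mp (n+1) x = Q.mi (Q.mp n x) := by
  unfold mp; rw [pow_succ']; rfl
theorem mp_inj (n : ℕ) : Function.Injective (Q.mp n) := by
  induction n with
  | zero => exact fun x y h => h
  | succ n ih => intro x y h; rw [mp_succ, mp_succ] at h; exact Q.mi_inj (ih h)

theorem mv_ch (x : V3) (i : Fin 3) : Q.mv (Q.mv (Q.mv x)) i + (Q.a+1) * Q.mv (Q.mv x) i + (Q.a+Q.b+1) * Q.mv x i + (1+Q.a+Q.b+Q.c) * x i = 0 := by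
  fin_cases i <;> simp [mv] <;> ring

theorem mp_coord (x : V3) (i : Fin 3) : Tendsto (fun n => Q.mp n x i) atTop (𝓝 0) := by
  apply rec_tendsto (a := Q.a) (b := Q.b) (c := Q.c) (by exact_mod_cast Q.ha) (by exact_mod_cast Q.hb) (by exact_mod_cast Q.hc)
  intro n
  have := Q.mv_ch (Q.mp (n+3) x) i
  rw [Q.mp_succ' (n+2), Q.mv_mi, Q.mp_succ' (n+1), Q.mv_mi, Q.mp_succ' n, Q.mv_mi] at this
  rw [Q.mp_succ' (n+2), Q.mp_succ' (n+1), Q.mp_succ' n]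
  exact this

theorem mp_tendsto (x : V3) : Tendsto (fun n => Q.mp n x) atTop (𝓝 0) := tendsto_pi_nhds.2 (Q.mp_coord x)

noncomputable def kn (n : ℕ) : ℝ := ∑ i, ‖Q.mp n (Pi.single i 1)‖

theorem kn_tendsto : Tendsto Q.kn atTop (𝓝 0) := by
  have : Tendsto Q.kn atTop (𝓝 (∑ i : Fin 3, ‖(0:V3)‖)) := tendsto_finset_sum _ (fun i _ => (Q.mp_tendsto _).norm)
  simpa using this

theorem mp_le (n : ℕ) (x : V3) : ‖Q.mp n x‖ ≤ Q.kn n * ‖x‖ := by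
  have hx : x = ∑ i, x i • (Pi.single i 1 : V3) := by
    ext j; fin_cases j <;> simp [Fin.sum_univ_three]
  conv_lhs => rw [hx]
  rw [map_sum, kn, Finset.sum_mul]
  refine (norm_sum_le _ _).trans (Finset.sum_le_sum fun i _ => ?_)
  rw [map_smul, norm_smul, mul_comm]
  exact mul_le_mul_of_nonneg_left (norm_le_pi_norm x i) (norm_nonneg _)

theorem kn_nonneg (n : ℕ) : 0 ≤ Q.kn n := Finset.sum_nonneg fun i _ => norm_nonneg _

theorem mp_cont (n : ℕ) : Continuous (Q.mp n) := LinearMap.continuous_of_finiteDimensional _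

/-- translate of the tile -/
def tr (x : V3) : Set V3 := {p | p - x ∈ Q.T}

theorem tr_closed (x : V3) : IsClosed (Q.tr x) := Q.hTc.isClosed.preimage (continuous_id.sub continuous_const)
theorem tr_compact (x : V3) : IsCompact (Q.tr x) := by
  have : Q.tr x = (fun p => p + x) '' Q.T := by
    ext p; constructor
    · intro h; exact ⟨p - x, h, by simp⟩
    · rintro ⟨q, h, rfl⟩; simpa [tr] using h
  rw [this]; exact Q.hTc.image (by fun_prop)

theorem mv_add (x y : V3) : Q.mv (x + y) = Q.mv x + Q.mv y := by
  ext i; fin_cases i <;> simp [mv] <;> ring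
theorem mv_sub (x y : V3) : Q.mv (x - y) = Q.mv x - Q.mv y := by
  ext i; fin_cases i <;> simp [mv] <;> ring

theorem mem_tr (x p : V3) : p ∈ Q.tr x ↔ ∃ i : ℤ, 0 ≤ i ∧ i < Q.C ∧ Q.mv p ∈ Q.tr (Q.mv x + dg i) := by
  unfold tr
  rw [Set.mem_setOf_eq, Q.hT]
  apply exists_congr
  intro i
  rw [Set.mem_setOf_eq, ← sub_sub, ← Q.mv_sub]
  rfl

theorem tr_mi {x p : V3} {i : ℤ} (h0 : 0 ≤ i) (h1 : i < Q.C) (h : p ∈ Q.tr (Q.mv x + dg i)) : Q.mi p ∈ Q.tr x := by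
  rw [mem_tr]; exact ⟨i, h0, h1, by rwa [Q.mv_mi]⟩

/-- bounded chains give intersections -/
theorem inter {S : ℕ → Set V3} {R : ℝ} (hn : (S 0).Nonempty) (hR : ∀ n, ∀ x ∈ S n, ∀ y ∈ S n, ‖x - y‖ ≤ R)
    (hS : ∀ n, ∀ x ∈ S n, ∃ i : ℤ, 0 ≤ i ∧ i < Q.C ∧ Q.mv x + dg i ∈ S (n+1)) : ∃ p, ∀ x ∈ S 0, p ∈ Q.tr x := by
  have key : ∀ n, ∀ k, ∀ x ∈ S k, ∃ y ∈ S (k+n), ∀ p ∈ Q.tr y, Q.mp n p ∈ Q.tr x := by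
    intro n
    induction n with
    | zero => intro k x hx; exact ⟨x, hx, fun p hp => hp⟩
    | succ n ih =>
      intro k x hx
      obtain ⟨i, h0, h1, h2⟩ := hS k x hx
      obtain ⟨y, hy, h⟩ := ih (k+1) _ h2
      refine ⟨y, by rwa [show k + (n+1) = k + 1 + n by ring], fun p hp => ?_⟩
      rw [mp_succ']
      exact Q.tr_mi h0 h1 (h p hp)
  have key' : ∀ x ∈ S 0, ∀ n, ∃ y ∈ S n, ∀ p ∈ Q.tr y, Q.mp n p ∈ Q.tr x := by
    intro x hx n
    have := key n 0 x hx
    rwa [zero_add] at this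
  obtain ⟨t0, ht0⟩ := Q.hTn
  obtain ⟨x0, hx0⟩ := hn
  choose y hy hp using key' x0 hx0
  have mt : ∀ z, t0 + z ∈ Q.tr z := fun z => by simpa [tr] using ht0
  obtain ⟨p, hpx, f, hf, hlim⟩ := (Q.tr_compact x0).tendsto_subseq (fun n => hp n _ (mt (y n)))
  refine ⟨p, fun x hx => ?_⟩
  choose z hz hq using key' x hx
  have h2 : Tendsto (fun n => Q.mp n (t0 + z n) - Q.mp n (t0 + y n)) atTop (𝓝 0) := by
    have hk : Tendsto (fun n => Q.kn n * R) atTop (𝓝 0) := by simpa using Q.kn_tendsto.mul_const R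
    refine squeeze_zero_norm (fun n => ?_) hk
    rw [← map_sub, add_sub_add_left_eq_sub]
    exact (Q.mp_le n _).trans (mul_le_mul_of_nonneg_left (hR n _ (hz n) _ (hy n)) (Q.kn_nonneg n))
  have h3 : Tendsto (fun n => Q.mp (f n) (t0 + z (f n))) atTop (𝓝 p) := by
    have := (h2.comp hf.tendsto_atTop).add hlim
    simpa [add_comm] using this
  exact (Q.tr_closed x).mem_of_tendsto h3 (Eventually.of_forall fun n => hq (f n) _ (mt _))

end Ti
end ABCT

set_option linter.all false

namespace ABCT
open Filter Topology
namespace Ti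
variable (Q : Ti)

def bt (x : L) : V3 := ![(x.1:ℝ) + Q.a * x.2.1 + Q.b * x.2.2, (x.2.1:ℝ) + Q.a * x.2.2, (x.2.2:ℝ)]
def chq (X : L) (i : ℤ) : L := (-X.1 * Q.a - X.2.1 * Q.b - X.2.2 * (Q.c + 1) + i, X.1 - X.2.2, X.2.1 - X.2.2)

theorem bt_chq (X : L) (i : ℤ) : Q.bt (Q.chq X i) = Q.mv (Q.bt X) + dg i := by
  ext j; fin_cases j <;> simp [bt, chq, mv, dg] <;> ring

theorem bt_add (x y : L) : Q.bt (x + y) = Q.bt x + Q.bt y := by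
  ext j; fin_cases j <;> simp [bt] <;> ring
theorem bt_sub (x y : L) : Q.bt (x - y) = Q.bt x - Q.bt y := by
  ext j; fin_cases j <;> simp [bt] <;> ring
theorem bt_zero : Q.bt 0 = 0 := by
  ext j; fin_cases j <;> simp [bt]

def rot (x : L) : L := (-x.2.2, x.1 - x.2.2, x.2.1 - x.2.2)
def gx (x : L) : ℤ := Q.a * x.1 + Q.b * x.2.1 + Q.c * x.2.2

theorem chq_rot (z x : L) (d : ℤ) : Q.chq (z + x) (d + Q.gx x) = Q.chq z d + rot x := by
  simp only [chq, gx, rot, Prod.fst_add, Prod.snd_add, Prod.mk_add_mk, Prod.mk.injEq]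
  refine ⟨by ring, by ring, by ring⟩

def zs (x : L) : ℕ → L
  | 0 => 0
  | n + 1 => Q.chq (zs x n) (max (-(Q.gx (rot^[n] x))) 0)

theorem fin_bd {W : Set L} (hf : W.Finite) : ∃ R : ℝ, 0 ≤ R ∧ ∀ x ∈ W, ‖Q.bt x‖ ≤ R := by
  obtain ⟨R, hR⟩ := (hf.image (fun x => ‖Q.bt x‖)).bddAbove
  exact ⟨max R 0, le_max_right _ _, fun x hx => (hR ⟨x, hx, rfl⟩).trans (le_max_left _ _)⟩

theorem nb_of {W : Set L} (hf : W.Finite) (hr : ∀ x ∈ W, rot x ∈ W) (hg : ∀ x ∈ W, |Q.gx x| < Q.C) {x : L} (hx : x ∈ W) :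
    (Q.tr 0 ∩ Q.tr (Q.bt x)).Nonempty := by
  have hit : ∀ n, rot^[n] x ∈ W := by
    intro n
    induction n with
    | zero => exact hx
    | succ n ih => rw [Function.iterate_succ_apply']; exact hr _ ih
  obtain ⟨R, hR0, hR⟩ := Q.fin_bd hf
  obtain ⟨p, hp⟩ := Q.inter (S := fun n => {Q.bt (Q.zs x n), Q.bt (Q.zs x n + rot^[n] x)}) (R := R) ⟨_, Or.inl rfl⟩ (by
    intro n u hu v hv
    have := hR _ (hit n)
    rcases hu with rfl | rfl <;> rcases hv with rfl | rfl
    · simpa using hR0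
    · rw [bt_add, ← norm_neg]; simpa using this
    · rw [bt_add]; simpa using this
    · simpa using hR0) (by
    intro n u hu
    have hb := abs_lt.1 (hg _ (hit n))
    rcases hu with rfl | rfl
    · refine ⟨max (-(Q.gx (rot^[n] x))) 0, le_max_right _ _, by omega, Or.inl ?_⟩
      rw [← bt_chq]; rfl
    · refine ⟨max (-(Q.gx (rot^[n] x))) 0 + Q.gx (rot^[n] x), by omega, by omega, Or.inr ?_⟩
      rw [← bt_chq, chq_rot, Function.iterate_succ_apply']; rfl)
  refine ⟨p, ?_, ?_⟩
  · have := hp (Q.bt (Q.zs x 0)) (Or.inl rfl)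
    rwa [show Q.zs x 0 = 0 from rfl, bt_zero] at this
  · have := hp _ (Or.inr rfl)
    rwa [show Q.zs x 0 = 0 from rfl, zero_add] at this

def W1 : Finset L := {(0,0,0),(1,0,0),(0,1,0),(0,0,1),(1,1,0),(1,0,1),(0,1,1),(1,1,1),
  (-1,0,0),(0,-1,0),(0,0,-1),(-1,-1,0),(-1,0,-1),(0,-1,-1),(-1,-1,-1)}
def W2 : Finset L := {(1,2,1),(-1,0,1),(-1,-2,-1),(1,0,-1)}

theorem nb1 {x : L} (hx : x ∈ W1) : (Q.tr 0 ∩ Q.tr (Q.bt x)).Nonempty := by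
  apply Q.nb_of (W := {x | x ∈ W1}) (Finset.finite_toSet W1) _ _ hx
  · have : ∀ x ∈ W1, rot x ∈ W1 := by decide
    exact this
  · intro x hx
    have ha := Q.ha; have hb := Q.hb; have hc := Q.hc
    have : ∀ x ∈ W1, (0 ≤ x.1 ∧ x.1 ≤ 1 ∧ 0 ≤ x.2.1 ∧ x.2.1 ≤ 1 ∧ 0 ≤ x.2.2 ∧ x.2.2 ≤ 1) ∨ (-1 ≤ x.1 ∧ x.1 ≤ 0 ∧ -1 ≤ x.2.1 ∧ x.2.1 ≤ 0 ∧ -1 ≤ x.2.2 ∧ x.2.2 ≤ 0) := by decide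
    unfold gx C
    rw [abs_lt]
    rcases this x hx with ⟨h1, h2, h3, h4, h5, h6⟩ | ⟨h1, h2, h3, h4, h5, h6⟩
    · constructor <;> nlinarith
    · constructor <;> nlinarith

theorem nb2 (h0 : Q.b = 0) {x : L} (hx : x ∈ W2) : (Q.tr 0 ∩ Q.tr (Q.bt x)).Nonempty := by
  apply Q.nb_of (W := {x | x ∈ W2}) (Finset.finite_toSet W2) _ _ hx
  · have : ∀ x ∈ W2, rot x ∈ W2 := by decide
    exact this
  · intro x hx
    have ha := Q.ha; have hc := Q.hc
    have : x = (1,2,1) ∨ x = (-1,0,1) ∨ x = (-1,-2,-1) ∨ x = (1,0,-1) := by simpa [W2] using hx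
    unfold gx C
    rw [h0, abs_lt]
    rcases this with rfl | rfl | rfl | rfl <;> simp only <;> constructor <;> omega

def zb (x : L) : Fin 3 → ℤ := ![x.1 + Q.a * x.2.1 + Q.b * x.2.2, x.2.1 + Q.a * x.2.2, x.2.2]

theorem zb_inj : Function.Injective Q.zb := by
  rintro ⟨x, y, z⟩ ⟨x', y', z'⟩ h
  have h0 := congrFun h 0; have h1 := congrFun h 1; have h2 := congrFun h 2
  simp [zb] at h0 h1 h2
  subst h2
  have : y = y' := by linarith
  subst this
  have : x = x' := by linarith
  rw [this]

theorem zb_surj (α : Fin 3 → ℤ) : ∃ x, Q.zb x = α := by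
  refine ⟨(α 0 - Q.a * (α 1 - Q.a * α 2) - Q.b * α 2, α 1 - Q.a * α 2, α 2), ?_⟩
  ext j; fin_cases j <;> simp [zb] <;> ring

theorem zb_bt (x : L) : (fun i => (Q.zb x i : ℝ)) = Q.bt x := by
  ext j; fin_cases j <;> simp [zb, bt]

theorem bt_inj : Function.Injective Q.bt := by
  intro x y h
  apply Q.zb_inj
  ext i
  have := congrFun h i
  rw [← zb_bt, ← zb_bt] at this
  change ((Q.zb x i : ℤ) : ℝ) = ((Q.zb y i : ℤ) : ℝ) at this
  exact_mod_cast this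

/-- with exactly fourteen neighbours we know them -/
theorem nb_eq (h14 : {x : L | x ≠ 0 ∧ (Q.tr 0 ∩ Q.tr (Q.bt x)).Nonempty}.ncard = 14) :
    1 ≤ Q.b ∧ ∀ x, (Q.tr 0 ∩ Q.tr (Q.bt x)).Nonempty → x ∈ W1 := by
  set N := {x : L | x ≠ 0 ∧ (Q.tr 0 ∩ Q.tr (Q.bt x)).Nonempty}
  have hfin : N.Finite := Set.finite_of_ncard_ne_zero (by rw [h14]; norm_num)
  have s1 : ((W1.erase 0 : Finset L) : Set L) ⊆ N := by
    intro x hx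
    have := Finset.mem_erase.1 (Finset.mem_coe.1 hx)
    exact ⟨this.1, Q.nb1 this.2⟩
  have c1 : (W1.erase 0).card = 14 := by decide
  have heq : ((W1.erase 0 : Finset L) : Set L) = N := by
    apply Set.eq_of_subset_of_ncard_le s1 _ hfin
    rw [h14, Set.ncard_coe_finset, c1]
  constructor
  · by_contra hb
    have h0 : Q.b = 0 := by have := Q.hb; omega
    have : (1,2,1) ∈ N := ⟨by decide, Q.nb2 h0 (by decide)⟩
    rw [← heq] at this
    revert this
    rw [Finset.mem_coe]; decide
  · intro x hx
    by_cases h0 : x = 0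
    · rw [h0]; decide
    · have : x ∈ N := ⟨h0, hx⟩
      rw [← heq] at this
      exact Finset.mem_of_mem_erase (Finset.mem_coe.1 this)

end Ti
end ABCT

set_option linter.all false

namespace ABCT
open Filter Topology
namespace Ti
open SD Prm
variable (Q : Ti)

/-- the combinatorial parameters -/
def P (hb : 1 ≤ Q.b) : Prm := ⟨Q.a, Q.b, Q.c, Q.ha, hb, Q.hc⟩

variable (hb : 1 ≤ Q.b) (hW : ∀ x, (Q.tr 0 ∩ Q.tr (Q.bt x)).Nonempty → x ∈ W1)

theorem tr_shift (x y p : V3) : p ∈ Q.tr (x + y) ↔ p - x ∈ Q.tr y := by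
  unfold tr; rw [Set.mem_setOf_eq, Set.mem_setOf_eq, sub_sub]

theorem W1_adj : ∀ d ∈ W1, ∃ σ : Wd, d = 0 ∨ d = e (σ 0) ∨ d = e (σ 0) + e (σ 1) ∨ d = e (σ 0) + e (σ 1) + e (σ 2) := by decide

theorem adj_of (hW : ∀ x, (Q.tr 0 ∩ Q.tr (Q.bt x)).Nonempty → x ∈ W1) {x y : L} {p : V3} (hx : p ∈ Q.tr (Q.bt x)) (hy : p ∈ Q.tr (Q.bt y)) : adj x y := by
  have : y - x ∈ W1 := by
    apply hW
    refine ⟨p - Q.bt x, ?_, ?_⟩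
    · rw [← tr_shift, add_zero]; exact hx
    · rw [← tr_shift, bt_sub, add_sub_cancel]; exact hy
  obtain ⟨σ, h⟩ := W1_adj _ this
  refine ⟨vx x σ, vx_can _ _, mem_Tl0 _ _, ?_⟩
  rw [mem_Tl_iff]
  rcases h with h | h | h | h
  · left; rw [sub_eq_zero] at h; exact h
  · right; left; rw [← h]; abel
  · right; right; left; rw [add_assoc, ← h]; abel
  · right; right; right; rw [add_assoc, add_assoc, ← add_assoc (e (σ 0)), ← h]; abel

theorem es_W1 : ∀ I, es I ∈ W1 := by decide

theorem adj_W1 {x y : L} (h : adj x y) : y - x ∈ W1 := by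
  obtain ⟨I, -, rfl⟩ := adj_es h
  rw [add_sub_cancel_left]; exact es_W1 I

theorem chq_ch (X : L) (i : ℤ) : Q.chq X i = (Q.P hb).ch X i := rfl
theorem bt_ch (X : L) (i : ℤ) : Q.bt ((Q.P hb).ch X i) = Q.mv (Q.bt X) + dg i := Q.bt_chq X i
theorem C_eq : Q.C = (Q.P hb).C := rfl

theorem bt_dl (y : L) : Q.bt y = Q.mv (Q.bt ((Q.P hb).dl y)) + dg ((Q.P hb).dig y) := by
  rw [← Q.bt_ch hb, Prm.ch_dl]

theorem old_chain {v : Vt} (hv : Can v) : ∃ v', Can v' ∧ (Q.P hb).dl '' Tl v' = Tl v := by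
  obtain ⟨X, σ, h, rfl⟩ := can_zero hv
  exact ⟨_, (Q.P hb).tv_can X σ 0, (Q.P hb).dl_tv0 X h⟩

theorem vert (hb : 1 ≤ Q.b) {v : Vt} (hv : Can v) : ∃ p, ∀ x ∈ Tl v, p ∈ Q.tr (Q.bt x) := by
  choose! f hf hf' using fun v (hv : Can v) => Q.old_chain hb hv
  have hc : ∀ n, Can (f^[n] v) := by
    intro n
    induction n with
    | zero => exact hv
    | succ n ih => rw [Function.iterate_succ_apply']; exact hf _ ih
  obtain ⟨R, hR0, hR⟩ := Q.fin_bd (Finset.finite_toSet W1)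
  obtain ⟨p, hp⟩ := Q.inter (S := fun n => Q.bt '' Tl (f^[n] v)) (R := R) ⟨_, v.1, Tl_fst v, rfl⟩ (by
    rintro n _ ⟨x, hx, rfl⟩ _ ⟨y, hy, rfl⟩
    rw [← bt_sub]
    exact hR _ (Finset.mem_coe.2 (adj_W1 ⟨_, hc n, hy, hx⟩))) (by
    rintro n _ ⟨x, hx, rfl⟩
    rw [← hf' _ (hc n)] at hx
    obtain ⟨y, hy, rfl⟩ := hx
    refine ⟨(Q.P hb).dig y, (Q.P hb).dig_nonneg y, (Q.P hb).dig_lt y, y, ?_, Q.bt_dl hb y⟩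
    rw [Function.iterate_succ_apply']; exact hy)
  exact ⟨p, fun x hx => hp _ ⟨x, hx, rfl⟩⟩

/-- passing to the parent tile -/
theorem tr_dl {y : L} {p : V3} (h : p ∈ Q.tr (Q.bt y)) : Q.mi p ∈ Q.tr (Q.bt ((Q.P hb).dl y)) := by
  rw [Q.bt_dl hb y] at h
  exact Q.tr_mi ((Q.P hb).dig_nonneg y) ((Q.P hb).dig_lt y) h

theorem tr_dln (n : ℕ) {y : L} {p : V3} (h : p ∈ Q.tr (Q.bt y)) : Q.mp n p ∈ Q.tr (Q.bt ((Q.P hb).dl^[n] y)) := by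
  induction n with
  | zero => exact h
  | succ n ih => rw [mp_succ', Function.iterate_succ_apply']; exact Q.tr_dl hb ih

theorem tr_child {X : L} {p : V3} (h : p ∈ Q.tr (Q.bt X)) : ∃ y, (Q.P hb).dl y = X ∧ Q.mv p ∈ Q.tr (Q.bt y) := by
  obtain ⟨i, h0, h1, h2⟩ := (Q.mem_tr _ _).1 h
  exact ⟨(Q.P hb).ch X i, (Q.P hb).dl_ch X h0 h1, by rwa [Q.bt_ch hb]⟩

theorem fin_bt (r : ℝ) : {d : L | ‖Q.bt d‖ ≤ r}.Finite := by
  have : (Set.Icc (fun _ : Fin 3 => -⌈r⌉) (fun _ => ⌈r⌉)).Finite := Set.finite_Icc _ _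
  apply (this.preimage Q.zb_inj.injOn).subset
  intro d hd
  have key : ∀ i, |((Q.zb d i : ℤ) : ℝ)| ≤ ⌈r⌉ := by
    intro i
    have := (norm_le_pi_norm (Q.bt d) i).trans (show ‖Q.bt d‖ ≤ r from hd)
    rw [← zb_bt, Real.norm_eq_abs] at this
    exact this.trans (Int.le_ceil r)
  constructor <;> intro i
  · have := (abs_le.1 (key i)).1; exact_mod_cast this
  · have := (abs_le.1 (key i)).2; exact_mod_cast this

theorem T_bd : ∃ R, 0 < R ∧ ∀ x ∈ Q.T, ∀ y ∈ Q.T, ‖x - y‖ ≤ R := by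
  obtain ⟨R, hR⟩ := Metric.isBounded_iff.1 Q.hTc.isBounded
  refine ⟨max R 1, by positivity, fun x hx y hy => ?_⟩
  rw [← dist_eq_norm]; exact (hR hx hy).trans (le_max_left _ _)

theorem sep_one {d : L} (h : ¬ (Q.tr 0 ∩ Q.tr (Q.bt d)).Nonempty) : ∃ ε > 0, ∀ p ∈ Q.tr 0, ∀ q ∈ Q.tr (Q.bt d), ε ≤ ‖p - q‖ := by
  have hd : Disjoint (Q.tr 0) (Q.tr (Q.bt d)) := Set.disjoint_iff_inter_eq_empty.2 (Set.not_nonempty_iff_eq_empty.1 h)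
  obtain ⟨r, hr, h'⟩ := hd.exists_thickenings (Q.tr_compact 0) (Q.tr_closed _)
  refine ⟨r, hr, fun p hp q hq => ?_⟩
  by_contra hlt
  push Not at hlt
  have h1 : q ∈ Metric.thickening r (Q.tr 0) :=
    Metric.mem_thickening_iff.2 ⟨p, hp, by rw [dist_comm, dist_eq_norm]; exact hlt⟩
  exact Set.disjoint_left.1 h' h1 (Metric.self_subset_thickening hr _ hq)

theorem sep : ∃ ε > 0, ∀ d : L, ¬ (Q.tr 0 ∩ Q.tr (Q.bt d)).Nonempty → ∀ p ∈ Q.tr 0, ∀ q ∈ Q.tr (Q.bt d), ε ≤ ‖p - q‖ := by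
  obtain ⟨R, hR0, hR⟩ := Q.T_bd
  have hfin := Q.fin_bt (R + 1)
  have : ∀ d : L, ∃ ε : ℝ, 0 < ε ∧ (¬ (Q.tr 0 ∩ Q.tr (Q.bt d)).Nonempty → ∀ p ∈ Q.tr 0, ∀ q ∈ Q.tr (Q.bt d), ε ≤ ‖p - q‖) := by
    intro d
    by_cases h : (Q.tr 0 ∩ Q.tr (Q.bt d)).Nonempty
    · exact ⟨1, one_pos, fun h' => absurd h h'⟩
    · obtain ⟨ε, h1, h2⟩ := Q.sep_one h
      exact ⟨ε, h1, fun _ => h2⟩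
  choose f hf hf' using this
  have hex : ∃ ε : ℝ, 0 < ε ∧ ∀ d ∈ hfin.toFinset, ε ≤ f d := by
    induction hfin.toFinset using Finset.induction_on with
    | empty => exact ⟨1, one_pos, by simp⟩
    | insert d s hd ih =>
      obtain ⟨ε, h1, h2⟩ := ih
      refine ⟨min ε (f d), lt_min h1 (hf d), fun x hx => ?_⟩
      rcases Finset.mem_insert.1 hx with rfl | hx
      · exact min_le_right _ _
      · exact (min_le_left _ _).trans (h2 x hx)
  obtain ⟨ε, h1, h2⟩ := hex
  refine ⟨min ε 1, lt_min h1 one_pos, fun d hd p hp q hq => ?_⟩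
  by_cases hin : ‖Q.bt d‖ ≤ R + 1
  · exact (min_le_left _ _).trans ((h2 d (hfin.mem_toFinset.2 hin)).trans (hf' d hd p hp q hq))
  · refine (min_le_right _ _).trans ?_
    push Not at hin
    have k1 : p ∈ Q.T := by simpa [tr] using hp
    have k2 := hR p k1 _ hq
    have : Q.bt d = (p - (q - Q.bt d)) - (p - q) := by abel
    rw [this] at hin
    have := norm_sub_le (p - (q - Q.bt d)) (p - q)
    linarith

theorem contr (hW : ∀ x, (Q.tr 0 ∩ Q.tr (Q.bt x)).Nonempty → x ∈ W1) :
    ∃ N0 : ℕ, ∀ t x t', adj t x → adj x t' → adj ((Q.P hb).dl^[N0] t) ((Q.P hb).dl^[N0] t') := by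
  obtain ⟨ε, hε, hsep⟩ := Q.sep
  obtain ⟨R, hR0, hR⟩ := Q.T_bd
  have h1 : Tendsto (fun n => Q.kn n * R) atTop (𝓝 0) := by simpa using Q.kn_tendsto.mul_const R
  obtain ⟨N0, hN⟩ := (h1.eventually (gt_mem_nhds hε)).exists
  refine ⟨N0, fun t x t' h h' => ?_⟩
  obtain ⟨v, hv, hv1, hv2⟩ := h
  obtain ⟨w, hw, hw1, hw2⟩ := h'
  obtain ⟨p, hp⟩ := Q.vert hb hv
  obtain ⟨q, hq⟩ := Q.vert hb hw
  have pq : ‖p - q‖ ≤ R := by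
    have := hR _ (hp x hv2) _ (hq x hw1)
    rwa [sub_sub_sub_cancel_right] at this
  have p1 := Q.tr_dln hb N0 (hp t hv1)
  have q1 := Q.tr_dln hb N0 (hq t' hw2)
  set y := (Q.P hb).dl^[N0] t
  set y' := (Q.P hb).dl^[N0] t'
  have lt : ‖Q.mp N0 p - Q.mp N0 q‖ < ε := by
    rw [← map_sub]
    exact ((Q.mp_le N0 _).trans (mul_le_mul_of_nonneg_left pq (Q.kn_nonneg _))).trans_lt hN
  by_cases hn : (Q.tr 0 ∩ Q.tr (Q.bt (y' - y))).Nonempty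
  · obtain ⟨z, z1, z2⟩ := hn
    apply Q.adj_of hW (p := z + Q.bt y)
    · rw [show Q.bt y = Q.bt y + 0 by simp, tr_shift]; simpa using z1
    · rw [show y' = y + (y' - y) by abel, bt_add, tr_shift, add_sub_cancel_right]; exact z2
  · have := hsep _ hn (Q.mp N0 p - Q.bt y) (by rw [← tr_shift, add_zero]; exact p1) (Q.mp N0 q - Q.bt y)
      (by rw [← tr_shift, ← bt_add, add_sub_cancel]; exact q1)
    rw [sub_sub_sub_cancel_right] at this
    linarith

end Ti
end ABCT

set_option linter.all false

namespace ABCT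
open Filter Topology

/-- the sign patterns of the successive subdivisions -/
noncomputable def SD.it (D : SD) (P : Prm) : ℕ → SD
  | 0 => D
  | n + 1 => (SD.it D P n).nx P

theorem SD.it_conn {D : SD} (P : Prm) (h : D.Conn) : ∀ n, (D.it P n).Conn
  | 0 => h
  | n + 1 => SD.Conn_nx (SD.it_conn P h n)

theorem pol_ne (φ : Fg) : ∃ v, v ∈ pol φ := by
  obtain ⟨b, x, σ⟩ := φ
  cases b
  · exact ⟨vx x σ, by simp [pol, sqP]⟩
  · exact ⟨vx x σ, by simp [pol, hexP]⟩

namespace Ti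
open SD Prm
variable (Q : Ti)

/-- the face piece of a flag -/
def fc (n : ℕ) (φ : Fg) : Set V3 := Q.mp n '' (Q.tr (Q.bt φ.2.1) ∩ Q.tr (Q.bt (oth φ)))

theorem fc_par (hb : 1 ≤ Q.b) {n : ℕ} {ψ φ : Fg} (h : (Q.P hb).par ψ φ) : Q.fc (n+1) ψ ⊆ Q.fc n φ := by
  rintro _ ⟨p, ⟨h1, h2⟩, rfl⟩
  refine ⟨Q.mi p, ?_, (Q.mp_succ n p).symm⟩
  have k1 := Q.tr_dl hb h1
  have k2 := Q.tr_dl hb h2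
  rcases h with ⟨a, b⟩ | ⟨a, b⟩ <;> rw [a] at k1 <;> rw [b] at k2
  · exact ⟨k1, k2⟩
  · exact ⟨k2, k1⟩

theorem fc_adj (hb : 1 ≤ Q.b) {n : ℕ} {φ ψ : Fg} {v : Vt} (h1 : v ∈ pol φ) (h2 : v ∈ pol ψ) : (Q.fc n φ ∩ Q.fc n ψ).Nonempty := by
  have hc := pol_can _ _ h1
  rw [mem_pol _ _ hc] at h1 h2
  obtain ⟨p, hp⟩ := Q.vert hb hc
  exact ⟨Q.mp n p, ⟨p, ⟨hp _ h1.1, hp _ h1.2⟩, rfl⟩, ⟨p, ⟨hp _ h2.1, hp _ h2.2⟩, rfl⟩⟩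

theorem disk (hb : 1 ≤ Q.b) (hW : ∀ x, (Q.tr 0 ∩ Q.tr (Q.bt x)).Nonempty → x ∈ W1) {α : L} (hα : α ≠ 0)
    (hn : (Q.tr 0 ∩ Q.tr (Q.bt α)).Nonempty) :
    Nonempty ((Q.tr 0 ∩ Q.tr (Q.bt α) : Set V3) ≃ₜ Metric.closedBall (0 : EuclideanSpace ℝ (Fin 2)) 1) := by
  obtain ⟨p0, hp0, hp1⟩ := hn
  have h00 : Q.bt 0 = 0 := Q.bt_zero
  obtain ⟨v0, hv0, hv1, hv2⟩ := Q.adj_of hW (x := 0) (y := α) (by rw [h00]; exact hp0) hp1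
  obtain ⟨φ0, hφ0⟩ := D0_OK hα hv0 hv1 hv2
  have hc0 : (D0 α).Conn := (D0_two hα).conn hφ0
  obtain ⟨N0, hN0⟩ := Q.contr hb hW
  obtain ⟨R, hR0, hR⟩ := Q.T_bd
  set P := Q.P hb with hP
  let Dn := (D0 α).it P
  have hc : ∀ n, (Dn n).Conn := it_conn P hc0
  have t0 : ∀ φ, (Dn 0).OK φ → (φ.2.1 = 0 ∧ oth φ = α) ∨ (φ.2.1 = α ∧ oth φ = 0) := by
    intro φ h
    obtain ⟨x, y, hx, hy, h'⟩ := (D0 α).OK_tiles h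
    have hx0 : x = 0 := by
      by_contra hne; simp only [D0, if_neg hne] at hx; split_ifs at hx <;> omega
    have hy0 : y = α := by
      by_contra hne; simp only [D0, if_neg hne] at hy; split_ifs at hy <;> omega
    rw [hx0, hy0] at h'; exact h'
  let S : Sys Vt Fg V3 := {
    I := P.I
    K := fun n => (Dn n).cx (hc n)
    X := Q.tr 0 ∩ Q.tr (Q.bt α)
    hX := (Q.tr_compact 0).inter_right (Q.tr_closed _)
    F := Q.fc
    par := fun _ => P.par
    hgm := fun n φ _ ψ hψ v => gp_mem hψ v
    hFc := fun n φ _ => (((Q.tr_compact _).inter_right (Q.tr_closed _)).image (Q.mp_cont n)).isClosed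
    hFn := fun n φ _ => by
      obtain ⟨v, hv⟩ := pol_ne φ
      exact (Q.fc_adj hb hv hv).mono Set.inter_subset_left
    hFX := by
      intro n
      induction n with
      | zero =>
        rintro φ hφ _ ⟨p, ⟨h1, h2⟩, rfl⟩
        rw [Q.mp_zero]
        rcases t0 φ ((Dn 0).mem_Fl.1 hφ) with ⟨a, b⟩ | ⟨a, b⟩ <;> rw [a] at h1 <;> rw [b] at h2
        · rw [h00] at h1; exact ⟨h1, h2⟩
        · rw [h00] at h2; exact ⟨h2, h1⟩
      | succ n ih =>
        intro ψ hψ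
        obtain ⟨φ, h1, h2⟩ := nx_hpar P (Dn n) ((Dn (n+1)).mem_Fl.1 hψ)
        exact (Q.fc_par hb h2).trans (ih φ ((Dn n).mem_Fl.2 h1))
    hX0 := by
      rintro x ⟨h1, h2⟩
      refine ⟨φ0, (Dn 0).mem_Fl.2 hφ0, x, ?_, Q.mp_zero x⟩
      rcases t0 φ0 hφ0 with ⟨a, b⟩ | ⟨a, b⟩ <;> rw [a, b, h00]
      · exact ⟨h1, h2⟩
      · exact ⟨h2, h1⟩
    hch := by
      rintro n φ hφ _ ⟨p, ⟨h1, h2⟩, rfl⟩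
      have hφ := (Dn n).mem_Fl.1 hφ
      obtain ⟨y1, e1, k1⟩ := Q.tr_child hb h1
      obtain ⟨y2, e2, k2⟩ := Q.tr_child hb h2
      obtain ⟨v, cv, m1, m2⟩ := Q.adj_of hW k1 k2
      have s1 := (Dn n).sd_ne hφ
      have s2 := (Dn n).OK_oth hφ
      have n1 : (Dn (n+1)).sd y1 = - (Dn n).sd φ.2.1 := by rw [← e1]; rfl
      have n2 : (Dn (n+1)).sd y2 = - (Dn n).sd (oth φ) := by rw [← e2]; rfl
      obtain ⟨ψ, g1, g2, g3⟩ := (Dn (n+1)).flag cv m1 m2 (by omega) (by omega)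
      refine ⟨ψ, (Dn (n+1)).mem_Fl.2 g1, ?_, Q.mv p, ?_, by rw [Q.mp_succ, Q.mi_mv]⟩
      · rcases g3 with ⟨a, b⟩ | ⟨a, b⟩
        · exact Or.inl ⟨by rw [a]; exact e1, by rw [b]; exact e2⟩
        · exact Or.inr ⟨by rw [a]; exact e2, by rw [b]; exact e1⟩
      · rcases g3 with ⟨a, b⟩ | ⟨a, b⟩ <;> rw [a, b]
        · exact ⟨k1, k2⟩
        · exact ⟨k2, k1⟩
    D := fun n => Q.kn n * R
    hD := by simpa using Q.kn_tendsto.mul_const R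
    hdiam := by
      rintro n φ _ _ ⟨p, ⟨h1, _⟩, rfl⟩ _ ⟨q, ⟨h2, _⟩, rfl⟩
      rw [dist_eq_norm, ← map_sub]
      refine (Q.mp_le n _).trans (mul_le_mul_of_nonneg_left ?_ (Q.kn_nonneg n))
      have := hR _ h1 _ h2
      simpa using this
    hadj := by
      rintro n φ _ ψ _ ⟨_, ⟨p, ⟨h1, h2⟩, rfl⟩, q, ⟨h3, h4⟩, he⟩
      obtain rfl := Q.mp_inj n he
      obtain ⟨u, hu, hs⟩ := clique (S := {x | q ∈ Q.tr (Q.bt x)}) (x0 := φ.2.1) h1 (fun x hx y hy => Q.adj_of hW hx hy)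
      refine ⟨u, ?_, ?_⟩
      · exact (mem_pol _ _ hu).2 ⟨hs h1, hs h2⟩
      · exact (mem_pol _ _ hu).2 ⟨hs h3, hs h4⟩
    hadj' := fun n φ _ ψ _ v h1 h2 => Q.fc_adj hb h1 h2
    hend := fun n φ _ ψ _ h v hv => P.par_end h hv
    hpar := by
      intro n ψ hψ
      obtain ⟨φ, h1, h2⟩ := nx_hpar P (Dn n) ((Dn (n+1)).mem_Fl.1 hψ)
      exact ⟨φ, (Dn n).mem_Fl.2 h1, h2⟩
    hold := by
      intro n v hv
      obtain ⟨v', h1, h2, h3, _⟩ := nx_old P (Dn n) ((Dn n).mem_RV.1 hv)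
      exact ⟨v', (Dn (n+1)).mem_RV.2 h1, h2, h3⟩
    N := N0 + 2
    hN := by omega
    hmesh := by
      intro n c hcF hcp v hv w hw
      refine P.mesh hN0 (b := fun k => c (N0 + 2 - k)) ?_ ?_ hv hw
      · intro k hk
        obtain ⟨m, hm⟩ : ∃ m, m + 1 + k = N0 + 2 := ⟨N0 + 1 - k, by omega⟩
        have e1 : N0 + 2 - k = m + 1 := by omega
        have e2 : N0 + 2 - (k+1) = m := by omega
        simp only [e1, e2]
        exact hcp m (by omega)
      · intro k hk
        obtain ⟨m, hm⟩ : ∃ m, m + 1 + k = N0 + 2 := ⟨N0 + 1 - k, by omega⟩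
        have e1 : N0 + 2 - k = m + 1 := by omega
        simp only [e1]
        have h1 : ((Dn (n+m)).nx P).OK (c (m+1)) := (Dn (n+(m+1))).mem_Fl.1 (hcF (m+1) (by omega))
        have h2 := sd_ne _ h1
        have h3 := OK_oth _ h1
        rw [nx_sd, nx_sd] at h3
        rw [nx_sd] at h2
        intro he
        rw [← he] at h3
        omega
    hstep := fun n pos h ε hε => SD.hstep (hc n) (hc (n+1)) pos h ε hε
    h0 := (D0_two hα).drawn hφ0 hc0
    hne := ⟨φ0, (Dn 0).mem_Fl.2 hφ0⟩ }
  exact S.disk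

end Ti
end ABCT

theorem stmt5 (A B C : ℤ) (T : Set (Fin 3 → ℝ)) (hT : IsABCTile A B C T)
    (h14 : (Neighbors T).ncard = 14) (α : Fin 3 → ℤ) (hα : α ≠ 0) :
    (α ∈ Neighbors T →
      Nonempty ((T ∩ tileTranslate (toR α) T : Set (Fin 3 → ℝ)) ≃ₜ
        Metric.closedBall (0 : EuclideanSpace ℝ (Fin 2)) 1)) ∧
    (α ∉ Neighbors T → T ∩ tileTranslate (toR α) T = ∅) := by
  obtain ⟨hA, hAB, hBC, hne, hcp, -, heq⟩ := hT
  have mvM : ∀ x : Fin 3 → ℝ, (Mmat A B C).mulVec x = ![-(C:ℝ) * x 2, x 0 - B * x 2, x 1 - A * x 2] := by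
    intro x
    ext j; fin_cases j <;> simp [Mmat, Matrix.mulVec, dotProduct, Fin.sum_univ_three] <;> ring
  have hC : (C : ℝ) ≠ 0 := by
    have : C ≠ 0 := by omega
    exact_mod_cast this
  have inj : Function.Injective (Mmat A B C).mulVec := by
    intro x y h
    simp only [mvM] at h
    have h0 := congrFun h 0; have h1 := congrFun h 1; have h2 := congrFun h 2
    simp at h0 h1 h2
    have e2 : x 2 = y 2 := by
      rcases h0 with h0 | h0
      · exact h0
      · exact absurd (by exact_mod_cast h0) hC
    rw [e2] at h1 h2
    ext j; fin_cases j
    · simpa using h1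
    · simpa using h2
    · exact e2
  have c1 : ((1:ℝ) + ((A - 1 : ℤ) : ℝ) + ((B - A : ℤ) : ℝ) + ((C - B : ℤ) : ℝ)) = C := by push_cast; ring
  have c2 : (((A - 1 : ℤ) : ℝ) + ((B - A : ℤ) : ℝ) + 1) = B := by push_cast; ring
  have c3 : (((A - 1 : ℤ) : ℝ) + 1) = A := by push_cast; ring
  let Q : ABCT.Ti := {
    a := A - 1
    b := B - A
    c := C - B
    ha := by omega
    hb := by omega
    hc := by omega
    T := T
    hTc := hcp
    hTn := hne
    hT := by
      intro x
      rw [c1, c2, c3, ← mvM]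
      have k : x ∈ T ↔ (Mmat A B C).mulVec x ∈ (Mmat A B C).mulVec '' T := (inj.mem_set_image).symm
      rw [k, heq]
      simp only [Set.mem_iUnion]
      constructor
      · rintro ⟨d, ⟨i, h0, h1, rfl⟩, y, hy, hxy⟩
        refine ⟨i, h0, by omega, ?_⟩
        rw [← hxy]
        show (y + ABCT.dg i) - ABCT.dg i ∈ T
        rw [add_sub_cancel_right]; exact hy
      · rintro ⟨i, h0, h1, h⟩
        exact ⟨_, ⟨i, h0, by omega, rfl⟩, _, h, sub_add_cancel _ (ABCT.dg i)⟩ }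
  have key : ∀ x : ABCT.L, T ∩ tileTranslate (toR (Q.zb x)) T = Q.tr 0 ∩ Q.tr (Q.bt x) := by
    intro x
    have e : toR (Q.zb x) = Q.bt x := Q.zb_bt x
    rw [e]
    ext p
    have a1 : p ∈ Q.tr 0 ↔ p ∈ T := by
      show p - 0 ∈ T ↔ p ∈ T
      rw [sub_zero]
    have a2 : p ∈ Q.tr (Q.bt x) ↔ p ∈ tileTranslate (Q.bt x) T := by
      show p - Q.bt x ∈ T ↔ _
      constructor
      · intro h; exact ⟨_, h, sub_add_cancel _ _⟩
      · rintro ⟨y, hy, rfl⟩; simpa using hy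
    rw [Set.mem_inter_iff, Set.mem_inter_iff, a1, a2]
  have z0 : Q.zb 0 = 0 := by
    ext j; fin_cases j <;> simp [ABCT.Ti.zb]
  have h14' : {x : ABCT.L | x ≠ 0 ∧ (Q.tr 0 ∩ Q.tr (Q.bt x)).Nonempty}.ncard = 14 := by
    rw [← h14, ← Set.ncard_image_of_injective _ Q.zb_inj]
    congr 1
    ext β
    constructor
    · rintro ⟨x, ⟨h1, h2⟩, rfl⟩
      exact ⟨fun h => h1 (Q.zb_inj (h.trans z0.symm)), by rw [key]; exact h2⟩
    · rintro ⟨h1, h2⟩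
      obtain ⟨x, rfl⟩ := Q.zb_surj β
      exact ⟨x, ⟨fun h => h1 (by rw [h, z0]), by rw [← key]; exact h2⟩, rfl⟩
  obtain ⟨hb, hW⟩ := Q.nb_eq h14'
  obtain ⟨x, rfl⟩ := Q.zb_surj α
  constructor
  · rintro ⟨h1, h2⟩
    rw [key] at h2 ⊢
    exact Q.disk hb hW (fun h => h1 (by rw [h, z0])) h2
  · intro h
    by_contra hh
    exact h ⟨hα, Set.nonempty_iff_ne_empty.2 hh⟩
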